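/- There exist absolute constants C > 0 and x_0 such that for all x ≥ x_0, setting E(x) = x·log_2(x)/(log x)^{7/6}, one has |#R_{2,1}(x) − (7/24)·π(x)| ≤ C·E(x), |#R_{2,2}(x) − π(x)/3| ≤ C·E(x), and |Σ_{k≥3} #R_{2,k}(x) − π(x)/12| ≤ C·E(x). -/

import Mathlib

open scoped Classical

/-- The iterated logarithm: `logI 0 x = x`, `logI (ν+1) x = max (log (logI ν x)) 1`,
so that `logI 1 x = log_1 x = max (log x, 1)` and `logI ν x = log_ν x`. -/
noncomputable def logI : ℕ → ℝ → ℝ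
  | 0, x => x
  | ν + 1, x => max (Real.log (logI ν x)) 1

/-- The prime counting function `π(x)`. -/
noncomputable def primePi (x : ℝ) : ℕ :=
  ((Finset.range (⌊x⌋₊ + 1)).filter Nat.Prime).card

/-- `r ∈ R_{p,k}`: `r` is an odd prime, `r ≠ p`, and `v₂(ℓ_p(r)) = k`. -/
def memR (p k r : ℕ) : Prop :=
  r.Prime ∧ Odd r ∧ r ≠ p ∧ padicValNat 2 (orderOf ((p : ZMod r))) = k

/-- `#R_{p,k}(x)`, the number of members of `R_{p,k}` up to `x`. -/
noncomputable def countR (p k : ℕ) (x : ℝ) : ℕ :=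
  ((Finset.range (⌊x⌋₊ + 1)).filter (fun r => memR p k r)).card

/-- `Σ_{k ≥ 3} #R_{p,k}(x)`: since the sets `R_{p,k}` are pairwise disjoint,
this is the number of odd primes `r ≤ x`, `r ≠ p`, with `v₂(ℓ_p(r)) ≥ 3`. -/
noncomputable def countRge3 (p : ℕ) (x : ℝ) : ℕ :=
  ((Finset.range (⌊x⌋₊ + 1)).filter
    (fun r => r.Prime ∧ Odd r ∧ r ≠ p ∧
      3 ≤ padicValNat 2 (orderOf ((p : ZMod r))))).card

section

open Metric Complex in
/-- Borel–Carathéodory bound for the logarithmic derivative of a nonvanishing function. -/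
theorem norm_logDeriv_le_of_ne_zero {f : ℂ → ℂ} {c : ℂ} {R M : ℝ} (hR : 0 < R) (hM : 0 ≤ M)
    (hf : DifferentiableOn ℂ f (ball c R)) (h0 : ∀ z ∈ ball c R, f z ≠ 0)
    (hb : ∀ z ∈ ball c R, ‖f z‖ ≤ Real.exp M * ‖f c‖) {z : ℂ} (hz : dist z c ≤ 3 * R / 4) :
    ‖deriv f z / f z‖ ≤ 112 * M / R := by
  have hcb : c ∈ ball c R := mem_ball_self hR
  have hd : DifferentiableOn ℂ (fun z => deriv f z / f z) (ball c R) :=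
    (hf.deriv isOpen_ball).div hf h0
  obtain ⟨F, hF⟩ := hd.isExactOn_ball
  set h : ℂ → ℂ := fun z => F z - F c with hh
  have hhd : ∀ z ∈ ball c R, HasDerivAt h (deriv f z / f z) z := fun z hz => (hF z hz).sub_const _
  have hconst : ∀ z ∈ ball c R, f z * exp (-h z) = f c := by
    intro z hz
    have key : ∀ w ∈ ball c R, HasDerivWithinAt (fun w => f w * exp (-h w)) 0 (ball c R) w := by
      intro w hw
      have h1 : HasDerivAt f (deriv f w) w :=
        (hf.differentiableAt (isOpen_ball.mem_nhds hw)).hasDerivAt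
      have h2 := (hhd w hw).neg.cexp
      have h3 := h1.mul h2
      have : deriv f w * exp (-h w) + f w * (exp (-h w) * -(deriv f w / f w)) = 0 := by
        have := h0 w hw
        field_simp
        ring
      simp only [Pi.neg_apply] at h3
      rw [this] at h3
      exact h3.hasDerivWithinAt
    have := (convex_ball c R).norm_image_sub_le_of_norm_hasDerivWithin_le
      (f := fun w => f w * exp (-h w)) (C := 0) key (by simp) hcb hz
    simp only [zero_mul, norm_le_zero_iff, sub_eq_zero] at this
    rw [this]
    simp [hh]
  have hre : ∀ z ∈ ball c R, (h z).re ≤ M := by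
    intro z hz
    have h1 : f z = f c * exp (h z) := by
      rw [← hconst z hz, mul_assoc, ← Complex.exp_add]; simp
    have h2 := hb z hz
    rw [h1, norm_mul, Complex.norm_exp, mul_comm] at h2
    have h3 : 0 < ‖f c‖ := norm_pos_iff.mpr (h0 c hcb)
    exact Real.exp_le_exp.mp (le_of_mul_le_mul_right h2 h3)
  have main : ∀ ε > 0, ‖deriv f z / f z‖ ≤ 112 * (M + ε) / R := by
    intro ε hε
    have hbc : ∀ w, dist w c ≤ 7 * R / 8 → ‖h w‖ ≤ 14 * (M + ε) := by
      intro w hw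
      have hg : DifferentiableOn ℂ (fun u => h (c + u)) (ball 0 R) := by
        intro u hu
        have hu' : c + u ∈ ball c R := by simpa [dist_eq_norm] using hu
        exact ((hhd _ hu').differentiableAt.comp u (by fun_prop)).differentiableWithinAt
      have hm : Set.MapsTo (fun u => h (c + u)) (ball 0 R) {z | z.re ≤ M + ε} := by
        intro u hu
        have hu' : c + u ∈ ball c R := by simpa [dist_eq_norm] using hu
        have := hre _ hu'
        change (h (c + u)).re ≤ M + ε
        linarith
      have hw' : dist w c = ‖w - c‖ := dist_eq_norm _ _
      have hwR : w - c ∈ ball (0 : ℂ) R := by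
        rw [mem_ball_zero_iff]; linarith
      have := Complex.borelCaratheodory_zero (M := M + ε) (by linarith) hg hm hR hwR (by simp [hh])
      simp only [add_sub_cancel] at this
      refine this.trans ?_
      rw [hw'] at hw
      rw [div_le_iff₀ (by linarith)]
      nlinarith [norm_nonneg (w - c)]
    have hsub : ∀ w, dist w z ≤ R / 8 → dist w c ≤ 7 * R / 8 := by
      intro w hw
      have := dist_triangle w z c
      linarith
    have hdc : DiffContOnCl ℂ h (ball z (R / 8)) := by
      apply DifferentiableOn.diffContOnCl
      intro w hw
      have hw1 : dist w z ≤ R / 8 := by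
        have := closure_ball_subset_closedBall hw
        simpa using this
      have hw2 : w ∈ ball c R := by
        have := hsub w hw1
        rw [mem_ball]; linarith
      exact (hhd w hw2).differentiableAt.differentiableWithinAt
    have := norm_deriv_le_of_forall_mem_sphere_norm_le (C := 14 * (M + ε)) (by linarith) hdc
      (fun w hw => hbc w (hsub w (le_of_eq hw)))
    rw [(hhd z (by rw [mem_ball]; linarith)).deriv] at this
    refine this.trans (le_of_eq ?_)
    field_simp
    ring
  refine le_of_forall_pos_le_add fun ε hε => ?_
  refine (main (ε * R / 112) (by positivity)).trans (le_of_eq ?_)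
  field_simp

open Metric Complex ComplexConjugate in
/-- Dividing out a zero by a Blaschke factor. -/
theorem exists_blaschke_quotient {f : ℂ → ℂ} {U : Set ℂ} {c ρ : ℂ} {R B : ℝ} (hR : 0 < R)
    (hU : IsOpen U) (hcU : closedBall c R ⊆ U) (hf : DifferentiableOn ℂ f U) (hc : f c ≠ 0)
    (hb : ∀ z ∈ sphere c R, ‖f z‖ ≤ B) (hρ : dist ρ c ≤ R / 2) (h0 : f ρ = 0) :
    ∃ g : ℂ → ℂ, DifferentiableOn ℂ g U ∧ (∀ z ∈ sphere c R, ‖g z‖ ≤ B) ∧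
      2 * ‖f c‖ ≤ ‖g c‖ ∧ (∀ z ∈ closedBall c R, g z = 0 → f z = 0) ∧
      deriv f c / f c = deriv g c / g c + ((c - ρ)⁻¹ - conj (c - ρ) / R ^ 2) ∧
      (∀ z, z ≠ ρ → f z = 0 → g z = 0) ∧ (deriv f ρ = 0 → g ρ = 0) := by
  have hρc : c ≠ ρ := fun h => hc (h ▸ h0)
  have hsub : c - ρ ≠ 0 := sub_ne_zero.mpr hρc
  have hRc : (R : ℂ) ≠ 0 := by exact_mod_cast hR.ne'
  have hρU : ρ ∈ U := hcU (by rw [mem_closedBall]; linarith)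
  have hccU : c ∈ U := hcU (by simp [hR.le])
  have hdn : dist ρ c = ‖c - ρ‖ := by rw [dist_comm, dist_eq_norm]
  rw [hdn] at hρ
  have hdsl : DifferentiableOn ℂ (dslope f ρ) U :=
    (differentiableOn_dslope (hU.mem_nhds hρU)).mpr hf
  set b : ℂ → ℂ := fun z => ((R : ℂ) ^ 2 - (z - c) * conj (ρ - c)) / R with hbdef
  have hbd : ∀ z, HasDerivAt b (-conj (ρ - c) / R) z := by
    intro z
    have : HasDerivAt (fun z : ℂ => ((R : ℂ) ^ 2 - (z - c) * conj (ρ - c)) / R)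
        ((0 - 1 * conj (ρ - c)) / R) z :=
      (((hasDerivAt_const z ((R : ℂ) ^ 2)).sub
        (((hasDerivAt_id z).sub_const c).mul_const (conj (ρ - c)))).div_const (R : ℂ))
    rw [zero_sub, one_mul] at this
    exact this
  have hbc : b c = R := by simp [hbdef]; field_simp
  have hfsl : ∀ z, f z = (z - ρ) * dslope f ρ z := by
    intro z
    have := sub_smul_dslope f ρ z
    rw [h0, sub_zero, smul_eq_mul] at this
    exact this.symm
  have hslc : dslope f ρ c ≠ 0 := fun h => hc (by rw [hfsl, h, mul_zero])
  refine ⟨fun z => dslope f ρ z * b z, ?_, ?_, ?_, ?_, ?_, ?_, ?_⟩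
  · exact hdsl.mul fun z _ => (hbd z).differentiableAt.differentiableWithinAt
  · intro z hz
    have hz' : ‖z - c‖ = R := by rw [← dist_eq_norm]; exact hz
    have h1 : ‖b z‖ = ‖z - ρ‖ := by
      have e : (R : ℂ) ^ 2 = (z - c) * conj (z - c) := by
        rw [Complex.mul_conj, Complex.normSq_eq_norm_sq, hz']; norm_cast
      have : b z = (z - c) * conj (z - ρ) / R := by
        simp only [hbdef]
        rw [e]; congr 1; simp only [map_sub]; ring
      rw [this, norm_div, norm_mul, hz', RCLike.norm_conj]
      simp [abs_of_pos hR, hR.ne']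
    rw [norm_mul, h1, mul_comm, ← norm_mul, ← hfsl]
    exact hb z hz
  · have h1 : ‖f c‖ = ‖c - ρ‖ * ‖dslope f ρ c‖ := by rw [← norm_mul, ← hfsl]
    rw [norm_mul, hbc, h1, Complex.norm_real, Real.norm_of_nonneg hR.le]
    nlinarith [norm_nonneg (dslope f ρ c)]
  · intro z hz h
    rcases mul_eq_zero.mp h with h | h
    · rw [hfsl, h, mul_zero]
    · exfalso
      have h2 : (R : ℂ) ^ 2 = (z - c) * conj (ρ - c) := by
        have := (div_eq_zero_iff.mp h).resolve_right hRc
        exact sub_eq_zero.mp this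
      have h3 : R ^ 2 = ‖z - c‖ * ‖ρ - c‖ := by
        have := congrArg norm h2
        rw [norm_mul, RCLike.norm_conj, norm_pow, Complex.norm_real,
          Real.norm_of_nonneg hR.le] at this
        exact this
      have h4 : ‖z - c‖ ≤ R := by rw [← dist_eq_norm]; exact hz
      have h5 : ‖ρ - c‖ = ‖c - ρ‖ := norm_sub_rev _ _
      rw [h5] at h3
      nlinarith [norm_nonneg (z - c), norm_nonneg (c - ρ)]
  · have hslD : HasDerivAt (dslope f ρ) (deriv (dslope f ρ) c) c :=
      (hdsl.differentiableAt (hU.mem_nhds hccU)).hasDerivAt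
    have e1 : deriv f c = dslope f ρ c + (c - ρ) * deriv (dslope f ρ) c := by
      have h1 : HasDerivAt (fun z => (z - ρ) * dslope f ρ z)
          (1 * dslope f ρ c + (c - ρ) * deriv (dslope f ρ) c) c :=
        ((hasDerivAt_id c).sub_const ρ).mul hslD
      have h2 : f = fun z => (z - ρ) * dslope f ρ z := funext hfsl
      have h3 : deriv f c = deriv (fun z => (z - ρ) * dslope f ρ z) c := by rw [← h2]
      rw [h3, h1.deriv, one_mul]
    have e2 : deriv (fun z => dslope f ρ z * b z) c
        = deriv (dslope f ρ) c * R + dslope f ρ c * (-conj (ρ - c) / R) := by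
      have := (hslD.mul (hbd c)).deriv
      rw [hbc] at this
      exact this
    have e3 : (fun z => dslope f ρ z * b z) c = dslope f ρ c * R := by rw [← hbc]
    rw [e1, e2, e3, hfsl c]
    have : conj (c - ρ) = -conj (ρ - c) := by rw [← map_neg]; congr 1; ring
    rw [this]
    field_simp
    ring
  · intro z hz h
    rw [hfsl] at h
    rcases mul_eq_zero.mp h with h | h
    · exact absurd (sub_eq_zero.mp h) hz
    · simp [h]
  · intro h
    simp [dslope_same, h]

open Metric Complex ComplexConjugate in
theorem re_blaschke_nonneg {c ρ : ℂ} {R : ℝ} (hR : 0 < R) (hρ : dist ρ c ≤ R / 2)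
    (hre : ρ.re ≤ c.re) : 0 ≤ ((c - ρ)⁻¹ - conj (c - ρ) / R ^ 2).re := by
  set w := c - ρ with hw
  have hwre : 0 ≤ w.re := by simp [hw, hre]
  have hn : ‖w‖ ≤ R / 2 := by rwa [hw, ← dist_eq_norm, dist_comm]
  rcases eq_or_ne w 0 with h | h
  · simp [h]
  have hp : 0 < ‖w‖ := norm_pos_iff.mpr h
  have e : ((w)⁻¹ - conj w / (R : ℂ) ^ 2).re = w.re * (1 / ‖w‖ ^ 2 - 1 / R ^ 2) := by
    rw [Complex.sub_re, Complex.inv_re, Complex.normSq_eq_norm_sq]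
    have : (conj w / (R : ℂ) ^ 2) = conj w / ((R ^ 2 : ℝ) : ℂ) := by push_cast; rfl
    rw [this, Complex.div_ofReal_re, Complex.conj_re]
    ring
  rw [e]
  apply mul_nonneg hwre
  rw [sub_nonneg]
  apply one_div_le_one_div_of_le (by positivity)
  nlinarith

open Metric Complex in
/-- Landau's lower bound for the real part of the logarithmic derivative. -/
theorem re_logDeriv_ge {f : ℂ → ℂ} {U : Set ℂ} {c : ℂ} {R M : ℝ} (hR : 0 < R)
    (hU : IsOpen U) (hcU : closedBall c R ⊆ U) (hf : DifferentiableOn ℂ f U) (hc : f c ≠ 0)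
    (hb : ∀ z ∈ sphere c R, ‖f z‖ ≤ Real.exp M * ‖f c‖)
    (hz : ∀ z ∈ closedBall c R, f z = 0 → z.re ≤ c.re) :
    0 ≤ M ∧ -(224 * M / R) ≤ (deriv f c / f c).re := by
  obtain ⟨N, hN⟩ : ∃ N : ℕ, M < N * Real.log 2 := by
    obtain ⟨N, hN⟩ := exists_nat_gt (M / Real.log 2)
    exact ⟨N, by rwa [div_lt_iff₀ (Real.log_pos (by norm_num))] at hN⟩
  have hmax : ∀ (g : ℂ → ℂ) (B : ℝ), DifferentiableOn ℂ g U → (∀ z ∈ sphere c R, ‖g z‖ ≤ B) →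
      ∀ z ∈ closedBall c R, ‖g z‖ ≤ B := by
    intro g B hg hB z hz
    have hd : DiffContOnCl ℂ g (ball c R) := by
      apply DifferentiableOn.diffContOnCl
      exact hg.mono (closure_ball_subset_closedBall.trans hcU)
    refine norm_le_of_forall_mem_frontier_norm_le (isBounded_ball (x := c) (r := R)) hd ?_ ?_
    · intro w hw
      rw [frontier_ball c hR.ne'] at hw
      exact hB w hw
    · rwa [closure_ball c hR.ne']
  induction N generalizing f M with
  | zero =>
    exfalso
    have h1 := hmax f _ hf hb c (by simp [hR.le])
    have h2 : 0 < ‖f c‖ := norm_pos_iff.mpr hc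
    have h3 : 1 ≤ Real.exp M := by
      by_contra h
      push Not at h
      nlinarith
    rw [Real.one_le_exp_iff] at h3
    simp at hN
    linarith
  | succ N ih =>
    have h2 : 0 < ‖f c‖ := norm_pos_iff.mpr hc
    have hM : 0 ≤ M := by
      have h1 := hmax f _ hf hb c (by simp [hR.le])
      rw [← Real.one_le_exp_iff]
      by_contra h
      push Not at h
      nlinarith
    refine ⟨hM, ?_⟩
    by_cases hex : ∃ ρ, dist ρ c ≤ R / 2 ∧ f ρ = 0
    · obtain ⟨ρ, hρ, h0⟩ := hex
      obtain ⟨g, hg1, hg2, hg3, hg4, hg5, -, -⟩ :=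
        exists_blaschke_quotient hR hU hcU hf hc hb hρ h0
      have hgc : g c ≠ 0 := by
        rw [← norm_pos_iff]; linarith
      have hre := re_blaschke_nonneg hR hρ (hz ρ (by rw [mem_closedBall]; linarith) h0)
      have hb' : ∀ z ∈ sphere c R, ‖g z‖ ≤ Real.exp (M - Real.log 2) * ‖g c‖ := by
        intro z hz
        refine (hg2 z hz).trans ?_
        rw [Real.exp_sub, Real.exp_log (by norm_num), div_mul_eq_mul_div, mul_div_assoc]
        apply mul_le_mul_of_nonneg_left _ (Real.exp_pos _).le
        linarith
      have := ih hg1 hgc hb' (fun z hz' h => hz z hz' (hg4 z hz' h))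
        (by push_cast at hN; linarith)
      rw [hg5, Complex.add_re]
      have h5 : 224 * (M - Real.log 2) / R ≤ 224 * M / R := by
        have := Real.log_pos (show (1 : ℝ) < 2 by norm_num)
        gcongr
        linarith
      linarith [this.2]
    · push Not at hex
      have hsubR : ball c (R / 2) ⊆ closedBall c R := by
        intro z hz
        rw [mem_ball] at hz
        rw [mem_closedBall]; linarith
      have := norm_logDeriv_le_of_ne_zero (R := R / 2) (by linarith) hM
        (hf.mono (hsubR.trans hcU)) (fun z hz => hex z (le_of_lt hz))
        (fun z hz => hmax f _ hf hb z (hsubR hz)) (z := c) (by simp; positivity)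
      have h3 := (abs_le.mp ((Complex.abs_re_le_norm _).trans this)).1
      have e : 112 * M / (R / 2) = 224 * M / R := by field_simp; ring
      rw [e] at h3
      exact h3

open Metric Complex ComplexConjugate in
/-- Landau's lower bound, keeping the contribution of one zero. -/
theorem re_logDeriv_ge_of_zero {f : ℂ → ℂ} {U : Set ℂ} {c ρ : ℂ} {R M : ℝ} (hR : 0 < R)
    (hU : IsOpen U) (hcU : closedBall c R ⊆ U) (hf : DifferentiableOn ℂ f U) (hc : f c ≠ 0)
    (hb : ∀ z ∈ sphere c R, ‖f z‖ ≤ Real.exp M * ‖f c‖)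
    (hz : ∀ z ∈ closedBall c R, f z = 0 → z.re ≤ c.re)
    (hρ : dist ρ c ≤ R / 2) (h0 : f ρ = 0) :
    ((c - ρ)⁻¹ - conj (c - ρ) / R ^ 2).re - 224 * M / R ≤ (deriv f c / f c).re := by
  obtain ⟨g, hg1, hg2, hg3, hg4, hg5, -, -⟩ :=
    exists_blaschke_quotient hR hU hcU hf hc hb hρ h0
  have h2 : 0 < ‖f c‖ := norm_pos_iff.mpr hc
  have hgc : g c ≠ 0 := by
    rw [← norm_pos_iff]; linarith
  have hb' : ∀ z ∈ sphere c R, ‖g z‖ ≤ Real.exp M * ‖g c‖ := by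
    intro z hz
    refine (hg2 z hz).trans ?_
    gcongr
    linarith
  have := re_logDeriv_ge hR hU hcU hg1 hgc hb' (fun z hz' h => hz z hz' (hg4 z hz' h))
  rw [hg5, Complex.add_re]
  linarith [this.2]

open Metric Complex ComplexConjugate in
/-- Landau's lower bound, keeping the contribution of two zeros (or of a double zero). -/
theorem re_logDeriv_ge_of_two_zeros {f : ℂ → ℂ} {U : Set ℂ} {c ρ ρ' : ℂ} {R M : ℝ} (hR : 0 < R)
    (hU : IsOpen U) (hcU : closedBall c R ⊆ U) (hf : DifferentiableOn ℂ f U) (hc : f c ≠ 0)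
    (hb : ∀ z ∈ sphere c R, ‖f z‖ ≤ Real.exp M * ‖f c‖)
    (hz : ∀ z ∈ closedBall c R, f z = 0 → z.re ≤ c.re)
    (hρ : dist ρ c ≤ R / 2) (h0 : f ρ = 0) (hρ' : dist ρ' c ≤ R / 2)
    (h0' : (ρ' ≠ ρ ∧ f ρ' = 0) ∨ (ρ' = ρ ∧ deriv f ρ = 0)) :
    ((c - ρ)⁻¹ - conj (c - ρ) / R ^ 2).re + ((c - ρ')⁻¹ - conj (c - ρ') / R ^ 2).re
      - 224 * M / R ≤ (deriv f c / f c).re := by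
  obtain ⟨g, hg1, hg2, hg3, hg4, hg5, hg6, hg7⟩ :=
    exists_blaschke_quotient hR hU hcU hf hc hb hρ h0
  have h2 : 0 < ‖f c‖ := norm_pos_iff.mpr hc
  have hgc : g c ≠ 0 := by
    rw [← norm_pos_iff]; linarith
  have hb' : ∀ z ∈ sphere c R, ‖g z‖ ≤ Real.exp M * ‖g c‖ := by
    intro z hz
    refine (hg2 z hz).trans ?_
    gcongr
    linarith
  have hg0 : g ρ' = 0 := by
    rcases h0' with ⟨h, h'⟩ | ⟨h, h'⟩
    · exact hg6 _ h h'
    · rw [h]; exact hg7 h'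
  have := re_logDeriv_ge_of_zero hR hU hcU hg1 hgc hb'
    (fun z hz' h => hz z hz' (hg4 z hz' h)) hρ' hg0
  rw [hg5, Complex.add_re]
  linarith [this]

end

section

open Complex ComplexConjugate Metric

/-- The analytic hypotheses on `f(s) = (s - 1) D(s)`, where `D` has the nonnegative von Mangoldt
coefficients `Λ`, with all bounds expressed through a parameter `P`. -/
structure GoodL (P : ℝ) (f : ℂ → ℂ) (Λ : ℕ → ℝ) : Prop where
  diff : DifferentiableOn ℂ f {s | 1 - 1 / P ^ 2 < s.re}
  ne : ∀ s : ℂ, 1 < s.re → f s ≠ 0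
  logd : ∀ s : ℂ, 1 < s.re → deriv f s / f s = 1 / (s - 1) - LSeries (fun n => (Λ n : ℂ)) s
  upper : ∀ s : ℂ, 1 - 1 / P ^ 2 < s.re → s.re ≤ 3 → |s.im| ≤ P ^ 31 → ‖f s‖ ≤ Real.exp (P ^ 4)
  lower : ∀ s : ℂ, 1 + 1 / P ^ 10 ≤ s.re → s.re ≤ 3 → |s.im| ≤ P ^ 31 →
    Real.exp (-P ^ 4) ≤ ‖f s‖
  conj_eq : ∀ s : ℂ, 1 - 1 / P ^ 2 < s.re → f (conj s) = conj (f s)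
  double : ∀ β : ℝ, 1 - 1 / P ^ 7 < β → β ≤ 1 → f β = 0 → deriv f β = 0
  nonneg : ∀ n, 0 ≤ Λ n
  le : ∀ n, Λ n ≤ P ^ 3 * ArithmeticFunction.vonMangoldt n

namespace GoodL

variable {P : ℝ} {f : ℂ → ℂ} {Λ : ℕ → ℝ}

theorem summable (h : GoodL P f Λ) {s : ℂ} (hs : 1 < s.re) :
    LSeriesSummable (fun n => (Λ n : ℂ)) s := by
  have h1 := (ArithmeticFunction.LSeriesSummable_vonMangoldt hs).norm.mul_left |P ^ 3|
  refine Summable.of_norm_bounded h1 fun n => ?_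
  rw [← Real.norm_eq_abs, ← Complex.norm_real, ← norm_mul]
  rcases eq_or_ne n 0 with rfl | hn
  · simp
  rw [LSeries.term_of_ne_zero hn, LSeries.term_of_ne_zero hn, norm_div, norm_mul, norm_div,
    ← mul_div_assoc]
  gcongr
  rw [Complex.norm_real, Complex.norm_real, Complex.norm_real, Real.norm_eq_abs, Real.norm_eq_abs,
    Real.norm_eq_abs, ← abs_mul, abs_of_nonneg (h.nonneg n)]
  exact (h.le n).trans (le_abs_self _)

theorem re_term {s : ℂ} {n : ℕ} (hn : n ≠ 0) :
    (LSeries.term (fun n => (Λ n : ℂ)) s n).re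
      = Λ n * (n : ℝ) ^ (-s.re) * Real.cos (s.im * Real.log n) := by
  have hn0 : (n : ℂ) ≠ 0 := by exact_mod_cast hn
  have hnp : (0 : ℝ) < n := by exact_mod_cast Nat.pos_of_ne_zero hn
  rw [LSeries.term_of_ne_zero hn, div_eq_mul_inv, ← Complex.cpow_neg, Complex.re_ofReal_mul,
    Complex.cpow_def_of_ne_zero hn0, ← Complex.natCast_log, Complex.exp_re,
    Real.rpow_def_of_pos hnp, mul_assoc]
  simp only [Complex.re_ofReal_mul, Complex.im_ofReal_mul, Complex.neg_re, Complex.neg_im]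
  rw [← Real.cos_neg (s.im * Real.log n)]
  ring_nf

theorem re_LSeries_real_nonneg (h : GoodL P f Λ) {u : ℝ} (hu : 1 < u) :
    0 ≤ (LSeries (fun n => (Λ n : ℂ)) u).re := by
  rw [LSeries, Complex.re_tsum (h.summable (by simpa using hu))]
  refine tsum_nonneg fun n => ?_
  rcases eq_or_ne n 0 with rfl | hn
  · simp
  rw [re_term hn]
  have := h.nonneg n
  simp only [ofReal_im, zero_mul, Real.cos_zero]
  positivity

theorem three_four_one (h : GoodL P f Λ) {u : ℝ} (hu : 1 < u) (t : ℝ) :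
    0 ≤ 3 * (LSeries (fun n => (Λ n : ℂ)) u).re
      + 4 * (LSeries (fun n => (Λ n : ℂ)) (u + t * I)).re
      + (LSeries (fun n => (Λ n : ℂ)) (u + (2 * t : ℝ) * I)).re := by
  have h0 : LSeriesSummable (fun n => (Λ n : ℂ)) u := h.summable (by simpa using hu)
  have h1 : LSeriesSummable (fun n => (Λ n : ℂ)) (u + t * I) := h.summable (by simpa using hu)
  have h2 : LSeriesSummable (fun n => (Λ n : ℂ)) (u + (2 * t : ℝ) * I) :=
    h.summable (by simpa using hu)
  have g0 := (Complex.hasSum_re h0.hasSum).mul_left 3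
  have g1 := (Complex.hasSum_re h1.hasSum).mul_left 4
  have g2 := Complex.hasSum_re h2.hasSum
  refine ((g0.add g1).add g2).nonneg fun n => ?_
  rcases eq_or_ne n 0 with rfl | hn
  · simp
  rw [re_term hn, re_term hn, re_term hn]
  have hL := h.nonneg n
  simp only [ofReal_im, zero_mul, Real.cos_zero, add_re, ofReal_re, mul_re, I_re, mul_zero, I_im,
    mul_one, sub_self, add_zero, add_im, mul_im, zero_add]
  rw [mul_assoc 2 t, Real.cos_two_mul]
  have : 0 ≤ Λ n * (n : ℝ) ^ (-u) := by positivity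
  nlinarith [mul_nonneg this (sq_nonneg (1 + Real.cos (t * Real.log n)))]

/-- Data for applying the Landau bounds on the ball of radius `1 / (4 P ^ 2)`. -/
theorem landau_data (h : GoodL P f Λ) (hP : 10 ^ 6 ≤ P) {c : ℂ} (hc : 1 + 1 / P ^ 10 ≤ c.re)
    (hc2 : c.re ≤ 2) (him : |c.im| ≤ 3 * P ^ 30) :
    closedBall c (1 / (4 * P ^ 2)) ⊆ {s | 1 - 1 / P ^ 2 < s.re} ∧ f c ≠ 0 ∧
    (∀ z ∈ sphere c (1 / (4 * P ^ 2)), ‖f z‖ ≤ Real.exp (2 * P ^ 4) * ‖f c‖) ∧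
    (∀ z ∈ closedBall c (1 / (4 * P ^ 2)), f z = 0 → z.re ≤ c.re) := by
  have hPpos : 0 < P := by linarith
  have hR : 1 / (4 * P ^ 2) ≤ 1 := by
    rw [div_le_one (by positivity)]; nlinarith
  have hR2 : 1 / (4 * P ^ 2) < 1 / P ^ 2 := by
    apply one_div_lt_one_div_of_lt (by positivity); nlinarith [sq_nonneg P]
  have hp10 : 0 < 1 / P ^ 10 := by positivity
  have hre : ∀ z ∈ closedBall c (1 / (4 * P ^ 2)), |z.re - c.re| ≤ 1 / (4 * P ^ 2) := by
    intro z hz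
    rw [← Complex.sub_re]
    exact (Complex.abs_re_le_norm _).trans (by rwa [mem_closedBall, dist_eq_norm] at hz)
  have himz : ∀ z ∈ closedBall c (1 / (4 * P ^ 2)), |z.im - c.im| ≤ 1 / (4 * P ^ 2) := by
    intro z hz
    rw [← Complex.sub_im]
    exact (Complex.abs_im_le_norm _).trans (by rwa [mem_closedBall, dist_eq_norm] at hz)
  have hsub : closedBall c (1 / (4 * P ^ 2)) ⊆ {s | 1 - 1 / P ^ 2 < s.re} := by
    intro z hz
    have := (abs_le.mp (hre z hz)).1
    change 1 - 1 / P ^ 2 < z.re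
    linarith
  have hfc : f c ≠ 0 := h.ne c (by linarith)
  have hp30 : 1 ≤ P ^ 30 := one_le_pow₀ (by linarith)
  have hp31 : 10 * P ^ 30 ≤ P ^ 31 := by
    have : P ^ 31 = P * P ^ 30 := by ring
    rw [this]; nlinarith
  refine ⟨hsub, hfc, ?_, ?_⟩
  · intro z hz
    have hz' := sphere_subset_closedBall hz
    have h1 := h.upper z (hsub hz') (by linarith [(abs_le.mp (hre z hz')).2]) (by
      have h1 := himz z hz'
      have h2 : |z.im| ≤ |z.im - c.im| + |c.im| := by
        have := abs_add_le (z.im - c.im) c.im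
        simpa using this
      linarith)
    have h2 := h.lower c hc (by linarith) (by linarith)
    refine h1.trans ?_
    have e : Real.exp (P ^ 4) = Real.exp (2 * P ^ 4) * Real.exp (-P ^ 4) := by
      rw [← Real.exp_add]; congr 1; ring
    rw [e]
    gcongr
  · intro z hz hz0
    by_contra hlt
    exact h.ne z (by linarith) hz0

theorem isOpen_dom : IsOpen {s : ℂ | 1 - 1 / P ^ 2 < s.re} :=
  isOpen_lt continuous_const Complex.continuous_re

theorem re_logDeriv_ge' (h : GoodL P f Λ) (hP : 10 ^ 6 ≤ P) {c : ℂ} (hc : 1 + 1 / P ^ 10 ≤ c.re)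
    (hc2 : c.re ≤ 2) (him : |c.im| ≤ 3 * P ^ 30) :
    -(1792 * P ^ 6) ≤ (deriv f c / f c).re := by
  obtain ⟨h1, h2, h3, h4⟩ := h.landau_data hP hc hc2 him
  have hPpos : 0 < P := by linarith
  have := (re_logDeriv_ge (by positivity) isOpen_dom h1 h.diff h2 h3 h4).2
  refine le_trans (le_of_eq ?_) this
  field_simp
  ring

theorem re_term_ge {c ρ : ℂ} (hP : 10 ^ 6 ≤ P) (h1 : 0 < (c - ρ).re)
    (h2 : (c - ρ).re ≤ 1 / P ^ 6) :
    (c - ρ).re / ((c - ρ).re ^ 2 + (c - ρ).im ^ 2) - 1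
      ≤ ((c - ρ)⁻¹ - conj (c - ρ) / ((1 / (4 * P ^ 2) : ℝ) : ℂ) ^ 2).re := by
  have hPpos : 0 < P := by linarith
  have e : (conj (c - ρ) / ((1 / (4 * P ^ 2) : ℝ) : ℂ) ^ 2).re = (c - ρ).re * (16 * P ^ 4) := by
    have : ((1 / (4 * P ^ 2) : ℝ) : ℂ) ^ 2 = ((1 / (16 * P ^ 4) : ℝ) : ℂ) := by
      rw [← Complex.ofReal_pow]; congr 1; field_simp; norm_num
    rw [this, Complex.div_ofReal_re, Complex.conj_re]
    field_simp
  rw [Complex.sub_re (c - ρ)⁻¹, e, Complex.inv_re, Complex.normSq_apply, ← sq, ← sq]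
  have : (c - ρ).re * (16 * P ^ 4) ≤ 1 := by
    calc (c - ρ).re * (16 * P ^ 4) ≤ 1 / P ^ 6 * (16 * P ^ 4) := by gcongr
      _ = 16 / P ^ 2 := by field_simp
      _ ≤ 1 := by rw [div_le_one (by positivity)]; nlinarith
  linarith

set_option maxHeartbeats 1000000 in
theorem ne_zero (h : GoodL P f Λ) (hP : 10 ^ 6 ≤ P) {ρ : ℂ} (hre : 1 - 1 / P ^ 7 < ρ.re)
    (him : |ρ.im| ≤ P ^ 30) : f ρ ≠ 0 := by
  intro h0
  have hPpos : 0 < P := by linarith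
  have hβ1 : ρ.re ≤ 1 := by
    by_contra hlt
    exact h.ne ρ (by linarith) h0
  set β := ρ.re with hβ
  set γ := ρ.im with hγ
  -- basic size comparisons
  have hp6 : 10 ^ 36 ≤ P ^ 6 := by
    have := pow_le_pow_left₀ (by norm_num) hP 6
    norm_num at this ⊢; exact this
  have hp30 : 1 ≤ P ^ 30 := one_le_pow₀ (by linarith)
  have hδ : 1 / P ^ 7 ≤ 1 / (10 ^ 6 * P ^ 6) := by
    apply one_div_le_one_div_of_le (by positivity)
    have : P ^ 7 = P * P ^ 6 := by ring
    rw [this]; gcongr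
  have hsmall : ∀ K : ℝ, 0 < K → K ≤ 10 ^ 5 → 1 + 1 / P ^ 10 ≤ 1 + 1 / (K * P ^ 6) := by
    intro K hK hK2
    have : 1 / P ^ 10 ≤ 1 / (K * P ^ 6) := by
      apply one_div_le_one_div_of_le (by positivity)
      have e : P ^ 10 = P ^ 4 * P ^ 6 := by ring
      rw [e]; gcongr
      have : (10 : ℝ) ^ 5 ≤ P ^ 4 := by
        have := pow_le_pow_left₀ (by norm_num) hP 4
        norm_num at this; linarith
      linarith
    linarith
  have hq : ∃ q : ℝ, q = 1 / P ^ 6 ∧ 0 < q ∧ q * P ^ 6 = 1 ∧ q ≤ 1 / 10 ^ 36 := by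
    refine ⟨1 / P ^ 6, rfl, by positivity, by field_simp, ?_⟩
    exact one_div_le_one_div_of_le (by norm_num) hp6
  obtain ⟨q, hqd, hq0, hqP, hq36⟩ := hq
  have eδ : 1 / (10 ^ 6 * P ^ 6) = q / 10 ^ 6 := by rw [hqd]; field_simp
  rw [eδ] at hδ
  have hradius : q ≤ 1 / (4 * P ^ 2) / 2 := by
    rw [hqd, div_div]
    apply one_div_le_one_div_of_le (by positivity)
    have e : P ^ 6 = P ^ 4 * P ^ 2 := by ring
    rw [e]
    have : (10 : ℝ) ≤ P ^ 4 := by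
      have := pow_le_pow_left₀ (by norm_num) hP 4
      norm_num at this; linarith
    nlinarith [sq_nonneg P]
  by_cases hcase : |γ| ≤ q / 16000
  · -- a conjugate pair of zeros, or a double real zero
    set a : ℝ := q / 8000 with ha
    set c : ℂ := ((1 + a : ℝ) : ℂ) with hc
    have ha0 : 0 < a := by positivity
    have ea : 1 / (8000 * P ^ 6) = a := by rw [ha, hqd]; field_simp
    have hcre : 1 + 1 / P ^ 10 ≤ c.re := by
      have := hsmall 8000 (by norm_num) (by norm_num)
      rw [ea] at this
      simpa [hc] using this
    obtain ⟨h1, h2, h3, h4⟩ := h.landau_data hP (c := c) hcre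
      (by simp [hc]; linarith) (by simp [hc]; positivity)
    have hre1 : (c - ρ).re = 1 + a - β := by simp [hc, hβ]
    have him1 : (c - ρ).im = -γ := by simp [hc, hγ]
    have hre2 : (c - conj ρ).re = 1 + a - β := by simp [hc, hβ]
    have him2 : (c - conj ρ).im = γ := by simp [hc, hγ]
    have hnorm : ∀ w : ℂ, w.re = 1 + a - β → |w.im| ≤ q / 16000 →
        ‖w‖ ≤ 1 / (4 * P ^ 2) / 2 := by
      intro w hw hw'
      refine (Complex.norm_le_abs_re_add_abs_im w).trans ?_
      rw [hw, abs_of_pos (by linarith)]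
      linarith
    have hd1 : dist ρ c ≤ 1 / (4 * P ^ 2) / 2 := by
      rw [dist_comm, dist_eq_norm]
      exact hnorm _ hre1 (by rw [him1, abs_neg]; exact hcase)
    have hd2 : dist (conj ρ) c ≤ 1 / (4 * P ^ 2) / 2 := by
      rw [dist_comm, dist_eq_norm]
      exact hnorm _ hre2 (by rw [him2]; exact hcase)
    have hdom : 1 - 1 / P ^ 2 < ρ.re := by
      have : 1 / P ^ 7 ≤ 1 / P ^ 2 := by
        apply one_div_le_one_div_of_le (by positivity)
        exact pow_le_pow_right₀ (by linarith) (by norm_num)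
      linarith
    have hz2 : (conj ρ ≠ ρ ∧ f (conj ρ) = 0) ∨ (conj ρ = ρ ∧ deriv f ρ = 0) := by
      by_cases hr : conj ρ = ρ
      · right
        refine ⟨hr, ?_⟩
        have hreal : ((β : ℝ) : ℂ) = ρ := Complex.conj_eq_iff_re.mp hr
        rw [← hreal]
        exact h.double β hre hβ1 (by rw [hreal]; exact h0)
      · left
        refine ⟨hr, ?_⟩
        rw [h.conj_eq ρ hdom, h0, map_zero]
    have key := re_logDeriv_ge_of_two_zeros (by positivity) isOpen_dom h1 h.diff h2 h3 h4 hd1 h0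
      hd2 hz2
    have t1 := re_term_ge (c := c) (ρ := ρ) hP (by rw [hre1]; linarith)
      (by rw [hre1, ← hqd]; linarith)
    have t2 := re_term_ge (c := c) (ρ := conj ρ) hP (by rw [hre2]; linarith)
      (by rw [hre2, ← hqd]; linarith)
    rw [hre1, him1, neg_sq] at t1
    rw [hre2, him2] at t2
    have hup : (deriv f c / f c).re ≤ 1 / a := by
      rw [h.logd c (by simp [hc, ha0]), Complex.sub_re]
      have := h.re_LSeries_real_nonneg (u := 1 + a) (by linarith)
      have e : (1 / (c - 1)).re = 1 / a := by
        have : (1 / (c - 1)) = ((1 / a : ℝ) : ℂ) := by simp [hc]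
        rw [this, Complex.ofReal_re]
      rw [e]; linarith
    have eA : 224 * (2 * P ^ 4) / (1 / (4 * P ^ 2)) = 1792 * P ^ 6 := by
      field_simp; ring
    rw [eA] at key
    set X := 1 + a - β with hX
    have hX1 : a ≤ X := by linarith
    have hX0 : 0 < X := by linarith
    have hX2 : X ≤ 1.1 * a := by rw [ha] at *; linarith
    have hγ2 : γ ^ 2 ≤ 0.25 * a ^ 2 := by
      have : |γ| ≤ a / 2 := by rw [ha]; linarith
      have := pow_le_pow_left₀ (abs_nonneg γ) this 2
      rw [sq_abs] at this
      linarith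
    have hfrac : 1 / (1.46 * a) ≤ X / (X ^ 2 + γ ^ 2) := by
      rw [div_le_div_iff₀ (by positivity) (by positivity)]
      nlinarith
    have hfa : 1 / (1.46 * a) = (1 / 1.46) * (1 / a) := by field_simp
    have hinv : 1 / a = 8000 * P ^ 6 := by rw [← ea]; field_simp
    rw [hfa, hinv] at hfrac
    rw [hinv] at hup
    norm_num at hfrac
    linarith
  · push Not at hcase
    set v : ℝ := q / 10 ^ 5 with hv
    have hv0 : 0 < v := by positivity
    have ev : 1 / (10 ^ 5 * P ^ 6) = v := by rw [hv, hqd]; field_simp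
    have hvs := hsmall (10 ^ 5) (by norm_num) (by norm_num)
    rw [ev] at hvs
    set c : ℂ := ((1 + v : ℝ) : ℂ) + γ * I with hc
    have hcre' : c.re = 1 + v := by simp [hc]
    have hcim' : c.im = γ := by simp [hc]
    obtain ⟨h1, h2, h3, h4⟩ := h.landau_data hP (c := c) (by rw [hcre']; exact hvs)
      (by rw [hcre']; linarith) (by rw [hcim']; linarith)
    have hre1 : (c - ρ).re = 1 + v - β := by rw [Complex.sub_re, hcre']
    have him1 : (c - ρ).im = 0 := by rw [Complex.sub_im, hcim', sub_self]
    have hd1 : dist ρ c ≤ 1 / (4 * P ^ 2) / 2 := by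
      rw [dist_comm, dist_eq_norm]
      refine (Complex.norm_le_abs_re_add_abs_im _).trans ?_
      rw [hre1, him1, abs_of_pos (by linarith), abs_zero]
      linarith
    have key := re_logDeriv_ge_of_zero (by positivity) isOpen_dom h1 h.diff h2 h3 h4 hd1 h0
    have t1 := re_term_ge (c := c) (ρ := ρ) hP (by rw [hre1]; linarith)
      (by rw [hre1, ← hqd]; linarith)
    rw [hre1, him1] at t1
    have eA : 224 * (2 * P ^ 4) / (1 / (4 * P ^ 2)) = 1792 * P ^ 6 := by
      field_simp; ring
    rw [eA] at key
    have k0 := h.re_logDeriv_ge' hP (c := ((1 + v : ℝ) : ℂ)) (by simpa using hvs)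
      (by simp; linarith) (by simp; positivity)
    have k2 := h.re_logDeriv_ge' hP (c := ((1 + v : ℝ) : ℂ) + (2 * γ : ℝ) * I) (by simpa using hvs)
      (by simp; linarith) (by
        simp only [add_im, ofReal_im, mul_im, ofReal_re, I_im, mul_one, I_re, mul_zero, add_zero,
          zero_add]
        rw [abs_mul]; norm_num; linarith)
    have t341 := h.three_four_one (u := 1 + v) (by linarith) γ
    rw [h.logd _ (by simp [hv0]), Complex.sub_re] at k0 k2
    rw [h.logd c (by rw [hcre']; linarith), Complex.sub_re (1 / (c - 1))] at key
    have hγ0 : 0 < γ ^ 2 := by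
      have : 0 < |γ| := lt_trans (by positivity) hcase
      have := pow_pos this 2
      rwa [sq_abs] at this
    have hγ2 : (q / 16000) ^ 2 ≤ γ ^ 2 := by
      have := pow_le_pow_left₀ (by positivity) hcase.le 2
      rwa [sq_abs] at this
    have e0 : (1 / (((1 + v : ℝ) : ℂ) - 1)).re = 1 / v := by
      have : (1 / (((1 + v : ℝ) : ℂ) - 1)) = ((1 / v : ℝ) : ℂ) := by simp
      rw [this, Complex.ofReal_re]
    have hpole : ∀ t : ℝ, γ ^ 2 ≤ t ^ 2 →
        (1 / (((1 + v : ℝ) : ℂ) + t * I - 1)).re ≤ v / γ ^ 2 := by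
      intro t ht
      rw [one_div, Complex.inv_re, Complex.normSq_apply]
      have hr : (((1 + v : ℝ) : ℂ) + t * I - 1).re = v := by simp
      have hi : (((1 + v : ℝ) : ℂ) + t * I - 1).im = t := by simp
      rw [hr, hi]
      have h5 : γ ^ 2 ≤ v * v + t * t := by
        have := sq t
        have := mul_self_nonneg v
        linarith
      exact div_le_div_of_nonneg_left hv0.le hγ0 h5
    have p1 := hpole γ le_rfl
    have p2 := hpole (2 * γ) (by rw [mul_pow]; linarith)
    rw [e0] at k0
    have hbnd : v / γ ^ 2 ≤ 2560 * P ^ 6 := by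
      rw [div_le_iff₀ hγ0]
      have e : 2560 * P ^ 6 * (q / 16000) ^ 2 = v := by
        have : 2560 * P ^ 6 * (q / 16000) ^ 2 = (q * P ^ 6) * q / 10 ^ 5 := by ring
        rw [this, hqP, hv, one_mul]
      calc v = 2560 * P ^ 6 * (q / 16000) ^ 2 := e.symm
        _ ≤ 2560 * P ^ 6 * γ ^ 2 := by gcongr
    have hX : 1 / (1.1 * v) ≤ (1 + v - β) / ((1 + v - β) ^ 2 + 0 ^ 2) := by
      have hX1 : 0 < 1 + v - β := by linarith
      have hX2 : 1 + v - β ≤ 1.1 * v := by rw [hv] at *; linarith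
      have : (1 + v - β) / ((1 + v - β) ^ 2 + 0 ^ 2) = 1 / (1 + v - β) := by field_simp; ring
      rw [this]
      exact one_div_le_one_div_of_le hX1 hX2
    have hfa : 1 / (1.1 * v) = (1 / 1.1) * (1 / v) := by field_simp
    have hinv : 1 / v = 10 ^ 5 * P ^ 6 := by rw [← ev]; field_simp
    rw [hfa, hinv] at hX
    rw [hinv] at k0
    have e11 : (1 / 1.1 : ℝ) = 10 / 11 := by norm_num
    rw [e11] at hX
    linarith

theorem norm_logDeriv_le (h : GoodL P f Λ) (hP : 10 ^ 6 ≤ P) {s : ℂ}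
    (hre1 : 1 - 1 / (2 * P ^ 7) ≤ s.re) (hre2 : s.re ≤ 1 + 1 / P ^ 7)
    (him : |s.im| ≤ P ^ 30 - 1) : ‖deriv f s / f s‖ ≤ 224 * P ^ 11 := by
  have hPpos : 0 < P := by linarith
  set δ := 1 / P ^ 7 with hδ
  have hδ0 : 0 < δ := by positivity
  have hδ1 : δ ≤ 1 := by
    rw [hδ, div_le_one (by positivity)]; exact one_le_pow₀ (by linarith)
  have hδ2 : δ < 1 / P ^ 2 := by
    apply one_div_lt_one_div_of_lt (by positivity)
    exact pow_lt_pow_right₀ (by linarith) (by norm_num)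
  have hδ10 : 1 / P ^ 10 ≤ δ / 4 := by
    rw [hδ, div_div]
    apply one_div_le_one_div_of_le (by positivity)
    have e : P ^ 10 = P ^ 7 * P ^ 3 := by ring
    rw [e]
    have : 4 ≤ P ^ 3 := by
      have := pow_le_pow_left₀ (by norm_num) hP 3
      norm_num at this; linarith
    gcongr
  have e2 : 1 / (2 * P ^ 7) = δ / 2 := by rw [hδ]; field_simp
  rw [e2] at hre1
  set c : ℂ := ((1 + δ / 4 : ℝ) : ℂ) + s.im * I with hc
  have hcre : c.re = 1 + δ / 4 := by simp [hc]
  have hcim : c.im = s.im := by simp [hc]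
  have hp30 : 1 ≤ P ^ 30 := one_le_pow₀ (by linarith)
  have hp31 : P ^ 30 ≤ P ^ 31 := pow_le_pow_right₀ (by linarith) (by norm_num)
  have hb : ∀ z ∈ ball c δ, 1 - δ < z.re ∧ z.re ≤ 3 ∧ |z.im| ≤ P ^ 30 := by
    intro z hz
    rw [mem_ball, dist_eq_norm] at hz
    have h1 := (Complex.abs_re_le_norm (z - c)).trans hz.le
    have h2 := (Complex.abs_im_le_norm (z - c)).trans hz.le
    rw [Complex.sub_re, hcre] at h1
    rw [Complex.sub_im, hcim] at h2
    refine ⟨by linarith [(abs_le.mp h1).1], by linarith [(abs_le.mp h1).2], ?_⟩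
    have h3 : |z.im| ≤ |z.im - s.im| + |s.im| := by
      have := abs_add_le (z.im - s.im) s.im
      simpa using this
    linarith
  have hdist : dist s c ≤ 3 * δ / 4 := by
    rw [dist_eq_norm]
    refine (Complex.norm_le_abs_re_add_abs_im _).trans ?_
    rw [Complex.sub_re, Complex.sub_im, hcre, hcim, sub_self, abs_zero, add_zero, abs_le]
    constructor <;> linarith
  have := norm_logDeriv_le_of_ne_zero (M := 2 * P ^ 4) hδ0 (by positivity)
    (h.diff.mono fun z hz => by
      have := (hb z hz).1
      change 1 - 1 / P ^ 2 < z.re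
      linarith)
    (fun z hz => h.ne_zero hP (hb z hz).1 (hb z hz).2.2)
    (fun z hz => by
      have h1 := h.upper z (by linarith [(hb z hz).1]) (hb z hz).2.1 (by linarith [(hb z hz).2.2])
      have h2 := h.lower c (by rw [hcre]; linarith) (by rw [hcre]; linarith)
        (by rw [hcim]; linarith)
      refine h1.trans ?_
      have e : Real.exp (P ^ 4) = Real.exp (2 * P ^ 4) * Real.exp (-P ^ 4) := by
        rw [← Real.exp_add]; congr 1; ring
      rw [e]
      gcongr) hdist
  refine this.trans (le_of_eq ?_)
  rw [hδ]
  field_simp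
  ring

end GoodL

end

section

open Complex Set MeasureTheory

/-- Mellin inversion for a function given through its Mellin transform on one vertical line. -/
theorem mellin_inversion_of_hasMellin {f g F : _ → ℂ} {σ : ℝ}
    (hg : ContinuousOn g (Ioi (0 : ℝ))) (hfg : EqOn f g (Ioi (0 : ℝ)))
    (hm : ∀ s : ℂ, s.re = σ → HasMellin f s (F s))
    (hF : Integrable fun t : ℝ => F (σ + t * I)) {u : ℝ} (hu : 0 < u) :
    ∫ t : ℝ, (u : ℂ) ^ (-(σ + t * I)) * F (σ + t * I) = 2 * Real.pi * g u := by
  have e : ∀ t : ℝ, mellin f (σ + t * I) = F (σ + t * I) := fun t => (hm _ (by simp)).2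
  have hcont : ContinuousAt f u := by
    have h1 : ContinuousAt g u := hg.continuousAt (Ioi_mem_nhds hu)
    exact h1.congr (Filter.eventually_of_mem (Ioi_mem_nhds hu) fun x hx => (hfg hx).symm)
  have h := mellinInv_mellin_eq σ f hu (hm σ (by simp)).1
    (by simpa only [VerticalIntegrable, e] using hF) hcont
  rw [mellinInv, hfg hu] at h
  simp only [e, smul_eq_mul] at h
  rw [← h]
  have : (Real.pi : ℂ) ≠ 0 := by exact_mod_cast Real.pi_ne_zero
  rw [Complex.real_smul]
  push_cast
  rw [← mul_assoc, mul_one_div_cancel (mul_ne_zero two_ne_zero this), one_mul]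

theorem norm_mul_add_one_ge {s : ℂ} (hs : 1 / 2 ≤ s.re) :
    (1 + s.im ^ 2) / 2 ≤ ‖s * (s + 1)‖ := by
  rw [norm_mul]
  have h1 : (1 + s.im ^ 2) / 4 ≤ ‖s‖ ^ 2 := by
    rw [← Complex.normSq_eq_norm_sq, Complex.normSq_apply]; nlinarith
  have h2 : 1 + s.im ^ 2 ≤ ‖s + 1‖ ^ 2 := by
    rw [← Complex.normSq_eq_norm_sq, Complex.normSq_apply]
    simp only [add_re, one_re, add_im, one_im]; nlinarith
  refine le_of_sq_le_sq ?_ (by positivity)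
  calc ((1 + s.im ^ 2) / 2) ^ 2 = (1 + s.im ^ 2) / 4 * (1 + s.im ^ 2) := by ring
    _ ≤ ‖s‖ ^ 2 * ‖s + 1‖ ^ 2 := by gcongr
    _ = (‖s‖ * ‖s + 1‖) ^ 2 := by ring

theorem norm_inv_mul_add_one_le {s : ℂ} (hs : 1 / 2 ≤ s.re) :
    ‖1 / (s * (s + 1))‖ ≤ 2 * (1 + s.im ^ 2)⁻¹ := by
  have h := norm_mul_add_one_ge hs
  rw [norm_div, norm_one]
  calc 1 / ‖s * (s + 1)‖ ≤ 1 / ((1 + s.im ^ 2) / 2) := by gcongr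
    _ = 2 * (1 + s.im ^ 2)⁻¹ := by field_simp

theorem ne_zero_of_half_le_re {s : ℂ} (hs : 1 / 2 ≤ s.re) : s * (s + 1) ≠ 0 := by
  have := norm_mul_add_one_ge hs
  intro h
  rw [h, norm_zero] at this
  nlinarith [sq_nonneg s.im]

theorem integrable_kernel {σ : ℝ} (hσ : 1 / 2 ≤ σ) {G : ℝ → ℂ} (hG : Continuous G) {B : ℝ}
    (hB : ∀ t, ‖G t‖ ≤ B) :
    Integrable fun t : ℝ => G t * (1 / ((σ + t * I : ℂ) * (σ + t * I + 1))) := by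
  have hne : ∀ t : ℝ, (σ + t * I : ℂ) * (σ + t * I + 1) ≠ 0 := fun t =>
    ne_zero_of_half_le_re (by simpa using hσ)
  refine Integrable.mono' (integrable_inv_one_add_sq.const_mul (B * 2)) ?_ ?_
  · refine (hG.mul (continuous_const.div ?_ hne)).aestronglyMeasurable
    fun_prop
  · refine Filter.Eventually.of_forall fun t => ?_
    have := norm_inv_mul_add_one_le (s := σ + t * I) (by simpa using hσ)
    simp only [add_im, ofReal_im, mul_im, ofReal_re, I_im, mul_one, I_re, mul_zero, add_zero,
      zero_add] at this
    rw [norm_mul, mul_assoc]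
    exact mul_le_mul (hB t) this (norm_nonneg _) ((norm_nonneg _).trans (hB t))

theorem integral_kernel_one {σ : ℝ} (hσ : 1 ≤ σ) {u : ℝ} (hu : 0 < u) :
    ∫ t : ℝ, (u : ℂ) ^ (-(σ + t * I)) * (1 / ((σ + t * I : ℂ) * (σ + t * I + 1)))
      = 2 * Real.pi * ((max (1 - u) 0 : ℝ) : ℂ) := by
  refine mellin_inversion_of_hasMellin
    (f := fun t => indicator (Ioc 0 1) (fun _ => 1 : ℝ → ℂ) t -
      indicator (Ioc 0 1) (fun t => (t : ℂ) ^ (1 : ℂ) : ℝ → ℂ) t)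
    (g := fun u : ℝ => ((max (1 - u) 0 : ℝ) : ℂ))
    (F := fun s : ℂ => 1 / (s * (s + 1))) ?_ ?_ ?_ ?_ hu
  · exact (by fun_prop : Continuous fun u : ℝ => ((max (1 - u) 0 : ℝ) : ℂ)).continuousOn
  · intro t ht
    change (0 : ℝ) < t at ht
    by_cases h1 : t ≤ 1
    · simp [indicator, ht, h1]
    · simp [indicator, h1, (not_le.mp h1).le]
  · intro s hs
    have h1 := hasMellin_one_Ioc (s := s) (by linarith)
    have h2 := hasMellin_cpow_Ioc 1 (s := s) (by rw [one_re]; linarith)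
    have h3 := hasMellin_sub h1.1 h2.1
    rw [h1.2, h2.2] at h3
    have h4 := ne_zero_of_half_le_re (s := s) (by linarith)
    have h5 : s ≠ 0 := left_ne_zero_of_mul h4
    have h6 : s + 1 ≠ 0 := right_ne_zero_of_mul h4
    have e : 1 / (s * (s + 1)) = 1 / s - 1 / (s + 1) := by field_simp; ring
    rw [e]
    exact h3
  · simpa using integrable_kernel (σ := σ) (by linarith) (G := fun _ => 1) continuous_const
      (B := 1) (by simp)

theorem integral_kernel_two {σ : ℝ} (hσ : 1 < σ) {u : ℝ} (hu : 0 < u) :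
    ∫ t : ℝ, (u : ℂ) ^ (-(σ + t * I)) *
        (1 / (σ + t * I - 1) * (1 / ((σ + t * I : ℂ) * (σ + t * I + 1))))
      = 2 * Real.pi * ((max (1 - u) 0 ^ 2 / (2 * u) : ℝ) : ℂ) := by
  refine mellin_inversion_of_hasMellin
    (f := fun t => (1 / 2 : ℂ) • (indicator (Ioc 0 1) (fun t => (t : ℂ) ^ (-1 : ℂ) : ℝ → ℂ) t) -
      (indicator (Ioc 0 1) (fun _ => 1 : ℝ → ℂ) t -
      (1 / 2 : ℂ) • (indicator (Ioc 0 1) (fun t => (t : ℂ) ^ (1 : ℂ) : ℝ → ℂ) t)))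
    (g := fun u : ℝ => ((max (1 - u) 0 ^ 2 / (2 * u) : ℝ) : ℂ))
    (F := fun s : ℂ => 1 / (s - 1) * (1 / (s * (s + 1)))) ?_ ?_ ?_ ?_ hu
  · refine Complex.continuous_ofReal.comp_continuousOn ?_
    refine ContinuousOn.div (by fun_prop) (by fun_prop) fun x hx => ?_
    change (0 : ℝ) < x at hx
    positivity
  · intro t ht
    change (0 : ℝ) < t at ht
    have htc : (t : ℂ) ≠ 0 := by exact_mod_cast ht.ne'
    by_cases h1 : t ≤ 1
    · simp only [indicator, mem_Ioc, ht, h1, and_self, if_true, cpow_neg, cpow_one, smul_eq_mul]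
      rw [max_eq_left (by linarith)]
      push_cast
      field_simp
      ring
    · simp [indicator, h1, (not_le.mp h1).le]
  · intro s hs
    have h0 := hasMellin_cpow_Ioc (-1) (s := s) (by rw [neg_re, one_re]; linarith)
    have h1 := hasMellin_one_Ioc (s := s) (by linarith)
    have h2 := hasMellin_cpow_Ioc 1 (s := s) (by rw [one_re]; linarith)
    have k0 := hasMellin_const_smul h0.1 (1 / 2 : ℂ)
    have k2 := hasMellin_const_smul h2.1 (1 / 2 : ℂ)
    have h3 := hasMellin_sub h1.1 k2.1
    have h7 := hasMellin_sub k0.1 h3.1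
    rw [h3.2, k0.2, k2.2, h0.2, h1.2, h2.2] at h7
    have h4 := ne_zero_of_half_le_re (s := s) (by linarith)
    have h5 : s ≠ 0 := left_ne_zero_of_mul h4
    have h6 : s + 1 ≠ 0 := right_ne_zero_of_mul h4
    have h8 : s - 1 ≠ 0 := by
      intro h
      rw [sub_eq_zero] at h
      rw [h, one_re] at hs
      linarith
    have e : 1 / (s - 1) * (1 / (s * (s + 1)))
        = (1 / 2 : ℂ) • (1 / (s + -1)) - (1 / s - (1 / 2 : ℂ) • (1 / (s + 1))) := by
      rw [← sub_eq_add_neg, smul_eq_mul, smul_eq_mul]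
      field_simp
      ring
    rw [e]
    exact h7
  · have hne : ∀ t : ℝ, (σ + t * I - 1 : ℂ) ≠ 0 := by
      intro t h
      have := congrArg Complex.re h
      simp at this
      linarith
    refine integrable_kernel (σ := σ) (by linarith) (G := fun t : ℝ => 1 / (σ + t * I - 1 : ℂ))
      (continuous_const.div (by fun_prop) hne) (B := 1 / (σ - 1)) ?_
    intro t
    rw [norm_div, norm_one]
    apply one_div_le_one_div_of_le (by linarith)
    have := Complex.re_le_norm (σ + t * I - 1 : ℂ)
    simpa using this

end

section

open Complex Set MeasureTheory

namespace GoodL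

variable {P : ℝ} {f : ℂ → ℂ} {Λ : ℕ → ℝ}

/-- The smoothed Perron kernel. -/
noncomputable def ker (y : ℝ) (s : ℂ) : ℂ := (y : ℂ) ^ s * (1 / (s * (s + 1)))

theorem norm_ker_le {y : ℝ} (hy : 0 < y) {s : ℂ} (hs : 1 / 2 ≤ s.re) :
    ‖ker y s‖ ≤ y ^ s.re * (2 * (1 + s.im ^ 2)⁻¹) := by
  rw [ker, norm_mul, Complex.norm_cpow_eq_rpow_re_of_pos hy]
  gcongr
  exact norm_inv_mul_add_one_le hs

theorem differentiableAt_ker {y : ℝ} (hy : 0 < y) {s : ℂ} (hs : 1 / 2 ≤ s.re) :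
    DifferentiableAt ℂ (ker y) s := by
  have h1 : (y : ℂ) ≠ 0 := by exact_mod_cast hy.ne'
  have h2 := ne_zero_of_half_le_re hs
  have h3 : DifferentiableAt ℂ (fun s : ℂ => (y : ℂ) ^ s) s :=
    differentiableAt_id.const_cpow (Or.inl h1)
  have h4 : DifferentiableAt ℂ (fun s : ℂ => 1 / (s * (s + 1))) s :=
    (differentiableAt_const _).div (by fun_prop) h2
  exact h3.mul h4

theorem continuous_ker_line {y σ : ℝ} (hy : 0 < y) (hσ : 1 / 2 ≤ σ) :
    Continuous fun t : ℝ => ker y (σ + t * I) := by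
  rw [continuous_iff_continuousAt]
  intro t
  have h := (differentiableAt_ker hy (s := σ + t * I) (by simpa using hσ)).continuousAt
  have h2 : ContinuousAt (fun t : ℝ => (σ + t * I : ℂ)) t := by fun_prop
  exact ContinuousAt.comp (f := fun t : ℝ => (σ + t * I : ℂ)) (g := ker y) h h2

theorem integrable_mul_ker {y σ : ℝ} (hy : 0 < y) (hσ : 1 / 2 ≤ σ) {G : ℝ → ℂ}
    (hG : Continuous G) {B : ℝ} (hB : ∀ t, ‖G t‖ ≤ B) :
    Integrable fun t : ℝ => G t * ker y (σ + t * I) := by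
  refine Integrable.mono' (integrable_inv_one_add_sq.const_mul (B * (y ^ σ * 2))) ?_ ?_
  · exact (hG.mul (continuous_ker_line hy hσ)).aestronglyMeasurable
  · refine Filter.Eventually.of_forall fun t => ?_
    have := norm_ker_le hy (s := σ + t * I) (by simpa using hσ)
    simp only [add_im, ofReal_im, mul_im, ofReal_re, I_im, mul_one, I_re, mul_zero, add_zero,
      zero_add, add_re, mul_re, sub_self] at this
    rw [norm_mul, mul_assoc, mul_assoc (y ^ σ)]
    exact mul_le_mul (hB t) this (norm_nonneg _) ((norm_nonneg _).trans (hB t))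

theorem div_cpow_neg {a y : ℝ} (ha : 0 < a) (hy : 0 < y) (s : ℂ) :
    ((a / y : ℝ) : ℂ) ^ (-s) = (y : ℂ) ^ s / (a : ℂ) ^ s := by
  have h1 : (a : ℂ) ≠ 0 := by exact_mod_cast ha.ne'
  have h2 : (y : ℂ) ≠ 0 := by exact_mod_cast hy.ne'
  have h3 : ((a / y : ℝ) : ℂ) ≠ 0 := by exact_mod_cast (div_pos ha hy).ne'
  rw [Complex.cpow_def_of_ne_zero h1, Complex.cpow_def_of_ne_zero h2,
    Complex.cpow_def_of_ne_zero h3, ← Complex.exp_sub, ← Complex.ofReal_log ha.le,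
    ← Complex.ofReal_log hy.le, ← Complex.ofReal_log (div_pos ha hy).le,
    Real.log_div ha.ne' hy.ne']
  congr 1
  push_cast
  ring

theorem hasSum_perron (h : GoodL P f Λ) {y σ : ℝ} (hy : 0 < y) (hσ : 1 < σ) :
    HasSum (fun k : ℕ => 2 * Real.pi * ((Λ k * max (1 - k / y) 0 : ℝ) : ℂ))
      (∫ t : ℝ, LSeries (fun n => (Λ n : ℂ)) (σ + t * I) * ker y (σ + t * I)) := by
  set F : ℕ → ℝ → ℂ := fun k t =>
    LSeries.term (fun n => (Λ n : ℂ)) (σ + t * I) k * ker y (σ + t * I) with hF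
  have hnorm : ∀ (k : ℕ) (t : ℝ), ‖LSeries.term (fun n => (Λ n : ℂ)) (σ + t * I) k‖
      = ‖LSeries.term (fun n => (Λ n : ℂ)) σ k‖ := by
    intro k t
    rw [LSeries.norm_term_eq, LSeries.norm_term_eq]; simp
  have hcont : ∀ k, Continuous fun t : ℝ => LSeries.term (fun n => (Λ n : ℂ)) (σ + t * I) k := by
    intro k
    rcases eq_or_ne k 0 with rfl | hk
    · simp only [LSeries.term_zero]; exact continuous_const
    have hk0 : (k : ℂ) ≠ 0 := by exact_mod_cast hk
    simp only [LSeries.term_of_ne_zero hk]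
    refine continuous_const.div ?_ ?_
    · exact Continuous.const_cpow (by fun_prop) (Or.inl hk0)
    · intro t; simp [Complex.cpow_eq_zero_iff, hk0]
  have hint : ∀ k, Integrable (F k) := fun k =>
    integrable_mul_ker hy (by linarith) (hcont k) (fun t => (hnorm k t).le)
  have hsum : Summable fun k => ∫ t, ‖F k t‖ := by
    have e : (fun k => ∫ t, ‖F k t‖) = fun k => ‖LSeries.term (fun n => (Λ n : ℂ)) σ k‖ *
        ∫ t : ℝ, ‖ker y (σ + t * I)‖ := by
      funext k
      rw [← integral_const_mul]
      congr 1; funext t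
      rw [hF, norm_mul, hnorm]
    rw [e]
    exact (h.summable (by simpa using hσ)).norm.mul_right _
  have hs := hasSum_integral_of_summable_integral_norm hint hsum
  have e2 : (fun t : ℝ => ∑' k, F k t)
      = fun t : ℝ => LSeries (fun n => (Λ n : ℂ)) (σ + t * I) * ker y (σ + t * I) := by
    funext t
    rw [LSeries, ← tsum_mul_right]
  rw [e2] at hs
  refine (funext fun k => ?_ : (fun k : ℕ => 2 * Real.pi * ((Λ k * max (1 - k / y) 0 : ℝ) : ℂ))
    = fun k => ∫ t : ℝ, F k t) ▸ hs
  rcases eq_or_ne k 0 with rfl | hk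
  · have h0 : Λ 0 = 0 := le_antisymm (by simpa using h.le 0) (h.nonneg 0)
    simp [hF, h0]
  have hkp : (0 : ℝ) < k := by exact_mod_cast Nat.pos_of_ne_zero hk
  have := integral_kernel_one hσ.le (div_pos hkp hy)
  push_cast
  rw [← mul_assoc, mul_comm (2 * (Real.pi : ℂ)) (Λ k : ℂ), mul_assoc]
  push_cast at this
  rw [← this, ← integral_const_mul]
  congr 1; funext t
  simp only [hF, LSeries.term_of_ne_zero hk, ker]
  have hd := div_cpow_neg hkp hy (σ + t * I)
  push_cast at hd
  rw [hd]
  ring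

theorem perron_pole {y σ : ℝ} (hy : 0 < y) (hσ : 1 < σ) :
    ∫ t : ℝ, 1 / (σ + t * I - 1) * ker y (σ + t * I)
      = 2 * Real.pi * ((max (1 - 1 / y) 0 ^ 2 * y / 2 : ℝ) : ℂ) := by
  have := integral_kernel_two hσ (one_div_pos.mpr hy)
  have e : max (1 - 1 / y) 0 ^ 2 / (2 * (1 / y)) = max (1 - 1 / y) 0 ^ 2 * y / 2 := by
    field_simp
  rw [e] at this
  rw [← this]
  congr 1; funext t
  rw [div_cpow_neg one_pos hy, ker]
  push_cast
  rw [one_cpow]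
  ring

theorem norm_LSeries_le (h : GoodL P f Λ) {u : ℝ} (hu : 1 < u) (t : ℝ) :
    ‖LSeries (fun n => (Λ n : ℂ)) (u + t * I)‖ ≤ (LSeries (fun n => (Λ n : ℂ)) u).re := by
  have hs0 : LSeriesSummable (fun n => (Λ n : ℂ)) u := h.summable (by simpa using hu)
  refine tsum_of_norm_bounded (Complex.hasSum_re hs0.hasSum) fun n => ?_
  rw [LSeries.norm_term_eq]
  rcases eq_or_ne n 0 with rfl | hn
  · simp
  rw [re_term hn, if_neg hn]
  have hnp : (0 : ℝ) < n := by exact_mod_cast Nat.pos_of_ne_zero hn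
  simp only [add_re, ofReal_re, mul_re, I_re, mul_zero, ofReal_im, I_im, mul_one, sub_self,
    add_zero, zero_mul, Real.cos_zero, Complex.norm_real, Real.norm_eq_abs,
    abs_of_nonneg (h.nonneg n)]
  rw [Real.rpow_neg hnp.le, div_eq_mul_inv]

/-- The logarithmic derivative on the line `Re s = 1 + 1 / P ^ 12`. -/
theorem norm_logDeriv_line (h : GoodL P f Λ) (hP : 10 ^ 6 ≤ P) (t : ℝ) :
    ‖deriv f ((1 + 1 / P ^ 12 : ℝ) + t * I) / f ((1 + 1 / P ^ 12 : ℝ) + t * I)‖ ≤ 3 * P ^ 12 := by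
  have hPpos : 0 < P := by linarith
  set v : ℝ := 1 / P ^ 12 with hv
  have hv0 : 0 < v := by positivity
  have hvinv : 1 / v = P ^ 12 := by rw [hv, one_div_one_div]
  have h1 := h.norm_LSeries_le (u := 1 + v) (by linarith) t
  have hv7 : v ≤ 1 / P ^ 7 := by
    apply one_div_le_one_div_of_le (by positivity)
    exact pow_le_pow_right₀ (by linarith) (by norm_num)
  have hp30 : 1 ≤ P ^ 30 := one_le_pow₀ (by linarith)
  have h2 := h.norm_logDeriv_le hP (s := ((1 + v : ℝ) : ℂ)) (by
      simp only [ofReal_re]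
      have : 0 < 1 / (2 * P ^ 7) := by positivity
      linarith) (by simpa using hv7) (by simpa using hp30)
  have h3 := (abs_le.mp ((Complex.abs_re_le_norm _).trans h2)).1
  rw [h.logd _ (by simpa using hv0), Complex.sub_re] at h3
  have e0 : (1 / (((1 + v : ℝ) : ℂ) - 1)).re = P ^ 12 := by
    have : (1 / (((1 + v : ℝ) : ℂ) - 1)) = ((1 / v : ℝ) : ℂ) := by simp
    rw [this, Complex.ofReal_re, hvinv]
  rw [e0] at h3
  rw [h.logd _ (by simpa using hv0)]
  refine (norm_sub_le _ _).trans ?_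
  have h4 : ‖1 / (((1 + v : ℝ) : ℂ) + t * I - 1)‖ ≤ P ^ 12 := by
    rw [norm_div, norm_one, ← hvinv]
    apply one_div_le_one_div_of_le hv0
    have := Complex.re_le_norm (((1 + v : ℝ) : ℂ) + t * I - 1)
    simpa using this
  have h5 : 224 * P ^ 11 ≤ P ^ 12 := by
    have : P ^ 12 = P * P ^ 11 := by ring
    rw [this]; gcongr; linarith
  linarith

theorem perron_identity (h : GoodL P f Λ) (hP : 10 ^ 6 ≤ P) {y : ℝ} (hy : 0 < y) :
    (∫ t : ℝ, deriv f ((1 + 1 / P ^ 12 : ℝ) + t * I) / f ((1 + 1 / P ^ 12 : ℝ) + t * I)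
        * ker y ((1 + 1 / P ^ 12 : ℝ) + t * I))
      = 2 * Real.pi * ((max (1 - 1 / y) 0 ^ 2 * y / 2
          - ∑' k : ℕ, Λ k * max (1 - k / y) 0 : ℝ) : ℂ) := by
  have hPpos : 0 < P := by linarith
  set σ : ℝ := 1 + 1 / P ^ 12 with hσ
  have hσ1 : 1 < σ := by
    have : 0 < 1 / P ^ 12 := by positivity
    linarith
  have h1 := (h.hasSum_perron hy hσ1)
  have h2 := perron_pole hy hσ1
  have hS : (∫ t : ℝ, LSeries (fun n => (Λ n : ℂ)) (σ + t * I) * ker y (σ + t * I))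
      = 2 * Real.pi * ((∑' k : ℕ, Λ k * max (1 - k / y) 0 : ℝ) : ℂ) := by
    rw [← h1.tsum_eq, tsum_mul_left, Complex.ofReal_tsum]
  push_cast [Complex.ofReal_sub] at *
  rw [mul_sub, ← hS, ← h2, ← integral_sub]
  · congr 1; funext t
    rw [h.logd _ (by simpa using hσ1)]
    ring
  · have hne : ∀ t : ℝ, (σ + t * I - 1 : ℂ) ≠ 0 := by
      intro t h
      have := congrArg Complex.re h
      simp at this
      linarith
    refine integrable_mul_ker hy (by linarith) (G := fun t : ℝ => 1 / (σ + t * I - 1 : ℂ))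
      (continuous_const.div (by fun_prop) hne) (B := 1 / (σ - 1)) ?_
    intro t
    rw [norm_div, norm_one]
    apply one_div_le_one_div_of_le (by linarith)
    have := Complex.re_le_norm (σ + t * I - 1 : ℂ)
    simpa using this
  · refine integrable_mul_ker hy (by linarith)
      (G := fun t : ℝ => LSeries (fun n => (Λ n : ℂ)) (σ + t * I)) ?_ (h.norm_LSeries_le hσ1)
    refine continuous_tsum (u := fun n => ‖LSeries.term (fun n => (Λ n : ℂ)) σ n‖) ?_
      (h.summable (s := σ) (by simpa using hσ1)).norm ?_
    · intro k
      rcases eq_or_ne k 0 with rfl | hk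
      · simp only [LSeries.term_zero]; exact continuous_const
      have hk0 : (k : ℂ) ≠ 0 := by exact_mod_cast hk
      simp only [LSeries.term_of_ne_zero hk]
      refine continuous_const.div ?_ ?_
      · exact Continuous.const_cpow (by fun_prop) (Or.inl hk0)
      · intro t; simp [Complex.cpow_eq_zero_iff, hk0]
    · intro k t
      rw [LSeries.norm_term_eq, LSeries.norm_term_eq]; simp

end GoodL

end

section

open Complex Set MeasureTheory

namespace GoodL

variable {P : ℝ} {f : ℂ → ℂ} {Λ : ℕ → ℝ}

theorem setIntegral_norm_le {g : ℝ → ℂ} {B : ℝ} {S : Set ℝ} (hS : MeasurableSet S)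
    (hb : ∀ t ∈ S, ‖g t‖ ≤ B * (1 + t ^ 2)⁻¹) :
    ‖∫ t in S, g t‖ ≤ B * ∫ t in S, (1 + t ^ 2)⁻¹ := by
  rw [← integral_const_mul]
  refine norm_integral_le_of_norm_le (integrable_inv_one_add_sq.const_mul B).integrableOn ?_
  exact (ae_restrict_iff' hS).mpr (Filter.Eventually.of_forall hb)

theorem half_pi_sub_arctan_le {T : ℝ} (hT : 0 < T) : Real.pi / 2 - Real.arctan T ≤ 1 / T := by
  rw [← Real.arctan_inv_of_pos hT, ← one_div]
  have h : 0 < 1 / T := by positivity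
  have h1 : 0 < Real.arctan (1 / T) := Real.arctan_pos.mpr h
  have := Real.le_tan h1.le (Real.arctan_lt_pi_div_two _)
  rwa [Real.tan_arctan] at this

theorem norm_integral_line_le {g : ℂ → ℂ} {σ₀ σ T Bl Bh Bt : ℝ} (hσ : σ₀ ≤ σ) (hT : 0 < T)
    (hd : ∀ s : ℂ, σ₀ ≤ s.re → s.re ≤ σ → |s.im| ≤ T → DifferentiableAt ℂ g s)
    (hint : Integrable fun t : ℝ => g (σ + t * I))
    (hBl : ∀ t : ℝ, |t| ≤ T → ‖g (σ₀ + t * I)‖ ≤ Bl * (1 + t ^ 2)⁻¹) (hBl0 : 0 ≤ Bl)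
    (hBh : ∀ s : ℂ, σ₀ ≤ s.re → s.re ≤ σ → |s.im| = T → ‖g s‖ ≤ Bh)
    (hBt : ∀ t : ℝ, T ≤ |t| → ‖g (σ + t * I)‖ ≤ Bt * (1 + t ^ 2)⁻¹) (hBt0 : 0 ≤ Bt) :
    ‖∫ t : ℝ, g (σ + t * I)‖ ≤ Bl * Real.pi + 2 * (Bh * (σ - σ₀)) + 2 * (Bt / T) := by
  have hrect := Complex.integral_boundary_rect_eq_zero_of_differentiableOn g
    (σ₀ + (-T : ℝ) * I) (σ + T * I) (by
      intro s hs
      refine (hd s ?_ ?_ ?_).differentiableWithinAt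
      all_goals
        rw [mem_reProdIm] at hs
        simp [uIcc_of_le hσ, uIcc_of_le (show -T ≤ T by linarith)] at hs
      · exact hs.1.1
      · exact hs.1.2
      · exact abs_le.mpr hs.2)
  simp only [add_re, ofReal_re, mul_re, I_re, mul_zero, ofReal_im, I_im, mul_one, sub_self,
    add_zero, add_im, mul_im, zero_add, smul_eq_mul] at hrect
  set H1 := ∫ x in σ₀..σ, g (x + (-T : ℝ) * I)
  set H2 := ∫ x in σ₀..σ, g (x + T * I)
  set V1 := ∫ t in (-T)..T, g (σ + t * I)
  set V0 := ∫ t in (-T)..T, g (σ₀ + t * I) with hV0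
  have hV : V1 = V0 + I * (H1 - H2) := by
    linear_combination (-I) * hrect + (V1 - V0) * (I_mul_I)
  have bH : ∀ u : ℝ, |u| = T → ‖∫ x in σ₀..σ, g (x + u * I)‖ ≤ Bh * (σ - σ₀) := by
    intro u hu
    have := intervalIntegral.norm_integral_le_of_norm_le_const (a := σ₀) (b := σ)
      (f := fun x : ℝ => g (x + u * I)) (C := Bh) (by
        intro x hx
        rw [uIoc_of_le hσ] at hx
        exact hBh _ (by simpa using hx.1.le) (by simpa using hx.2) (by simpa using hu))
    rwa [abs_of_nonneg (by linarith)] at this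
  have bH1 : ‖H1‖ ≤ Bh * (σ - σ₀) := bH (-T) (by rw [abs_neg, abs_of_pos hT])
  have bH2 : ‖H2‖ ≤ Bh * (σ - σ₀) := bH T (abs_of_pos hT)
  have bV0 : ‖V0‖ ≤ Bl * Real.pi := by
    rw [hV0, intervalIntegral.integral_of_le (by linarith)]
    refine (setIntegral_norm_le measurableSet_Ioc (B := Bl)
      fun t ht => hBl t (abs_le.mpr ⟨ht.1.le, ht.2⟩)).trans ?_
    gcongr
    rw [← integral_univ_inv_one_add_sq]
    exact setIntegral_le_integral integrable_inv_one_add_sq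
      (Filter.Eventually.of_forall fun t => by positivity)
  have bV1 : ‖V1‖ ≤ Bl * Real.pi + 2 * (Bh * (σ - σ₀)) := by
    rw [hV]
    refine (norm_add_le _ _).trans ?_
    rw [norm_mul, norm_I, one_mul]
    have := norm_sub_le H1 H2
    linarith
  have bR : ‖∫ t in Ioi T, g (σ + t * I)‖ ≤ Bt / T := by
    refine (setIntegral_norm_le measurableSet_Ioi (B := Bt)
      fun t (ht : T < t) => hBt t (ht.le.trans (le_abs_self _))).trans ?_
    rw [integral_Ioi_inv_one_add_sq, div_eq_mul_one_div Bt T]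
    gcongr
    exact half_pi_sub_arctan_le hT
  have bL : ‖∫ t in Iic (-T), g (σ + t * I)‖ ≤ Bt / T := by
    refine (setIntegral_norm_le measurableSet_Iic (B := Bt)
      fun t (ht : t ≤ -T) => hBt t ((by linarith : T ≤ -t).trans (neg_le_abs _))).trans ?_
    rw [integral_Iic_inv_one_add_sq, div_eq_mul_one_div Bt T, Real.arctan_neg]
    gcongr
    have := half_pi_sub_arctan_le hT
    linarith
  have split : ∫ t : ℝ, g (σ + t * I)
      = (∫ t in Iic (-T), g (σ + t * I)) + (V1 + ∫ t in Ioi T, g (σ + t * I)) := by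
    rw [← intervalIntegral.integral_Iic_add_Ioi (b := -T) hint.integrableOn hint.integrableOn]
    congr 1
    have : Ioi (-T) = Ioc (-T) T ∪ Ioi T := (Ioc_union_Ioi_eq_Ioi (by linarith)).symm
    rw [this, setIntegral_union (Ioc_disjoint_Ioi le_rfl) measurableSet_Ioi hint.integrableOn
      hint.integrableOn, ← intervalIntegral.integral_of_le (by linarith)]
  rw [split]
  refine (norm_add_le _ _).trans ?_
  have := norm_add_le V1 (∫ t in Ioi T, g (σ + t * I))
  linarith

theorem norm_perron_integral_le (h : GoodL P f Λ) (hP : 10 ^ 6 ≤ P) {y : ℝ} (hy : 0 < y)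
    (hy1 : P ^ 12 / 2 ≤ Real.log y) (hy2 : Real.log y ≤ 2 * P ^ 12) :
    ‖∫ t : ℝ, deriv f ((1 + 1 / P ^ 12 : ℝ) + t * I) / f ((1 + 1 / P ^ 12 : ℝ) + t * I)
        * ker y ((1 + 1 / P ^ 12 : ℝ) + t * I)‖ ≤ y / P ^ 10 := by
  have hPpos : 0 < P := by linarith
  have hP1 : 1 ≤ P := by linarith
  set σ : ℝ := 1 + 1 / P ^ 12 with hσ
  set σ₀ : ℝ := 1 - 1 / (2 * P ^ 7) with hσ₀
  set T : ℝ := P ^ 30 - 1 with hT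
  have hP30 : 10 ^ 6 ≤ P ^ 30 := hP.trans (le_self_pow₀ hP1 (by norm_num))
  have hTpos : 0 < T := by linarith
  have hT2 : P ^ 30 / 2 ≤ T := by linarith
  have hP7 : 10 ^ 6 ≤ P ^ 7 := hP.trans (le_self_pow₀ hP1 (by norm_num))
  have hP12 : 10 ^ 6 ≤ P ^ 12 := hP.trans (le_self_pow₀ hP1 (by norm_num))
  have hd7 : 1 / (2 * P ^ 7) ≤ 1 / 4 := by
    apply one_div_le_one_div_of_le (by norm_num); linarith
  have hd7' : 0 < 1 / (2 * P ^ 7) := by positivity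
  have hd12 : 1 / P ^ 12 ≤ 1 / 4 := by
    apply one_div_le_one_div_of_le (by norm_num); linarith
  have hd12' : 0 < 1 / P ^ 12 := by positivity
  have h127 : 1 / P ^ 12 ≤ 1 / P ^ 7 := by
    apply one_div_le_one_div_of_le (by positivity)
    exact pow_le_pow_right₀ hP1 (by norm_num)
  have h77 : 1 / (2 * P ^ 7) < 1 / P ^ 7 := by
    apply one_div_lt_one_div_of_lt (by positivity); linarith
  have h72 : 1 / P ^ 7 ≤ 1 / P ^ 2 := by
    apply one_div_le_one_div_of_le (by positivity)
    exact pow_le_pow_right₀ hP1 (by norm_num)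
  have hdiff : ∀ s : ℂ, 1 - 1 / P ^ 2 < s.re → DifferentiableAt ℂ f s := fun s hs =>
    h.diff.differentiableAt (isOpen_dom.mem_nhds hs)
  have hdd : ∀ s : ℂ, 1 - 1 / P ^ 2 < s.re → DifferentiableAt ℂ (deriv f) s := fun s hs =>
    (h.diff.deriv isOpen_dom).differentiableAt (isOpen_dom.mem_nhds hs)
  have hH : ∀ s : ℂ, σ₀ ≤ s.re → s.re ≤ σ → |s.im| ≤ T → ‖deriv f s / f s‖ ≤ 224 * P ^ 11 :=
    fun s h1 h2 h3 => h.norm_logDeriv_le hP h1 (h2.trans (by linarith)) h3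
  have hyσ : ∀ u : ℝ, u ≤ σ → y ^ u ≤ 8 * y := by
    intro u hu
    have hl : 0 ≤ Real.log y := le_trans (by positivity) hy1
    calc y ^ u = Real.exp (Real.log y * u) := Real.rpow_def_of_pos hy u
      _ ≤ Real.exp (Real.log y + 2) := by
        apply Real.exp_le_exp.mpr
        have h1 : Real.log y * u ≤ Real.log y * σ := by gcongr
        have h2 : Real.log y * (1 / P ^ 12) ≤ 2 := by
          rw [mul_one_div, div_le_iff₀ (by positivity)]; exact hy2
        rw [hσ, mul_add] at h1
        linarith
      _ ≤ 8 * y := by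
        rw [Real.exp_add, Real.exp_log hy]
        have : Real.exp 2 ≤ 8 := by
          have h1 := Real.exp_one_lt_d9
          have : Real.exp 2 = Real.exp 1 * Real.exp 1 := by rw [← Real.exp_add]; norm_num
          rw [this]
          nlinarith [Real.exp_pos 1]
        nlinarith
  have hyσ₀ : y ^ σ₀ ≤ 122880 * y / P ^ 25 := by
    rw [hσ₀, Real.rpow_sub hy, Real.rpow_one, div_le_div_iff₀ (by positivity) (by positivity)]
    have h1 : P ^ 5 / 4 ≤ Real.log y * (1 / (2 * P ^ 7)) := by
      rw [mul_one_div, le_div_iff₀ (by positivity)]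
      calc P ^ 5 / 4 * (2 * P ^ 7) = P ^ 12 / 2 := by ring
        _ ≤ _ := hy1
    have h2 : (P ^ 5 / 4) ^ 5 / 120 ≤ y ^ (1 / (2 * P ^ 7)) := by
      rw [Real.rpow_def_of_pos hy]
      have := Real.pow_div_factorial_le_exp (P ^ 5 / 4) (by positivity) 5
      norm_num [Nat.factorial] at this ⊢
      exact this.trans (Real.exp_le_exp.mpr (by simpa using h1))
    calc y * P ^ 25 = 122880 * y * ((P ^ 5 / 4) ^ 5 / 120) := by ring
      _ ≤ _ := by gcongr
  have hker : ∀ s : ℂ, σ₀ ≤ s.re → ‖ker y s‖ ≤ y ^ s.re * (2 * (1 + s.im ^ 2)⁻¹) :=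
    fun s hs => norm_ker_le hy (by linarith)
  have main := norm_integral_line_le (g := fun s => deriv f s / f s * ker y s) (σ₀ := σ₀) (σ := σ)
    (T := T) (Bl := 224 * P ^ 11 * (122880 * y / P ^ 25 * 2))
    (Bh := 224 * P ^ 11 * (8 * y * (2 * (1 + T ^ 2)⁻¹))) (Bt := 3 * P ^ 12 * (8 * y * 2))
    (by linarith) hTpos
    (by
      intro s h1 h2 h3
      refine ((hdd s (by linarith)).div (hdiff s (by linarith)) ?_).mul
        (differentiableAt_ker hy (by linarith))
      exact h.ne_zero hP (by linarith) (by linarith))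
    (by
      refine integrable_mul_ker hy (by linarith)
        (G := fun t : ℝ => deriv f (σ + t * I) / f (σ + t * I)) ?_ (h.norm_logDeriv_line hP)
      rw [continuous_iff_continuousAt]
      intro t
      have hre : 1 - 1 / P ^ 2 < (σ + t * I : ℂ).re := by
        simp only [add_re, ofReal_re, mul_re, I_re, mul_zero, ofReal_im, I_im, mul_one, sub_self,
          add_zero]
        linarith
      have h1 : DifferentiableAt ℂ (fun s => deriv f s / f s) (σ + t * I) :=
        (hdd _ hre).div (hdiff _ hre) (h.ne _ (by simp; linarith))
      exact ContinuousAt.comp (f := fun t : ℝ => (σ + t * I : ℂ))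
        (g := fun s => deriv f s / f s) h1.continuousAt (by fun_prop))
    (by
      intro t ht
      have h1 := hH (σ₀ + t * I) (by simp) (by simp; linarith) (by simpa using ht)
      have h2 := hker (σ₀ + t * I) (by simp)
      simp only [add_re, ofReal_re, mul_re, I_re, mul_zero, ofReal_im, I_im, mul_one, sub_self,
        add_zero, add_im, mul_im, zero_add] at h2
      rw [norm_mul, mul_assoc]
      refine mul_le_mul h1 (h2.trans ?_) (norm_nonneg _) (by positivity)
      rw [mul_assoc]
      gcongr)
    (by positivity)
    (by
      intro s h1 h2 h3
      rw [norm_mul]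
      refine mul_le_mul (hH s h1 h2 h3.le) ((hker s h1).trans ?_) (norm_nonneg _) (by positivity)
      have : s.im ^ 2 = T ^ 2 := by rw [← h3, sq_abs]
      rw [this]
      gcongr
      exact hyσ _ h2)
    (by
      intro t ht
      have h1 := h.norm_logDeriv_line hP t
      have h2 := hker (σ + t * I) (by simp; linarith)
      simp only [add_re, ofReal_re, mul_re, I_re, mul_zero, ofReal_im, I_im, mul_one, sub_self,
        add_zero, add_im, mul_im, zero_add] at h2
      rw [norm_mul, mul_assoc]
      refine mul_le_mul h1 (h2.trans ?_) (norm_nonneg _) (by positivity)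
      rw [mul_assoc]
      gcongr
      exact hyσ _ le_rfl)
    (by positivity)
  refine main.trans ?_
  have hp2 : 10 ^ 12 ≤ P ^ 2 := by nlinarith
  have t1 : 224 * P ^ 11 * (122880 * y / P ^ 25 * 2) * Real.pi ≤ y / P ^ 10 / 4 := by
    have e : 224 * P ^ 11 * (122880 * y / P ^ 25 * 2) * Real.pi
        = y / P ^ 10 * ((224 * 122880 * 2 * Real.pi) / P ^ 4) := by field_simp
    rw [e, div_eq_mul_one_div _ (4 : ℝ)]
    gcongr ?_ * ?_
    rw [div_le_iff₀ (by positivity)]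
    have := Real.pi_lt_four
    nlinarith
  have t2 : 2 * (224 * P ^ 11 * (8 * y * (2 * (1 + T ^ 2)⁻¹)) * (σ - σ₀)) ≤ y / P ^ 10 / 4 := by
    have e1 : (1 + T ^ 2)⁻¹ ≤ (P ^ 30 / 2)⁻¹ := by
      apply inv_anti₀ (by positivity); nlinarith
    calc 2 * (224 * P ^ 11 * (8 * y * (2 * (1 + T ^ 2)⁻¹)) * (σ - σ₀))
        ≤ 2 * (224 * P ^ 11 * (8 * y * (2 * (P ^ 30 / 2)⁻¹)) * 1) := by
          have : σ - σ₀ ≤ 1 := by rw [hσ, hσ₀]; linarith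
          have : 0 ≤ σ - σ₀ := by rw [hσ, hσ₀]; linarith
          gcongr
      _ = y / P ^ 10 * (14336 / P ^ 9) := by field_simp; ring
      _ ≤ y / P ^ 10 * (1 / 4) := by
          gcongr ?_ * ?_
          rw [div_le_iff₀ (by positivity)]
          have : P ^ 2 ≤ P ^ 9 := pow_le_pow_right₀ hP1 (by norm_num)
          linarith
      _ = _ := by ring
  have t3 : 2 * (3 * P ^ 12 * (8 * y * 2) / T) ≤ y / P ^ 10 / 4 := by
    calc 2 * (3 * P ^ 12 * (8 * y * 2) / T) ≤ 2 * (3 * P ^ 12 * (8 * y * 2) / (P ^ 30 / 2)) := by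
          gcongr
      _ = y / P ^ 10 * (192 / P ^ 8) := by field_simp; ring
      _ ≤ y / P ^ 10 * (1 / 4) := by
          gcongr ?_ * ?_
          rw [div_le_iff₀ (by positivity)]
          have : P ^ 2 ≤ P ^ 8 := pow_le_pow_right₀ hP1 (by norm_num)
          linarith
      _ = _ := by ring
  have : 0 ≤ y / P ^ 10 := by positivity
  linarith

/-- The smoothed sum of coefficients. -/
theorem abs_tsum_sub_le (h : GoodL P f Λ) (hP : 10 ^ 6 ≤ P) {y : ℝ} (hy : 0 < y)
    (hy1 : P ^ 12 / 2 ≤ Real.log y) (hy2 : Real.log y ≤ 2 * P ^ 12) :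
    |∑' k : ℕ, Λ k * max (y - k) 0 - (y - 1) ^ 2 / 2| ≤ y ^ 2 / P ^ 10 := by
  have h1 := h.norm_perron_integral_le hP hy hy1 hy2
  rw [h.perron_identity hP hy] at h1
  rw [norm_mul, norm_mul, Complex.norm_real, Complex.norm_real, Complex.norm_ofNat,
    Real.norm_eq_abs, Real.norm_eq_abs, abs_of_pos Real.pi_pos] at h1
  have hlog : 0 < Real.log y := lt_of_lt_of_le (by have : 0 < P := by linarith
                                                   positivity) hy1
  have hy1' : 1 ≤ y := by
    by_contra hc
    exact absurd (Real.log_nonpos hy.le (by linarith)) (by linarith)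
  have e0 : max (1 - 1 / y) 0 = 1 - 1 / y := by
    apply max_eq_left
    rw [sub_nonneg, div_le_one hy]; exact hy1'
  have e1 : ∑' k : ℕ, Λ k * max (y - k) 0 = y * ∑' k : ℕ, Λ k * max (1 - k / y) 0 := by
    rw [← tsum_mul_left]
    congr 1; funext k
    have : y - k = y * (1 - k / y) := by field_simp
    rw [this, ← mul_zero y, ← mul_max_of_nonneg _ _ hy.le]
    ring_nf
  rw [e0] at h1
  set S := ∑' k : ℕ, Λ k * max (1 - k / y) 0
  have e2 : y * S - (y - 1) ^ 2 / 2 = -(y * ((1 - 1 / y) ^ 2 * y / 2 - S)) := by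
    field_simp
    ring
  rw [e1, e2, abs_neg, abs_mul, abs_of_pos hy]
  have h3 : |(1 - 1 / y) ^ 2 * y / 2 - S| ≤ y / P ^ 10 := by
    refine le_trans ?_ h1
    refine le_mul_of_one_le_left (abs_nonneg _) ?_
    have := Real.pi_gt_three
    linarith
  calc _ ≤ y * (y / P ^ 10) := by gcongr
    _ = _ := by ring

theorem tsum_max_eq {y : ℝ} {N : ℕ} (hN : y ≤ N) :
    ∑' k : ℕ, Λ k * max (y - k) 0 = ∑ k ∈ Finset.range N, Λ k * max (y - k) 0 := by
  refine tsum_eq_sum fun k hk => ?_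
  have : (N : ℝ) ≤ k := by exact_mod_cast not_lt.mp (by simpa using hk)
  rw [max_eq_right (by linarith), mul_zero]

theorem mul_sum_le (h : GoodL P f Λ) {x d : ℝ} (hx : 0 ≤ x) (hd : 0 ≤ d) :
    d * ∑ k ∈ Finset.range (⌊x⌋₊ + 1), Λ k
      ≤ ∑' k : ℕ, Λ k * max (x + d - k) 0 - ∑' k : ℕ, Λ k * max (x - k) 0 := by
  obtain ⟨N, hN⟩ := exists_nat_ge (x + d + ⌊x⌋₊ + 1)
  have hf : (0 : ℝ) ≤ ⌊x⌋₊ := by positivity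
  rw [tsum_max_eq (N := N) (by linarith), tsum_max_eq (N := N) (by linarith),
    ← Finset.sum_sub_distrib, Finset.mul_sum]
  have hsub : Finset.range (⌊x⌋₊ + 1) ⊆ Finset.range N := by
    apply Finset.range_mono
    have : ((⌊x⌋₊ + 1 : ℕ) : ℝ) ≤ N := by push_cast; linarith
    exact_mod_cast this
  calc _ ≤ ∑ k ∈ Finset.range (⌊x⌋₊ + 1), (Λ k * max (x + d - k) 0 - Λ k * max (x - k) 0) := by
        refine Finset.sum_le_sum fun k hk => ?_
        have hkx : (k : ℝ) ≤ x := (Nat.le_floor_iff hx).mp (by simpa [Nat.lt_succ_iff] using hk)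
        rw [max_eq_left (by linarith), max_eq_left (by linarith)]
        apply le_of_eq; ring
    _ ≤ _ := by
        refine Finset.sum_le_sum_of_subset_of_nonneg hsub fun k _ _ => ?_
        rw [← mul_sub]
        refine mul_nonneg (h.nonneg k) (sub_nonneg.mpr ?_)
        gcongr; linarith

theorem le_mul_sum (h : GoodL P f Λ) {x d : ℝ} (hd : 0 ≤ d) :
    ∑' k : ℕ, Λ k * max (x - k) 0 - ∑' k : ℕ, Λ k * max (x - d - k) 0
      ≤ d * ∑ k ∈ Finset.range (⌊x⌋₊ + 1), Λ k := by
  rw [tsum_max_eq (N := ⌊x⌋₊ + 1) (by exact_mod_cast (Nat.lt_floor_add_one x).le),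
    tsum_max_eq (N := ⌊x⌋₊ + 1) (by push_cast; linarith [(Nat.lt_floor_add_one x)]),
    ← Finset.sum_sub_distrib, Finset.mul_sum]
  refine Finset.sum_le_sum fun k _ => ?_
  rw [← mul_sub, mul_comm d]
  refine mul_le_mul_of_nonneg_left ?_ (h.nonneg k)
  rcases le_total (x - k) 0 with h1 | h1
  · rw [max_eq_right h1]; linarith [le_max_right (x - d - k) 0]
  · rw [max_eq_left h1]; linarith [le_max_left (x - d - k) 0]

/-- The prime number theorem with explicit error for the coefficients `Λ`. -/
theorem abs_sum_sub_le (h : GoodL P f Λ) (hP : 10 ^ 6 ≤ P) {x : ℝ} (hx : x = Real.exp (P ^ 12)) :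
    |∑ k ∈ Finset.range (⌊x⌋₊ + 1), Λ k - x| ≤ x / P ^ 2 := by
  have hPpos : 0 < P := by linarith
  have hP1 : 1 ≤ P := by linarith
  have hx0 : 0 < x := hx ▸ Real.exp_pos _
  have hlx : Real.log x = P ^ 12 := by rw [hx, Real.log_exp]
  have hP12 : 10 ^ 6 ≤ P ^ 12 := hP.trans (le_self_pow₀ hP1 (by norm_num))
  have hP3 : 10 ^ 6 ≤ P ^ 3 := hP.trans (le_self_pow₀ hP1 (by norm_num))
  set d := x / P ^ 3 with hd
  have hd0 : 0 < d := by positivity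
  have hdx : d ≤ x / 2 := by
    rw [hd]; gcongr; linarith
  have hrange : ∀ y, x / 2 ≤ y → y ≤ 2 * x → 0 < y ∧ P ^ 12 / 2 ≤ Real.log y ∧
      Real.log y ≤ 2 * P ^ 12 := by
    intro y h1 h2
    have hy : 0 < y := by linarith
    have l2 : Real.log 2 ≤ 1 := by linarith [Real.log_two_lt_d9]
    refine ⟨hy, ?_, ?_⟩
    · have := Real.log_le_log (by linarith) h1
      rw [Real.log_div hx0.ne' (by norm_num), hlx] at this
      linarith
    · have := Real.log_le_log hy h2
      rw [Real.log_mul (by norm_num) hx0.ne', hlx] at this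
      linarith
  have hb : ∀ y, x / 2 ≤ y → y ≤ 2 * x →
      |∑' k : ℕ, Λ k * max (y - k) 0 - (y - 1) ^ 2 / 2| ≤ 4 * x ^ 2 / P ^ 10 := by
    intro y h1 h2
    obtain ⟨a, b, c⟩ := hrange y h1 h2
    refine (h.abs_tsum_sub_le hP a b c).trans ?_
    gcongr
    nlinarith
  have b0 := abs_le.mp (hb x (by linarith) (by linarith))
  have b1 := abs_le.mp (hb (x + d) (by linarith) (by linarith))
  have b2 := abs_le.mp (hb (x - d) (by linarith) (by linarith))
  have c1 := h.mul_sum_le hx0.le hd0.le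
  have c2 := h.le_mul_sum hd0.le (x := x)
  set S := ∑ k ∈ Finset.range (⌊x⌋₊ + 1), Λ k
  have hxP : P ^ 3 ≤ x := by
    have h1 := Real.add_one_le_exp (P ^ 12)
    have h2 : P ^ 3 ≤ P ^ 12 := pow_le_pow_right₀ hP1 (by norm_num)
    rw [hx]; linarith
  have hd1 : 1 ≤ d := by rw [hd, le_div_iff₀ (by positivity)]; linarith
  have e8 : 8 * x ^ 2 / P ^ 10 ≤ d * d := by
    rw [hd, div_mul_div_comm, div_le_div_iff₀ (by positivity) (by positivity)]
    have : P ^ 10 = P ^ 3 * P ^ 3 * P ^ 4 := by ring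
    have h4 : 8 ≤ P ^ 4 := by
      have := hP.trans (le_self_pow₀ hP1 (show 4 ≠ 0 by norm_num)); linarith
    rw [this]
    have : 0 ≤ x * x * (P ^ 3 * P ^ 3) := by positivity
    nlinarith
  have e4 : 4 * x ^ 2 / P ^ 10 = (8 * x ^ 2 / P ^ 10) / 2 := by ring
  rw [e4] at b0 b1 b2
  have u : d * (S - x) ≤ d * (3 * d) := by nlinarith
  have l : d * (x - S) ≤ d * (3 * d) := by nlinarith
  have u' := le_of_mul_le_mul_left u hd0
  have l' := le_of_mul_le_mul_left l hd0
  have fin : 3 * d ≤ x / P ^ 2 := by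
    rw [hd, mul_div_assoc', div_le_div_iff₀ (by positivity) (by positivity)]
    have : 0 ≤ x * P ^ 2 := by positivity
    nlinarith
  exact abs_le.mpr ⟨by linarith, by linarith⟩

end GoodL

end

section

open MeasureTheory Submodule
open scoped ENNReal

namespace LatCount

variable {E ι : Type*} [NormedAddCommGroup E] [NormedSpace ℝ E] [MeasurableSpace E] [BorelSpace E]
  [Fintype ι] (b : Module.Basis ι ℝ E)

/-- The number of points of `u + L` in `S`, for the lattice `L` spanned by the basis `b`. -/
noncomputable def num (u : E) (S : Set E) : ℝ≥0∞ :=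
  ∑' l : span ℤ (Set.range b), S.indicator 1 (u + l)

theorem lintegral_num (μ : Measure E) [μ.IsAddHaarMeasure] {S : Set E} (hS : MeasurableSet S) :
    ∫⁻ v in ZSpan.fundamentalDomain b, num b v S ∂μ = μ S := by
  have hfd := ZSpan.isAddFundamentalDomain b μ
  have : FiniteDimensional ℝ E := b.finiteDimensional_of_finite
  have hinv : VAddInvariantMeasure (span ℤ (Set.range b)) E μ :=
    inferInstanceAs (VAddInvariantMeasure (span ℤ (Set.range b)).toAddSubgroup E μ)
  rw [← lintegral_indicator_one hS, hfd.lintegral_eq_tsum'']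
  unfold num
  rw [lintegral_tsum]
  · congr 1; funext l
    congr 1; funext v
    rw [add_comm]; rfl
  · intro l
    exact ((measurable_one.indicator hS).comp (measurable_id.add_const _)).aemeasurable

variable {b} {S S' Δ : Set E}

theorem num_le_num (h : ∀ x ∈ S, ∀ d ∈ Δ, x + d ∈ S')
    (cover : ∀ z : E, ∃ d ∈ Δ, ∃ l ∈ span ℤ (Set.range b), z = d + l) (u v : E) :
    num b u S ≤ num b v S' := by
  obtain ⟨d, hd, l, hl, e⟩ := cover (v - u)
  unfold num
  rw [← (Equiv.addRight (⟨-l, neg_mem hl⟩ : span ℤ (Set.range b))).tsum_eq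
    (fun m : span ℤ (Set.range b) => S'.indicator 1 (v + (m : E)))]
  refine ENNReal.tsum_le_tsum fun m => ?_
  by_cases hm : u + (m : E) ∈ S
  · have h2 := h _ hm d hd
    have e2 : u + (m : E) + d = v + ((m : E) + -l) := by
      have : v = d + l + u := by rw [← e]; abel
      rw [this]; abel
    rw [e2] at h2
    simp [Set.indicator_of_mem hm, Set.indicator_of_mem h2]
  · simp [Set.indicator_of_notMem hm]

theorem num_mul_le (μ : Measure E) [μ.IsAddHaarMeasure] (hS' : MeasurableSet S')
    (h : ∀ x ∈ S, ∀ d ∈ Δ, x + d ∈ S')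
    (cover : ∀ z : E, ∃ d ∈ Δ, ∃ l ∈ span ℤ (Set.range b), z = d + l) (u : E) :
    num b u S * μ (ZSpan.fundamentalDomain b) ≤ μ S' := by
  rw [← lintegral_num b μ hS', ← setLIntegral_const]
  exact lintegral_mono fun v => num_le_num h cover u v

theorem le_num_mul (μ : Measure E) [μ.IsAddHaarMeasure] (hS : MeasurableSet S)
    (h : ∀ x ∈ S, ∀ d ∈ Δ, x + d ∈ S')
    (cover : ∀ z : E, ∃ d ∈ Δ, ∃ l ∈ span ℤ (Set.range b), z = d + l) (u : E) :
    μ S ≤ num b u S' * μ (ZSpan.fundamentalDomain b) := by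
  rw [← lintegral_num b μ hS, ← setLIntegral_const]
  exact lintegral_mono fun v => num_le_num h cover v u

end LatCount

end

section

open MeasureTheory Submodule NumberField NumberField.InfinitePlace NumberField.mixedEmbedding Module
open scoped ENNReal NNReal nonZeroDivisors

namespace BoxCount

variable {K : Type*} [Field K] [NumberField K]

theorem mem_convexBodyLT {f : InfinitePlace K → ℝ≥0} {x : mixedSpace K} :
    x ∈ convexBodyLT K f ↔ ∀ w, normAtPlace w x < f w := by
  constructor
  · rintro ⟨h1, h2⟩ w
    rcases isReal_or_isComplex w with hw | hw
    · rw [normAtPlace_apply_of_isReal hw]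
      simpa using h1 ⟨w, hw⟩ (Set.mem_univ _)
    · rw [normAtPlace_apply_of_isComplex hw]
      simpa using h2 ⟨w, hw⟩ (Set.mem_univ _)
  · intro h
    refine ⟨fun w _ => ?_, fun w _ => ?_⟩
    · have := h w.1
      rw [normAtPlace_apply_of_isReal w.2] at this
      simpa using this
    · have := h w.1
      rw [normAtPlace_apply_of_isComplex w.2] at this
      simpa using this

theorem span_of_basis {ι : Type*} [Fintype ι] (b : Basis ι ℚ K) (z : mixedSpace K) :
    ∃ c : ι → ℝ, z = ∑ i, c i • mixedEmbedding K (b i) := by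
  have h : ⊤ ≤ span ℝ (Set.range fun i => mixedEmbedding K (b i)) := by
    rw [← (latticeBasis K).span_eq, span_le]
    rintro _ ⟨i, rfl⟩
    rw [latticeBasis_apply, ← b.sum_repr (integralBasis K i), map_sum]
    refine sum_mem fun j _ => ?_
    rw [map_rat_smul, ← Rat.cast_smul_eq_qsmul ℝ]
    exact smul_mem _ _ (subset_span ⟨j, rfl⟩)
  have hz := h (show z ∈ ⊤ from trivial)
  rw [mem_span_range_iff_exists_fun] at hz
  obtain ⟨c, hc⟩ := hz
  exact ⟨c, hc.symm⟩

theorem cover {ι : Type*} [Fintype ι] [Nonempty ι] (b : Basis ι ℚ K) (hint : ∀ i, IsIntegral ℤ (b i))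
    (hb : ∀ i (w : InfinitePlace K), w (b i) ≤ 2) (I : (FractionalIdeal (𝓞 K)⁰ K)ˣ)
    {f : InfinitePlace K → ℝ≥0} {ε : ℝ≥0}
    (hε : minkowskiBound K I < volume (convexBodyLT K fun w => ε * f w)) (z : mixedSpace K) :
    ∃ d ∈ convexBodyLT K (fun w => 2 * Fintype.card ι * ε * f w),
      ∃ l ∈ span ℤ (Set.range (fractionalIdealLatticeBasis K I)), z = d + l := by
  obtain ⟨a, ha, ha0, hlt⟩ := exists_ne_zero_mem_ideal_lt K I hε
  obtain ⟨c, hc⟩ := span_of_basis b (z * mixedEmbedding K a⁻¹)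
  have hinv : mixedEmbedding K a⁻¹ * mixedEmbedding K a = 1 := by
    rw [← map_mul, inv_mul_cancel₀ ha0, map_one]
  have hz : z = (∑ i, c i • mixedEmbedding K (b i)) * mixedEmbedding K a := by
    rw [← hc, mul_assoc, hinv, mul_one]
  refine ⟨(∑ i, Int.fract (c i) • mixedEmbedding K (b i)) * mixedEmbedding K a, ?_,
    mixedEmbedding K ((∑ i, (⌊c i⌋ : K) * b i) * a), ?_, ?_⟩
  · rw [mem_convexBodyLT]
    intro w
    rw [map_mul, normAtPlace_apply]
    have h1 : normAtPlace w (∑ i, Int.fract (c i) • mixedEmbedding K (b i)) ≤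
        2 * Fintype.card ι := by
      have hsum : ∀ s : Finset ι, normAtPlace w (∑ i ∈ s, Int.fract (c i) • mixedEmbedding K (b i)) ≤
          ∑ i ∈ s, (2 : ℝ) := by
        intro s
        induction s using Finset.induction_on with
        | empty => simp
        | insert i s hi ih =>
          rw [Finset.sum_insert hi, Finset.sum_insert hi]
          refine (normAtPlace_add_le _ _ _).trans (add_le_add ?_ ih)
          rw [normAtPlace_smul, normAtPlace_apply, abs_of_nonneg (Int.fract_nonneg _)]
          have := (Int.fract_lt_one (c i)).le
          have h0 := Int.fract_nonneg (c i)
          have h2 := hb i w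
          have h3 : 0 ≤ w (b i) := apply_nonneg _ _
          nlinarith
      refine (hsum _).trans ?_
      simp [mul_comm]
    have h2 := hlt w
    push_cast at h2 ⊢
    have hpos : (0 : ℝ) < 2 * Fintype.card ι := by
      have := Fintype.card_pos (α := ι)
      positivity
    calc _ ≤ 2 * Fintype.card ι * w a := by gcongr
      _ < 2 * Fintype.card ι * (ε * f w) := by gcongr
      _ = _ := by ring
  · rw [mem_span_fractionalIdealLatticeBasis]
    refine ⟨_, ?_, rfl⟩
    have hint' : IsIntegral ℤ (∑ i, (⌊c i⌋ : K) * b i) :=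
      IsIntegral.sum _ fun i _ => (isIntegral_algebraMap (x := ⌊c i⌋)).mul (hint i)
    have := (I : FractionalIdeal (𝓞 K)⁰ K).coeToSubmodule.smul_mem (⟨_, hint'⟩ : 𝓞 K) ha
    exact this
  · rw [map_mul, ← add_mul, hz, map_sum, ← Finset.sum_add_distrib]
    congr 1
    refine Finset.sum_congr rfl fun i _ => ?_
    rw [map_mul, map_intCast, ← zsmul_eq_mul, ← Int.cast_smul_eq_zsmul ℝ, ← add_smul,
      Int.fract_add_floor]

variable (K) in
/-- The covolume of the ring of integers in the mixed space. -/
noncomputable def covol : ℝ≥0∞ := volume (ZSpan.fundamentalDomain (latticeBasis K))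

theorem add_mem_convexBodyLT {f : InfinitePlace K → ℝ≥0} {s t u : ℝ≥0} (hu : s + t ≤ u) :
    ∀ x ∈ convexBodyLT K (fun w => s * f w), ∀ d ∈ convexBodyLT K (fun w => t * f w),
      x + d ∈ convexBodyLT K (fun w => u * f w) := by
  intro x hx d hd
  rw [mem_convexBodyLT] at *
  intro w
  have h1 := hx w
  have h2 := hd w
  push_cast at h1 h2 ⊢
  have hu' : (s : ℝ) + t ≤ u := by exact_mod_cast hu
  calc _ ≤ _ := normAtPlace_add_le _ _ _
    _ < s * f w + t * f w := add_lt_add h1 h2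
    _ = (s + t) * f w := by ring
    _ ≤ _ := by gcongr

theorem volume_smul_convexBodyLT (f : InfinitePlace K → ℝ≥0) (t : ℝ≥0) :
    volume (convexBodyLT K fun w => t * f w) =
      (t : ℝ≥0∞) ^ finrank ℚ K * (convexBodyLTFactor K * ∏ w, (f w : ℝ≥0∞) ^ (mult w)) := by
  rw [convexBodyLT_volume]
  simp only [ENNReal.coe_mul, mul_pow, Finset.prod_mul_distrib, Finset.prod_pow_eq_pow_sum,
    sum_mult_eq]
  push_cast
  ring

theorem measurableSet_convexBodyLT (f : InfinitePlace K → ℝ≥0) :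
    MeasurableSet (convexBodyLT K f) :=
  (MeasurableSet.univ_pi fun _ => measurableSet_ball).prod
    (MeasurableSet.univ_pi fun _ => measurableSet_ball)

section
variable {ι : Type*} [Fintype ι] [Nonempty ι] (b : Basis ι ℚ K) (hint : ∀ i, IsIntegral ℤ (b i))
    (hb : ∀ i (w : InfinitePlace K), w (b i) ≤ 2) (I : (FractionalIdeal (𝓞 K)⁰ K)ˣ)
    {f : InfinitePlace K → ℝ≥0} {ε : ℝ≥0}
    (hε : minkowskiBound K I < volume (convexBodyLT K fun w => ε * f w)) (u : mixedSpace K)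

include hint hb hε in
theorem num_le : LatCount.num (fractionalIdealLatticeBasis K I) u (convexBodyLT K f) *
      (.ofReal (FractionalIdeal.absNorm I.1) * covol K) ≤
    (1 + 2 * Fintype.card ι * ε : ℝ≥0) ^ finrank ℚ K *
      (convexBodyLTFactor K * ∏ w, (f w : ℝ≥0∞) ^ (mult w)) := by
  rw [covol, ← volume_fundamentalDomain_fractionalIdealLatticeBasis, ← volume_smul_convexBodyLT]
  refine LatCount.num_mul_le volume (measurableSet_convexBodyLT _) ?_ (cover b hint hb I hε) u
  have := add_mem_convexBodyLT (K := K) (f := f) (s := 1) (le_refl (1 + 2 * Fintype.card ι * ε))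
  simpa only [one_mul] using this

include hint hb hε in
theorem le_num : (1 - 2 * Fintype.card ι * ε : ℝ≥0) ^ finrank ℚ K *
      (convexBodyLTFactor K * ∏ w, (f w : ℝ≥0∞) ^ (mult w)) ≤
    LatCount.num (fractionalIdealLatticeBasis K I) u (convexBodyLT K f) *
      (.ofReal (FractionalIdeal.absNorm I.1) * covol K) := by
  rw [covol, ← volume_fundamentalDomain_fractionalIdealLatticeBasis, ← volume_smul_convexBodyLT]
  rcases le_total (2 * Fintype.card ι * ε) 1 with h1 | h1
  · refine LatCount.le_num_mul volume (measurableSet_convexBodyLT _) ?_ (cover b hint hb I hε) u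
    have := add_mem_convexBodyLT (K := K) (f := f)
      (tsub_add_cancel_of_le h1).le
    simpa only [one_mul] using this
  · rw [tsub_eq_zero_of_le h1, volume_smul_convexBodyLT]
    simp [finrank_pos.ne']
end

end BoxCount

end

section

open MeasureTheory Submodule NumberField NumberField.InfinitePlace NumberField.mixedEmbedding Module
open NumberField.Units NumberField.Units.dirichletUnitTheorem
open scoped ENNReal NNReal nonZeroDivisors Pointwise

namespace UnitLog

variable {K : Type*} [Field K] [NumberField K]

/-- The extension of a vector of the logarithmic space to all infinite places with sum zero. -/
noncomputable def ext (v : logSpace K) (w : InfinitePlace K) : ℝ :=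
  if h : w ≠ w₀ then v ⟨w, h⟩ else -∑ i, v i

theorem ext_coe (v : logSpace K) (w : {w : InfinitePlace K // w ≠ w₀}) : ext v w = v w := by
  simp [ext, w.2]

theorem sum_ext (v : logSpace K) : ∑ w, ext v w = 0 := by
  rw [Fintype.sum_eq_add_sum_subtype_ne _ w₀]
  simp only [ext_coe]
  simp [ext]

theorem ext_sub (v v' : logSpace K) (w : InfinitePlace K) : ext (v - v') w = ext v w - ext v' w := by
  unfold ext
  split_ifs
  · rfl
  · simp only [Pi.sub_apply, Finset.sum_sub_distrib]; ring

theorem ext_smul (c : ℝ) (v : logSpace K) (w : InfinitePlace K) : ext (c • v) w = c * ext v w := by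
  unfold ext
  split_ifs
  · rfl
  · simp only [Pi.smul_apply, smul_eq_mul, ← Finset.mul_sum]; ring

theorem continuous_ext (w : InfinitePlace K) : Continuous fun v : logSpace K => ext v w := by
  unfold ext
  split_ifs
  · fun_prop
  · fun_prop

theorem ext_logMap {x : mixedSpace K} (hx : mixedEmbedding.norm x ≠ 0) (w : InfinitePlace K) :
    ext (logMap x) w = mult w * (Real.log (normAtPlace w x) -
      Real.log (mixedEmbedding.norm x) * (finrank ℚ K : ℝ)⁻¹) := by
  by_cases h : w ≠ w₀
  · exact ext_coe _ ⟨w, h⟩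
  · have h0 : ∑ w : InfinitePlace K, (mult w : ℝ) * (Real.log (normAtPlace w x) -
      Real.log (mixedEmbedding.norm x) * (finrank ℚ K : ℝ)⁻¹) = 0 := by
      simp only [mul_sub, Finset.sum_sub_distrib, ← Finset.sum_mul]
      rw [← Nat.cast_sum, sum_mult_eq, mixedEmbedding.norm_apply, Real.log_prod]
      · simp only [Real.log_pow]
        field_simp [(finrank_pos (R := ℚ) (M := K)).ne']
        ring
      · intro w _
        exact pow_ne_zero _ (mixedEmbedding.norm_ne_zero_iff.mp hx w)
    rw [Fintype.sum_eq_add_sum_subtype_ne _ w₀] at h0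
    push Not at h
    subst h
    simp only [ext, ne_eq, not_true_eq_false, dite_false, logMap_apply]
    linarith

variable (K) in
/-- The simplex cut out in the logarithmic space by the box condition at height `ℓ`. -/
def T (ℓ : ℝ) : Set (logSpace K) :=
  {v | ∀ w : InfinitePlace K, -(mult w * (ℓ / finrank ℚ K)) < ext v w}

theorem isOpen_T (ℓ : ℝ) : IsOpen (T K ℓ) := by
  have : T K ℓ = ⋂ w : InfinitePlace K, {v | -(mult w * (ℓ / finrank ℚ K)) < ext v w} := by
    ext; simp [T]
  rw [this]
  exact isOpen_iInter_of_finite fun w => isOpen_lt continuous_const (continuous_ext w)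

theorem T_eq_empty {ℓ : ℝ} (h : ℓ ≤ 0) : T K ℓ = ∅ := by
  rw [Set.eq_empty_iff_forall_notMem]
  intro v hv
  have h1 : ∑ w : InfinitePlace K, -((mult w : ℝ) * (ℓ / finrank ℚ K)) < ∑ w, ext v w :=
    Finset.sum_lt_sum_of_nonempty Finset.univ_nonempty fun w _ => hv w
  rw [sum_ext, Finset.sum_neg_distrib, ← Finset.sum_mul, ← Nat.cast_sum, sum_mult_eq] at h1
  have : (0 : ℝ) < finrank ℚ K := by exact_mod_cast finrank_pos
  rw [mul_div_cancel₀ _ this.ne'] at h1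
  linarith

theorem T_eq_smul {ℓ : ℝ} (h : 0 < ℓ) : T K ℓ = ℓ • T K 1 := by
  ext v
  rw [Set.mem_smul_set_iff_inv_smul_mem₀ h.ne']
  refine forall_congr' fun w => ?_
  rw [ext_smul, ← div_eq_inv_mul, lt_div_iff₀ h]
  ring_nf

theorem finrank_logSpace : finrank ℝ (logSpace K) = rank K := by
  simp [rank]

theorem volume_T (ℓ : ℝ) : volume (T K ℓ) =
    if 0 < ℓ then ENNReal.ofReal (ℓ ^ rank K) * volume (T K 1) else 0 := by
  split_ifs with h
  · rw [T_eq_smul h, Measure.addHaar_smul, finrank_logSpace, abs_of_pos (by positivity)]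
  · rw [T_eq_empty (not_lt.mp h), measure_empty]

theorem volume_T_one_ne_zero : volume (T K 1) ≠ 0 := by
  refine ((isOpen_T 1).measure_pos volume ⟨0, fun w => ?_⟩).ne'
  have h1 : ext (0 : logSpace K) w = 0 := by
    have := ext_smul 0 (0 : logSpace K) w
    simpa using this
  rw [h1, neg_lt_zero]
  have : (0 : ℝ) < finrank ℚ K := by exact_mod_cast finrank_pos
  have : (0 : ℝ) < mult w := by exact_mod_cast mult_pos
  positivity

theorem volume_T_one_ne_top : volume (T K 1) ≠ ⊤ := by
  refine (lt_of_le_of_lt (measure_mono (t := Metric.closedBall 0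
    (2 * Fintype.card (InfinitePlace K))) ?_) measure_closedBall_lt_top).ne
  intro v hv
  have hb : ∀ w, -2 ≤ ext v w := fun w => by
    refine le_trans ?_ (hv w).le
    have hn : (1 : ℝ) ≤ finrank ℚ K := by exact_mod_cast finrank_pos
    have h2 : (mult w : ℝ) ≤ 2 := by
      unfold mult; split_ifs <;> norm_num
    have h3 : (1 : ℝ) / finrank ℚ K ≤ 1 := by
      rw [div_le_one (by linarith)]; exact hn
    have h4 : (0 : ℝ) ≤ 1 / finrank ℚ K := by positivity
    nlinarith
  have hc : (1 : ℝ) ≤ Fintype.card (InfinitePlace K) := by exact_mod_cast Fintype.card_pos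
  rw [mem_closedBall_zero_iff, pi_norm_le_iff_of_nonneg (by positivity)]
  intro i
  rw [Real.norm_eq_abs, abs_le, ← ext_coe v i]
  constructor
  · linarith [hb i]
  · have h1 := sum_ext v
    rw [← Finset.add_sum_erase _ _ (Finset.mem_univ i.1)] at h1
    have h2 : ∑ w ∈ Finset.univ.erase i.1, (-2 : ℝ) ≤ ∑ w ∈ Finset.univ.erase i.1, ext v w :=
      Finset.sum_le_sum fun w _ => hb w
    rw [Finset.sum_const, Finset.card_erase_of_mem (Finset.mem_univ _), nsmul_eq_mul,
      Finset.card_univ, Nat.cast_sub Fintype.card_pos] at h2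
    push_cast at h2
    linarith

/-- The box with shape `τ` and volume proportional to `Y`. -/
noncomputable def fbox (τ : logSpace K) (Y : ℝ) (w : InfinitePlace K) : ℝ≥0 :=
  (Real.exp (ext τ w / mult w + Real.log Y / finrank ℚ K)).toNNReal

theorem coe_fbox (τ : logSpace K) (Y : ℝ) (w : InfinitePlace K) :
    (fbox τ Y w : ℝ) = Real.exp (ext τ w / mult w + Real.log Y / finrank ℚ K) :=
  Real.coe_toNNReal _ (Real.exp_pos _).le

theorem prod_fbox (τ : logSpace K) {Y : ℝ} (hY : 0 < Y) :
    ∏ w, (fbox τ Y w : ℝ≥0∞) ^ (mult w) = ENNReal.ofReal Y := by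
  have h : ∏ w, (fbox τ Y w : ℝ) ^ (mult w) = Y := by
    simp only [coe_fbox, ← Real.exp_nat_mul]
    rw [← Real.exp_sum]
    have : ∀ w : InfinitePlace K, (mult w : ℝ) * (ext τ w / mult w + Real.log Y / finrank ℚ K) =
        ext τ w + mult w * (Real.log Y / finrank ℚ K) := fun w => by
      have : (mult w : ℝ) ≠ 0 := mult_coe_ne_zero
      field_simp
    simp only [this, Finset.sum_add_distrib, sum_ext, ← Finset.sum_mul, ← Nat.cast_sum,
      sum_mult_eq]
    have : (0 : ℝ) < finrank ℚ K := by exact_mod_cast finrank_pos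
    rw [mul_div_cancel₀ _ this.ne', zero_add, Real.exp_log hY]
  conv_rhs => rw [← h]
  rw [ENNReal.ofReal_prod_of_nonneg (fun _ _ => by positivity)]
  refine Finset.prod_congr rfl fun w _ => ?_
  rw [ENNReal.ofReal_pow (by positivity), ENNReal.ofReal_coe_nnreal]

theorem mem_box_iff (τ : logSpace K) {Y : ℝ} (hY : 0 < Y) {x : mixedSpace K}
    (hx : mixedEmbedding.norm x ≠ 0) :
    x ∈ convexBodyLT K (fbox τ Y) ↔
      τ - logMap x ∈ T K (Real.log (Y / mixedEmbedding.norm x)) := by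
  rw [BoxCount.mem_convexBodyLT]
  refine forall_congr' fun w => ?_
  have h0 : 0 < normAtPlace w x := lt_of_le_of_ne (normAtPlace_nonneg w x)
    (Ne.symm (mixedEmbedding.norm_ne_zero_iff.mp hx w))
  have hm : (0 : ℝ) < mult w := by exact_mod_cast mult_pos
  have : (0 : ℝ) < finrank ℚ K := by exact_mod_cast finrank_pos
  rw [coe_fbox, ext_sub, ext_logMap hx, Real.log_div hY.ne' hx, ← Real.log_lt_iff_lt_exp h0,
    ← mul_lt_mul_iff_right₀ hm, mul_add, mul_div_cancel₀ _ hm.ne', ← sub_pos, ← sub_pos (b := - _)]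
  have e : ∀ a b : ℝ, a = b → (0 < a ↔ 0 < b) := fun a b h => by rw [h]
  apply e
  field_simp
  ring

variable (K) in
/-- A fundamental domain for the action of the units on the logarithmic space. -/
noncomputable def dom : Set (logSpace K) :=
  ZSpan.fundamentalDomain ((basisUnitLattice K).ofZLatticeBasis ℝ (unitLattice K))

theorem tsum_units_volume (S : Set (logSpace K)) (v : logSpace K) :
    ∑' u : (𝓞 K)ˣ, volume ({τ | τ - (logEmbedding K (Additive.ofMul u) + v) ∈ S} ∩ dom K) =
      (Nat.card (torsion K)) * volume S := by
  let g : (𝓞 K)ˣ → unitLattice K := fun u =>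
    ⟨logEmbedding K (Additive.ofMul u), ⟨Additive.ofMul u, trivial, rfl⟩⟩
  have hfd : IsAddFundamentalDomain (unitLattice K) (dom K) volume :=
    ZLattice.isAddFundamentalDomain (basisUnitLattice K) volume
  have hinv : VAddInvariantMeasure (unitLattice K) (logSpace K) volume :=
    inferInstanceAs (VAddInvariantMeasure (unitLattice K).toAddSubgroup (logSpace K) volume)
  have : Countable (unitLattice K) := inferInstance
  have h1 : volume S = volume ({τ | τ - v ∈ S}) := by
    have := measure_preimage_add_right volume (-v) S
    rw [← this]; simp only [sub_eq_add_neg]; rfl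
  rw [h1, hfd.measure_eq_tsum, ← ENNReal.tsum_mul_left, ← ENNReal.tsum_fiberwise _ g]
  congr 1; funext l
  have h2 : ∀ u : g ⁻¹' {l}, volume ({τ | τ - (logEmbedding K (Additive.ofMul (u : (𝓞 K)ˣ)) + v) ∈ S}
      ∩ dom K) = volume ((l +ᵥ {τ | τ - v ∈ S}) ∩ dom K) := by
    rintro ⟨u, hu⟩
    congr 2
    have hu' : logEmbedding K (Additive.ofMul u) = l := congrArg Subtype.val hu
    ext τ
    rw [Set.mem_vadd_set_iff_neg_vadd_mem]
    change τ - (logEmbedding K (Additive.ofMul u) + v) ∈ S ↔ (-(l : logSpace K) + τ) - v ∈ S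
    rw [hu']
    have : τ - ((l : logSpace K) + v) = (-(l : logSpace K) + τ) - v := by abel
    rw [this]
  simp only [h2]
  obtain ⟨u0, -, hu0⟩ := l.2
  have hu0 : logEmbedding K u0 = l := hu0
  have e : torsion K ≃ g ⁻¹' {l} :=
    { toFun := fun ζ => ⟨Additive.toMul u0 * ζ, by
        apply Subtype.ext
        change logEmbedding K (u0 + Additive.ofMul (ζ : (𝓞 K)ˣ)) = _
        rw [map_add, logEmbedding_eq_zero_iff.mpr ζ.2, add_zero]; exact hu0⟩
      invFun := fun u => ⟨(Additive.toMul u0)⁻¹ * u, by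
        rw [← logEmbedding_eq_zero_iff]
        change logEmbedding K (-u0 + Additive.ofMul (u : (𝓞 K)ˣ)) = _
        have hu : logEmbedding K (Additive.ofMul (u : (𝓞 K)ˣ)) = l := congrArg Subtype.val u.2
        rw [map_add, hu, ← hu0, map_neg, neg_add_cancel]⟩
      left_inv := fun ζ => by ext; simp
      right_inv := fun u => by ext; simp }
  have : Fintype (torsion K) := Fintype.ofFinite _
  rw [← e.tsum_eq, tsum_fintype, Finset.sum_const, nsmul_eq_mul, Finset.card_univ,
    Nat.card_eq_fintype_card]

end UnitLog

end

section

open MeasureTheory Submodule NumberField NumberField.InfinitePlace NumberField.mixedEmbedding Module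
open NumberField.Units NumberField.Units.dirichletUnitTheorem
open scoped ENNReal NNReal nonZeroDivisors

namespace IdealSum

variable {K : Type*} [Field K] [NumberField K]

theorem norm_mixedEmbedding (α : 𝓞 K) :
    mixedEmbedding.norm (mixedEmbedding K (α : K)) = Ideal.absNorm (Ideal.span {α}) := by
  rw [mixedEmbedding.norm_eq_norm, Ideal.absNorm_span_singleton, ← Algebra.coe_norm_int,
    Nat.cast_natAbs]
  push_cast
  rfl

theorem norm_mixedEmbedding_ne_zero {α : 𝓞 K} (h : α ≠ 0) :
    mixedEmbedding.norm (mixedEmbedding K (α : K)) ≠ 0 := by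
  rw [norm_mixedEmbedding]
  simpa [Ideal.absNorm_eq_zero_iff] using h

/-- The measure of the set of shapes in the unit domain for which the box contains `α`. -/
noncomputable def wt (Y : ℝ) (α : 𝓞 K) : ℝ≥0∞ :=
  volume ({τ | mixedEmbedding K (α : K) ∈ convexBodyLT K (UnitLog.fbox τ Y)} ∩ UnitLog.dom K)

theorem setOf_mem_box {Y : ℝ} (hY : 0 < Y) {α : 𝓞 K} (h : α ≠ 0) :
    {τ : logSpace K | mixedEmbedding K (α : K) ∈ convexBodyLT K (UnitLog.fbox τ Y)} =
      {τ | τ - logMap (mixedEmbedding K (α : K)) ∈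
        UnitLog.T K (Real.log (Y / Ideal.absNorm (Ideal.span {α})))} := by
  ext τ
  rw [← norm_mixedEmbedding]
  exact UnitLog.mem_box_iff τ hY (norm_mixedEmbedding_ne_zero h)

theorem sum_units_wt {Y : ℝ} (hY : 0 < Y) {α : 𝓞 K} (h : α ≠ 0) :
    ∑' u : (𝓞 K)ˣ, wt Y ((u : 𝓞 K) * α) = Nat.card (torsion K) *
      volume (UnitLog.T K (Real.log (Y / Ideal.absNorm (Ideal.span {α})))) := by
  rw [← UnitLog.tsum_units_volume _ (logMap (mixedEmbedding K (α : K)))]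
  congr 1; funext u
  rw [wt, setOf_mem_box hY (mul_ne_zero u.ne_zero h)]
  have h1 : Ideal.span {(u : 𝓞 K) * α} = Ideal.span {α} :=
    Ideal.span_singleton_mul_left_unit u.isUnit α
  have h2 : logMap (mixedEmbedding K (((u : 𝓞 K) * α : 𝓞 K) : K)) =
      logEmbedding K (Additive.ofMul u) + logMap (mixedEmbedding K (α : K)) := by
    rw [← logMap_unit_smul u (norm_mixedEmbedding_ne_zero h), unitSMul_smul, ← map_mul]
    rfl
  rw [h1, h2]

theorem unfold {J : Ideal (𝓞 K)} (hJ : J ≠ ⊥) (c : Ideal (𝓞 K) → ℝ≥0∞) (g : 𝓞 K → ℝ≥0∞)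
    (hg0 : g 0 = 0) (hg : ∀ α 𝔞, α ≠ 0 → Ideal.span {α} = 𝔞 * J → g α = c 𝔞) {Y : ℝ} (hY : 0 < Y) :
    ∫⁻ τ in UnitLog.dom K, ∑' α : J, g α *
      (convexBodyLT K (UnitLog.fbox τ (Y * Ideal.absNorm J))).indicator 1 (mixedEmbedding K ((α : 𝓞 K) : K)) =
    ∑' 𝔞 : Ideal (𝓞 K), if 𝔞 ≠ ⊥ ∧ (𝔞 * J).IsPrincipal then
      c 𝔞 * (Nat.card (torsion K) * volume (UnitLog.T K (Real.log (Y / Ideal.absNorm 𝔞)))) else 0 := by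
  have hNJ : (0 : ℝ) < Ideal.absNorm J := by
    have := (Ideal.absNorm_eq_zero_iff (I := J)).not.mpr hJ
    positivity
  have hY' : 0 < Y * Ideal.absNorm J := by positivity
  have : Countable (𝓞 K) := (RingOfIntegers.basis K).equivFun.injective.countable
  have hcount : Countable J := inferInstance
  have hmeas : ∀ α : 𝓞 K, α ≠ 0 → MeasurableSet {τ : logSpace K | mixedEmbedding K (α : K) ∈
      convexBodyLT K (UnitLog.fbox τ (Y * Ideal.absNorm J))} := by
    intro α hα
    rw [setOf_mem_box hY' hα]
    exact ((UnitLog.isOpen_T _).preimage (continuous_id.sub continuous_const)).measurableSet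
  have step1 : ∀ α : J, ∫⁻ τ in UnitLog.dom K, g α *
      (convexBodyLT K (UnitLog.fbox τ (Y * Ideal.absNorm J))).indicator 1 (mixedEmbedding K ((α : 𝓞 K) : K)) =
      g α * wt (Y * Ideal.absNorm J) (α : 𝓞 K) := by
    intro α
    by_cases hα : (α : 𝓞 K) = 0
    · rw [hα, hg0]; simp
    · have e : (fun τ : logSpace K => g α * (convexBodyLT K
            (UnitLog.fbox τ (Y * Ideal.absNorm J))).indicator (1 : mixedSpace K → ℝ≥0∞)
            (mixedEmbedding K ((α : 𝓞 K) : K))) =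
          fun τ => g α * Set.indicator {τ : logSpace K | mixedEmbedding K ((α : 𝓞 K) : K) ∈
            convexBodyLT K (UnitLog.fbox τ (Y * Ideal.absNorm J))} 1 τ := by
        funext τ; rfl
      rw [e, lintegral_const_mul _ (measurable_one.indicator (hmeas _ hα)),
        lintegral_indicator_one (hmeas _ hα), wt, Measure.restrict_apply (hmeas _ hα)]
  rw [lintegral_tsum]
  swap
  · intro α
    by_cases hα : (α : 𝓞 K) = 0
    · simp only [hα, hg0, zero_mul]; exact aemeasurable_const
    · exact ((measurable_one.indicator (hmeas _ hα)).const_mul _).aemeasurable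
  simp only [step1]
  have hex : ∀ α : J, ∃ 𝔞, Ideal.span {(α : 𝓞 K)} = 𝔞 * J := fun α => by
    obtain ⟨𝔞, h⟩ := Ideal.dvd_span_singleton.mpr α.2
    exact ⟨𝔞, by rw [h, mul_comm]⟩
  choose qf hqf using hex
  rw [← ENNReal.tsum_fiberwise _ qf]
  congr 1; funext 𝔞
  by_cases h0 : 𝔞 = ⊥
  · rw [if_neg (by simp [h0])]
    refine ENNReal.tsum_eq_zero.mpr ?_
    rintro ⟨α, hα⟩
    have h1 := hqf α
    have h2 : qf α = 𝔞 := hα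
    rw [h2, h0, Ideal.bot_mul, Ideal.span_singleton_eq_bot] at h1
    simp only [h1, hg0, zero_mul]
  by_cases hp : (𝔞 * J).IsPrincipal
  swap
  · rw [if_neg (by tauto)]
    refine ENNReal.tsum_eq_zero.mpr ?_
    rintro ⟨α, hα⟩
    have h1 := hqf α
    have h2 : qf α = 𝔞 := hα
    rw [h2] at h1
    exact absurd ⟨(α : 𝓞 K), h1.symm⟩ hp
  rw [if_pos ⟨h0, hp⟩]
  obtain ⟨α0, hα0⟩ := hp
  have hα0 : 𝔞 * J = Ideal.span {α0} := hα0
  have hne : α0 ≠ 0 := by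
    rintro rfl
    rw [Ideal.span_singleton_eq_bot.mpr rfl, Ideal.mul_eq_bot] at hα0
    tauto
  have hmem : ∀ u : (𝓞 K)ˣ, (u : 𝓞 K) * α0 ∈ J := fun u => by
    refine J.mul_mem_left _ ((Ideal.mul_le_right : 𝔞 * J ≤ J) ?_)
    rw [hα0]; exact Ideal.mem_span_singleton_self α0
  have hspan : ∀ u : (𝓞 K)ˣ, Ideal.span {(u : 𝓞 K) * α0} = 𝔞 * J := fun u => by
    rw [hα0]; exact Ideal.span_singleton_mul_left_unit u.isUnit α0
  have hq : ∀ α : J, qf α = 𝔞 ↔ Ideal.span {(α : 𝓞 K)} = Ideal.span {α0} := fun α => by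
    rw [hqf, ← hα0]
    exact ⟨fun h => by rw [h], fun h => mul_right_cancel₀ hJ h⟩
  let e : (𝓞 K)ˣ ≃ qf ⁻¹' {𝔞} := Equiv.ofBijective
    (fun u => ⟨⟨(u : 𝓞 K) * α0, hmem u⟩, (hq _).mpr (by rw [hspan u, hα0])⟩) (by
      constructor
      · intro u v huv
        have : (u : 𝓞 K) * α0 = v * α0 := congrArg (fun z => ((z : qf ⁻¹' {𝔞}) : J).1) huv
        exact Units.ext (mul_right_cancel₀ hne this)
      · rintro ⟨α, hα⟩
        obtain ⟨u, hu⟩ := Ideal.span_singleton_eq_span_singleton.mp ((hq α).mp hα).symm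
        refine ⟨u, ?_⟩
        apply Subtype.ext; apply Subtype.ext
        change (u : 𝓞 K) * α0 = α
        rw [← hu, mul_comm])
  rw [← e.tsum_eq]
  have hval : ∀ u : (𝓞 K)ˣ, g (((e u : qf ⁻¹' {𝔞}) : J) : 𝓞 K) *
      wt (Y * Ideal.absNorm J) (((e u : qf ⁻¹' {𝔞}) : J) : 𝓞 K) =
      c 𝔞 * wt (Y * Ideal.absNorm J) ((u : 𝓞 K) * α0) := fun u => by
    change g ((u : 𝓞 K) * α0) * wt _ ((u : 𝓞 K) * α0) = _
    rw [hg _ 𝔞 (mul_ne_zero u.ne_zero hne) (hspan u)]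
  simp only [hval]
  rw [ENNReal.tsum_mul_left, sum_units_wt hY' hne, ← hα0, map_mul]
  push_cast
  rw [mul_div_mul_right _ _ hNJ.ne']

end IdealSum

end

section

open MeasureTheory Submodule NumberField NumberField.InfinitePlace NumberField.mixedEmbedding Module
open NumberField.Units NumberField.Units.dirichletUnitTheorem
open scoped ENNReal NNReal nonZeroDivisors

namespace CosetCount

variable {K : Type*} [Field K] [NumberField K]

/-- The multiples by `q` inside an ideal `J`. -/
def mulSub (J : Ideal (𝓞 K)) (q : ℕ) : AddSubgroup J :=
  (nsmulAddMonoidHom (α := J) q).range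

theorem mem_mulSub {J : Ideal (𝓞 K)} {q : ℕ} {x : J} :
    x ∈ mulSub J q ↔ ∃ y : J, (x : 𝓞 K) = q * y := by
  constructor
  · rintro ⟨y, hy⟩
    refine ⟨y, ?_⟩
    rw [← hy]; simp
  · rintro ⟨y, hy⟩
    exact ⟨y, by ext; simp [hy]⟩

/-- The fractional ideal `q J`. -/
noncomputable def scaled {J : Ideal (𝓞 K)} (hJ : J ≠ ⊥) {q : ℕ} (hq : q ≠ 0) :
    (FractionalIdeal (𝓞 K)⁰ K)ˣ :=
  Units.mk0 ((Ideal.span {(q : 𝓞 K)} * J : Ideal (𝓞 K)) : FractionalIdeal (𝓞 K)⁰ K) (by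
    rw [FractionalIdeal.coeIdeal_ne_zero]
    exact mul_ne_zero (by simpa using hq) hJ)

variable {J : Ideal (𝓞 K)} (hJ : J ≠ ⊥) {q : ℕ} (hq : q ≠ 0)

theorem absNorm_scaled : FractionalIdeal.absNorm (scaled hJ hq).1 =
    (q : ℚ) ^ finrank ℚ K * Ideal.absNorm J := by
  simp only [scaled, Units.val_mk0, FractionalIdeal.coeIdeal_absNorm, map_mul]
  rw [Ideal.absNorm_span_singleton, ← map_natCast (algebraMap ℤ (𝓞 K)) q, Algebra.norm_algebraMap,
    RingOfIntegers.rank]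
  simp [Int.natAbs_pow]

theorem mem_span_scaled {x : mixedSpace K} :
    x ∈ span ℤ (Set.range (fractionalIdealLatticeBasis K (scaled hJ hq))) ↔
      ∃ y : J, x = mixedEmbedding K ((q * y : 𝓞 K) : K) := by
  rw [mem_span_fractionalIdealLatticeBasis]
  constructor
  · rintro ⟨z, hz, rfl⟩
    have hz' : z ∈ ((Ideal.span {(q : 𝓞 K)} * J : Ideal (𝓞 K)) : FractionalIdeal (𝓞 K)⁰ K) := hz
    rw [FractionalIdeal.mem_coeIdeal] at hz'
    obtain ⟨w, hw, rfl⟩ := hz'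
    rw [Ideal.mem_span_singleton_mul] at hw
    obtain ⟨y, hy, rfl⟩ := hw
    exact ⟨⟨y, hy⟩, rfl⟩
  · rintro ⟨y, rfl⟩
    refine ⟨_, ?_, rfl⟩
    change _ ∈ ((Ideal.span {(q : 𝓞 K)} * J : Ideal (𝓞 K)) : FractionalIdeal (𝓞 K)⁰ K)
    rw [FractionalIdeal.mem_coeIdeal]
    exact ⟨_, Ideal.mem_span_singleton_mul.mpr ⟨y, y.2, rfl⟩, rfl⟩

theorem tsum_eq_tsum_num (g : 𝓞 K → ℝ≥0∞) (hg : ∀ α : J, ∀ β : J, g (α + q * β) = g α)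
    (S : Set (mixedSpace K)) :
    ∑' α : J, g α * S.indicator 1 (mixedEmbedding K ((α : 𝓞 K) : K)) =
      ∑' c : J ⧸ mulSub J q, g (c.out : J) *
        LatCount.num (fractionalIdealLatticeBasis K (scaled hJ hq))
          (mixedEmbedding K (((c.out : J) : 𝓞 K) : K)) S := by
  rw [← ENNReal.tsum_fiberwise _ (fun α : J => (α : J ⧸ mulSub J q))]
  congr 1; funext c
  have hinj : Function.Injective fun z : 𝓞 K => mixedEmbedding K (z : K) := fun a b h =>
    RingOfIntegers.ext ((mixedEmbedding K).injective h)
  have hmem : ∀ α : J, (α : J ⧸ mulSub J q) = c ↔ ∃ y : J, (α : 𝓞 K) = (c.out : J) + q * y := by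
    intro α
    rw [← c.out_eq', eq_comm]
    erw [QuotientAddGroup.eq]
    rw [mem_mulSub, c.out_eq']
    refine exists_congr fun y => ?_
    simp only [Submodule.coe_add, NegMemClass.coe_neg]
    constructor
    · intro h; rw [← h]; ring
    · intro h; rw [h]; ring
  let e : ((fun α : J => (α : J ⧸ mulSub J q)) ⁻¹' {c}) ≃
      span ℤ (Set.range (fractionalIdealLatticeBasis K (scaled hJ hq))) := Equiv.ofBijective
    (fun α => ⟨mixedEmbedding K (((α : J) : 𝓞 K) - ((c.out : J) : 𝓞 K) : 𝓞 K), by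
      obtain ⟨y, hy⟩ := (hmem α).mp α.2
      rw [mem_span_scaled]
      refine ⟨y, ?_⟩
      rw [hy, add_sub_cancel_left]⟩) (by
      constructor
      · intro a b hab
        have h := hinj (congrArg Subtype.val hab)
        apply Subtype.ext; apply Subtype.ext
        exact sub_left_injective h
      · rintro ⟨l, hl⟩
        obtain ⟨y, rfl⟩ := (mem_span_scaled hJ hq).mp hl
        refine ⟨⟨c.out + ⟨q * y, J.mul_mem_left _ y.2⟩, (hmem _).mpr ⟨y, rfl⟩⟩, ?_⟩
        apply Subtype.ext
        change mixedEmbedding K _ = _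
        congr 2
        change ((c.out : J) : 𝓞 K) + q * y - (c.out : J) = _
        ring)
  rw [LatCount.num, ← ENNReal.tsum_mul_left, ← e.tsum_eq]
  congr 1; funext α
  obtain ⟨y, hy⟩ := (hmem α).mp α.2
  have h1 : g ((α : J) : 𝓞 K) = g ((c.out : J) : 𝓞 K) := by rw [hy]; exact hg _ _
  have h2 : mixedEmbedding K (((c.out : J) : 𝓞 K) : K) + ((e α : span ℤ _) : mixedSpace K) =
      mixedEmbedding K (((α : J) : 𝓞 K) : K) := by
    change mixedEmbedding K _ + mixedEmbedding K (((α : J) : 𝓞 K) - ((c.out : J) : 𝓞 K) : 𝓞 K) = _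
    rw [← map_add]
    congr 1
    push_cast
    ring
  rw [h1, h2]

/-- The relative size of the error in the lattice point count. -/
noncomputable def err (n q : ℕ) (v Y : ℝ) : ℝ≥0 := (4 * n * q * v * Y ^ (-(1 / n : ℝ))).toNNReal

section

variable {ι : Type*} [Fintype ι] [Nonempty ι] (b : Basis ι ℚ K) (hint : ∀ i, IsIntegral ℤ (b i))
    (hb : ∀ i (w : InfinitePlace K), w (b i) ≤ 2) {v : ℝ} (hv0 : 0 < v)
    (hv : BoxCount.covol K < ENNReal.ofReal (v ^ finrank ℚ K))
    {Y : ℝ} (hY : 0 < Y)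

include hq hv0 hv hY in
theorem minkowskiBound_lt (τ : logSpace K) :
    minkowskiBound K (scaled hJ hq) < volume (convexBodyLT K fun w =>
      (2 * q * v * Y ^ (-(1 / finrank ℚ K : ℝ))).toNNReal *
        UnitLog.fbox τ (Y * Ideal.absNorm J) w) := by
  have hNJ : (0 : ℝ) < Ideal.absNorm J := by
    have := (Ideal.absNorm_eq_zero_iff (I := J)).not.mpr hJ
    positivity
  have hq' : (0 : ℝ) < q := by positivity
  have hn : (finrank ℚ K : ℝ) ≠ 0 := by exact_mod_cast finrank_pos.ne'
  rw [BoxCount.volume_smul_convexBodyLT, UnitLog.prod_fbox _ (by positivity), minkowskiBound,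
    volume_fundamentalDomain_fractionalIdealLatticeBasis, absNorm_scaled, mixedEmbedding.finrank]
  have e1 : ((2 * q * v * Y ^ (-(1 / finrank ℚ K : ℝ))).toNNReal : ℝ≥0∞) ^ finrank ℚ K =
      ENNReal.ofReal ((2 * q) ^ finrank ℚ K * v ^ finrank ℚ K * Y⁻¹) := by
    change ENNReal.ofReal _ ^ _ = _
    rw [← ENNReal.ofReal_pow (by positivity), mul_pow, mul_pow]
    congr 2
    rw [← Real.rpow_natCast, ← Real.rpow_mul hY.le, neg_mul, one_div, inv_mul_cancel₀ hn,
      Real.rpow_neg_one]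
  have e2 : (ENNReal.ofReal (((q : ℚ) ^ finrank ℚ K * Ideal.absNorm J : ℚ) : ℝ)) *
      (2 : ℝ≥0∞) ^ finrank ℚ K = ENNReal.ofReal ((2 * q) ^ finrank ℚ K * Ideal.absNorm J) := by
    rw [← ENNReal.ofReal_ofNat, ← ENNReal.ofReal_pow (by norm_num), ← ENNReal.ofReal_mul]
    · push_cast
      congr 1
      rw [mul_pow]; ring
    · positivity
  calc _ = ENNReal.ofReal ((2 * q) ^ finrank ℚ K * Ideal.absNorm J) * BoxCount.covol K := by
        rw [← e2, BoxCount.covol]; ring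
    _ < ENNReal.ofReal ((2 * q) ^ finrank ℚ K * Ideal.absNorm J) *
        ENNReal.ofReal (v ^ finrank ℚ K) := by
      refine (ENNReal.mul_lt_mul_iff_right ?_ ENNReal.ofReal_ne_top).mpr hv
      rw [ne_eq, ENNReal.ofReal_eq_zero, not_le]
      positivity
    _ = ENNReal.ofReal ((2 * q) ^ finrank ℚ K * v ^ finrank ℚ K * Y⁻¹) *
        (1 * ENNReal.ofReal (Y * Ideal.absNorm J)) := by
      rw [one_mul, ← ENNReal.ofReal_mul (by positivity), ← ENNReal.ofReal_mul (by positivity)]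
      congr 1
      field_simp
    _ ≤ _ := by
      rw [e1]
      gcongr
      exact_mod_cast one_le_convexBodyLTFactor K

include hv0 hY in
theorem err_eq [Fintype ι] (hι : Fintype.card ι = finrank ℚ K) :
    2 * Fintype.card ι * (2 * q * v * Y ^ (-(1 / finrank ℚ K : ℝ))).toNNReal =
      err (finrank ℚ K) q v Y := by
  rw [err, hι]
  apply NNReal.eq
  push_cast
  rw [Real.coe_toNNReal _ (by positivity), Real.coe_toNNReal _ (by positivity)]
  ring

include b hint hb hq hv0 hv hY in
theorem num_bounds (τ : logSpace K) (u : mixedSpace K) :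
    LatCount.num (fractionalIdealLatticeBasis K (scaled hJ hq)) u
        (convexBodyLT K (UnitLog.fbox τ (Y * Ideal.absNorm J))) *
      (q ^ finrank ℚ K * BoxCount.covol K) ≤
    (1 + err (finrank ℚ K) q v Y : ℝ≥0) ^ finrank ℚ K * (convexBodyLTFactor K * ENNReal.ofReal Y) ∧
    (1 - err (finrank ℚ K) q v Y : ℝ≥0) ^ finrank ℚ K * (convexBodyLTFactor K * ENNReal.ofReal Y) ≤
    LatCount.num (fractionalIdealLatticeBasis K (scaled hJ hq)) u
        (convexBodyLT K (UnitLog.fbox τ (Y * Ideal.absNorm J))) *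
      (q ^ finrank ℚ K * BoxCount.covol K) := by
  have hNJ0 : Ideal.absNorm J ≠ 0 := (Ideal.absNorm_eq_zero_iff (I := J)).not.mpr hJ
  have hNJ : (0 : ℝ) < Ideal.absNorm J := by positivity
  have hm := minkowskiBound_lt hJ hq hv0 hv hY τ
  have h1 := BoxCount.num_le b hint hb _ hm u
  have h2 := BoxCount.le_num b hint hb _ hm u
  rw [err_eq hv0 hY (finrank_eq_card_basis b).symm, UnitLog.prod_fbox _ (by positivity),
    absNorm_scaled] at h1 h2
  have e3 : ENNReal.ofReal (((q : ℚ) ^ finrank ℚ K * Ideal.absNorm J : ℚ) : ℝ) =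
      q ^ finrank ℚ K * Ideal.absNorm J := by
    push_cast
    rw [ENNReal.ofReal_mul (by positivity), ENNReal.ofReal_pow (by positivity)]
    simp
  have e4 : ENNReal.ofReal (Y * Ideal.absNorm J) = ENNReal.ofReal Y * Ideal.absNorm J := by
    rw [ENNReal.ofReal_mul hY.le]; simp
  rw [e3, e4] at h1 h2
  have hc0 : (Ideal.absNorm J : ℝ≥0∞) ≠ 0 := by exact_mod_cast hNJ0
  have hct : (Ideal.absNorm J : ℝ≥0∞) ≠ ⊤ := ENNReal.natCast_ne_top _
  constructor
  · rw [← ENNReal.mul_le_mul_iff_left hc0 hct]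
    convert h1 using 1 <;> ring
  · rw [← ENNReal.mul_le_mul_iff_left hc0 hct]
    convert h2 using 1 <;> ring

/-- The number of residue classes weighted by `g`. -/
noncomputable def classSum (J : Ideal (𝓞 K)) (q : ℕ) (g : 𝓞 K → ℝ≥0∞) : ℝ≥0∞ :=
  ∑' c : J ⧸ mulSub J q, g (c.out : J)

include hJ b hint hb hq hv0 hv hY in
theorem ideal_sum_bounds (c : Ideal (𝓞 K) → ℝ≥0∞) (g : 𝓞 K → ℝ≥0∞)
    (hg0 : g 0 = 0) (hg : ∀ α 𝔞, α ≠ 0 → Ideal.span {α} = 𝔞 * J → g α = c 𝔞)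
    (hper : ∀ α : J, ∀ β : J, g (α + q * β) = g α) :
    (∑' 𝔞 : Ideal (𝓞 K), if 𝔞 ≠ ⊥ ∧ (𝔞 * J).IsPrincipal then
      c 𝔞 * (Nat.card (torsion K) * volume (UnitLog.T K (Real.log (Y / Ideal.absNorm 𝔞)))) else 0) *
        (q ^ finrank ℚ K * BoxCount.covol K) ≤
      volume (UnitLog.dom K) * classSum J q g * ((1 + err (finrank ℚ K) q v Y : ℝ≥0) ^ finrank ℚ K *
        (convexBodyLTFactor K * ENNReal.ofReal Y)) ∧
    volume (UnitLog.dom K) * classSum J q g * ((1 - err (finrank ℚ K) q v Y : ℝ≥0) ^ finrank ℚ K *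
        (convexBodyLTFactor K * ENNReal.ofReal Y)) ≤
    (∑' 𝔞 : Ideal (𝓞 K), if 𝔞 ≠ ⊥ ∧ (𝔞 * J).IsPrincipal then
      c 𝔞 * (Nat.card (torsion K) * volume (UnitLog.T K (Real.log (Y / Ideal.absNorm 𝔞)))) else 0) *
        (q ^ finrank ℚ K * BoxCount.covol K) := by
  have hnum := num_bounds hJ hq b hint hb hv0 hv hY
  have hcov : (q : ℝ≥0∞) ^ finrank ℚ K * BoxCount.covol K ≠ ⊤ :=
    ENNReal.mul_ne_top (ENNReal.pow_ne_top (ENNReal.natCast_ne_top _))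
      (ne_top_of_lt hv)
  rw [← IdealSum.unfold hJ c g hg0 hg hY, ← lintegral_mul_const' _ _ hcov]
  simp only [tsum_eq_tsum_num hJ hq g hper, ← ENNReal.tsum_mul_right]
  rw [show ∀ C : ℝ≥0∞, volume (UnitLog.dom K) * classSum J q g * C =
      ∫⁻ _ in UnitLog.dom K, classSum J q g * C from fun C => by
    rw [setLIntegral_const]; ring]
  rw [show ∀ C : ℝ≥0∞, volume (UnitLog.dom K) * classSum J q g * C =
      ∫⁻ _ in UnitLog.dom K, classSum J q g * C from fun C => by
    rw [setLIntegral_const]; ring]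
  constructor
  · refine lintegral_mono fun τ => ?_
    rw [classSum, ← ENNReal.tsum_mul_right]
    refine ENNReal.tsum_le_tsum fun c => ?_
    rw [mul_assoc]
    exact mul_le_mul' le_rfl (hnum τ _).1
  · refine lintegral_mono fun τ => ?_
    rw [classSum, ← ENNReal.tsum_mul_right]
    refine ENNReal.tsum_le_tsum fun c => ?_
    rw [mul_assoc]
    exact mul_le_mul' le_rfl (hnum τ _).2

end

end CosetCount

end

section

open MeasureTheory Submodule NumberField NumberField.InfinitePlace NumberField.mixedEmbedding Module
open NumberField.Units NumberField.Units.dirichletUnitTheorem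
open scoped ENNReal NNReal nonZeroDivisors

namespace NormRes

variable {K : Type*} [Field K] [NumberField K] {J : Ideal (𝓞 K)} (hJ : J ≠ ⊥)

/-- Multiplication of the ring of integers into the ideal `J` by an element of `J`. -/
noncomputable def mulInto (α : J) : 𝓞 K →ₗ[ℤ] J :=
  (LinearMap.toSpanSingleton (𝓞 K) J α).restrictScalars ℤ

theorem mulInto_apply (α : J) (x : 𝓞 K) : mulInto α x = x • α := rfl

/-- The integral matrix of `mulInto`. -/
noncomputable def mat (α : J) :
    Matrix (Free.ChooseBasisIndex ℤ (𝓞 K)) (Free.ChooseBasisIndex ℤ (𝓞 K)) ℤ :=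
  LinearMap.toMatrix (RingOfIntegers.basis K) (J.selfBasis (RingOfIntegers.basis K) hJ)
    (mulInto α)

/-- A signed version of the index of `α` in `J`. -/
noncomputable def relNorm (α : J) : ℤ := (mat hJ α).det

theorem relNorm_zero : relNorm hJ 0 = 0 := by
  have : mulInto (0 : J) = 0 := by
    ext x; simp [mulInto_apply]
  rw [relNorm, mat, this, map_zero, Matrix.det_zero]

theorem mat_add_nsmul (q : ℕ) (α β : J) : mat hJ (α + q • β) = mat hJ α + q • mat hJ β := by
  have : mulInto (α + q • β) = mulInto α + q • mulInto β := by
    ext x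
    simp only [mulInto_apply, LinearMap.add_apply, LinearMap.smul_apply, smul_add]
    rw [smul_comm]
  rw [mat, this, map_add, map_nsmul]
  rfl

theorem relNorm_add_nsmul (q : ℕ) (α β : J) :
    ((relNorm hJ (α + q • β) : ℤ) : ZMod q) = relNorm hJ α := by
  rw [relNorm, relNorm, mat_add_nsmul, Int.cast_det, Int.cast_det]
  congr 1
  ext i j
  simp [Matrix.smul_apply, -nsmul_eq_mul]

theorem relNorm_smul (μ : 𝓞 K) (α : J) :
    relNorm hJ (μ • α) = relNorm hJ α * Algebra.norm ℤ μ := by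
  have : mulInto (μ • α) = mulInto α ∘ₗ LinearMap.mulLeft ℤ μ := by
    ext x
    simp [mulInto_apply]
    ring
  rw [relNorm, mat, this, LinearMap.toMatrix_comp _ (RingOfIntegers.basis K), Matrix.det_mul,
    relNorm, mat, Algebra.norm_eq_matrix_det (RingOfIntegers.basis K)]
  rfl

theorem natAbs_relNorm (α : J) {𝔞 : Ideal (𝓞 K)}
    (h : Ideal.span {(α : 𝓞 K)} = 𝔞 * J) : (relNorm hJ α).natAbs = Ideal.absNorm 𝔞 := by
  have h1 : Algebra.norm ℤ (α : 𝓞 K) = (LinearMap.toMatrix (J.selfBasis (RingOfIntegers.basis K) hJ)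
      (RingOfIntegers.basis K) (J.subtype.restrictScalars ℤ)).det * relNorm hJ α := by
    rw [relNorm, mat, ← Matrix.det_mul, ← LinearMap.toMatrix_comp,
      Algebra.norm_eq_matrix_det (RingOfIntegers.basis K), Algebra.leftMulMatrix_apply]
    congr 2
    ext x
    simp [mulInto_apply, mul_comm]
  have h2 : (LinearMap.toMatrix (J.selfBasis (RingOfIntegers.basis K) hJ)
      (RingOfIntegers.basis K) (J.subtype.restrictScalars ℤ)).det.natAbs = Ideal.absNorm J := by
    rw [← Ideal.natAbs_det_basis_change (RingOfIntegers.basis K) J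
      (J.selfBasis (RingOfIntegers.basis K) hJ), Basis.det_apply]
    congr 2
    ext i j
    rw [LinearMap.toMatrix_apply, Basis.toMatrix_apply]
    rfl
  have h3 := congrArg Ideal.absNorm h
  rw [Ideal.absNorm_span_singleton, h1, Int.natAbs_mul, h2, map_mul, mul_comm] at h3
  exact Nat.eq_of_mul_eq_mul_right (Nat.pos_of_ne_zero
    ((Ideal.absNorm_eq_zero_iff (I := J)).not.mpr hJ)) h3

/-- Indicator of the elements of `J` whose relative norm is `± a` modulo `q`. -/
noncomputable def ind (q : ℕ) (a : ZMod q) (α : 𝓞 K) : ℝ≥0∞ :=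
  if ∃ h : α ∈ J, (relNorm hJ ⟨α, h⟩ : ZMod q) = a ∨ (relNorm hJ ⟨α, h⟩ : ZMod q) = -a then 1 else 0

theorem ind_coe (q : ℕ) (a : ZMod q) (α : J) : ind hJ q a α =
    if (relNorm hJ α : ZMod q) = a ∨ (relNorm hJ α : ZMod q) = -a then 1 else 0 := by
  simp [ind]

theorem ind_zero {q : ℕ} {a : ZMod q} (ha : a ≠ 0) : ind hJ q a 0 = 0 := by
  have := ind_coe hJ q a 0
  simp only [ZeroMemClass.coe_zero, relNorm_zero, Int.cast_zero] at this
  rw [this, if_neg]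
  rintro (h | h)
  · exact ha h.symm
  · exact ha (by simpa using h)

theorem ind_add (q : ℕ) (a : ZMod q) (α β : J) : ind hJ q a (α + q * β) = ind hJ q a α := by
  have h : (α : 𝓞 K) + q * β = ((α + q • β : J) : 𝓞 K) := by simp
  rw [h, ind_coe, ind_coe, relNorm_add_nsmul]

theorem cast_eq_or_iff {q : ℕ} (z : ℤ) (a : ZMod q) :
    ((z : ZMod q) = a ∨ (z : ZMod q) = -a) ↔
      ((z.natAbs : ZMod q) = a ∨ (z.natAbs : ZMod q) = -a) := by
  rcases Int.natAbs_eq z with h | h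
  · have h' : (z : ZMod q) = (z.natAbs : ZMod q) := by
      rw [← Int.cast_natCast, ← h]
    rw [h']
  · have h' : (z : ZMod q) = -(z.natAbs : ZMod q) := by
      rw [← Int.cast_natCast, ← Int.cast_neg, ← h]
    rw [h', neg_inj, neg_eq_iff_eq_neg, or_comm]

theorem ind_coe_eq (q : ℕ) (a : ZMod q) (α : J) (𝔞 : Ideal (𝓞 K))
    (h : Ideal.span {(α : 𝓞 K)} = 𝔞 * J) :
    ind hJ q a α = if (Ideal.absNorm 𝔞 : ZMod q) = a ∨ (Ideal.absNorm 𝔞 : ZMod q) = -a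
      then 1 else 0 := by
  rw [ind_coe, ← natAbs_relNorm hJ α h]
  simp only [cast_eq_or_iff]

theorem ind_eq (q : ℕ) (a : ZMod q) (α : 𝓞 K) (𝔞 : Ideal (𝓞 K))
    (h : Ideal.span {α} = 𝔞 * J) :
    ind hJ q a α = if (Ideal.absNorm 𝔞 : ZMod q) = a ∨ (Ideal.absNorm 𝔞 : ZMod q) = -a
      then 1 else 0 := by
  have h1 : α ∈ 𝔞 * J := by
    rw [← h]; exact Ideal.mem_span_singleton_self α
  have h2 : 𝔞 * J ≤ J := Ideal.mul_le_right
  have hm : α ∈ J := h2 h1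
  obtain ⟨β, rfl⟩ : ∃ β : J, (β : 𝓞 K) = α := ⟨⟨α, hm⟩, rfl⟩
  have := ind_coe_eq hJ q a β 𝔞
  exact this h

section perm

variable {q : ℕ} (μ : 𝓞 K)

/-- Multiplication by `μ` on `J / q J`. -/
def quotMul (J : Ideal (𝓞 K)) (q : ℕ) (μ : 𝓞 K) :
    J ⧸ CosetCount.mulSub J q →+ J ⧸ CosetCount.mulSub J q :=
  QuotientAddGroup.map _ _ (DistribSMul.toAddMonoidHom J μ) (by
    rintro _ ⟨y, rfl⟩
    exact ⟨μ • y, (smul_comm μ q y).symm⟩)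

theorem quotMul_mk (x : J) : quotMul J q μ (x : J ⧸ CosetCount.mulSub J q) = (μ • x : J) := rfl

/-- `μ` permutes `J / q J` if its norm is prime to `q`. -/
theorem quotMul_bijective {N : ℕ} (hN : Ideal.absNorm (Ideal.span {μ}) = N) (hq : N.Coprime q) :
    Function.Bijective (quotMul J q μ) := by
  have h1 : (N : 𝓞 K) ∈ Ideal.span {μ} := hN ▸ Ideal.absNorm_mem _
  obtain ⟨ν, hν⟩ := Ideal.mem_span_singleton.mp h1
  obtain ⟨u, w, huw⟩ := Int.isCoprime_iff_gcd_eq_one.mpr (by simpa using hq : Int.gcd (N : ℤ) q = 1)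
  have h2 : (μ * (ν * u) : 𝓞 K) = 1 - q * w := by
    rw [← mul_assoc, ← hν, eq_sub_iff_add_eq]
    have := congrArg (Int.cast : ℤ → 𝓞 K) huw
    push_cast at this
    linear_combination this
  have key : ∀ x : J ⧸ CosetCount.mulSub J q, quotMul J q μ (quotMul J q (ν * u) x) = x := by
    intro x
    obtain ⟨x, rfl⟩ := QuotientAddGroup.mk_surjective x
    rw [quotMul_mk, quotMul_mk, ← mul_smul, h2]
    rw [QuotientAddGroup.eq, CosetCount.mem_mulSub]
    refine ⟨(w : 𝓞 K) • x, ?_⟩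
    simp
    ring
  have key2 : ∀ x : J ⧸ CosetCount.mulSub J q, quotMul J q (ν * u) (quotMul J q μ x) = x := by
    intro x
    rw [← key x]
    obtain ⟨x, rfl⟩ := QuotientAddGroup.mk_surjective x
    rw [quotMul_mk, quotMul_mk, quotMul_mk, quotMul_mk, ← mul_smul, ← mul_smul, ← mul_smul]
    rw [← mul_smul]
    have := key ((ν * u * μ) • x : J)
    rw [quotMul_mk, quotMul_mk, ← mul_smul, ← mul_smul] at this
    convert key ((μ * (ν * u)) • x : J) using 2
    rw [quotMul_mk, quotMul_mk, ← mul_smul, ← mul_smul]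
    congr 2; ring
  exact Function.bijective_iff_has_inverse.mpr ⟨_, key2, key⟩

theorem classSum_mul {N : ℕ} (hN : Ideal.absNorm (Ideal.span {μ}) = N) (hq : N.Coprime q)
    (a : ZMod q) :
    CosetCount.classSum J q (ind hJ q (N * a)) = CosetCount.classSum J q (ind hJ q a) := by
  rw [CosetCount.classSum, CosetCount.classSum,
    ← (Equiv.ofBijective _ (quotMul_bijective μ hN hq)).tsum_eq]
  refine tsum_congr fun c => ?_
  rw [Equiv.ofBijective_apply]
  have h1 : (((quotMul J q μ c).out : J) : J ⧸ CosetCount.mulSub J q) = (μ • c.out : J) := by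
    rw [QuotientAddGroup.out_eq', ← quotMul_mk, QuotientAddGroup.out_eq']
  obtain ⟨y, hy⟩ := CosetCount.mem_mulSub.mp (QuotientAddGroup.eq.mp h1.symm)
  have h2 : ((quotMul J q μ c).out : 𝓞 K) = ((μ • c.out : J) : 𝓞 K) + q * y := by
    rw [← hy]; simp
  rw [h2, ind_add, ind_coe, ind_coe, relNorm_smul]
  have h3 : (N : ℤ) = (Algebra.norm ℤ μ).natAbs := by
    rw [← hN, Ideal.absNorm_span_singleton]
  have hu : IsUnit ((N : ℕ) : ZMod q) := (ZMod.isUnit_iff_coprime N q).mpr hq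
  congr 1
  rw [eq_iff_iff]
  rcases Int.natAbs_eq (Algebra.norm ℤ μ) with h | h
  · rw [h, ← h3]
    push_cast
    rw [mul_comm, hu.mul_right_inj, ← mul_neg, hu.mul_right_inj]
  · rw [h, ← h3]
    push_cast
    rw [mul_neg, mul_comm, neg_inj, hu.mul_right_inj, neg_eq_iff_eq_neg, ← mul_neg,
      hu.mul_right_inj, or_comm]

end perm

end NormRes

end

section

open MeasureTheory Submodule NumberField NumberField.InfinitePlace NumberField.mixedEmbedding Module
open NumberField.Units NumberField.Units.dirichletUnitTheorem
open scoped ENNReal NNReal nonZeroDivisors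

namespace ClassCount

variable (K : Type*) [Field K] [NumberField K]

/-- The number of ideals of norm `k`. -/
noncomputable def idealCount (k : ℕ) : ℕ := Nat.card {I : Ideal (𝓞 K) // Ideal.absNorm I = k}

/-- The logarithmically weighted number of ideals with norm below `Y` and `± a` modulo `q`. -/
noncomputable def resSum (q : ℕ) (a : ZMod q) (Y : ℝ) : ℝ :=
  ∑ k ∈ Finset.range ⌈Y⌉₊, if (k : ZMod q) = a ∨ (k : ZMod q) = -a then
    idealCount K k * Real.log (Y / k) ^ rank K else 0

/-- The same count, normalised by volumes. -/
noncomputable def resVol (q : ℕ) (a : ZMod q) (Y : ℝ) : ℝ≥0∞ :=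
  ∑' 𝔞 : Ideal (𝓞 K), if 𝔞 ≠ ⊥ then
    (if (Ideal.absNorm 𝔞 : ZMod q) = a ∨ (Ideal.absNorm 𝔞 : ZMod q) = -a then 1 else 0) *
    (Nat.card (torsion K) * volume (UnitLog.T K (Real.log (Y / Ideal.absNorm 𝔞)))) else 0

variable {K}

theorem tsum_absNorm (F : ℕ → ℝ≥0∞) :
    ∑' 𝔞 : Ideal (𝓞 K), F (Ideal.absNorm 𝔞) = ∑' k, idealCount K k * F k := by
  rw [← ENNReal.tsum_fiberwise _ (fun 𝔞 : Ideal (𝓞 K) => Ideal.absNorm 𝔞)]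
  refine tsum_congr fun k => ?_
  have h : ∀ b : ↥((fun 𝔞 : Ideal (𝓞 K) => Ideal.absNorm 𝔞) ⁻¹' {k}),
      F (Ideal.absNorm (b : Ideal (𝓞 K))) = F k := fun b => congrArg F b.2
  rw [tsum_congr h, ENNReal.tsum_const]
  have hf : Finite ↥((fun 𝔞 : Ideal (𝓞 K) => Ideal.absNorm 𝔞) ⁻¹' {k}) :=
    Ideal.finite_setOfPred_absNorm_eq k
  rw [ENat.card_eq_coe_natCard]
  rfl

theorem nonneg_log_pow {Y : ℝ} {k : ℕ} (hk : k ∈ Finset.range ⌈Y⌉₊) (hk0 : k ≠ 0) :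
    0 < Real.log (Y / k) := by
  rw [Finset.mem_range, Nat.lt_ceil] at hk
  have : (0 : ℝ) < k := by positivity
  exact Real.log_pos (by rwa [one_lt_div this])

theorem resVol_eq {q : ℕ} {a : ZMod q} (ha : a ≠ 0) {Y : ℝ} (hY : 0 ≤ Y) :
    resVol K q a Y = ENNReal.ofReal (resSum K q a Y) *
      (Nat.card (torsion K) * volume (UnitLog.T K 1)) := by
  have h0 : ∀ k : ℕ, ((k : ZMod q) = a ∨ (k : ZMod q) = -a) → k ≠ 0 := by
    rintro k h rfl
    rcases h with h | h
    · exact ha (by simpa using h.symm)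
    · exact ha (by simpa using h.symm)
  obtain ⟨F, hF⟩ : ∃ F : ℕ → ℝ≥0∞, F = fun k : ℕ =>
      if (k : ZMod q) = a ∨ (k : ZMod q) = -a then
        Nat.card (torsion K) * volume (UnitLog.T K (Real.log (Y / k))) else 0 := ⟨_, rfl⟩
  have h1 : resVol K q a Y = ∑' 𝔞 : Ideal (𝓞 K), F (Ideal.absNorm 𝔞) := by
    rw [hF]
    refine tsum_congr fun 𝔞 => ?_
    by_cases h : (Ideal.absNorm 𝔞 : ZMod q) = a ∨ (Ideal.absNorm 𝔞 : ZMod q) = -a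
    · have : 𝔞 ≠ ⊥ := by
        rintro rfl
        exact h0 _ h (by simp)
      rw [if_pos this, if_pos h, one_mul]
      simp only [if_pos h]
    · simp only [if_neg h, zero_mul, ite_self]
  rw [h1, tsum_absNorm F, hF, tsum_eq_sum (s := Finset.range ⌈Y⌉₊), resSum, ENNReal.ofReal_sum_of_nonneg,
    Finset.sum_mul]
  · refine Finset.sum_congr rfl fun k hk => ?_
    beta_reduce
    split_ifs with h
    · have hl := nonneg_log_pow hk (h0 k h)
      rw [UnitLog.volume_T (Real.log _), if_pos hl, ENNReal.ofReal_mul (by positivity), ENNReal.ofReal_natCast]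
      ring
    · simp
  · intro k hk
    split_ifs with h
    · have hl := nonneg_log_pow hk (h0 k h)
      positivity
    · exact le_rfl
  · intro k hk
    beta_reduce
    split_ifs with h
    · have hk0 := h0 k h
      rw [UnitLog.volume_T, if_neg]
      · simp
      · rw [not_lt]
        rw [Finset.mem_range, Nat.lt_ceil, not_lt] at hk
        exact Real.log_nonpos (by positivity) (div_le_one_of_le₀ hk (by positivity))
    · simp

/-- An integral representative of an ideal class. -/
noncomputable def rep (C : ClassGroup (𝓞 K)) : Ideal (𝓞 K) :=
  (ClassGroup.mk0_surjective C).choose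

theorem rep_ne_bot (C : ClassGroup (𝓞 K)) : rep C ≠ ⊥ :=
  mem_nonZeroDivisors_iff_ne_zero.mp (ClassGroup.mk0_surjective C).choose.2

theorem isPrincipal_mul_rep_iff {𝔞 : Ideal (𝓞 K)} (h : 𝔞 ≠ ⊥) (C : ClassGroup (𝓞 K)) :
    (𝔞 * rep C).IsPrincipal ↔
      C = (ClassGroup.mk0 ⟨𝔞, mem_nonZeroDivisors_iff_ne_zero.mpr h⟩)⁻¹ := by
  have h1 : ClassGroup.mk0 (ClassGroup.mk0_surjective C).choose = C :=
    (ClassGroup.mk0_surjective C).choose_spec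
  have h2 := ClassGroup.mk0_eq_one_iff (I := 𝔞 * rep C)
    (mem_nonZeroDivisors_iff_ne_zero.mpr (mul_ne_zero h (rep_ne_bot C)))
  rw [← h2, eq_inv_iff_mul_eq_one]
  have h3 : C * ClassGroup.mk0 ⟨𝔞, mem_nonZeroDivisors_iff_ne_zero.mpr h⟩ = ClassGroup.mk0
      ⟨𝔞 * rep C, mem_nonZeroDivisors_iff_ne_zero.mpr (mul_ne_zero h (rep_ne_bot C))⟩ := by
    conv_lhs => rw [← h1, ← map_mul, mul_comm]
    rfl
  rw [h3]

theorem resVol_eq_sum (q : ℕ) (a : ZMod q) (Y : ℝ) :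
    resVol K q a Y = ∑ C : ClassGroup (𝓞 K), ∑' 𝔞 : Ideal (𝓞 K),
      if 𝔞 ≠ ⊥ ∧ (𝔞 * rep C).IsPrincipal then
    (if (Ideal.absNorm 𝔞 : ZMod q) = a ∨ (Ideal.absNorm 𝔞 : ZMod q) = -a then 1 else 0) *
    (Nat.card (torsion K) * volume (UnitLog.T K (Real.log (Y / Ideal.absNorm 𝔞)))) else 0 := by
  rw [resVol, ← tsum_fintype (L := SummationFilter.unconditional _), ENNReal.tsum_comm]
  refine tsum_congr fun 𝔞 => ?_
  by_cases h : 𝔞 = ⊥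
  · simp [h]
  · simp only [ne_eq, h, not_false_eq_true, if_true, true_and, isPrincipal_mul_rep_iff h]
    rw [tsum_ite_eq]

section

variable {ι : Type*} [Fintype ι] [Nonempty ι] (b : Basis ι ℚ K) (hint : ∀ i, IsIntegral ℤ (b i))
    (hb : ∀ i (w : InfinitePlace K), w (b i) ≤ 2) {v : ℝ} (hv0 : 0 < v)
    (hv : BoxCount.covol K < ENNReal.ofReal (v ^ finrank ℚ K)) {q : ℕ} (hq : q ≠ 0)

variable (K) in
/-- The total weight of the residue class `a` over all ideal classes. -/
noncomputable def weight (q : ℕ) (a : ZMod q) : ℝ≥0∞ :=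
  volume (UnitLog.dom K) * ∑ C : ClassGroup (𝓞 K),
    CosetCount.classSum (rep C) q (NormRes.ind (rep_ne_bot C) q a) * convexBodyLTFactor K

include b hint hb hv0 hv hq in
theorem resVol_bounds {a : ZMod q} (ha : a ≠ 0) {Y : ℝ} (hY : 0 < Y) :
    resVol K q a Y * (q ^ finrank ℚ K * BoxCount.covol K) ≤ weight K q a *
      ((1 + CosetCount.err (finrank ℚ K) q v Y : ℝ≥0) ^ finrank ℚ K * ENNReal.ofReal Y) ∧
    weight K q a *
      ((1 - CosetCount.err (finrank ℚ K) q v Y : ℝ≥0) ^ finrank ℚ K * ENNReal.ofReal Y) ≤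
    resVol K q a Y * (q ^ finrank ℚ K * BoxCount.covol K) := by
  have h := fun C : ClassGroup (𝓞 K) => CosetCount.ideal_sum_bounds (rep_ne_bot C) hq b hint hb hv0
    hv hY (fun 𝔞 => if (Ideal.absNorm 𝔞 : ZMod q) = a ∨ (Ideal.absNorm 𝔞 : ZMod q) = -a
      then 1 else 0) (NormRes.ind (rep_ne_bot C) q a) (NormRes.ind_zero _ ha)
    (fun α 𝔞 _ h => NormRes.ind_eq _ q a α 𝔞 h) (NormRes.ind_add _ q a)
  rw [resVol_eq_sum, weight, Finset.sum_mul, Finset.mul_sum, Finset.sum_mul, Finset.sum_mul]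
  constructor
  · refine Finset.sum_le_sum fun C _ => (h C).1.trans_eq (by ring)
  · refine Finset.sum_le_sum fun C _ => le_trans (le_of_eq (by ring)) (h C).2

theorem weight_mul (μ : 𝓞 K) {N : ℕ} (hN : Ideal.absNorm (Ideal.span {μ}) = N) (h : N.Coprime q)
    (a : ZMod q) : weight K q (N * a) = weight K q a := by
  simp only [weight, NormRes.classSum_mul _ μ hN h]

theorem weight_neg (a : ZMod q) : weight K q (-a) = weight K q a := by
  have : ∀ C : ClassGroup (𝓞 K), NormRes.ind (rep_ne_bot C) q (-a) =
      NormRes.ind (rep_ne_bot C) q a := by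
    intro C
    funext α
    simp only [NormRes.ind, neg_neg]
    congr 1
    simp only [or_comm]
  simp only [weight, this]

theorem weight_eq (μ : 𝓞 K) {N : ℕ} (hN : Ideal.absNorm (Ideal.span {μ}) = N) (h : N.Coprime q)
    {a : ZMod q} (ha : ∃ i : ℕ, a = (N : ZMod q) ^ i ∨ a = -(N : ZMod q) ^ i) :
    weight K q a = weight K q 1 := by
  have h1 : ∀ i : ℕ, weight K q ((N : ZMod q) ^ i) = weight K q 1 := by
    intro i
    induction i with
    | zero => simp
    | succ i ih => rw [pow_succ', weight_mul μ hN h, ih]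
  obtain ⟨i, rfl | rfl⟩ := ha
  · exact h1 i
  · rw [weight_neg, h1]

include b hint hb hv0 hv hq in
theorem weight_ne_top {a : ZMod q} (ha : a ≠ 0) : weight K q a ≠ ⊤ := by
  have hn : (0 : ℝ) < finrank ℚ K := by exact_mod_cast finrank_pos
  have hq' : (0 : ℝ) < q := by positivity
  have hp : 0 < 8 * finrank ℚ K * q * v := by positivity
  have hY : 0 < (8 * finrank ℚ K * q * v) ^ (finrank ℚ K : ℝ) := by positivity
  have h := (resVol_bounds b hint hb hv0 hv hq ha hY).2
  have herr : CosetCount.err (finrank ℚ K) q v ((8 * finrank ℚ K * q * v) ^ (finrank ℚ K : ℝ)) =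
      1 / 2 := by
    rw [CosetCount.err, ← Real.rpow_mul hp.le, mul_neg, mul_one_div_cancel hn.ne', Real.rpow_neg_one]
    apply NNReal.eq
    rw [Real.coe_toNNReal _ (by positivity)]
    push_cast
    field_simp
    norm_num
  intro hW
  rw [hW, herr, ENNReal.top_mul] at h
  · refine absurd (top_le_iff.mp h) (ENNReal.mul_ne_top ?_ (ENNReal.mul_ne_top
      (ENNReal.pow_ne_top (ENNReal.natCast_ne_top _)) (ne_top_of_lt hv)))
    rw [resVol_eq ha hY.le]
    exact ENNReal.mul_ne_top ENNReal.ofReal_ne_top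
      (ENNReal.mul_ne_top (ENNReal.natCast_ne_top _) UnitLog.volume_T_one_ne_top)
  · refine mul_ne_zero (pow_ne_zero _ ?_) ?_
    · have : (1 - 1 / 2 : ℝ≥0) = 1 / 2 := by
        apply NNReal.eq; rw [NNReal.coe_sub] <;> norm_num
      rw [this]; norm_num
    · simpa using hY

theorem covol_ne_zero : BoxCount.covol K ≠ 0 :=
  ZSpan.measure_fundamentalDomain_ne_zero _

include b hint hb hv0 hv hq in
/-- Ideals are equidistributed, with a uniform main term, over the classes `± a` generated by the
norm of an element. -/
theorem exists_const (hq1 : 1 < q) (μ : 𝓞 K) {N : ℕ} (hN : Ideal.absNorm (Ideal.span {μ}) = N)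
    (h : N.Coprime q) : ∃ κ : ℝ, 0 < κ ∧ ∀ a : ZMod q,
      (∃ i : ℕ, a = (N : ZMod q) ^ i ∨ a = -(N : ZMod q) ^ i) → ∀ Y : ℝ, 0 < Y →
      resSum K q a Y ≤ κ * Y *
        (1 + 4 * finrank ℚ K * q * v * Y ^ (-(1 / finrank ℚ K : ℝ))) ^ finrank ℚ K ∧
      κ * Y * (max (1 - 4 * finrank ℚ K * q * v * Y ^ (-(1 / finrank ℚ K : ℝ))) 0) ^ finrank ℚ K ≤
      resSum K q a Y := by
  have : Fact (1 < q) := ⟨hq1⟩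
  have h10 : (1 : ZMod q) ≠ 0 := one_ne_zero
  set Z : ℝ≥0∞ := Nat.card (torsion K) * volume (UnitLog.T K 1) with hZ
  have hZ0 : Z ≠ 0 := mul_ne_zero (by exact_mod_cast Nat.card_pos.ne') UnitLog.volume_T_one_ne_zero
  have hZt : Z ≠ ⊤ := ENNReal.mul_ne_top (ENNReal.natCast_ne_top _) UnitLog.volume_T_one_ne_top
  set A : ℝ≥0∞ := q ^ finrank ℚ K * BoxCount.covol K with hA
  have hA0 : A ≠ 0 := mul_ne_zero (pow_ne_zero _ (by simpa using hq)) covol_ne_zero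
  have hAt : A ≠ ⊤ := ENNReal.mul_ne_top (ENNReal.pow_ne_top (ENNReal.natCast_ne_top _))
    (ne_top_of_lt hv)
  have hW := weight_ne_top b hint hb hv0 hv hq h10
  have hZA0 : Z * A ≠ 0 := mul_ne_zero hZ0 hA0
  have hZAt : Z * A ≠ ⊤ := ENNReal.mul_ne_top hZt hAt
  set κ : ℝ≥0∞ := weight K q 1 / (Z * A) with hκ
  have hκt : κ ≠ ⊤ := ENNReal.div_ne_top hW hZA0
  have nonneg : ∀ (a : ZMod q) (_ : a ≠ 0) (Y : ℝ), 0 ≤ resSum K q a Y := by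
    intro a ha Y
    refine Finset.sum_nonneg fun k hk => ?_
    split_ifs with hka
    · have hk0 : k ≠ 0 := by
        rintro rfl
        rcases hka with h | h
        · exact ha (by simpa using h.symm)
        · exact ha (by simpa using h.symm)
      have := nonneg_log_pow hk hk0
      positivity
    · exact le_rfl
  have main : ∀ a : ZMod q, (∃ i : ℕ, a = (N : ZMod q) ^ i ∨ a = -(N : ZMod q) ^ i) →
      ∀ Y : ℝ, 0 < Y → ENNReal.ofReal (resSum K q a Y) ≤
        κ * ((1 + CosetCount.err (finrank ℚ K) q v Y : ℝ≥0) ^ finrank ℚ K * ENNReal.ofReal Y) ∧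
      κ * ((1 - CosetCount.err (finrank ℚ K) q v Y : ℝ≥0) ^ finrank ℚ K * ENNReal.ofReal Y) ≤
      ENNReal.ofReal (resSum K q a Y) ∧ a ≠ 0 := by
    intro a ha Y hY
    have hu : IsUnit ((N : ℕ) : ZMod q) := (ZMod.isUnit_iff_coprime N q).mpr h
    have ha0 : a ≠ 0 := by
      obtain ⟨i, rfl | rfl⟩ := ha
      · exact (hu.pow i).ne_zero
      · exact neg_ne_zero.mpr (hu.pow i).ne_zero
    obtain ⟨h1, h2⟩ := resVol_bounds b hint hb hv0 hv hq ha0 hY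
    rw [weight_eq μ hN h ha, resVol_eq ha0 hY.le, mul_assoc] at h1 h2
    refine ⟨?_, ?_, ha0⟩
    · rw [hκ, ← ENNReal.mul_div_right_comm, ENNReal.le_div_iff_mul_le (Or.inl hZA0) (Or.inl hZAt)]
      exact h1
    · rw [hκ, ← ENNReal.mul_div_right_comm]
      exact ENNReal.div_le_of_le_mul h2
  have hκ0 : κ ≠ 0 := by
    intro h0
    have h1 := (main 1 ⟨0, Or.inl (by simp)⟩ 2 (by norm_num)).1
    rw [h0, zero_mul, nonpos_iff_eq_zero, ENNReal.ofReal_eq_zero, resSum] at h1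
    have hm : (1 : ℕ) ∈ Finset.range ⌈(2 : ℝ)⌉₊ := by norm_num
    have h2 := Finset.single_le_sum (f := fun k : ℕ => if (k : ZMod q) = 1 ∨ (k : ZMod q) = -1 then
      (idealCount K k : ℝ) * Real.log (2 / k) ^ rank K else 0) (fun k hk => by
        split_ifs with hk1
        · rcases eq_or_ne k 0 with rfl | hk0
          · simp only [Nat.cast_zero, div_zero, Real.log_zero]
            positivity
          · have := nonneg_log_pow hk hk0
            positivity
        · exact le_rfl) hm
    have h3 : 0 < idealCount K 1 := by
      have : Finite {I : Ideal (𝓞 K) // Ideal.absNorm I = 1} := Ideal.finite_setOfPred_absNorm_eq 1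
      have : Nonempty {I : Ideal (𝓞 K) // Ideal.absNorm I = 1} := ⟨⟨⊤, by simp⟩⟩
      exact Nat.card_pos
    have h4 : 0 < Real.log (2 / (1 : ℕ)) := Real.log_pos (by norm_num)
    simp only [Nat.cast_one, true_or, if_true] at h2 h4
    have h5 : 0 < (idealCount K 1 : ℝ) * Real.log (2 / 1) ^ rank K := by positivity
    linarith
  refine ⟨κ.toReal, ENNReal.toReal_pos hκ0 hκt, fun a ha Y hY => ?_⟩
  obtain ⟨h1, h2, ha0⟩ := main a ha Y hY
  have hδ : 0 ≤ 4 * finrank ℚ K * q * v * Y ^ (-(1 / finrank ℚ K : ℝ)) := by positivity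
  have hS := nonneg a ha0 Y
  constructor
  · have := ENNReal.toReal_mono (ENNReal.mul_ne_top hκt (ENNReal.mul_ne_top (ENNReal.pow_ne_top
      ENNReal.coe_ne_top) ENNReal.ofReal_ne_top)) h1
    rw [ENNReal.toReal_ofReal hS, ENNReal.toReal_mul, ENNReal.toReal_mul, ENNReal.toReal_pow,
      ENNReal.toReal_ofReal hY.le, ENNReal.coe_toReal, NNReal.coe_add, CosetCount.err,
      Real.coe_toNNReal _ hδ, NNReal.coe_one] at this
    exact this.trans_eq (by ring)
  · have := ENNReal.toReal_mono ENNReal.ofReal_ne_top h2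
    rw [ENNReal.toReal_ofReal hS, ENNReal.toReal_mul, ENNReal.toReal_mul, ENNReal.toReal_pow,
      ENNReal.toReal_ofReal hY.le, ENNReal.coe_toReal, NNReal.coe_sub_def, CosetCount.err,
      Real.coe_toNNReal _ hδ, NNReal.coe_one] at this
    exact le_trans (le_of_eq (by ring)) this

end

end ClassCount

end

section

open MeasureTheory Set Filter Topology Asymptotics

namespace Continue

/-- The function `(-log t)^r` on `(0,1)`, extended by zero. -/
noncomputable def logInd (r : ℕ) (t : ℝ) : ℂ :=
  (Ioo (0 : ℝ) 1).indicator (fun t => (((-Real.log t) ^ r : ℝ) : ℂ)) t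

theorem measurable_logInd (r : ℕ) : Measurable (logInd r) :=
  Measurable.indicator (by fun_prop) measurableSet_Ioo

theorem logInd_succ (r : ℕ) : logInd (r + 1) = fun t => -(Real.log t • logInd r t) := by
  funext t
  by_cases h : t ∈ Ioo (0 : ℝ) 1
  · simp only [logInd, indicator_of_mem h, Complex.real_smul]
    push_cast
    ring
  · simp [logInd, indicator_of_notMem h]

theorem norm_logInd_le {t : ℝ} (ht : 0 < t) (r : ℕ) : ‖logInd r t‖ ≤ |Real.log t| ^ r := by
  by_cases h : t ∈ Ioo (0 : ℝ) 1
  · simp [logInd, indicator_of_mem h]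
  · simp only [logInd, indicator_of_notMem h, norm_zero]
    positivity

theorem logInd_of_one_le {t : ℝ} (ht : 1 ≤ t) (r : ℕ) : logInd r t = 0 :=
  indicator_of_notMem (fun h => absurd h.2 (not_lt.2 ht)) _

theorem locallyIntegrableOn_logInd (r : ℕ) : LocallyIntegrableOn (logInd r) (Ioi 0) := by
  have h : LocallyIntegrableOn (fun t : ℝ => (((-Real.log t) ^ r : ℝ) : ℂ)) (Ioi 0) := by
    refine ContinuousOn.locallyIntegrableOn ?_ measurableSet_Ioi
    refine Complex.continuous_ofReal.comp_continuousOn ?_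
    exact ((Real.continuousOn_log.mono fun x hx => (ne_of_gt hx)).neg).pow r
  refine h.mono (measurable_logInd r).aestronglyMeasurable (Eventually.of_forall fun t => ?_)
  exact norm_indicator_le_norm_self _ _

theorem isBigO_logInd_atTop (r : ℕ) (a : ℝ) : logInd r =O[atTop] fun x => x ^ (-a) := by
  refine (isBigO_zero _ _).congr' ?_ EventuallyEq.rfl
  filter_upwards [eventually_ge_atTop 1] with t ht
  exact (logInd_of_one_le ht r).symm

theorem isBigO_logInd_zero (r : ℕ) {b : ℝ} (hb : 0 < b) :
    logInd r =O[𝓝[>] 0] fun x => x ^ (-b) := by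
  refine IsBigO.trans (g := fun x => |Real.log x| ^ (r : ℝ)) ?_
    (isLittleO_abs_log_rpow_rpow_nhdsGT_zero r (by linarith : -b < 0)).isBigO
  refine IsBigO.of_bound 1 ?_
  filter_upwards [self_mem_nhdsWithin] with t ht
  rw [one_mul, Real.rpow_natCast, norm_pow, Real.norm_eq_abs, abs_abs]
  exact norm_logInd_le ht r

theorem mellinConvergent_logInd (r : ℕ) {s : ℂ} (hs : 0 < s.re) :
    MellinConvergent (logInd r) s :=
  mellinConvergent_of_isBigO_rpow (locallyIntegrableOn_logInd r)
    (isBigO_logInd_atTop r (s.re + 1)) (by linarith)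
    (isBigO_logInd_zero r (half_pos hs)) (by linarith)

theorem mellin_logInd (r : ℕ) : ∀ {s : ℂ}, 0 < s.re →
    mellin (logInd r) s = (r.factorial : ℂ) / s ^ (r + 1) := by
  induction r with
  | zero =>
    intro s hs
    rw [Nat.factorial_zero, Nat.cast_one, zero_add, pow_one, ← (hasMellin_one_Ioc hs).2]
    refine setIntegral_congr_ae measurableSet_Ioi ?_
    have : ∀ᵐ t : ℝ, t ≠ 1 := by simp [ae_iff]
    filter_upwards [this] with t ht ht0
    congr 1
    simp only [logInd, pow_zero, Complex.ofReal_one]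
    by_cases h : t < 1
    · rw [indicator_of_mem (show t ∈ Ioo (0 : ℝ) 1 from ⟨ht0, h⟩), indicator_of_mem (show t ∈ Ioc (0 : ℝ) 1 from ⟨ht0, h.le⟩)]
    · rw [indicator_of_notMem (fun h' : t ∈ Ioo (0 : ℝ) 1 => h h'.2),
        indicator_of_notMem (fun h' => h (lt_of_le_of_ne h'.2 ht))]
  | succ r ih =>
    intro s hs
    have h := (mellin_hasDerivAt_of_isBigO_rpow (locallyIntegrableOn_logInd r)
      (isBigO_logInd_atTop r (s.re + 1)) (by linarith)
      (isBigO_logInd_zero r (half_pos hs)) (by linarith)).2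
    have hs0 : s ≠ 0 := by
      rintro rfl
      simp at hs
    have h2 : HasDerivAt (mellin (logInd r))
        ((0 * s ^ (r + 1) - r.factorial * (((r + 1 : ℕ) : ℂ) * s ^ r)) / (s ^ (r + 1)) ^ 2) s := by
      have h3 : HasDerivAt (fun s : ℂ => (r.factorial : ℂ) / s ^ (r + 1)) _ s :=
        (hasDerivAt_const s (r.factorial : ℂ)).div (hasDerivAt_pow (r + 1) s) (pow_ne_zero _ hs0)
      refine h3.congr_of_eventuallyEq ?_
      filter_upwards [(isOpen_lt continuous_const Complex.continuous_re).mem_nhds hs] with z hz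
      exact ih hz
    have h4 : mellin (logInd (r + 1)) s
        = -mellin (fun t => Real.log t • logInd r t) s := by
      rw [logInd_succ]
      simp only [mellin, smul_neg, integral_neg]
    rw [h4, h.unique h2, Nat.factorial_succ]
    push_cast
    field_simp
    ring

variable {c : ℕ → ℂ} {r : ℕ}

/-- The weighted partial sums in the variable `t = 1 / Y`. -/
noncomputable def wsum (c : ℕ → ℂ) (r : ℕ) (t : ℝ) : ℂ := ∑' k : ℕ, c k * logInd r (k * t)

theorem wsum_eq (hc : c 0 = 0) {t : ℝ} (ht : 0 < t) :
    wsum c r t = ∑ k ∈ Finset.range ⌈1 / t⌉₊, c k * ((Real.log ((1 / t) / k) ^ r : ℝ) : ℂ) := by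
  rw [wsum, tsum_eq_sum (s := Finset.range ⌈1 / t⌉₊)]
  · refine Finset.sum_congr rfl fun k hk => ?_
    rcases eq_or_ne k 0 with rfl | hk0
    · simp [hc]
    have hkp : (0 : ℝ) < k := by positivity
    rw [Finset.mem_range, Nat.lt_ceil, lt_div_iff₀ ht] at hk
    rw [logInd, indicator_of_mem (show k * t ∈ Ioo (0 : ℝ) 1 from ⟨by positivity, hk⟩), ← Real.log_inv]
    congr 5
    field_simp
  · intro k hk
    rw [Finset.mem_range, Nat.lt_ceil, lt_div_iff₀ ht] at hk
    rw [logInd_of_one_le (not_lt.1 hk), mul_zero]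

theorem integrable_term (r k : ℕ) (hk : k ≠ 0) {s : ℂ} (hs : 0 < s.re) :
    MellinConvergent (fun t => logInd r (k * t)) s :=
  (MellinConvergent.comp_mul_left (by positivity : (0 : ℝ) < k)).2 (mellinConvergent_logInd r hs)

theorem integral_norm_term (r k : ℕ) (hk : k ≠ 0) (s : ℂ) :
    ∫ t in Ioi (0 : ℝ), ‖(t : ℂ) ^ (s - 1) • logInd r (k * t)‖
      = (k : ℝ) ^ (-s.re) * ∫ t in Ioi (0 : ℝ), ‖(t : ℂ) ^ (s - 1) • logInd r t‖ := by
  have hkp : (0 : ℝ) < k := by positivity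
  have h := integral_comp_mul_left_Ioi (fun t : ℝ => ‖(t : ℂ) ^ (s - 1) • logInd r t‖) 0 hkp
  rw [mul_zero, smul_eq_mul] at h
  have h2 : ∀ t ∈ Ioi (0 : ℝ), ‖(t : ℂ) ^ (s - 1) • logInd r (k * t)‖
      = (k : ℝ) ^ (1 - s.re) * ‖((k * t : ℝ) : ℂ) ^ (s - 1) • logInd r (k * t)‖ := by
    intro t ht
    have ht : 0 < t := ht
    rw [norm_smul, norm_smul, Complex.norm_cpow_eq_rpow_re_of_pos ht,
      Complex.norm_cpow_eq_rpow_re_of_pos (by positivity), Real.mul_rpow hkp.le ht.le, ← mul_assoc,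
      ← mul_assoc, ← Real.rpow_add hkp]
    simp
  rw [setIntegral_congr_fun measurableSet_Ioi h2, integral_const_mul, h, ← mul_assoc,
    ← Real.rpow_neg_one, ← Real.rpow_add hkp]
  ring_nf

theorem hasSum_mellin_wsum (hc : c 0 = 0) {s : ℂ} (hs : 1 < s.re) (hsum : LSeriesSummable c s) :
    mellin (wsum c r) s = LSeries c s * (r.factorial / s ^ (r + 1)) := by
  have hs0 : 0 < s.re := by linarith
  have h := hasSum_integral_of_summable_integral_norm (μ := volume.restrict (Ioi (0 : ℝ)))
    (F := fun (k : ℕ) (t : ℝ) => (t : ℂ) ^ (s - 1) • (c k * logInd r (k * t))) ?_ ?_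
  · have h2 : (fun k : ℕ => ∫ t in Ioi (0 : ℝ), (t : ℂ) ^ (s - 1) • (c k * logInd r (k * t)))
        = fun k => LSeries.term c s k * (r.factorial / s ^ (r + 1)) := by
      funext k
      rcases eq_or_ne k 0 with rfl | hk
      · simp [hc]
      have hkp : (0 : ℝ) < k := by positivity
      have h3 := mellin_comp_mul_left (logInd r) s hkp
      rw [mellin_logInd r hs0] at h3
      rw [LSeries.term_of_ne_zero hk, div_eq_mul_inv, ← Complex.cpow_neg, mul_assoc]
      simp only [mellin, smul_eq_mul] at h3
      simp only [smul_eq_mul, mul_left_comm _ (c k), integral_const_mul]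
      rw [h3]
      simp
    rw [h2] at h
    rw [LSeries, ← tsum_mul_right, h.tsum_eq, mellin]
    refine integral_congr_ae (Eventually.of_forall fun t => ?_)
    simp only [wsum, smul_eq_mul, tsum_mul_left]
  · intro k
    rcases eq_or_ne k 0 with rfl | hk
    · simp [hc]
    have h1 : Integrable (fun t : ℝ => (t : ℂ) ^ (s - 1) • logInd r (k * t))
        (volume.restrict (Ioi (0 : ℝ))) := integrable_term r k hk hs0
    convert h1.const_mul (c k) using 2 with t
    simp only [smul_eq_mul]
    ring
  · have h1 := (hsum.norm.mul_right (∫ t in Ioi (0 : ℝ), ‖(t : ℂ) ^ (s - 1) • logInd r t‖))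
    refine h1.congr fun k => ?_
    rcases eq_or_ne k 0 with rfl | hk
    · simp [hc]
    have h2 := integral_norm_term r k hk s
    rw [LSeries.norm_term_eq, if_neg hk, div_eq_mul_inv, ← Real.rpow_neg (by positivity), mul_assoc,
      ← h2, ← integral_const_mul]
    refine integral_congr_ae (Eventually.of_forall fun t => ?_)
    simp only [norm_smul, norm_mul]
    ring

theorem measurable_wsum : Measurable (wsum c r) :=
  Measurable.tsum fun k => ((measurable_logInd r).comp (measurable_const_mul _)).const_mul _

/-- The weighted partial sums minus the main term. -/
noncomputable def rem (c : ℕ → ℂ) (r : ℕ) (M : ℝ) (t : ℝ) : ℂ :=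
  (Ioc (0 : ℝ) 1).indicator (fun t => wsum c r t - M * ((t : ℂ) ^ (-1 : ℂ))) t

theorem measurable_rem (M : ℝ) : Measurable (rem c r M) := by
  refine Measurable.indicator (measurable_wsum.sub ?_) measurableSet_Ioc
  simp only [Complex.cpow_neg_one]
  fun_prop

theorem norm_rem_le (hc : c 0 = 0) {A M δ : ℝ} (hA : 0 ≤ A)
    (hS : ∀ Y : ℝ, 1 ≤ Y → ‖∑ k ∈ Finset.range ⌈Y⌉₊, c k * ((Real.log (Y / k) ^ r : ℝ) : ℂ) - M * Y‖
      ≤ A * Y ^ (1 - δ)) (t : ℝ) :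
    ‖rem c r M t‖ ≤ (Ioc (0 : ℝ) 1).indicator (fun t => A * t ^ (δ - 1)) t := by
  by_cases ht : t ∈ Ioc (0 : ℝ) 1
  · rw [rem, indicator_of_mem ht, indicator_of_mem ht, wsum_eq hc ht.1]
    have h := hS (1 / t) (by rw [le_div_iff₀ ht.1]; linarith [ht.2])
    rw [one_div, Real.inv_rpow ht.1.le, ← Real.rpow_neg ht.1.le, neg_sub] at h
    rw [Complex.cpow_neg_one, one_div]
    simpa using h
  · rw [rem, indicator_of_notMem ht, indicator_of_notMem ht, norm_zero]

/-- Analytic continuation of a Dirichlet series from an asymptotic formula, with power saving,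
for the logarithmically weighted partial sums. -/
theorem exists_continuation (hc : c 0 = 0) {A M δ : ℝ} (hA : 0 ≤ A)
    (hS : ∀ Y : ℝ, 1 ≤ Y → ‖∑ k ∈ Finset.range ⌈Y⌉₊, c k * ((Real.log (Y / k) ^ r : ℝ) : ℂ) - M * Y‖
      ≤ A * Y ^ (1 - δ)) (hsum : ∀ s : ℂ, 1 < s.re → LSeriesSummable c s) :
    ∃ F : ℂ → ℂ, DifferentiableOn ℂ F {s | 1 - δ < s.re} ∧
      (∀ s : ℂ, 1 < s.re → 0 < δ →
        F s = LSeries c s * (r.factorial / s ^ (r + 1)) - M / (s - 1)) ∧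
      ∀ s : ℂ, 1 - δ < s.re → ‖F s‖ ≤ A / (s.re - (1 - δ)) := by
  have hloc : LocallyIntegrableOn (rem c r M) (Ioi 0) := by
    have h : LocallyIntegrableOn (fun t : ℝ => A * t ^ (δ - 1)) (Ioi 0) := by
      refine ContinuousOn.locallyIntegrableOn ?_ measurableSet_Ioi
      exact ContinuousOn.mul continuousOn_const
        (continuousOn_id.rpow_const fun x hx => Or.inl (ne_of_gt hx))
    refine h.mono (measurable_rem M).aestronglyMeasurable (Eventually.of_forall fun t => ?_)
    refine (norm_rem_le hc hA hS t).trans ((le_abs_self _).trans ?_)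
    exact norm_indicator_le_norm_self (fun t : ℝ => A * t ^ (δ - 1)) t
  have htop : ∀ a : ℝ, rem c r M =O[atTop] fun x => x ^ (-a) := by
    intro a
    refine (isBigO_zero _ _).congr' ?_ EventuallyEq.rfl
    filter_upwards [eventually_gt_atTop 1] with t ht
    exact (indicator_of_notMem (fun h => absurd h.2 (not_le.2 ht)) _).symm
  have hbot : rem c r M =O[𝓝[>] 0] fun x => x ^ (-(1 - δ)) := by
    refine IsBigO.of_bound A ?_
    filter_upwards [self_mem_nhdsWithin] with t ht
    have ht : 0 < t := ht
    refine (norm_rem_le hc hA hS t).trans ?_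
    rw [neg_sub, Real.norm_of_nonneg (by positivity)]
    by_cases h : t ∈ Ioc (0 : ℝ) 1
    · rw [indicator_of_mem h]
    · rw [indicator_of_notMem h]
      positivity
  refine ⟨mellin (rem c r M), fun s hs => ?_, fun s hs hδ0 => ?_, fun s hs => ?_⟩
  · exact (mellin_differentiableAt_of_isBigO_rpow hloc (htop (s.re + 1)) (by linarith)
      hbot hs).differentiableWithinAt
  · have hm : HasMellin ((Ioc (0 : ℝ) 1).indicator fun t : ℝ => (t : ℂ) ^ (-1 : ℂ)) s
        (1 / (s + -1)) := hasMellin_cpow_Ioc (-1) (by simp; linarith)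
    have hconv : MellinConvergent (rem c r M) s :=
      mellinConvergent_of_isBigO_rpow hloc (htop (s.re + 1)) (by linarith)
        hbot (by linarith)
    have hm2 : HasMellin (fun t => (M : ℂ) • (Ioc (0 : ℝ) 1).indicator
        (fun t : ℝ => (t : ℂ) ^ (-1 : ℂ)) t) s (M / (s - 1)) := by
      refine ⟨hm.1.const_smul _, ?_⟩
      rw [mellin_const_smul, hm.2, smul_eq_mul]
      ring
    have hadd := hasMellin_add hconv hm2.1
    rw [hm2.2] at hadd
    rw [← hasSum_mellin_wsum hc hs (hsum s hs), eq_sub_iff_add_eq, ← hadd.2]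
    refine setIntegral_congr_fun measurableSet_Ioi fun t ht => ?_
    have ht : 0 < t := ht
    simp only [rem]
    congr 1
    by_cases h : t ≤ 1
    · rw [indicator_of_mem (show t ∈ Ioc (0 : ℝ) 1 from ⟨ht, h⟩),
        indicator_of_mem (show t ∈ Ioc (0 : ℝ) 1 from ⟨ht, h⟩)]
      simp
    · rw [indicator_of_notMem (fun h' : t ∈ Ioc (0 : ℝ) 1 => h h'.2),
        indicator_of_notMem (fun h' : t ∈ Ioc (0 : ℝ) 1 => h h'.2), smul_zero, add_zero,
        wsum_eq hc ht]
      have h1 : ⌈1 / t⌉₊ ≤ 1 := Nat.ceil_le.2 (by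
        rw [Nat.cast_one, div_le_one ht]
        exact (not_le.1 h).le)
      refine (Finset.sum_eq_zero fun k hk => ?_).symm
      have : k = 0 := by
        have := Finset.mem_range.1 hk
        omega
      rw [this, hc, zero_mul]
  · have hint : IntegrableOn (fun t : ℝ => A * t ^ (s.re - 1 + (δ - 1))) (Ioc 0 1) := by
      refine Integrable.const_mul ?_ A
      refine (intervalIntegrable_iff_integrableOn_Ioc_of_le zero_le_one).1 ?_
      exact intervalIntegral.intervalIntegrable_rpow' (by linarith [show 1 - δ < s.re from hs])
    have h1 : ‖mellin (rem c r M) s‖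
        ≤ ∫ t in Ioi (0 : ℝ), (Ioc (0 : ℝ) 1).indicator
          (fun t => A * t ^ (s.re - 1 + (δ - 1))) t := by
      refine norm_integral_le_of_norm_le ((hint.integrable_indicator measurableSet_Ioc).integrableOn)
        ?_
      filter_upwards [ae_restrict_mem measurableSet_Ioi] with t ht
      have ht : 0 < t := ht
      rw [norm_smul, Complex.norm_cpow_eq_rpow_re_of_pos ht, Complex.sub_re, Complex.one_re]
      refine (mul_le_mul_of_nonneg_left (norm_rem_le hc hA hS t) (by positivity)).trans ?_
      by_cases h : t ∈ Ioc (0 : ℝ) 1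
      · rw [indicator_of_mem h, indicator_of_mem h, Real.rpow_add ht]
        apply le_of_eq
        ring
      · rw [indicator_of_notMem h, indicator_of_notMem h, mul_zero]
    refine h1.trans (le_of_eq ?_)
    rw [setIntegral_indicator measurableSet_Ioc, inter_eq_right.2 (fun t h => h.1),
      integral_const_mul, ← intervalIntegral.integral_of_le zero_le_one,
      integral_rpow (Or.inl (by linarith [show 1 - δ < s.re from hs])), Real.one_rpow,
      Real.zero_rpow (by have : 1 - δ < s.re := hs; linarith), sub_zero, mul_one_div]
    congr 1
    ring

end Continue

end

section

open Complex Filter Topology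

/-- `a` and `Λ` are the coefficients of `L` and `-L'/L`, converging for `re s > 1`. -/
structure IsVM (a Λ : ℕ → ℂ) : Prop where
  one : a 1 = 1
  conv : LSeries.logMul a = LSeries.convolution a Λ
  sum_a : ∀ s : ℂ, 1 < s.re → LSeriesSummable a s
  sum_L : ∀ s : ℂ, 1 < s.re → LSeriesSummable Λ s

namespace IsVM

variable {a Λ : ℕ → ℂ}

/-- The coefficients `Λ(n) / log n` of the logarithm. -/
noncomputable def logCoeff (Λ : ℕ → ℂ) (n : ℕ) : ℂ := Λ n / Complex.log n

theorem abscissa_le {f : ℕ → ℂ} (h : ∀ s : ℂ, 1 < s.re → LSeriesSummable f s) :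
    LSeries.abscissaOfAbsConv f ≤ 1 := by
  have := LSeries.abscissaOfAbsConv_le_of_forall_lt_LSeriesSummable (f := f) (x := 1)
    fun y hy => h y (by simpa using hy)
  exact_mod_cast this

theorem abscissa_lt {f : ℕ → ℂ} (h : ∀ s : ℂ, 1 < s.re → LSeriesSummable f s) {s : ℂ}
    (hs : 1 < s.re) : LSeries.abscissaOfAbsConv f < s.re :=
  (abscissa_le h).trans_lt (by exact_mod_cast hs)

theorem vm_one (h : IsVM a Λ) : Λ 1 = 0 := by
  have := congrFun h.conv 1
  simpa [LSeries.logMul, LSeries.convolution_def, h.one] using this.symm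

theorem norm_logCoeff_le (Λ : ℕ → ℂ) (h1 : Λ 1 = 0) (n : ℕ) :
    ‖logCoeff Λ n‖ ≤ (Real.log 2)⁻¹ * ‖Λ n‖ := by
  rcases Nat.lt_or_ge n 2 with hn | hn
  · interval_cases n
    · simp only [logCoeff, Nat.cast_zero, Complex.log_zero, div_zero, norm_zero]
      have := Real.log_pos one_lt_two
      positivity
    · simp [logCoeff, h1]
  · have h2 : Real.log 2 ≤ Real.log n := Real.log_le_log two_pos (by exact_mod_cast hn)
    have h3 := Real.log_pos one_lt_two
    rw [logCoeff, norm_div, ← Complex.natCast_log, Complex.norm_real, Real.norm_of_nonneg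
      (by linarith), div_eq_inv_mul]
    gcongr

theorem sum_logCoeff (h : IsVM a Λ) (s : ℂ) (hs : 1 < s.re) :
    LSeriesSummable (logCoeff Λ) s := by
  refine Summable.of_norm_bounded ((h.sum_L s hs).norm.mul_left (Real.log 2)⁻¹) fun n => ?_
  rw [LSeries.norm_term_eq, LSeries.norm_term_eq]
  split_ifs with hn
  · simp
  rw [← mul_div_assoc]
  gcongr
  exact norm_logCoeff_le Λ h.vm_one n

theorem logMul_logCoeff (h : IsVM a Λ) {n : ℕ} (hn : n ≠ 0) :
    LSeries.logMul (logCoeff Λ) n = Λ n := by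
  rcases eq_or_ne n 1 with rfl | hn1
  · simp [LSeries.logMul, h.vm_one]
  · have : Complex.log n ≠ 0 := by
      rw [← Complex.natCast_log]
      have : 0 < Real.log n := Real.log_pos (by exact_mod_cast (by omega : 1 < n))
      exact_mod_cast this.ne'
    rw [LSeries.logMul, logCoeff, mul_div_cancel₀ _ this]

theorem hasDerivAt_log (h : IsVM a Λ) {s : ℂ} (hs : 1 < s.re) :
    HasDerivAt (LSeries (logCoeff Λ)) (-LSeries Λ s) s := by
  have h1 := LSeries_hasDerivAt (abscissa_lt h.sum_logCoeff hs)
  rwa [LSeries_congr (fun hn => h.logMul_logCoeff hn) s] at h1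

theorem hasDerivAt (h : IsVM a Λ) {s : ℂ} (hs : 1 < s.re) :
    HasDerivAt (LSeries a) (-(LSeries a s * LSeries Λ s)) s := by
  have h1 := LSeries_hasDerivAt (abscissa_lt h.sum_a hs)
  rwa [h.conv, LSeries_convolution' (h.sum_a s hs) (h.sum_L s hs)] at h1

theorem eq_exp (h : IsVM a Λ) {s : ℂ} (hs : 1 < s.re) :
    LSeries a s = exp (LSeries (logCoeff Λ) s) := by
  have hd : ∀ z : ℂ, 1 < z.re → HasDerivAt
      (fun z => LSeries a z * exp (-LSeries (logCoeff Λ) z)) 0 z := fun z hz => by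
    refine ((h.hasDerivAt hz).mul (h.hasDerivAt_log hz).neg.cexp).congr_deriv ?_
    simp only [Pi.neg_apply]
    ring
  have hopen : IsOpen {z : ℂ | 1 < z.re} := isOpen_lt continuous_const continuous_re
  have hconst : ∀ z w : ℂ, 1 < z.re → 1 < w.re →
      LSeries a z * exp (-LSeries (logCoeff Λ) z) = LSeries a w * exp (-LSeries (logCoeff Λ) w) :=
    fun z w hz hw => hopen.is_const_of_deriv_eq_zero (convex_halfSpace_re_gt 1).isPreconnected
      (fun x hx => (hd x hx).differentiableAt.differentiableWithinAt)
      (fun x hx => (hd x hx).deriv) hz hw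
  have hlt : ∀ f : ℕ → ℂ, (∀ s : ℂ, 1 < s.re → LSeriesSummable f s) →
      LSeries.abscissaOfAbsConv f < ⊤ := fun f hf =>
    (abscissa_le hf).trans_lt (by exact_mod_cast EReal.coe_lt_top 1)
  have hlim : Tendsto (fun x : ℝ => LSeries a x * exp (-LSeries (logCoeff Λ) x)) atTop
      (𝓝 (a 1 * exp (-logCoeff Λ 1))) :=
    (LSeries.tendsto_atTop (hlt a h.sum_a)).mul
      (LSeries.tendsto_atTop (hlt _ h.sum_logCoeff)).neg.cexp
  have hlim2 : Tendsto (fun x : ℝ => LSeries a x * exp (-LSeries (logCoeff Λ) x)) atTop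
      (𝓝 (LSeries a s * exp (-LSeries (logCoeff Λ) s))) := by
    refine tendsto_const_nhds.congr' ?_
    filter_upwards [eventually_gt_atTop 1] with x hx
    exact hconst s x hs (by simpa using hx)
  have h1 := tendsto_nhds_unique hlim2 hlim
  rw [h.one, logCoeff, h.vm_one, zero_div, neg_zero, exp_zero, mul_one, Complex.exp_neg] at h1
  rwa [mul_inv_eq_one₀ (exp_ne_zero _)] at h1

theorem ne_zero (h : IsVM a Λ) {s : ℂ} (hs : 1 < s.re) : LSeries a s ≠ 0 := by
  rw [h.eq_exp hs]
  exact exp_ne_zero _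

theorem isVM_one : IsVM 1 (fun n => (ArithmeticFunction.vonMangoldt n : ℂ)) where
  one := rfl
  conv := by
    rw [show LSeries.convolution (1 : ℕ → ℂ)
        (fun n => (ArithmeticFunction.vonMangoldt n : ℂ)) =
      LSeries.convolution (fun n => (ArithmeticFunction.vonMangoldt n : ℂ)) 1 by
        simp only [LSeries.convolution, mul_comm], ArithmeticFunction.convolution_vonMangoldt_const_one]
    funext n
    simp [LSeries.logMul]
  sum_a s hs := LSeriesSummable_one_iff.2 hs
  sum_L s hs := ArithmeticFunction.LSeriesSummable_vonMangoldt hs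

/-- `log ζ(σ)` as a sum over prime powers. -/
noncomputable def logZeta (σ : ℝ) : ℝ :=
  ∑' n : ℕ, ‖LSeries.term (logCoeff fun n => (ArithmeticFunction.vonMangoldt n : ℂ)) σ n‖

theorem term_logCoeff (σ : ℝ) (n : ℕ) :
    LSeries.term (logCoeff fun n => (ArithmeticFunction.vonMangoldt n : ℂ)) σ n =
    (‖LSeries.term (logCoeff fun n => (ArithmeticFunction.vonMangoldt n : ℂ)) σ n‖ : ℝ) := by
  rcases eq_or_ne n 0 with rfl | hn
  · simp
  have h0 : (0 : ℝ) ≤ ArithmeticFunction.vonMangoldt n / Real.log n / (n : ℝ) ^ σ := by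
    have := ArithmeticFunction.vonMangoldt_nonneg (n := n)
    have := Real.log_natCast_nonneg n
    positivity
  have h1 : LSeries.term (logCoeff fun n => (ArithmeticFunction.vonMangoldt n : ℂ)) σ n
      = ((ArithmeticFunction.vonMangoldt n / Real.log n / (n : ℝ) ^ σ : ℝ) : ℂ) := by
    rw [LSeries.term_of_ne_zero hn, logCoeff]
    push_cast
    rw [Complex.ofReal_cpow (by positivity)]
    simp
  rw [h1, Complex.norm_real, Real.norm_of_nonneg h0]

theorem exp_logZeta {σ : ℝ} (hσ : 1 < σ) : Real.exp (logZeta σ) = ∑' n : ℕ, 1 / ((n : ℝ) + 1) ^ σ := by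
  have h := isVM_one.eq_exp (s := σ) (by simpa using hσ)
  have h1 : LSeries (logCoeff fun n => (ArithmeticFunction.vonMangoldt n : ℂ)) σ = (logZeta σ : ℂ) := by
    rw [LSeries, logZeta, Complex.ofReal_tsum]
    exact tsum_congr fun n => term_logCoeff σ n
  rw [h1, LSeries_one_eq_riemannZeta (by simpa using hσ),
    zeta_eq_tsum_one_div_nat_add_one_cpow (by simpa using hσ)] at h
  have h2 : (∑' n : ℕ, 1 / ((n : ℂ) + 1) ^ (σ : ℂ)) = ((∑' n : ℕ, 1 / ((n : ℝ) + 1) ^ σ : ℝ) : ℂ) := by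
    rw [Complex.ofReal_tsum]
    refine tsum_congr fun n => ?_
    push_cast
    rw [Complex.ofReal_cpow (by positivity)]
    push_cast
    rfl
  rw [h2] at h
  exact_mod_cast h.symm

theorem exp_logZeta_le {σ : ℝ} (hσ : 1 < σ) : Real.exp (logZeta σ) ≤ σ / (σ - 1) := by
  have h := ZetaAsymptotics.termTSum_of_lt hσ
  have h0 : 0 ≤ ZetaAsymptotics.termTSum σ :=
    tsum_nonneg fun n => ZetaAsymptotics.term_nonneg _ _
  rw [exp_logZeta hσ]
  rw [h] at h0
  have h1 : σ * (1 / σ * ∑' n : ℕ, 1 / ((n : ℝ) + 1) ^ σ) ≤ σ * (1 / (σ - 1)) :=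
    mul_le_mul_of_nonneg_left (by linarith) (by linarith)
  rw [← mul_assoc, mul_one_div_cancel (by linarith), one_mul] at h1
  simpa [div_eq_mul_inv] using h1

theorem norm_log_le (h : IsVM a Λ) {N : ℝ} (hN : ∀ n, ‖Λ n‖ ≤ N * ArithmeticFunction.vonMangoldt n)
    {s : ℂ} (hs : 1 < s.re) : ‖LSeries (logCoeff Λ) s‖ ≤ N * logZeta s.re := by
  rw [LSeries, logZeta, ← tsum_mul_left]
  refine tsum_of_norm_bounded (Summable.hasSum ?_) fun n => ?_
  · exact ((isVM_one.sum_logCoeff s.re (by simpa using hs)).norm).mul_left N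
  · rw [LSeries.norm_term_eq, LSeries.norm_term_eq]
    split_ifs with hn
    · simp
    rw [ofReal_re, ← mul_div_assoc]
    gcongr
    rw [logCoeff, logCoeff, norm_div, norm_div, ← mul_div_assoc]
    gcongr
    rw [norm_real, Real.norm_of_nonneg ArithmeticFunction.vonMangoldt_nonneg]
    exact hN n

theorem norm_le (h : IsVM a Λ) {N : ℝ} (hN : ∀ n, ‖Λ n‖ ≤ N * ArithmeticFunction.vonMangoldt n)
    {s : ℂ} (hs : 1 < s.re) : ‖LSeries a s‖ ≤ Real.exp (N * logZeta s.re) := by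
  rw [h.eq_exp hs, norm_exp]
  exact Real.exp_le_exp.2 ((re_le_norm _).trans (h.norm_log_le hN hs))

theorem le_norm (h : IsVM a Λ) {N : ℝ} (hN : ∀ n, ‖Λ n‖ ≤ N * ArithmeticFunction.vonMangoldt n)
    {s : ℂ} (hs : 1 < s.re) : Real.exp (-(N * logZeta s.re)) ≤ ‖LSeries a s‖ := by
  rw [h.eq_exp hs, norm_exp]
  refine Real.exp_le_exp.2 ?_
  have := (abs_le.1 (abs_re_le_norm (LSeries (logCoeff Λ) s))).1
  linarith [h.norm_log_le hN hs]

end IsVM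

end

section

open NumberField Module ClassCount
open scoped ENNReal

namespace IdealVM

variable (K : Type*) [Field K] [NumberField K]

/-- The nonzero prime ideals of the ring of integers. -/
abbrev PrimeId := {𝔭 : Ideal (𝓞 K) // Prime 𝔭}

variable {K}

/-- The logarithm of the norm. -/
noncomputable def logN (I : Ideal (𝓞 K)) : ℝ≥0∞ := ENNReal.ofReal (Real.log (Ideal.absNorm I))

theorem logN_mul {I J : Ideal (𝓞 K)} (hI : I ≠ 0) (hJ : J ≠ 0) : logN (I * J) = logN I + logN J := by
  have hI' : (Ideal.absNorm I : ℝ) ≠ 0 := by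
    rw [Nat.cast_ne_zero]
    exact fun h => hI (Ideal.absNorm_eq_zero_iff.1 h)
  have hJ' : (Ideal.absNorm J : ℝ) ≠ 0 := by
    rw [Nat.cast_ne_zero]
    exact fun h => hJ (Ideal.absNorm_eq_zero_iff.1 h)
  rw [logN, logN, logN, map_mul, Nat.cast_mul, Real.log_mul hI' hJ',
    ENNReal.ofReal_add (Real.log_natCast_nonneg _) (Real.log_natCast_nonneg _)]

theorem tsum_pow_dvd_mul (g : PrimeId K → ℝ≥0∞) (𝔮 : PrimeId K) {𝔟 : Ideal (𝓞 K)} :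
    ∑' (𝔭 : PrimeId K) (e : ℕ), (if 𝔭.1 ^ (e + 1) ∣ 𝔮.1 * 𝔟 then g 𝔭 else 0)
      = g 𝔮 + ∑' (𝔭 : PrimeId K) (e : ℕ), (if 𝔭.1 ^ (e + 1) ∣ 𝔟 then g 𝔭 else 0) := by
  have h1 : ∀ 𝔭 : PrimeId K, ∑' e : ℕ, (if 𝔭.1 ^ (e + 1) ∣ 𝔮.1 * 𝔟 then g 𝔭 else 0)
      = (if 𝔭 = 𝔮 then g 𝔮 else 0) + ∑' e : ℕ, (if 𝔭.1 ^ (e + 1) ∣ 𝔟 then g 𝔭 else 0) := by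
    intro 𝔭
    by_cases h : 𝔭 = 𝔮
    · subst h
      rw [if_pos rfl, tsum_eq_zero_add' ENNReal.summable, zero_add, pow_one,
        if_pos (dvd_mul_right _ _)]
      congr 1
      refine tsum_congr fun e => ?_
      rw [pow_succ' _ (e + 1), mul_dvd_mul_iff_left 𝔭.2.ne_zero]
    · rw [if_neg h, zero_add]
      refine tsum_congr fun e => ?_
      have : 𝔭.1 ^ (e + 1) ∣ 𝔮.1 * 𝔟 ↔ 𝔭.1 ^ (e + 1) ∣ 𝔟 := by
        refine ⟨fun h2 => 𝔭.2.pow_dvd_of_dvd_mul_left _ (fun h3 => h ?_) h2, fun h2 =>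
          h2.mul_left _⟩
        exact Subtype.ext (associated_iff_eq.1 (𝔭.2.associated_of_dvd 𝔮.2 h3))
      rw [if_congr this rfl rfl]
  rw [tsum_congr h1, ENNReal.tsum_add, tsum_ite_eq]

theorem tsum_logN {𝔞 : Ideal (𝓞 K)} (h : 𝔞 ≠ 0) :
    ∑' (𝔭 : PrimeId K) (e : ℕ), (if 𝔭.1 ^ (e + 1) ∣ 𝔞 then logN 𝔭.1 else 0) = logN 𝔞 := by
  induction 𝔞 using UniqueFactorizationMonoid.induction_on_prime with
  | h₁ => exact absurd rfl h
  | h₂ I hI =>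
    rw [Ideal.isUnit_iff.1 hI]
    have : ∀ (𝔭 : PrimeId K) (e : ℕ), ¬ 𝔭.1 ^ (e + 1) ∣ (⊤ : Ideal (𝓞 K)) := by
      intro 𝔭 e h1
      refine 𝔭.2.not_isUnit (isUnit_of_dvd_unit ((dvd_pow_self _ (Nat.succ_ne_zero e)).trans h1) ?_)
      exact Ideal.isUnit_iff.2 rfl
    simp [this, logN]
  | h₃ I J hI hJ ih =>
    rw [tsum_pow_dvd_mul (fun 𝔭 => logN 𝔭.1) ⟨J, hJ⟩, ih hI, ← logN_mul hJ.ne_zero hI]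

variable (K) in
/-- The von Mangoldt coefficients of the Dedekind zeta function, as extended reals. -/
noncomputable def lamE (d : ℕ) : ℝ≥0∞ :=
  ∑' (𝔭 : PrimeId K) (e : ℕ), if Ideal.absNorm (𝔭.1 ^ (e + 1)) = d then logN 𝔭.1 else 0

theorem tsum_indicator_eq (k : ℕ) :
    (∑' 𝔞 : Ideal (𝓞 K), if Ideal.absNorm 𝔞 = k then (1 : ℝ≥0∞) else 0) = idealCount K k := by
  rw [tsum_absNorm (K := K) (fun j => if j = k then (1 : ℝ≥0∞) else 0), tsum_eq_single k]
  · simp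
  · intro j hj
    simp [hj]

theorem tsum_dvd_indicator {I : Ideal (𝓞 K)} (hI : I ≠ 0) {k : ℕ} (hk : k ≠ 0) :
    (∑' 𝔞 : Ideal (𝓞 K), if Ideal.absNorm 𝔞 = k ∧ I ∣ 𝔞 then (1 : ℝ≥0∞) else 0)
      = ∑ p ∈ k.divisorsAntidiagonal, if Ideal.absNorm I = p.1 then (idealCount K p.2 : ℝ≥0∞)
        else 0 := by
  have hinj : Function.Injective (fun J : Ideal (𝓞 K) => I * J) := mul_right_injective₀ hI
  have h1 : (∑' 𝔞 : Ideal (𝓞 K), if Ideal.absNorm 𝔞 = k ∧ I ∣ 𝔞 then (1 : ℝ≥0∞) else 0)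
      = ∑' J : Ideal (𝓞 K), if Ideal.absNorm I * Ideal.absNorm J = k then (1 : ℝ≥0∞) else 0 := by
    rw [← hinj.tsum_eq]
    · refine tsum_congr fun J => ?_
      simp only [map_mul, dvd_mul_right, and_true]
    · intro 𝔞 h𝔞
      simp only [Function.mem_support, ne_eq, ite_eq_right_iff, one_ne_zero, imp_false,
        not_not] at h𝔞
      obtain ⟨J, hJ⟩ := h𝔞.2
      exact ⟨J, hJ.symm⟩
  have hN : Ideal.absNorm I ≠ 0 := fun h => hI (Ideal.absNorm_eq_zero_iff.1 h)
  rw [h1]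
  by_cases hd : Ideal.absNorm I ∣ k
  · obtain ⟨m, rfl⟩ := hd
    have hm : m ≠ 0 := right_ne_zero_of_mul hk
    rw [Finset.sum_eq_single (Ideal.absNorm I, m)]
    · rw [if_pos rfl, ← tsum_indicator_eq]
      refine tsum_congr fun J => ?_
      simp [hN]
    · rintro ⟨d, e⟩ hp hne
      rw [Nat.mem_divisorsAntidiagonal] at hp
      refine if_neg fun h => hne ?_
      simp only at h hp
      subst h
      rw [Nat.mul_right_inj hN] at hp
      rw [hp.1]
    · intro h
      exact absurd (Nat.mem_divisorsAntidiagonal.2 ⟨rfl, hk⟩) h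
  · rw [Finset.sum_eq_zero]
    · refine ENNReal.tsum_eq_zero.2 fun J => if_neg fun h => hd ⟨_, h.symm⟩
    · rintro ⟨d, e⟩ hp
      rw [Nat.mem_divisorsAntidiagonal] at hp
      refine if_neg fun h => hd ?_
      rw [h, ← hp.1]
      exact dvd_mul_right _ _

theorem count_mul_log {k : ℕ} (hk : k ≠ 0) :
    (idealCount K k : ℝ≥0∞) * ENNReal.ofReal (Real.log k)
      = ∑ p ∈ k.divisorsAntidiagonal, lamE K p.1 * idealCount K p.2 := by
  have h0 : (0 : ℝ≥0∞) = 0 := rfl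
  calc (idealCount K k : ℝ≥0∞) * ENNReal.ofReal (Real.log k)
      = ∑' 𝔞 : Ideal (𝓞 K), if Ideal.absNorm 𝔞 = k then logN 𝔞 else 0 := by
        rw [← tsum_indicator_eq, ← ENNReal.tsum_mul_right]
        refine tsum_congr fun 𝔞 => ?_
        split_ifs with h
        · rw [one_mul, logN, h]
        · rw [zero_mul]
    _ = ∑' (𝔞 : Ideal (𝓞 K)) (𝔭 : PrimeId K) (e : ℕ), logN 𝔭.1 *
          (if Ideal.absNorm 𝔞 = k ∧ 𝔭.1 ^ (e + 1) ∣ 𝔞 then 1 else 0) := by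
        refine tsum_congr fun 𝔞 => ?_
        split_ifs with h
        · have h𝔞 : 𝔞 ≠ 0 := by
            rintro rfl
            exact hk (by rw [← h]; simp)
          rw [← tsum_logN h𝔞]
          refine tsum_congr fun 𝔭 => tsum_congr fun e => ?_
          simp [h]
        · simp [h]
    _ = ∑' (𝔭 : PrimeId K) (e : ℕ), logN 𝔭.1 * ∑ p ∈ k.divisorsAntidiagonal,
          if Ideal.absNorm (𝔭.1 ^ (e + 1)) = p.1 then (idealCount K p.2 : ℝ≥0∞) else 0 := by
        rw [ENNReal.tsum_comm]
        refine tsum_congr fun 𝔭 => ?_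
        rw [ENNReal.tsum_comm]
        refine tsum_congr fun e => ?_
        rw [ENNReal.tsum_mul_left, tsum_dvd_indicator (pow_ne_zero _ 𝔭.2.ne_zero) hk]
    _ = _ := by
        simp only [lamE, Finset.mul_sum]
        simp only [← ENNReal.tsum_mul_right]
        rw [← Summable.tsum_finsetSum (fun _ _ => ENNReal.summable)]
        refine tsum_congr fun 𝔭 => ?_
        rw [← Summable.tsum_finsetSum (fun _ _ => ENNReal.summable)]
        refine tsum_congr fun e => Finset.sum_congr rfl fun p _ => ?_
        split_ifs <;> simp

theorem tsum_logN_dvd_le {p : ℕ} (hp : p.Prime) :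
    ∑' 𝔭 : PrimeId K, (if (p : 𝓞 K) ∈ 𝔭.1 then logN 𝔭.1 else 0)
      ≤ ENNReal.ofReal (finrank ℚ K * Real.log p) := by
  have h0 : Ideal.span {(p : 𝓞 K)} ≠ 0 := by
    intro h
    rw [Ideal.zero_eq_bot, Ideal.span_singleton_eq_bot] at h
    exact hp.ne_zero (by exact_mod_cast h)
  have h1 : logN (Ideal.span {(p : 𝓞 K)}) = ENNReal.ofReal (finrank ℚ K * Real.log p) := by
    rw [logN, Ideal.absNorm_span_natCast, NumberField.RingOfIntegers.rank, Nat.cast_pow,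
      Real.log_pow]
  rw [← h1, ← tsum_logN h0]
  refine ENNReal.tsum_le_tsum fun 𝔭 => ?_
  refine le_trans ?_ (ENNReal.le_tsum 0)
  rw [zero_add, pow_one, if_congr Ideal.dvd_span_singleton rfl rfl]

theorem lamE_le (d : ℕ) :
    lamE K d ≤ ENNReal.ofReal (finrank ℚ K * ArithmeticFunction.vonMangoldt d) := by
  have hpp : ∀ 𝔭 : PrimeId K, ∃ p n : ℕ, 0 < n ∧ (p : 𝓞 K) ∈ 𝔭.1 ∧ p.Prime ∧
      Ideal.absNorm 𝔭.1 = p ^ n := fun 𝔭 => by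
    have h1 : 𝔭.1.IsPrime := Ideal.isPrime_of_prime 𝔭.2
    have : 𝔭.1.IsMaximal := h1.isMaximal 𝔭.2.ne_zero
    exact Ideal.exists_prime_and_absNorm_eq_pow 𝔭.1
  by_cases hd : IsPrimePow d
  · obtain ⟨p, j, hp, hj, rfl⟩ := hd
    have hp : p.Prime := hp.nat_prime
    rw [ArithmeticFunction.vonMangoldt_apply_pow hj.ne', ArithmeticFunction.vonMangoldt_apply_prime hp]
    refine le_trans ?_ (tsum_logN_dvd_le hp)
    refine ENNReal.tsum_le_tsum fun 𝔭 => ?_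
    by_cases he : ∃ e, Ideal.absNorm (𝔭.1 ^ (e + 1)) = p ^ j
    · obtain ⟨e, he⟩ := he
      obtain ⟨p', n, hn, hmem, hp', hN⟩ := hpp 𝔭
      have hpe : p' = p := by
        rw [map_pow, hN, ← pow_mul] at he
        have h2 : p' ∣ p ^ j := by
          rw [← he]
          exact dvd_pow_self _ (by positivity)
        exact (Nat.prime_dvd_prime_iff_eq hp' hp).1 (hp'.dvd_of_dvd_pow h2)
      rw [hpe] at hmem
      rw [if_pos hmem, tsum_eq_single e]
      · rw [if_pos he]
      · intro e' hne
        refine if_neg fun h => hne ?_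
        rw [← he, map_pow, map_pow] at h
        have h3 : 2 ≤ Ideal.absNorm 𝔭.1 := by
          rw [hN]
          exact hp'.two_le.trans (Nat.le_self_pow hn.ne' _)
        have := Nat.pow_right_injective h3 h
        omega
    · push Not at he
      simp only [he, if_false, tsum_zero, zero_le]
  · have h : lamE K d = 0 := by
      refine ENNReal.tsum_eq_zero.2 fun 𝔭 => ENNReal.tsum_eq_zero.2 fun e => if_neg fun h => hd ?_
      obtain ⟨p', n, hn, hmem, hp', hN⟩ := hpp 𝔭
      rw [← h, map_pow, hN, ← pow_mul]
      exact hp'.isPrimePow.pow (by positivity)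
    rw [h]
    exact zero_le

variable (K) in
/-- The von Mangoldt coefficients of the Dedekind zeta function. -/
noncomputable def lam (d : ℕ) : ℝ := (lamE K d).toReal

theorem lam_nonneg (d : ℕ) : 0 ≤ lam K d := ENNReal.toReal_nonneg

theorem lam_le (d : ℕ) : lam K d ≤ finrank ℚ K * ArithmeticFunction.vonMangoldt d :=
  ENNReal.toReal_le_of_le_ofReal
    (mul_nonneg (Nat.cast_nonneg _) ArithmeticFunction.vonMangoldt_nonneg) (lamE_le d)

theorem ofReal_lam (d : ℕ) : ENNReal.ofReal (lam K d) = lamE K d :=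
  ENNReal.ofReal_toReal (ne_top_of_le_ne_top ENNReal.ofReal_ne_top (lamE_le d))

theorem count_mul_log_real {k : ℕ} (hk : k ≠ 0) :
    (idealCount K k : ℝ) * Real.log k
      = ∑ p ∈ k.divisorsAntidiagonal, lam K p.1 * idealCount K p.2 := by
  have h := congrArg ENNReal.toReal (count_mul_log (K := K) hk)
  rw [ENNReal.toReal_mul, ENNReal.toReal_natCast, ENNReal.toReal_ofReal
    (Real.log_natCast_nonneg _), ENNReal.toReal_sum] at h
  · rw [h]
    simp [lam]
  · intro p _
    rw [← ofReal_lam]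
    exact ENNReal.mul_ne_top ENNReal.ofReal_ne_top (ENNReal.natCast_ne_top _)

theorem idealCount_one : idealCount K 1 = 1 := by
  rw [idealCount, Nat.card_eq_one_iff_unique]
  refine ⟨⟨fun a b => Subtype.ext ?_⟩, ⟨⟨⊤, by simp⟩⟩⟩
  rw [Ideal.absNorm_eq_one_iff.1 a.2, Ideal.absNorm_eq_one_iff.1 b.2]

theorem lam_one : lam K 1 = 0 :=
  le_antisymm ((lam_le 1).trans (by simp)) (lam_nonneg 1)

theorem lam_prime {r : ℕ} (hr : r.Prime) : lam K r = idealCount K r * Real.log r := by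
  have hdiv : r.divisorsAntidiagonal = {(1, r), (r, 1)} := by
    rw [← Nat.map_div_right_divisors, hr.divisors]
    rw [Finset.map_insert, Finset.map_singleton]
    change ({(1, r / 1), (r, r / r)} : Finset (ℕ × ℕ)) = _
    rw [Nat.div_one, Nat.div_self hr.pos]
  rw [count_mul_log_real hr.ne_zero, hdiv, Finset.sum_pair (by simp [hr.ne_one.symm]), lam_one,
    idealCount_one]
  simp

theorem summable_idealCount {s : ℂ} (hs : 1 < s.re) :
    LSeriesSummable (fun k => (idealCount K k : ℂ)) s := by
  have h := (Ideal.tendsto_norm_le_div_atTop₀ K).comp tendsto_natCast_atTop_atTop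
  obtain ⟨c, hc⟩ : ∃ c, Filter.Tendsto ((fun s : ℝ => (Nat.card {I : nonZeroDivisors (Ideal (𝓞 K)) //
      (Ideal.absNorm (I : Ideal (𝓞 K)) : ℝ) ≤ s} : ℝ) / s) ∘ (Nat.cast : ℕ → ℝ)) Filter.atTop (nhds c) :=
    ⟨_, h⟩
  have h2 : Filter.Tendsto (fun n : ℕ => (∑ k ∈ Finset.Icc 1 n, (idealCount K k : ℝ)) / n)
      Filter.atTop (nhds c) := by
    refine hc.congr fun n ↦ ?_
    simp only [Function.comp_apply, Nat.cast_le, ← Nat.cast_sum]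
    congr
    rw [← add_left_inj 1, ← Ideal.card_norm_le_eq_card_norm_le_add_one,
      show Finset.Icc 1 n = Finset.Ioc 0 n from Finset.Icc_succ_left_eq_Ioc _ _,
      show 1 = idealCount K 0 by simp [idealCount, Ideal.absNorm_eq_zero_iff],
      Finset.sum_Ioc_add_eq_sum_Icc (n.zero_le)]
    simp only [idealCount]
    rw [← Finset.card_preimage_eq_sum_card_image_eq
        (fun k _ ↦ Ideal.finite_setOfPred_absNorm_eq k)]
    simp [Set.coe_eq_subtype]
  have h3 : (fun n : ℕ => ∑ k ∈ Finset.Icc 1 n, (idealCount K k : ℝ)) =O[Filter.atTop]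
      fun n : ℕ => (n : ℝ) ^ (1 : ℝ) := by
    have h4 := (h2.isBigO_one ℝ).mul (Asymptotics.isBigO_refl (fun n : ℕ => (n : ℝ)) Filter.atTop)
    refine h4.congr' ?_ (Filter.Eventually.of_forall fun n => by simp)
    filter_upwards [Filter.eventually_gt_atTop 0] with n hn
    have : (n : ℝ) ≠ 0 := by positivity
    field_simp
  have := LSeriesSummable_of_sum_norm_bigO_and_nonneg h3 (fun n => Nat.cast_nonneg _) zero_le_one hs
  simpa using this

theorem isVM : IsVM (fun k => (idealCount K k : ℂ)) (fun k => (lam K k : ℂ)) where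
  one := by simp [idealCount_one]
  conv := by
    funext k
    rcases eq_or_ne k 0 with rfl | hk
    · simp [LSeries.logMul]
    · have hcomm : LSeries.convolution (fun k => (idealCount K k : ℂ)) (fun k => (lam K k : ℂ))
          = LSeries.convolution (fun k => (lam K k : ℂ))
            (fun k => (idealCount K k : ℂ)) := by
        unfold LSeries.convolution
        rw [mul_comm]
      rw [hcomm, LSeries.logMul, LSeries.convolution_def, mul_comm]
      have := congrArg (fun x : ℝ => (x : ℂ)) (count_mul_log_real (K := K) hk)
      push_cast at this
      rw [this]
  sum_a s hs := summable_idealCount hs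
  sum_L s hs := by
    refine Summable.of_norm_bounded
      (((ArithmeticFunction.LSeriesSummable_vonMangoldt hs).norm).mul_left (finrank ℚ K : ℝ))
      fun n => ?_
    rw [LSeries.norm_term_eq, LSeries.norm_term_eq]
    split_ifs with hn
    · simp
    rw [← mul_div_assoc, Complex.norm_real, Complex.norm_real, Real.norm_of_nonneg (lam_nonneg n),
      Real.norm_of_nonneg ArithmeticFunction.vonMangoldt_nonneg]
    gcongr
    exact lam_le n

end IdealVM

/-- Twisting by a Dirichlet character. -/
theorem IsVM.twist {a Λ : ℕ → ℂ} (h : IsVM a Λ) {q : ℕ} (χ : DirichletCharacter ℂ q) :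
    IsVM (fun n => χ n * a n) (fun n => χ n * Λ n) := by
  have hb : ∀ f : ℕ → ℂ, ∀ s : ℂ, LSeriesSummable f s → LSeriesSummable (fun n => χ n * f n) s := by
    intro f s hf
    refine Summable.of_norm_bounded hf.norm fun n => ?_
    rw [LSeries.norm_term_eq, LSeries.norm_term_eq]
    split_ifs with hn
    · exact le_rfl
    gcongr
    rw [norm_mul]
    exact mul_le_of_le_one_left (norm_nonneg _) (χ.norm_le_one _)
  refine ⟨by simp [h.one], ?_, fun s hs => hb _ _ (h.sum_a s hs), fun s hs => hb _ _ (h.sum_L s hs)⟩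
  have h1 := χ.mul_convolution_distrib a Λ
  rw [← h.conv] at h1
  change LSeries.logMul _ = LSeries.convolution ((fun n : ℕ => χ n) * a)
    ((fun n : ℕ => χ n) * Λ)
  rw [h1]
  funext n
  simp only [LSeries.logMul, Pi.mul_apply]
  ring

end

section

open NumberField Module ClassCount

namespace CharSum

variable (K : Type*) [Field K] [NumberField K]

/-- Ideals are equidistributed over the classes `± a`, with density `κ` and an error controlled
by `B`. -/
structure Equi (q : ℕ) (B κ : ℝ) : Prop where
  pos : 0 < κ
  nonneg : 0 ≤ B
  upper : ∀ a : ZMod q, IsUnit a → ∀ Y : ℝ, 0 < Y →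
    resSum K q a Y ≤ κ * Y * (1 + B * Y ^ (-(1 / finrank ℚ K : ℝ))) ^ finrank ℚ K
  lower : ∀ a : ZMod q, IsUnit a → ∀ Y : ℝ, 0 < Y →
    κ * Y * (max (1 - B * Y ^ (-(1 / finrank ℚ K : ℝ))) 0) ^ finrank ℚ K ≤ resSum K q a Y

/-- The density attached to the principal character. -/
noncomputable def dens (q : ℕ) (κ : ℝ) : ℝ := q.totient * κ / 2

/-- The weighted character sum over ideals. -/
noncomputable def charSum {q : ℕ} (ψ : DirichletCharacter ℂ q) (Y : ℝ) : ℂ :=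
  ∑ k ∈ Finset.range ⌈Y⌉₊, ψ k * idealCount K k *
    ((Real.log (Y / k) ^ Units.rank K : ℝ) : ℂ)

/-- The main term of the character sum. -/
noncomputable def mainC {q : ℕ} (ψ : DirichletCharacter ℂ q) (κ : ℝ) : ℂ :=
  if ψ = 1 then (dens q κ : ℂ) else 0

variable {K} {q : ℕ} {B κ : ℝ}

theorem abs_sub_le {δ : ℝ} (hδ : 0 ≤ δ) (n : ℕ) {X T : ℝ} (hX : 0 ≤ X) (h1 : T ≤ X * (1 + δ) ^ n)
    (h2 : X * (max (1 - δ) 0) ^ n ≤ T) : |T - X| ≤ X * ((1 + δ) ^ n - 1) := by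
  rw [abs_le]
  constructor
  · have h3 : 1 - n * δ ≤ (max (1 - δ) 0) ^ n := by
      rcases le_total δ 1 with h | h
      · rw [max_eq_left (by linarith)]
        have := one_add_mul_le_pow (a := -δ) (by linarith) n
        rw [show 1 - δ = 1 + -δ by ring]
        linarith
      · rcases Nat.eq_zero_or_pos n with rfl | hn
        · simp
        have : (1 : ℝ) ≤ n := by exact_mod_cast hn
        have : 0 ≤ (max (1 - δ) 0) ^ n := by positivity
        nlinarith
    have h4 : 1 + n * δ ≤ (1 + δ) ^ n := one_add_mul_le_pow (by linarith) n
    nlinarith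
  · linarith

theorem two_mul_charSum (hq : 2 < q) {ψ : DirichletCharacter ℂ q} (hψ : ψ.Even) (Y : ℝ) :
    haveI : NeZero q := ⟨by omega⟩
    2 * charSum K ψ Y = ∑ a : ZMod q, ψ a * resSum K q a Y := by
  have : NeZero q := ⟨by omega⟩
  have hq2 : (2 : ZMod q) ≠ 0 := by
    intro h
    have h2 : ((2 : ℕ) : ZMod q) = 0 := by exact_mod_cast h
    rw [ZMod.natCast_eq_zero_iff] at h2
    exact absurd (Nat.le_of_dvd (by norm_num) h2) (by omega)
  simp only [charSum, resSum, Complex.ofReal_sum, Finset.mul_sum]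
  rw [Finset.sum_comm]
  refine Finset.sum_congr rfl fun k _ => ?_
  by_cases hk : IsUnit (k : ZMod q)
  · have hne : (k : ZMod q) ≠ -k := by
      intro h
      apply hq2
      have h3 : (k : ZMod q) * 2 = 0 := by
        rw [mul_two]
        nth_rewrite 2 [h]
        exact add_neg_cancel _
      exact (hk.mul_right_eq_zero).1 h3
    rw [← Finset.sum_subset (Finset.subset_univ {(k : ZMod q), -(k : ZMod q)}),
      Finset.sum_pair hne, hψ.eval_neg]
    · simp
      ring
    · intro a _ ha
      simp only [Finset.mem_insert, Finset.mem_singleton, not_or] at ha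
      rw [if_neg]
      · simp
      · rintro (h | h)
        · exact ha.1 h.symm
        · exact ha.2 (by rw [h, neg_neg])
  · rw [MulChar.map_nonunit ψ hk, Finset.sum_eq_zero]
    · simp
    · intro a _
      split_ifs with h
      · have : ¬ IsUnit a := by
          rcases h with h | h
          · rwa [← h]
          · rw [h, IsUnit.neg_iff] at hk
            exact hk
        rw [MulChar.map_nonunit ψ this, zero_mul]
      · simp

theorem Equi.abs_resSum_sub_le (h : Equi K q B κ) {a : ZMod q} (ha : IsUnit a) {Y : ℝ}
    (hY : 0 < Y) : |resSum K q a Y - κ * Y| ≤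
      κ * Y * ((1 + B * Y ^ (-(1 / finrank ℚ K : ℝ))) ^ finrank ℚ K - 1) :=
  abs_sub_le (mul_nonneg h.nonneg (by positivity)) _ (mul_nonneg h.pos.le hY.le)
    (h.upper a ha Y hY) (h.lower a ha Y hY)

theorem pow_sub_le {δ B : ℝ} (hδ : 0 ≤ δ) (hδ1 : δ ≤ 1) (hB : 0 ≤ B) (n : ℕ) :
    (1 + B * δ) ^ n - 1 ≤ δ * ((1 + B) ^ n - 1) := by
  induction n with
  | zero => simp
  | succ n ih =>
    have h1 : (1 : ℝ) ≤ (1 + B) ^ n := one_le_pow₀ (by linarith)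
    have h2 : 0 ≤ B * δ := by positivity
    calc (1 + B * δ) ^ (n + 1) - 1 = (1 + B * δ) * ((1 + B * δ) ^ n - 1) + B * δ := by ring
      _ ≤ (1 + B * δ) * (δ * ((1 + B) ^ n - 1)) + B * δ := by gcongr
      _ ≤ (1 + B) * (δ * ((1 + B) ^ n - 1)) + B * δ := by
          have : B * δ ≤ B := mul_le_of_le_one_right hB hδ1
          have : 0 ≤ δ * ((1 + B) ^ n - 1) := mul_nonneg hδ (by linarith)
          gcongr
      _ = δ * ((1 + B) ^ (n + 1) - 1) := by ring

theorem Equi.norm_charSum_sub_le (h : Equi K q B κ) (hq : 2 < q) {ψ : DirichletCharacter ℂ q}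
    (hψ : ψ.Even) {Y : ℝ} (hY : 0 < Y) :
    ‖charSum K ψ Y - mainC ψ κ * Y‖ ≤
      dens q κ * Y * ((1 + B * Y ^ (-(1 / finrank ℚ K : ℝ))) ^ finrank ℚ K - 1) := by
  have : NeZero q := ⟨by omega⟩
  set D := (1 + B * Y ^ (-(1 / finrank ℚ K : ℝ))) ^ finrank ℚ K - 1 with hD
  have hsum : ∑ a : ZMod q, ψ a = if ψ = 1 then (q.totient : ℂ) else 0 := by
    split_ifs with h1
    · rw [h1, MulChar.sum_one_eq_card_units, ZMod.card_units_eq_totient]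
    · exact MulChar.sum_eq_zero_of_ne_one h1
  have hnorm : ∑ a : ZMod q, ‖ψ a‖ = q.totient := by
    have h2 : ∀ a : ZMod q, ((‖ψ a‖ : ℝ) : ℂ) = (1 : DirichletCharacter ℂ q) a := by
      intro a
      by_cases ha : IsUnit a
      · rw [MulChar.one_apply ha]
        have := ψ.unit_norm_eq_one ha.unit
        rw [IsUnit.unit_spec] at this
        rw [this, Complex.ofReal_one]
      · rw [MulChar.map_nonunit _ ha, MulChar.map_nonunit _ ha]
        simp
    have h3 : ((∑ a : ZMod q, ‖ψ a‖ : ℝ) : ℂ) = (q.totient : ℂ) := by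
      rw [Complex.ofReal_sum, Finset.sum_congr rfl fun a _ => h2 a,
        MulChar.sum_one_eq_card_units, ZMod.card_units_eq_totient]
    exact_mod_cast h3
  have key : 2 * (charSum K ψ Y - mainC ψ κ * Y)
      = ∑ a : ZMod q, ψ a * ((resSum K q a Y - κ * Y : ℝ) : ℂ) := by
    rw [mul_sub, two_mul_charSum hq hψ]
    simp only [Complex.ofReal_sub, mul_sub, Finset.sum_sub_distrib, ← Finset.sum_mul, hsum]
    congr 1
    rw [mainC]
    split_ifs
    · simp only [dens]
      push_cast
      ring
    · simp
  have h4 : ‖∑ a : ZMod q, ψ a * ((resSum K q a Y - κ * Y : ℝ) : ℂ)‖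
      ≤ ∑ a : ZMod q, ‖ψ a‖ * (κ * Y * D) := by
    refine (norm_sum_le _ _).trans (Finset.sum_le_sum fun a _ => ?_)
    rw [norm_mul]
    by_cases ha : IsUnit a
    · rw [Complex.norm_real, Real.norm_eq_abs]
      exact mul_le_mul_of_nonneg_left (h.abs_resSum_sub_le ha hY) (norm_nonneg _)
    · rw [MulChar.map_nonunit _ ha]
      simp
  rw [← key, norm_mul, ← Finset.sum_mul, hnorm] at h4
  simp only [Complex.norm_ofNat] at h4
  have h5 : dens q κ * Y * D = q.totient * (κ * Y * D) / 2 := by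
    rw [dens]
    ring
  rw [h5, le_div_iff₀ two_pos, mul_comm]
  exact h4

theorem dens_nonneg (h : 0 ≤ κ) : 0 ≤ dens q κ := by
  rw [dens]
  positivity

theorem Equi.norm_charSum_sub_le_rpow (h : Equi K q B κ) (hq : 2 < q)
    {ψ : DirichletCharacter ℂ q} (hψ : ψ.Even) {Y : ℝ} (hY : 1 ≤ Y) :
    ‖charSum K ψ Y - mainC ψ κ * Y‖ ≤
      dens q κ * (1 + B) ^ finrank ℚ K * Y ^ (1 - (1 / finrank ℚ K : ℝ)) := by
  have hY0 : 0 < Y := by linarith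
  refine (h.norm_charSum_sub_le hq hψ hY0).trans ?_
  have hδ1 : Y ^ (-(1 / finrank ℚ K : ℝ)) ≤ 1 :=
    Real.rpow_le_one_of_one_le_of_nonpos hY (by simp)
  have h1 := pow_sub_le (by positivity) hδ1 h.nonneg (finrank ℚ K)
  rw [sub_eq_add_neg 1 (1 / finrank ℚ K : ℝ), Real.rpow_add hY0, Real.rpow_one]
  have hd := dens_nonneg (q := q) h.pos.le
  calc _ ≤ dens q κ * Y * (Y ^ (-(1 / finrank ℚ K : ℝ)) * ((1 + B) ^ finrank ℚ K)) := by
        gcongr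
        refine h1.trans ?_
        gcongr
        linarith
    _ = _ := by ring

theorem idealCount_isVM_le (n : ℕ) :
    ‖(IdealVM.lam K n : ℂ)‖ ≤ finrank ℚ K * ArithmeticFunction.vonMangoldt n := by
  rw [Complex.norm_real, Real.norm_of_nonneg (IdealVM.lam_nonneg n)]
  exact IdealVM.lam_le n

theorem sum_idealCount_div_sq_le (m : ℕ) :
    ∑ k ∈ Finset.range m, (if k = 0 then 0 else (idealCount K k : ℝ) / (k : ℝ) ^ 2)
      ≤ 2 ^ finrank ℚ K := by
  have h2 : (1 : ℝ) < (2 : ℂ).re := by simp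
  have hs := (IdealVM.isVM (K := K)).sum_a 2 h2
  have hterm : ∀ k, LSeries.term (fun k => (idealCount K k : ℂ)) 2 k
      = ((if k = 0 then 0 else (idealCount K k : ℝ) / (k : ℝ) ^ 2 : ℝ) : ℂ) := by
    intro k
    rw [LSeries.term_def]
    split_ifs
    · simp
    · push_cast
      norm_cast
  have hb := (IdealVM.isVM (K := K)).norm_le idealCount_isVM_le h2
  have hz : Real.exp (IsVM.logZeta 2) ≤ 2 := (IsVM.exp_logZeta_le (by norm_num)).trans (by norm_num)
  have h3 : Real.exp (finrank ℚ K * IsVM.logZeta (2 : ℂ).re) ≤ 2 ^ finrank ℚ K := by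
    rw [Real.exp_nat_mul]
    simp only [Complex.re_ofNat]
    gcongr
  have hs' : Summable fun k : ℕ => (if k = 0 then 0 else (idealCount K k : ℝ) / (k : ℝ) ^ 2 : ℝ) := by
    have := hs
    rw [LSeriesSummable, funext hterm] at this
    exact_mod_cast this
  refine (hs'.sum_le_tsum _ fun k _ => by split_ifs <;> positivity).trans ?_
  refine le_trans ?_ (hb.trans h3)
  rw [LSeries, tsum_congr hterm, ← Complex.ofReal_tsum, Complex.norm_real]
  exact le_abs_self _

theorem charSum_one_le (hq : 2 < q) {Y : ℝ} (hY : 1 ≤ Y) :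
    ‖charSum K (1 : DirichletCharacter ℂ q) Y‖
      ≤ Real.log Y ^ Units.rank K * Y ^ 2 * 2 ^ finrank ℚ K := by
  have : Fact (1 < q) := ⟨by omega⟩
  refine le_trans ?_ (mul_le_mul_of_nonneg_left (sum_idealCount_div_sq_le (K := K) ⌈Y⌉₊) (by
    have := Real.log_nonneg hY
    positivity))
  rw [Finset.mul_sum]
  refine (norm_sum_le _ _).trans (Finset.sum_le_sum fun k hk => ?_)
  split_ifs with hk0
  · rw [hk0, Nat.cast_zero, MulChar.map_zero]
    simp
  have hk1 : (1 : ℝ) ≤ k := by exact_mod_cast Nat.one_le_iff_ne_zero.2 hk0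
  have hkY : (k : ℝ) < Y := Nat.lt_ceil.1 (Finset.mem_range.1 hk)
  have hl0 : 0 ≤ Real.log (Y / k) := Real.log_nonneg (by rw [le_div_iff₀] <;> linarith)
  have hl1 : Real.log (Y / k) ≤ Real.log Y :=
    Real.log_le_log (by positivity) (div_le_self (by linarith) hk1)
  rw [norm_mul, norm_mul, Complex.norm_natCast, Complex.norm_real,
    Real.norm_of_nonneg (by positivity)]
  have h1 : ‖(1 : DirichletCharacter ℂ q) k‖ ≤ 1 := DirichletCharacter.norm_le_one _ _
  have h2 : 1 ≤ Y ^ 2 / (k : ℝ) ^ 2 := by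
    rw [one_le_div (by positivity)]
    gcongr
  calc _ ≤ 1 * idealCount K k * Real.log Y ^ Units.rank K := by gcongr
    _ ≤ idealCount K k * Real.log Y ^ Units.rank K * (Y ^ 2 / (k : ℝ) ^ 2) := by
        rw [one_mul]
        exact le_mul_of_one_le_right (by
          have := Real.log_nonneg hY
          positivity) h2
    _ = _ := by ring

theorem Equi.dens_le (h : Equi K q B κ) (hq : 2 < q) {Y : ℝ} (hY : 1 ≤ Y)
    (hB : 2 * finrank ℚ K * B ≤ Y ^ (1 / finrank ℚ K : ℝ)) :
    dens q κ ≤ 2 * (Real.log Y ^ Units.rank K * Y * 2 ^ finrank ℚ K) := by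
  have : NeZero q := ⟨by omega⟩
  have hY0 : 0 < Y := by linarith
  have hn : (1 : ℝ) ≤ finrank ℚ K := by exact_mod_cast Module.finrank_pos
  have hδ : finrank ℚ K * (B * Y ^ (-(1 / finrank ℚ K : ℝ))) ≤ 1 / 2 := by
    rw [Real.rpow_neg hY0.le, ← div_eq_mul_inv, mul_div_assoc', div_le_iff₀ (by positivity)]
    linarith
  set δ := B * Y ^ (-(1 / finrank ℚ K : ℝ)) with hδ'
  have hδ0 : 0 ≤ δ := mul_nonneg h.nonneg (by positivity)
  have hδ2 : δ ≤ 1 / 2 := by nlinarith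
  have hlow : (1 / 2 : ℝ) ≤ (max (1 - δ) 0) ^ finrank ℚ K := by
    rw [max_eq_left (by linarith)]
    have := one_add_mul_le_pow (a := -δ) (by linarith) (finrank ℚ K)
    rw [show 1 - δ = 1 + -δ by ring]
    linarith
  have heven : (1 : DirichletCharacter ℂ q).Even :=
    MulChar.one_apply isUnit_one.neg
  have h2 := two_mul_charSum (K := K) hq heven Y
  have h3 : ∀ a : ZMod q, ((1 : DirichletCharacter ℂ q) a) * (resSum K q a Y : ℂ)
      = ((if IsUnit a then resSum K q a Y else 0 : ℝ) : ℂ) := by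
    intro a
    split_ifs with ha
    · rw [MulChar.one_apply ha, one_mul]
    · rw [MulChar.map_nonunit _ ha, zero_mul, Complex.ofReal_zero]
  rw [Finset.sum_congr rfl fun a _ => h3 a, ← Complex.ofReal_sum] at h2
  have h4 : ∑ a : ZMod q, (if IsUnit a then κ * Y * (1 / 2) else 0)
      ≤ ∑ a : ZMod q, (if IsUnit a then resSum K q a Y else 0) := by
    refine Finset.sum_le_sum fun a _ => ?_
    split_ifs with ha
    · refine le_trans ?_ (h.lower a ha Y hY0)
      exact mul_le_mul_of_nonneg_left hlow (mul_nonneg h.pos.le hY0.le)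
    · exact le_rfl
  have h5 : ∑ a : ZMod q, (if IsUnit a then κ * Y * (1 / 2) else 0) = dens q κ * Y := by
    have h6 : ∑ a : ZMod q, ((if IsUnit a then (1:ℝ) else 0)) = q.totient := by
      have h7 := MulChar.sum_one_eq_card_units (R := ZMod q) (R' := ℝ)
      rw [ZMod.card_units_eq_totient] at h7
      rw [← h7]
      refine Finset.sum_congr rfl fun a _ => ?_
      split_ifs with ha
      · rw [MulChar.one_apply ha]
      · rw [MulChar.map_nonunit _ ha]
    rw [dens, ← h6, Finset.sum_mul, Finset.sum_div, Finset.sum_mul]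
    refine Finset.sum_congr rfl fun a _ => ?_
    split_ifs <;> ring
  have h8 := charSum_one_le (K := K) hq hY
  have h9 : ‖2 * charSum K (1 : DirichletCharacter ℂ q) Y‖
      = ‖((∑ a : ZMod q, (if IsUnit a then resSum K q a Y else 0) : ℝ) : ℂ)‖ := by rw [h2]
  rw [norm_mul, Complex.norm_ofNat, Complex.norm_real, Real.norm_eq_abs] at h9
  have h10 := le_abs_self (∑ a : ZMod q, (if IsUnit a then resSum K q a Y else 0))
  have h11 : dens q κ * Y ≤ 2 * (Real.log Y ^ Units.rank K * Y * 2 ^ finrank ℚ K) * Y := by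
    nlinarith
  exact le_of_mul_le_mul_right h11 hY0

end CharSum

end

section

open NumberField Module ClassCount CharSum Filter Topology
open scoped ComplexConjugate

namespace LTil

/-- Identity theorem on half planes. -/
theorem eq_of_halfPlane {f g : ℂ → ℂ} {c : ℝ} (hc : c < 1)
    (hf : DifferentiableOn ℂ f {s | c < s.re}) (hg : DifferentiableOn ℂ g {s | c < s.re})
    (h : ∀ s : ℂ, 1 < s.re → f s = g s) : ∀ s : ℂ, c < s.re → f s = g s := by
  have ho : IsOpen {s : ℂ | c < s.re} := isOpen_lt continuous_const Complex.continuous_re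
  have hpre : IsPreconnected {s : ℂ | c < s.re} :=
    (convex_halfSpace_re_gt c).isPreconnected
  have h2 : (2 : ℂ) ∈ {s : ℂ | c < s.re} := by
    change c < (2 : ℂ).re
    simp
    linarith
  refine fun s hs => (hf.analyticOnNhd ho).eqOn_of_preconnected_of_eventuallyEq
    (hg.analyticOnNhd ho) hpre h2 ?_ hs
  have : {s : ℂ | 1 < s.re} ∈ 𝓝 (2 : ℂ) :=
    (isOpen_lt continuous_const Complex.continuous_re).mem_nhds (by simp)
  filter_upwards [this] with s hs using h s hs

theorem conj_LSeries (a : ℕ → ℂ) (s : ℂ) :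
    conj (LSeries a s) = LSeries (fun n => conj (a n)) (conj s) := by
  rw [LSeries, LSeries, Complex.conj_tsum]
  refine tsum_congr fun n => ?_
  rw [LSeries.term_def, LSeries.term_def]
  split_ifs with hn
  · simp
  · rw [map_div₀, Complex.cpow_conj, Complex.conj_natCast]
    rw [Complex.natCast_arg]
    exact Real.pi_pos.ne

variable (K : Type*) [Field K] [NumberField K] {q : ℕ}

/-- The factor cancelling the pole. -/
noncomputable def fac (ψ : DirichletCharacter ℂ q) (s : ℂ) : ℂ := if ψ = 1 then s - 1 else 1

/-- The coefficients of the twisted zeta function. -/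
noncomputable def coef (ψ : DirichletCharacter ℂ q) (k : ℕ) : ℂ := ψ k * idealCount K k

/-- `G` continues the twisted zeta function, without its pole. -/
structure IsCont (ψ : DirichletCharacter ℂ q) (G : ℂ → ℂ) : Prop where
  diff : DifferentiableOn ℂ G {s | 1 - 1 / (finrank ℚ K : ℝ) < s.re}
  eq : ∀ s : ℂ, 1 < s.re → G s = fac ψ s * LSeries (coef K ψ) s

variable {K} {B κ : ℝ}

theorem isVM (ψ : DirichletCharacter ℂ q) :
    IsVM (coef K ψ) (fun n => ψ n * (IdealVM.lam K n : ℂ)) :=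
  (IdealVM.isVM (K := K)).twist ψ

theorem exists_isCont (h : Equi K q B κ) (hq : 2 < q) {ψ : DirichletCharacter ℂ q}
    (hψ : ψ.Even) : ∃ G : ℂ → ℂ, IsCont K ψ G ∧
      (∀ s : ℂ, 1 - 1 / (finrank ℚ K : ℝ) < s.re →
        ‖G s‖ ≤ (‖s‖ + 1) ^ (Units.rank K + 2) * (dens q κ * (1 + B) ^ finrank ℚ K) *
          (1 / (s.re - (1 - 1 / (finrank ℚ K : ℝ))) + 1)) ∧
      (ψ = 1 → G 1 ≠ 0) := by
  have : Fact (1 < q) := ⟨by omega⟩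
  have hn : (0 : ℝ) < finrank ℚ K := by exact_mod_cast Module.finrank_pos
  have hδ : 0 < 1 / (finrank ℚ K : ℝ) := by positivity
  have hd : 0 < dens q κ := by
    have := h.pos
    have : 0 < q.totient := Nat.totient_pos.2 (by omega)
    rw [dens]
    positivity
  have hB := h.nonneg
  have hA : 0 ≤ dens q κ * (1 + B) ^ finrank ℚ K := by positivity
  have hc : coef K ψ 0 = 0 := by rw [coef, Nat.cast_zero, MulChar.map_zero, zero_mul]
  have hM : ‖mainC ψ κ‖ ≤ dens q κ * (1 + B) ^ finrank ℚ K := by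
    refine le_trans ?_ (le_mul_of_one_le_right hd.le (one_le_pow₀ (by linarith)))
    rw [mainC]
    split_ifs
    · rw [Complex.norm_real, Real.norm_of_nonneg hd.le]
    · simpa using hd.le
  obtain ⟨M, hMr⟩ : ∃ M : ℝ, (M : ℂ) = mainC ψ κ := by
    rw [mainC]
    split_ifs
    · exact ⟨_, rfl⟩
    · exact ⟨0, Complex.ofReal_zero⟩
  obtain ⟨F, hF1, hF2, hF3⟩ := Continue.exists_continuation (c := coef K ψ) (r := Units.rank K)
    (A := dens q κ * (1 + B) ^ finrank ℚ K) (M := M) (δ := 1 / (finrank ℚ K : ℝ)) hc hA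
    (fun Y hY => by
      rw [hMr]
      exact h.norm_charSum_sub_le_rpow hq hψ hY) (isVM ψ).sum_a
  have hfac : Differentiable ℂ (fac ψ) := by
    unfold fac
    split_ifs <;> fun_prop
  refine ⟨fun s => s ^ (Units.rank K + 1) / (Units.rank K).factorial *
    (fac ψ s * F s + mainC ψ κ), ⟨?_, ?_⟩, ?_, ?_⟩
  · refine DifferentiableOn.mul (by fun_prop) ?_
    exact (hfac.differentiableOn.mul hF1).add_const _
  · intro s hs
    have hs0 : s ≠ 0 := by
      rintro rfl
      simp at hs
      linarith
    have hs1 : s - 1 ≠ 0 := by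
      intro h
      rw [sub_eq_zero] at h
      rw [h] at hs
      simp at hs
    have hf0 : ((Units.rank K).factorial : ℂ) ≠ 0 := by
      exact_mod_cast Nat.factorial_ne_zero _
    have hfm : fac ψ s * (mainC ψ κ / (s - 1)) = mainC ψ κ := by
      rw [fac, mainC]
      split_ifs
      · field_simp
      · simp
    rw [hF2 s hs hδ, hMr, mul_sub, hfm, sub_add_cancel]
    field_simp
  · intro s hs
    have h1 : ‖fac ψ s‖ ≤ ‖s‖ + 1 := by
      rw [fac]
      split_ifs
      · refine (norm_sub_le _ _).trans (by simp)
      · simp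
    have hs' : 0 < s.re - (1 - 1 / (finrank ℚ K : ℝ)) := by linarith
    have h2 := hF3 s hs
    set A := dens q κ * (1 + B) ^ finrank ℚ K with hA'
    have h3 : ‖fac ψ s * F s + mainC ψ κ‖
        ≤ (‖s‖ + 1) * A * (1 / (s.re - (1 - 1 / (finrank ℚ K : ℝ))) + 1) := by
      refine (norm_add_le _ _).trans ?_
      rw [norm_mul, mul_add, mul_one]
      refine add_le_add ?_ (hM.trans ?_)
      · rw [mul_assoc, mul_one_div]
        gcongr
      · exact le_mul_of_one_le_left hA (by linarith [norm_nonneg s])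
    have h4 : ‖s ^ (Units.rank K + 1) / ((Units.rank K).factorial : ℂ)‖
        ≤ (‖s‖ + 1) ^ (Units.rank K + 1) := by
      rw [norm_div, norm_pow, Complex.norm_natCast]
      refine (div_le_self (by positivity) ?_).trans ?_
      · exact_mod_cast Nat.one_le_iff_ne_zero.2 (Nat.factorial_ne_zero _)
      · gcongr
        linarith
    calc _ = ‖s ^ (Units.rank K + 1) / ((Units.rank K).factorial : ℂ)‖ *
          ‖fac ψ s * F s + mainC ψ κ‖ := norm_mul _ _
      _ ≤ (‖s‖ + 1) ^ (Units.rank K + 1) *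
          ((‖s‖ + 1) * A * (1 / (s.re - (1 - 1 / (finrank ℚ K : ℝ))) + 1)) := by gcongr
      _ = _ := by ring
  · rintro rfl
    have hf0 : ((Units.rank K).factorial : ℂ) ≠ 0 := by
      exact_mod_cast Nat.factorial_ne_zero _
    have hd' : (dens q κ : ℂ) ≠ 0 := by exact_mod_cast hd.ne'
    simp [fac, mainC, hd', hf0]

theorem IsCont.conj_eq {ψ : DirichletCharacter ℂ q} {G G' : ℂ → ℂ} (h : IsCont K ψ G)
    (h' : IsCont K ψ⁻¹ G') : ∀ s : ℂ, 1 - 1 / (finrank ℚ K : ℝ) < s.re →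
      G (conj s) = conj (G' s) := by
  have hn : (0 : ℝ) < finrank ℚ K := by exact_mod_cast Module.finrank_pos
  have hδ : 0 < 1 / (finrank ℚ K : ℝ) := by positivity
  have ho : IsOpen {s : ℂ | 1 - 1 / (finrank ℚ K : ℝ) < s.re} :=
    isOpen_lt continuous_const Complex.continuous_re
  have key := eq_of_halfPlane (f := conj ∘ G ∘ conj) (g := G') (by linarith) ?_ h'.diff ?_
  · intro s hs
    rw [← key s hs]
    simp
  · intro s hs
    refine DifferentiableAt.differentiableWithinAt ?_
    have := h.diff.differentiableAt (ho.mem_nhds (x := conj s) (by simpa using hs))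
    simpa using this.conj_conj
  · intro s hs
    rw [Function.comp_apply, Function.comp_apply, h.eq (conj s) (by simpa using hs), h'.eq s hs,
      map_mul, conj_LSeries, Complex.conj_conj]
    have hco : (fun n => conj (coef K ψ n)) = coef K ψ⁻¹ := by
      funext n
      rw [coef, coef, map_mul, Complex.conj_natCast, ← MulChar.star_apply' ψ]
      rfl
    rw [hco]
    congr 1
    rw [fac, fac]
    simp only [inv_eq_one]
    split_ifs <;> simp

variable (K q) in
/-- The von Mangoldt coefficients of the product of the twisted zeta functions. -/
noncomputable def Lam [NeZero q] (n : ℕ) : ℝ :=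
  if (n : ZMod q) = 1 ∨ (n : ZMod q) = -1 then q.totient / 2 * IdealVM.lam K n else 0

variable (q) in
/-- The even characters. -/
noncomputable def evens [NeZero q] : Finset (DirichletCharacter ℂ q) :=
  Finset.univ.filter DirichletCharacter.Even

theorem sum_evens [NeZero q] (hq : 2 < q) (a : ZMod q) :
    ∑ ψ ∈ evens q, ψ a = if a = 1 ∨ a = -1 then (q.totient : ℂ) / 2 else 0 := by
  have hne : (1 : ZMod q) ≠ -1 := by
    intro h
    have h2 : ((2 : ℕ) : ZMod q) = 0 := by
      push_cast
      rw [← one_add_one_eq_two]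
      nth_rewrite 2 [h]
      exact add_neg_cancel _
    rw [ZMod.natCast_eq_zero_iff] at h2
    exact absurd (Nat.le_of_dvd (by norm_num) h2) (by omega)
  have h1 : ∑ ψ ∈ evens q, ψ a = ∑ ψ : DirichletCharacter ℂ q, (ψ a + ψ (-a)) / 2 := by
    rw [evens, Finset.sum_filter]
    refine Finset.sum_congr rfl fun ψ _ => ?_
    have h3 : ψ (-a) = ψ (-1) * ψ a := by rw [← map_mul, neg_one_mul]
    split_ifs with he
    · rw [he.eval_neg]
      ring
    · have : ψ.Odd := ψ.even_or_odd.resolve_left he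
      rw [h3, this]
      ring
  rw [h1, ← Finset.sum_div, Finset.sum_add_distrib, DirichletCharacter.sum_characters_eq,
    DirichletCharacter.sum_characters_eq]
  simp only [neg_eq_iff_eq_neg]
  by_cases ha : a = 1
  · subst ha
    simp [hne]
  · by_cases hb : a = -1
    · subst hb
      simp [hne.symm]
    · simp [ha, hb]

theorem sum_evens_mul [NeZero q] (hq : 2 < q) (n : ℕ) :
    ∑ ψ ∈ evens q, ψ n * (IdealVM.lam K n : ℂ) = (Lam K q n : ℂ) := by
  rw [← Finset.sum_mul, sum_evens hq, Lam]
  split_ifs <;> simp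

end LTil

end

section

open NumberField Module ClassCount CharSum Filter Topology LTil
open scoped ComplexConjugate

namespace GoodIns

variable {K : Type*} [Field K] [NumberField K] {q : ℕ} {B κ P : ℝ}

theorem pow_le_exp {x P : ℝ} {c n : ℕ} (hP : 1 ≤ P) (hx0 : 0 ≤ x) (hx : x ≤ P ^ c)
    (hn : (n : ℝ) ≤ P) : x ^ n ≤ Real.exp (c * P ^ 2) := by
  have h1 : P ≤ Real.exp P := by linarith [Real.add_one_le_exp P]
  calc x ^ n ≤ (Real.exp (c * P)) ^ n := by
        gcongr
        rw [Real.exp_nat_mul]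
        exact hx.trans (by gcongr)
    _ = Real.exp (n * (c * P)) := (Real.exp_nat_mul _ _).symm
    _ ≤ Real.exp (c * P ^ 2) := by
        apply Real.exp_le_exp.2
        have : 0 ≤ c * P := by positivity
        nlinarith

theorem pow_const_le_exp {P : ℝ} (c : ℕ) (hP : 1 ≤ P) : P ^ c ≤ Real.exp (c * P ^ 2) := by
  have h1 : P ≤ Real.exp P := by linarith [Real.add_one_le_exp P]
  calc P ^ c ≤ (Real.exp P) ^ c := by gcongr
    _ = Real.exp (c * P) := (Real.exp_nat_mul _ _).symm
    _ ≤ _ := by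
        apply Real.exp_le_exp.2
        have : P ≤ P ^ 2 := by nlinarith
        gcongr

theorem rank_le : Units.rank K + 1 ≤ finrank ℚ K := by
  have h1 := InfinitePlace.card_add_two_mul_card_eq_rank K
  have h2 := InfinitePlace.card_eq_nrRealPlaces_add_nrComplexPlaces K
  have h3 : 0 < Fintype.card (InfinitePlace K) := Fintype.card_pos
  rw [Units.rank]
  omega

theorem dens_le_exp (h : Equi K q B κ) (hq : 2 < q) (hP : 1000 ≤ P)
    (hn : (finrank ℚ K : ℝ) ≤ P) (hB : B ≤ P ^ 4) :
    dens q κ ≤ Real.exp (15 * P ^ 2) := by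
  have hn1 : (1 : ℝ) ≤ finrank ℚ K := by exact_mod_cast Module.finrank_pos
  have hP1 : 1 ≤ P := by linarith
  have hB0 := h.nonneg
  have hr : (Units.rank K : ℝ) ≤ P := by
    have : (Units.rank K : ℝ) ≤ finrank ℚ K := by
      exact_mod_cast (Nat.le_succ _).trans rank_le
    linarith
  set Y : ℝ := (P ^ 6) ^ finrank ℚ K with hY
  have hY1 : 1 ≤ Y := one_le_pow₀ (one_le_pow₀ hP1)
  have hYn : Y ^ (1 / finrank ℚ K : ℝ) = P ^ 6 := by
    rw [hY, one_div, Real.pow_rpow_inv_natCast (by positivity)]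
    exact Module.finrank_pos.ne'
  have h1 := h.dens_le hq hY1 (by
    rw [hYn]
    calc 2 * finrank ℚ K * B ≤ 2 * P * P ^ 4 := by gcongr
      _ ≤ P ^ 6 := by
        have : 0 ≤ P ^ 5 := by positivity
        nlinarith)
  have hYe : Y ≤ Real.exp (6 * P ^ 2) := by
    have := pow_le_exp (c := 6) (n := finrank ℚ K) hP1 (by positivity) le_rfl hn
    exact_mod_cast this
  have hlog0 : 0 ≤ Real.log Y := Real.log_nonneg hY1
  have hlog : Real.log Y ≤ P ^ 3 := by
    have := (Real.log_le_iff_le_exp (by linarith)).2 hYe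
    have h2 : 0 ≤ P ^ 2 := by positivity
    nlinarith
  have h2 : Real.log Y ^ Units.rank K ≤ Real.exp (3 * P ^ 2) := by
    have := pow_le_exp (c := 3) (n := Units.rank K) hP1 (Real.log_nonneg hY1) hlog hr
    exact_mod_cast this
  have h3 : (2 : ℝ) ^ finrank ℚ K ≤ Real.exp (1 * P ^ 2) := by
    have := pow_le_exp (x := 2) (c := 1) (n := finrank ℚ K) hP1 (by norm_num) (by
      rw [pow_one]
      linarith) hn
    exact_mod_cast this
  have h4 : (2 : ℝ) ≤ Real.exp (1 * P ^ 2) := by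
    have := Real.add_one_le_exp (1 * P ^ 2)
    nlinarith
  calc dens q κ ≤ 2 * (Real.log Y ^ Units.rank K * Y * 2 ^ finrank ℚ K) := h1
    _ ≤ Real.exp (1 * P ^ 2) * (Real.exp (3 * P ^ 2) * Real.exp (6 * P ^ 2) *
        Real.exp (1 * P ^ 2)) := by gcongr
    _ = Real.exp (11 * P ^ 2) := by
        rw [← Real.exp_add, ← Real.exp_add, ← Real.exp_add]
        ring_nf
    _ ≤ _ := by
        apply Real.exp_le_exp.2
        have h2 : 0 ≤ P ^ 2 := by positivity
        linarith

theorem norm_le_exp (h : Equi K q B κ) (hq : 2 < q) (hP : 1000 ≤ P)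
    (hn : (finrank ℚ K : ℝ) ≤ P) (hB : B ≤ P ^ 4) {s : ℂ} {x : ℝ}
    (hs : 1 - 1 / P ^ 2 < s.re) (hs3 : s.re ≤ 3) (him : |s.im| ≤ P ^ 31)
    (hx : x ≤ (‖s‖ + 1) ^ (Units.rank K + 2) * (dens q κ * (1 + B) ^ finrank ℚ K) *
          (1 / (s.re - (1 - 1 / (finrank ℚ K : ℝ))) + 1)) : x ≤ Real.exp (100 * P ^ 2) := by
  have hn1 : (1 : ℝ) ≤ finrank ℚ K := by exact_mod_cast Module.finrank_pos
  have hP1 : 1 ≤ P := by linarith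
  have hB0 := h.nonneg
  have h31 : 1 ≤ P ^ 31 := one_le_pow₀ hP1
  have hd0 : 0 ≤ dens q κ := dens_nonneg h.pos.le
  have hs0 : 0 ≤ s.re := by
    have : 1 / P ^ 2 ≤ 1 := by
      rw [div_le_one (by positivity)]
      exact one_le_pow₀ hP1
    linarith
  have hnorm : ‖s‖ + 1 ≤ P ^ 32 := by
    have := Complex.norm_le_abs_re_add_abs_im s
    rw [abs_of_nonneg hs0] at this
    have h32 : P ^ 32 = P * P ^ 31 := by ring
    nlinarith
  have h1 : (‖s‖ + 1) ^ (Units.rank K + 2) ≤ Real.exp (64 * P ^ 2) := by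
    have h2 := pow_le_exp (c := 32) (n := Units.rank K + 1) hP1 (by positivity) hnorm (by
      have : ((Units.rank K + 1 : ℕ) : ℝ) ≤ finrank ℚ K := by exact_mod_cast rank_le
      linarith)
    have h3 := hnorm.trans (pow_const_le_exp 32 hP1)
    calc (‖s‖ + 1) ^ (Units.rank K + 2) = (‖s‖ + 1) ^ (Units.rank K + 1) * (‖s‖ + 1) := by ring
      _ ≤ Real.exp ((32 : ℕ) * P ^ 2) * Real.exp ((32 : ℕ) * P ^ 2) := by gcongr
      _ = _ := by
        rw [← Real.exp_add]
        push_cast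
        ring_nf
  have h2 := dens_le_exp h hq hP hn hB
  have h3 : (1 + B) ^ finrank ℚ K ≤ Real.exp ((5 : ℕ) * P ^ 2) := by
    refine pow_le_exp hP1 (by linarith) ?_ hn
    have : 1 ≤ P ^ 4 := one_le_pow₀ hP1
    nlinarith
  have h4 : 1 / (s.re - (1 - 1 / (finrank ℚ K : ℝ))) + 1 ≤ Real.exp ((2 : ℕ) * P ^ 2) := by
    refine le_trans ?_ (pow_const_le_exp 2 hP1)
    have h5 : 1 / P ≤ 1 / (finrank ℚ K : ℝ) := by gcongr
    have h6 : 1 / P ^ 2 ≤ 1 / (2 * P) := by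
      gcongr
      nlinarith
    have h7 : 1 / (2 * P) = 1 / P / 2 := by
      field_simp
    have h8 : 1 / (2 * P) ≤ s.re - (1 - 1 / (finrank ℚ K : ℝ)) := by linarith
    have h9 : 1 / (s.re - (1 - 1 / (finrank ℚ K : ℝ))) ≤ 2 * P := by
      rw [div_le_iff₀ (lt_of_lt_of_le (by positivity) h8)]
      have h10 : 2 * P * (1 / (2 * P)) = 1 := mul_one_div_cancel (by positivity)
      have : 2 * P * (1 / (2 * P)) ≤ 2 * P * (s.re - (1 - 1 / (finrank ℚ K : ℝ))) := by gcongr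
      linarith
    nlinarith
  have hsub : 0 < s.re - (1 - 1 / (finrank ℚ K : ℝ)) := by
    have h5 : 1 / P ≤ 1 / (finrank ℚ K : ℝ) := by gcongr
    have h6 : 1 / P ^ 2 ≤ 1 / P := by
      gcongr
      nlinarith
    linarith
  calc x ≤ _ := hx
    _ ≤ Real.exp (64 * P ^ 2) * (Real.exp (15 * P ^ 2) * Real.exp ((5 : ℕ) * P ^ 2)) *
        Real.exp ((2 : ℕ) * P ^ 2) := by gcongr
    _ = Real.exp (86 * P ^ 2) := by
        rw [← Real.exp_add, ← Real.exp_add, ← Real.exp_add]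
        push_cast
        ring_nf
    _ ≤ _ := by
        apply Real.exp_le_exp.2
        have h2 : 0 ≤ P ^ 2 := by positivity
        linarith

theorem exp_le_norm (ψ : DirichletCharacter ℂ q) (hP : 1000 ≤ P)
    (hn : (finrank ℚ K : ℝ) ≤ P) {s : ℂ} (hs : 1 + 1 / P ^ 10 ≤ s.re) :
    Real.exp (-(100 * P ^ 2)) ≤ ‖fac ψ s * LSeries (coef K ψ) s‖ := by
  have hP1 : 1 ≤ P := by linarith
  have h10 : 0 < 1 / P ^ 10 := by positivity
  have hs1 : 1 < s.re := by linarith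
  have hfac : Real.exp (-((10 : ℕ) * P ^ 2)) ≤ ‖fac ψ s‖ := by
    have h1 : Real.exp (-((10 : ℕ) * P ^ 2)) ≤ 1 / P ^ 10 := by
      rw [Real.exp_neg, ← one_div]
      exact one_div_le_one_div_of_le (by positivity) (pow_const_le_exp 10 hP1)
    rw [fac]
    split_ifs
    · refine h1.trans ?_
      have := Complex.re_le_norm (s - 1)
      simp only [Complex.sub_re, Complex.one_re] at this
      linarith
    · rw [norm_one]
      exact Real.exp_le_one_iff.2 (by
        have : 0 ≤ P ^ 2 := by positivity
        push_cast
        linarith)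
  have hL := (isVM (K := K) ψ).le_norm (N := finrank ℚ K) (fun n => by
    rw [norm_mul]
    exact (mul_le_of_le_one_left (norm_nonneg _) (ψ.norm_le_one _)).trans
      (idealCount_isVM_le n)) hs1
  have hz : Real.exp (finrank ℚ K * IsVM.logZeta s.re) ≤ Real.exp ((11 : ℕ) * P ^ 2) := by
    rw [Real.exp_nat_mul]
    refine pow_le_exp hP1 (by positivity) ?_ hn
    refine (IsVM.exp_logZeta_le hs1).trans ?_
    rw [div_le_iff₀ (by linarith)]
    have h2 : P ^ 10 * (1 / P ^ 10) = 1 := mul_one_div_cancel (by positivity)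
    have h3 : 1 ≤ P ^ 10 * (s.re - 1) := by
      rw [← h2]
      gcongr
      linarith
    have h4 : P ^ 11 * (s.re - 1) = P * (P ^ 10 * (s.re - 1)) := by ring
    have h5 : 1 ≤ P ^ 10 := one_le_pow₀ hP1
    nlinarith
  have hL' : Real.exp (-((11 : ℕ) * P ^ 2)) ≤ ‖LSeries (coef K ψ) s‖ := by
    refine le_trans ?_ hL
    rw [Real.exp_neg, Real.exp_neg]
    gcongr
  rw [norm_mul]
  calc Real.exp (-(100 * P ^ 2)) ≤ Real.exp (-((10 : ℕ) * P ^ 2)) * Real.exp (-((11 : ℕ) * P ^ 2)) := by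
        rw [← Real.exp_add]
        apply Real.exp_le_exp.2
        have : 0 ≤ P ^ 2 := by positivity
        push_cast
        linarith
    _ ≤ _ := by gcongr

theorem card_evens_le [NeZero q] (hqP : (q : ℝ) ≤ P) : ((evens q).card : ℝ) ≤ P := by
  refine le_trans ?_ hqP
  have h1 : Fintype.card (DirichletCharacter ℂ q) = q.totient := by
    rw [← Nat.card_eq_fintype_card]
    exact DirichletCharacter.card_eq_totient_of_hasEnoughRootsOfUnity ℂ q
  exact_mod_cast (Finset.card_le_univ _).trans (h1.le.trans (Nat.totient_le q))

theorem hasDerivAt_prod_zero {ι : Type*} {u : Finset ι} {f : ι → ℂ → ℂ} {x : ℂ} {i j : ι}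
    (hi : i ∈ u) (hj : j ∈ u) (hij : i ≠ j) (hfi : f i x = 0) (hfj : f j x = 0)
    (hf : ∀ i ∈ u, DifferentiableAt ℂ (f i) x) : deriv (fun s => ∏ k ∈ u, f k s) x = 0 := by
  have h1 : (fun s => ∏ k ∈ u, f k s) = fun s => f i s * (f j s * ∏ k ∈ (u.erase i).erase j, f k s) := by
    funext s
    rw [Finset.mul_prod_erase (u.erase i) (fun k => f k s) (Finset.mem_erase.2 ⟨hij.symm, hj⟩),
      Finset.mul_prod_erase u (fun k => f k s) hi]
  have h2 : DifferentiableAt ℂ (fun s => ∏ k ∈ (u.erase i).erase j, f k s) x :=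
    DifferentiableAt.fun_finsetProd fun k hk =>
      hf k (Finset.mem_of_mem_erase (Finset.mem_of_mem_erase hk))
  rw [h1, ((hf i hi).hasDerivAt.fun_mul ((hf j hj).hasDerivAt.fun_mul h2.hasDerivAt)).deriv, hfi, hfj]
  simp

theorem logDeriv_eq {ψ : DirichletCharacter ℂ q} {G : ℂ → ℂ} (h : IsCont K ψ G) {s : ℂ}
    (hs : 1 < s.re) : logDeriv G s = (if ψ = 1 then 1 / (s - 1) else 0) -
      LSeries (fun n => ψ n * (IdealVM.lam K n : ℂ)) s := by
  have h1 : G =ᶠ[𝓝 s] fun s => fac ψ s * LSeries (coef K ψ) s := by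
    have : {s : ℂ | 1 < s.re} ∈ 𝓝 s :=
      (isOpen_lt continuous_const Complex.continuous_re).mem_nhds hs
    filter_upwards [this] with z hz using h.eq z hz
  have hL := (isVM (K := K) ψ).hasDerivAt hs
  have hL0 := (isVM (K := K) ψ).ne_zero hs
  have hs1 : s - 1 ≠ 0 := by
    intro h
    rw [sub_eq_zero] at h
    rw [h] at hs
    simp at hs
  rw [logDeriv_apply, h1.deriv_eq, h1.self_of_nhds]
  unfold fac
  split_ifs
  · have h2 : HasDerivAt (fun s : ℂ => s - 1) 1 s := (hasDerivAt_id s).sub_const 1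
    rw [(h2.fun_mul hL).deriv]
    field_simp
    ring
  · simp only [one_mul]
    rw [hL.deriv]
    field_simp
    ring

theorem even_inv {ψ : DirichletCharacter ℂ q} (h : ψ.Even) : (ψ⁻¹).Even := by
  rw [DirichletCharacter.Even] at h ⊢
  rw [← MulChar.star_apply', h, star_one]

theorem goodL [NeZero q] (h : Equi K q B κ) (hq : 2 < q) (hP : 1000 ≤ P)
    (hn : (finrank ℚ K : ℝ) ≤ P) (hqP : (q : ℝ) ≤ P) (hB : B ≤ P ^ 4)
    {G : DirichletCharacter ℂ q → ℂ → ℂ} (hG : ∀ ψ, ψ.Even → IsCont K ψ (G ψ))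
    (hGb : ∀ ψ, ψ.Even → ∀ s : ℂ, 1 - 1 / (finrank ℚ K : ℝ) < s.re →
        ‖G ψ s‖ ≤ (‖s‖ + 1) ^ (Units.rank K + 2) * (dens q κ * (1 + B) ^ finrank ℚ K) *
          (1 / (s.re - (1 - 1 / (finrank ℚ K : ℝ))) + 1))
    (hd : ∀ β : ℝ, 1 - 1 / P ^ 7 < β → β ≤ 1 → ∀ ψ : DirichletCharacter ℂ q, ψ.Even → ψ⁻¹ = ψ →
      G ψ β = 0 → ∃ ψ', ψ' ≠ ψ ∧ ψ'.Even ∧ G ψ' β = 0) :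
    GoodL P (fun s => ∏ ψ ∈ evens q, G ψ s) (Lam K q) := by
  have hn1 : (1 : ℝ) ≤ finrank ℚ K := by exact_mod_cast Module.finrank_pos
  have hP1 : 1 ≤ P := by linarith
  have hP2 : (0 : ℝ) ≤ P ^ 2 := by positivity
  have hev : ∀ ψ : DirichletCharacter ℂ q, ψ ∈ evens q ↔ ψ.Even := fun ψ => by
    rw [evens, Finset.mem_filter]
    simp
  have hsub : ∀ {s : ℂ}, 1 - 1 / P ^ 2 < s.re → 1 - 1 / (finrank ℚ K : ℝ) < s.re := by
    intro s hs
    have h5 : 1 / P ≤ 1 / (finrank ℚ K : ℝ) := by gcongr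
    have h6 : 1 / P ^ 2 ≤ 1 / P := by
      gcongr
      nlinarith
    linarith
  have ho : IsOpen {s : ℂ | 1 - 1 / (finrank ℚ K : ℝ) < s.re} :=
    isOpen_lt continuous_const Complex.continuous_re
  have hcard := card_evens_le (P := P) hqP
  have hexp : 100 * P ^ 2 * (evens q).card ≤ P ^ 4 := by
    calc 100 * P ^ 2 * (evens q).card ≤ 100 * P ^ 2 * P := by gcongr
      _ ≤ P ^ 4 := by
        have : 0 ≤ P ^ 3 := by positivity
        nlinarith
  have hone : (1 : DirichletCharacter ℂ q).Even := MulChar.one_apply isUnit_one.neg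
  refine ⟨?_, ?_, ?_, ?_, ?_, ?_, ?_, ?_, ?_⟩
  · exact DifferentiableOn.fun_finsetProd fun ψ hψ =>
      (hG ψ ((hev ψ).1 hψ)).diff.mono fun s hs => hsub hs
  · intro s hs
    refine Finset.prod_ne_zero_iff.2 fun ψ hψ => ?_
    rw [(hG ψ ((hev ψ).1 hψ)).eq s hs]
    refine mul_ne_zero ?_ ((isVM (K := K) ψ).ne_zero hs)
    rw [fac]
    split_ifs
    · intro h
      rw [sub_eq_zero] at h
      rw [h] at hs
      simp at hs
    · exact one_ne_zero
  · intro s hs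
    have hs' : 1 - 1 / (finrank ℚ K : ℝ) < s.re := by
      have : 0 < 1 / (finrank ℚ K : ℝ) := by positivity
      linarith
    have hne : ∀ ψ ∈ evens q, G ψ s ≠ 0 := by
      intro ψ hψ
      rw [(hG ψ ((hev ψ).1 hψ)).eq s hs]
      refine mul_ne_zero ?_ ((isVM (K := K) ψ).ne_zero hs)
      rw [fac]
      split_ifs
      · intro h
        rw [sub_eq_zero] at h
        rw [h] at hs
        simp at hs
      · exact one_ne_zero
    rw [← logDeriv_apply, logDeriv_prod hne
      (fun ψ hψ => (hG ψ ((hev ψ).1 hψ)).diff.differentiableAt (ho.mem_nhds hs')),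
      Finset.sum_congr rfl fun ψ hψ => logDeriv_eq (hG ψ ((hev ψ).1 hψ)) hs,
      Finset.sum_sub_distrib]
    congr 1
    · refine (Finset.sum_eq_single 1 (fun ψ _ h1 => if_neg h1)
        (fun h1 => absurd ((hev 1).2 hone) h1)).trans (if_pos rfl)
    rw [← LSeries_sum (fun ψ _ => (isVM (K := K) ψ).sum_L s hs)]
    congr 1
    funext n
    rw [Finset.sum_apply]
    exact sum_evens_mul hq n
  · intro s hs hs3 him
    rw [norm_prod]
    calc ∏ ψ ∈ evens q, ‖G ψ s‖ ≤ ∏ ψ ∈ evens q, Real.exp (100 * P ^ 2) := by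
          refine Finset.prod_le_prod (fun _ _ => norm_nonneg _) fun ψ hψ => ?_
          exact norm_le_exp h hq hP hn hB hs hs3 him (hGb ψ ((hev ψ).1 hψ) s (hsub hs))
      _ = Real.exp ((evens q).card * (100 * P ^ 2)) := by
          rw [Finset.prod_const, Real.exp_nat_mul]
      _ ≤ _ := Real.exp_le_exp.2 (by linarith)
  · intro s hs hs3 him
    have hs1 : 1 < s.re := by
      have : 0 < 1 / P ^ 10 := by positivity
      linarith
    rw [norm_prod]
    calc Real.exp (-P ^ 4) ≤ Real.exp ((evens q).card * (-(100 * P ^ 2))) :=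
          Real.exp_le_exp.2 (by linarith)
      _ = ∏ ψ ∈ evens q, Real.exp (-(100 * P ^ 2)) := by
          rw [Finset.prod_const, Real.exp_nat_mul]
      _ ≤ _ := by
          refine Finset.prod_le_prod (fun _ _ => (Real.exp_pos _).le) fun ψ hψ => ?_
          rw [(hG ψ ((hev ψ).1 hψ)).eq s hs1]
          exact exp_le_norm ψ hP hn hs
  · intro s hs
    rw [map_prod]
    refine Finset.prod_bij' (fun ψ _ => ψ⁻¹) (fun ψ _ => ψ⁻¹) ?_ ?_ ?_ ?_ ?_
    · exact fun ψ hψ => (hev _).2 (even_inv ((hev ψ).1 hψ))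
    · exact fun ψ hψ => (hev _).2 (even_inv ((hev ψ).1 hψ))
    · simp
    · simp
    · intro ψ hψ
      exact (hG ψ ((hev ψ).1 hψ)).conj_eq (hG _ (even_inv ((hev ψ).1 hψ))) s (hsub hs)
  · intro β hβ hβ1 h0
    obtain ⟨ψ, hψ, hz⟩ := Finset.prod_eq_zero_iff.1 h0
    have hψe := (hev ψ).1 hψ
    have hβ2 : 1 - 1 / P ^ 2 < ((β : ℂ)).re := by
      rw [Complex.ofReal_re]
      have : 1 / P ^ 7 ≤ 1 / P ^ 2 := by
        gcongr
        norm_num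
      linarith
    have : ∃ ψ', ψ' ≠ ψ ∧ ψ'.Even ∧ G ψ' β = 0 := by
      by_cases hi : ψ⁻¹ = ψ
      · exact hd β hβ hβ1 ψ hψe hi hz
      · refine ⟨ψ⁻¹, hi, even_inv hψe, ?_⟩
        have h3 := (hG ψ hψe).conj_eq (hG _ (even_inv hψe)) β (hsub hβ2)
        rw [Complex.conj_ofReal, hz] at h3
        exact (map_eq_zero _).1 h3.symm
    obtain ⟨ψ', hne, hψ', hz'⟩ := this
    exact hasDerivAt_prod_zero hψ ((hev ψ').2 hψ') hne.symm hz hz' fun χ hχ =>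
      (hG χ ((hev χ).1 hχ)).diff.differentiableAt (ho.mem_nhds (hsub hβ2))
  · intro n
    rw [Lam]
    have := IdealVM.lam_nonneg (K := K) n
    split_ifs <;> positivity
  · intro n
    have hv := ArithmeticFunction.vonMangoldt_nonneg (n := n)
    rw [Lam]
    split_ifs
    · have h1 : (q.totient : ℝ) / 2 ≤ P := by
        have : (q.totient : ℝ) ≤ q := by exact_mod_cast Nat.totient_le q
        linarith
      calc (q.totient : ℝ) / 2 * IdealVM.lam K n
          ≤ P * (P * ArithmeticFunction.vonMangoldt n) := by
            refine mul_le_mul h1 ?_ (IdealVM.lam_nonneg n) (by linarith)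
            refine (IdealVM.lam_le n).trans ?_
            gcongr
        _ = P ^ 2 * ArithmeticFunction.vonMangoldt n := by ring
        _ ≤ _ := by
            gcongr
            norm_num
    · positivity

end GoodIns

end

section

namespace UnitsThree

/-- Residues `1` modulo `4` are powers of `-3`. -/
theorem eq_neg_three_pow {m : ℕ} (a : ZMod (2 ^ (m + 2)))
    (ha : ZMod.castHom (pow_dvd_pow 2 (Nat.le_add_left 2 m) : 2 ^ 2 ∣ 2 ^ (m + 2)) (ZMod (2 ^ 2)) a = 1) :
    ∃ i : ℕ, a = (-3) ^ i := by
  set π := ZMod.castHom (pow_dvd_pow 2 (Nat.le_add_left 2 m) : 2 ^ 2 ∣ 2 ^ (m + 2)) (ZMod (2 ^ 2))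
    with hπ
  have hord : orderOf (-3 : ZMod (2 ^ (m + 2))) = 2 ^ m := by
    have := ZMod.orderOf_one_add_four_mul (-1) (by decide) m
    convert this using 2
    push_cast; ring
  have hinj : Set.InjOn (fun i : ℕ => (-3 : ZMod (2 ^ (m + 2))) ^ i) (Finset.range (2 ^ m)) := by
    intro i hi j hj h
    simp only [Finset.coe_range, Set.mem_Iio] at hi hj
    exact pow_injOn_Iio_orderOf (by simpa [hord] using hi) (by simpa [hord] using hj) h
  set A : Finset (ZMod (2 ^ (m + 2))) :=
    (Finset.range (2 ^ m)).image (fun i : ℕ => (-3 : ZMod (2 ^ (m + 2))) ^ i) with hA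
  have hAc : A.card = 2 ^ m := by
    rw [hA, Finset.card_image_of_injOn hinj, Finset.card_range]
  set B : Finset (ZMod (2 ^ (m + 2))) := Finset.univ.filter fun a => π a = 1 with hB
  have h3 : π (-3) = 1 := by
    rw [map_neg, map_ofNat]; decide
  have hAB : A ⊆ B := by
    intro x hx
    obtain ⟨i, -, rfl⟩ := Finset.mem_image.1 hx
    simp [hB, map_pow, h3]
  have hBc : B.card ≤ 2 ^ m := by
    have : B ⊆ (Finset.range (2 ^ m)).image fun i : ℕ => ((1 + 4 * i : ℕ) : ZMod (2 ^ (m + 2))) := by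
      intro x hx
      have hx1 : π x = 1 := by simpa [hB] using hx
      rw [Finset.mem_image]
      have hxv : ((x.val : ℕ) : ZMod (2 ^ 2)) = ((1 : ℕ) : ZMod (2 ^ 2)) := by
        rw [← hx1.trans Nat.cast_one.symm, hπ]
        conv_rhs => rw [← ZMod.natCast_zmod_val x]
        rw [map_natCast]
      rw [ZMod.natCast_eq_natCast_iff] at hxv
      have h4 : x.val % 4 = 1 := hxv
      have hlt : x.val < 2 ^ m * 2 ^ 2 := (ZMod.val_lt x).trans_eq (pow_add _ _ _)
      refine ⟨x.val / 4, by rw [Finset.mem_range]; omega, ?_⟩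
      rw [show 1 + 4 * (x.val / 4) = x.val by omega, ZMod.natCast_zmod_val]
    exact (Finset.card_le_card this).trans (Finset.card_image_le.trans (by simp))
  have hEq : A = B := Finset.eq_of_subset_of_card_le hAB (by rw [hAc]; exact hBc)
  have : a ∈ A := by rw [hEq]; simp [hB, ha]
  obtain ⟨i, -, rfl⟩ := Finset.mem_image.1 this
  exact ⟨i, rfl⟩

/-- Modulo a power of two, every unit is `±` a power of three. -/
theorem exists_pow {m : ℕ} {a : ZMod (2 ^ (m + 2))} (ha : IsUnit a) :
    ∃ i : ℕ, a = 3 ^ i ∨ a = -3 ^ i := by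
  set π := ZMod.castHom (pow_dvd_pow 2 (Nat.le_add_left 2 m) : 2 ^ 2 ∣ 2 ^ (m + 2)) (ZMod (2 ^ 2))
    with hπ
  have key : ∀ b : ZMod (2 ^ (m + 2)), π b = 1 → ∃ i : ℕ, b = 3 ^ i ∨ b = -3 ^ i := by
    intro b hb
    obtain ⟨i, hi⟩ := eq_neg_three_pow b hb
    rw [neg_pow] at hi
    rcases neg_one_pow_eq_or (ZMod (2 ^ (m + 2))) i with h | h <;> rw [h] at hi
    · exact ⟨i, .inl (by simpa using hi)⟩
    · exact ⟨i, .inr (by simpa using hi)⟩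
  have h2 : ∀ b : ZMod (2 ^ 2), IsUnit b → b = 1 ∨ b = -1 := by decide
  rcases h2 _ (ha.map π) with h | h
  · exact key a h
  · obtain ⟨i, hi⟩ := key (-a) (by rw [map_neg, h, neg_neg])
    refine ⟨i, ?_⟩
    rcases hi with hi | hi
    · exact .inr (by rw [← hi, neg_neg])
    · exact .inl (neg_injective hi)

end UnitsThree

end

section

open NumberField Module Polynomial ClassCount CharSum
open scoped ENNReal NNReal

namespace RadField

variable {K : Type*} [Field K] [NumberField K] {n : ℕ} {pb : PowerBasis ℚ K}

/-- The power basis is generated by an `n`-th root of `-2`. -/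
structure IsRad (pb : PowerBasis ℚ K) (n : ℕ) : Prop where
  pos : 0 < n
  minpoly_eq : minpoly ℚ pb.gen = X ^ n + C 2

namespace IsRad

variable (h : IsRad pb n)
include h

theorem dim_eq : pb.dim = n := by
  rw [← pb.natDegree_minpoly, h.minpoly_eq, natDegree_X_pow_add_C]

theorem finrank_eq : finrank ℚ K = n := by rw [pb.finrank, h.dim_eq]

theorem gen_pow : pb.gen ^ n = -2 := by
  have := minpoly.aeval ℚ pb.gen
  rw [h.minpoly_eq] at this
  simp only [map_add, map_pow, aeval_X, aeval_C, map_ofNat] at this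
  linear_combination this

theorem isIntegral : IsIntegral ℤ pb.gen := by
  refine ⟨X ^ n + C 2, monic_X_pow_add_C _ h.pos.ne', ?_⟩
  simp [h.gen_pow]

theorem place_le (w : InfinitePlace K) (i : Fin pb.dim) : w (pb.basis i) ≤ 2 := by
  have h1 : w pb.gen ^ n = 2 := by
    rw [← map_pow, h.gen_pow]
    rw [← w.norm_embedding_eq, map_neg, norm_neg, map_ofNat, RCLike.norm_ofNat]
  have h2 : 1 ≤ w pb.gen := by
    by_contra! h3
    have := pow_le_one₀ (n := n) (apply_nonneg w _) h3.le
    linarith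
  rw [pb.basis_eq_pow, map_pow, ← h1]
  exact pow_le_pow_right₀ h2 (i.2.le.trans_eq h.dim_eq)

theorem norm_gen : |Algebra.norm ℚ pb.gen| = 2 := by
  rw [Algebra.PowerBasis.norm_gen_eq_coeff_zero_minpoly, h.minpoly_eq, abs_mul, abs_pow]
  simp [h.pos.ne]

theorem discr_eq : |Algebra.discr ℚ pb.basis| = n ^ n * 2 ^ (n - 1) := by
  rw [Algebra.discr_powerBasis_eq_norm, h.minpoly_eq, abs_mul, abs_pow]
  simp only [derivative_add, derivative_X_pow, derivative_C, add_zero, map_mul, aeval_C, map_pow,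
    aeval_X, Algebra.norm_algebraMap, h.finrank_eq, abs_mul, abs_pow, h.norm_gen]
  simp

/-- The discriminant of the field is at most that of the power basis. -/
theorem discr_le : (|discr K| : ℝ) ≤ n ^ n * 2 ^ (n - 1) := by
  have hN : (Fintype.card (Free.ChooseBasisIndex ℤ (𝓞 K))) = pb.dim := by
    rw [← finrank_eq_card_chooseBasisIndex, RingOfIntegers.rank, pb.finrank]
  obtain ⟨e⟩ : Nonempty (Free.ChooseBasisIndex ℤ (𝓞 K) ≃ Fin pb.dim) :=
    ⟨Fintype.equivFinOfCardEq hN⟩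
  set B := (integralBasis K).reindex e with hB
  have hBd : (discr K : ℚ) = Algebra.discr ℚ B := by
    rw [coe_discr, hB, Basis.coe_reindex, Algebra.discr_reindex]
  have h1 : Algebra.discr ℚ pb.basis = (B.toMatrix pb.basis).det ^ 2 * Algebra.discr ℚ B := by
    rw [← Algebra.discr_of_matrix_vecMul, Basis.toMatrix_map_vecMul]
  obtain ⟨d, hd⟩ : ∃ d : ℤ, (B.toMatrix pb.basis).det = d := by
    have : B.toMatrix pb.basis = (Matrix.of fun i j : Fin pb.dim =>
        ((RingOfIntegers.basis K).repr ((⟨pb.gen, h.isIntegral⟩ : 𝓞 K) ^ (j : ℕ)) (e.symm i))).map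
        (Int.castRingHom ℚ) := by
      ext i j
      rw [Basis.toMatrix_apply, pb.basis_eq_pow, hB, Basis.repr_reindex_apply]
      have := integralBasis_repr_apply K ((⟨pb.gen, h.isIntegral⟩ : 𝓞 K) ^ (j : ℕ)) (e.symm i)
      exact this
    rw [this, ← RingHom.mapMatrix_apply, ← RingHom.map_det]
    exact ⟨_, rfl⟩
  have hne := Algebra.discr_not_zero_of_basis ℚ pb.basis
  have h3 := h.discr_eq
  rw [h1, hd] at hne
  have hd0 : d ≠ 0 := by rintro rfl; simp at hne
  rw [h1, ← hBd, abs_mul, hd] at h3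
  have h4 : (|discr K| : ℚ) ≤ n ^ n * 2 ^ (n - 1) := by
    rw [← h3]
    refine le_mul_of_one_le_left (abs_nonneg _) ?_
    rw [abs_pow]
    exact one_le_pow₀ (by exact_mod_cast Int.one_le_abs hd0)
  exact_mod_cast h4

theorem covol_lt : BoxCount.covol K < ENNReal.ofReal ((2 * n : ℝ) ^ finrank ℚ K) := by
  have hn := h.pos
  rw [BoxCount.covol, mixedEmbedding.volume_fundamentalDomain_latticeBasis, h.finrank_eq]
  refine lt_of_le_of_lt (mul_le_of_le_one_left' (pow_le_one₀ (zero_le) (by simp))) ?_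
  rw [ENNReal.ofReal, ENNReal.coe_lt_coe, ← NNReal.coe_lt_coe,
    Real.coe_toNNReal _ (by positivity), Real.coe_sqrt, coe_nnnorm, Int.norm_eq_abs,
    Real.sqrt_lt' (by positivity)]
  refine lt_of_le_of_lt (show _ ≤ (n:ℝ) ^ n * 2 ^ (n - 1) by exact_mod_cast h.discr_le) ?_
  have h1 : (1:ℝ) ≤ n := by exact_mod_cast hn
  rw [mul_pow, mul_pow, ← pow_mul, ← pow_mul, mul_comm ((n:ℝ) ^ n)]
  have h2 : (2:ℝ) ^ (n - 1) < 2 ^ (n * 2) := pow_lt_pow_right₀ (by norm_num) (by omega)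
  have h3 : (n:ℝ) ^ n ≤ n ^ (n * 2) := pow_le_pow_right₀ h1 (by omega)
  exact mul_lt_mul h2 h3 (by positivity) (by positivity)

/-- The generator as an algebraic integer. -/
def θ : 𝓞 K := ⟨pb.gen, h.isIntegral⟩

theorem absNorm_one_sub : Ideal.absNorm (Ideal.span {1 - h.θ}) = 3 := by
  rw [Ideal.absNorm_span_singleton]
  have h1 : ((Algebra.norm ℤ (1 - h.θ) : ℤ) : ℚ) = 3 := by
    rw [Algebra.coe_norm_int]
    change Algebra.norm ℚ (1 - pb.gen) = 3
    have h2 := Matrix.eval_charpoly (Algebra.leftMulMatrix pb.basis pb.gen) 1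
    rw [charpoly_leftMulMatrix, h.minpoly_eq, map_one, ← map_one (Algebra.leftMulMatrix pb.basis),
      ← map_sub, ← Algebra.norm_eq_matrix_det] at h2
    rw [← h2]
    norm_num
  have h2 : Algebra.norm ℤ (1 - h.θ) = 3 := by exact_mod_cast h1
  rw [h2]; rfl

theorem exists_equi (m : ℕ) :
    ∃ κ, Equi K (2 ^ (m + 2)) (8 * n ^ 2 * 2 ^ (m + 2)) κ := by
  have hne : Nonempty (Fin pb.dim) := ⟨⟨0, by rw [h.dim_eq]; exact h.pos⟩⟩
  have hn : (0:ℝ) < n := by exact_mod_cast h.pos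
  obtain ⟨κ, hκ, H⟩ := ClassCount.exists_const pb.basis
    (fun i => by rw [pb.basis_eq_pow]; exact h.isIntegral.pow _) (fun i w => h.place_le w i)
    (v := 2 * n) (by positivity) h.covol_lt (q := 2 ^ (m + 2)) (by positivity)
    (Nat.one_lt_two_pow (by omega)) (1 - h.θ) h.absNorm_one_sub
    (Nat.Coprime.pow_right _ (by norm_num))
  have h1 : (4 * (finrank ℚ K:ℝ) * ((2 ^ (m + 2) : ℕ) : ℝ) * (2 * n)) = 8 * n ^ 2 * 2 ^ (m + 2) := by
    rw [h.finrank_eq]; push_cast; ring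
  rw [h1] at H
  refine ⟨κ, hκ, by positivity, fun a ha Y hY => ?_, fun a ha Y hY => ?_⟩
  · exact (H a (by simpa using UnitsThree.exists_pow ha) Y hY).1
  · exact (H a (by simpa using UnitsThree.exists_pow ha) Y hY).2

end IsRad

end RadField

end

section

open NumberField Module Polynomial ClassCount RadField RingOfIntegers UniqueFactorizationMonoid

namespace RadField.IsRad

variable {K : Type*} [Field K] [NumberField K] {n : ℕ} {pb : PowerBasis ℚ K} (h : IsRad pb n)
include h

theorem minpoly_θ : minpoly ℤ h.θ = X ^ n + C 2 := by
  have h1 : minpoly ℚ pb.gen = (minpoly ℤ h.θ).map (algebraMap ℤ ℚ) :=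
    minpoly.isIntegrallyClosed_eq_field_fractions ℚ K (RingOfIntegers.isIntegral h.θ)
  apply Polynomial.map_injective (algebraMap ℤ ℚ) (RingHom.injective_int _)
  rw [← h1, h.minpoly_eq, Polynomial.map_add, Polynomial.map_pow, map_X, map_C]
  simp

theorem not_dvd_exponent {r : ℕ} [hr : Fact r.Prime] (hr2 : r ≠ 2) (hrn : ¬ r ∣ n) :
    ¬ r ∣ exponent h.θ := by
  have hn := h.pos
  obtain ⟨D, hD⟩ : ∃ D : ℤ, (D : ℚ) = Algebra.discr ℚ pb.basis ∧ |D| = (n ^ n * 2 ^ (n - 1) : ℕ) := by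
    rcases abs_choice (Algebra.discr ℚ pb.basis) with h1 | h1 <;> rw [h.discr_eq] at h1
    · exact ⟨(n ^ n * 2 ^ (n - 1) : ℕ), by rw [← h1]; push_cast; ring, by rw [Nat.abs_cast]⟩
    · exact ⟨-(n ^ n * 2 ^ (n - 1) : ℕ), by rw [← neg_eq_iff_eq_neg.2 h1]; push_cast; ring,
        by rw [abs_neg, Nat.abs_cast]⟩
  have hmem : (D : 𝓞 K) ∈ conductor ℤ h.θ := by
    rw [mem_conductor_iff]
    intro b
    have h1 := Algebra.discr_mul_isIntegral_mem_adjoin ℚ (B := pb) h.isIntegral b.2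
    rw [← hD.1] at h1
    have h2 : Algebra.adjoin ℤ {pb.gen} =
        (Algebra.adjoin ℤ {h.θ}).map (IsScalarTower.toAlgHom ℤ (𝓞 K) K) := by
      rw [AlgHom.map_adjoin, Set.image_singleton]; rfl
    rw [h2] at h1
    obtain ⟨c, hc, hce⟩ := h1
    have : c = (D : 𝓞 K) * b := by
      apply RingOfIntegers.ext
      change algebraMap (𝓞 K) K c = _ at hce
      rw [RingOfIntegers.coe_eq_algebraMap, hce, RingOfIntegers.coe_eq_algebraMap, map_mul, map_intCast, Algebra.smul_def,
        map_intCast]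
      rfl
    rw [← this]; exact hc
  have hdvd : ((exponent h.θ : ℕ) : ℤ) ∣ D := by
    rw [← Ideal.mem_span_singleton, exponent, Int.ideal_span_absNorm_eq_self, Ideal.mem_comap]
    simpa using hmem
  intro hd
  have h1 : (r : ℤ) ∣ |D| := (dvd_abs _ _).2 ((Int.natCast_dvd_natCast.2 hd).trans hdvd)
  rw [hD.2, Int.natCast_dvd_natCast, hr.out.dvd_mul] at h1
  rcases h1 with h1 | h1
  · exact hrn (hr.out.dvd_of_dvd_pow h1)
  · exact hr2 ((Nat.prime_dvd_prime_iff_eq hr.out Nat.prime_two).1 (hr.out.dvd_of_dvd_pow h1))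

/-- The ideals of prime norm correspond to the roots of the defining polynomial. -/
theorem idealCount_eq {r : ℕ} [hr : Fact r.Prime] (hr2 : r ≠ 2) (hrn : ¬ r ∣ n) :
    idealCount K r = (Finset.univ.filter fun x : ZMod r => x ^ n = -2).card := by
  have hp := h.not_dvd_exponent hr2 hrn
  have hpol : (minpoly ℤ h.θ).map (Int.castRingHom (ZMod r)) = X ^ n + C 2 := by
    rw [h.minpoly_θ, Polynomial.map_add, Polynomial.map_pow, map_X, map_C]; simp
  have hne : (X ^ n + C 2 : (ZMod r)[X]) ≠ 0 := (monic_X_pow_add_C _ h.pos.ne').ne_zero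
  have hmem : ∀ x : ZMod r, x ^ n = -2 → X - C x ∈ monicFactorsMod h.θ r := by
    intro x hx
    rw [monicFactorsMod, Multiset.mem_toFinset, hpol, Polynomial.mem_normalizedFactors_iff hne]
    refine ⟨irreducible_X_sub_C x, monic_X_sub_C x, ?_⟩
    rw [dvd_iff_isRoot, IsRoot.def]
    simp [hx]
  rw [idealCount, ← Fintype.card_subtype, ← Nat.card_eq_fintype_card]
  symm
  have hspan : Prime (r : ℤ) := Nat.prime_iff_prime_int.1 hr.out
  refine Nat.card_congr (Equiv.ofBijective (fun x => ⟨((Ideal.primesOverSpanEquivMonicFactorsMod hp).symm ⟨X - C x.1, hmem x.1 x.2⟩ : Ideal (𝓞 K)), ?_⟩) ⟨?_, ?_⟩)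
  · have h1 := Ideal.inertiaDeg_primesOverSpanEquivMonicFactorsMod_symm_apply' hp (hmem x.1 x.2)
    rw [natDegree_X_sub_C] at h1
    have := ((Ideal.primesOverSpanEquivMonicFactorsMod hp).symm ⟨X - C x.1, hmem x.1 x.2⟩).2
    have i1 := this.1
    have i2 := this.2
    have h2 := Ideal.natAbs_pow_inertiaDeg (r : ℤ) ((Ideal.primesOverSpanEquivMonicFactorsMod hp).symm ⟨X - C x.1, hmem x.1 x.2⟩ : Ideal (𝓞 K))
    rw [← h2, h1]; simp
  · intro x y hxy
    have h1 := Subtype.ext_iff.1 hxy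
    have h2 := (Ideal.primesOverSpanEquivMonicFactorsMod hp).symm.injective (Subtype.ext h1)
    have h3 := Subtype.ext_iff.1 h2
    exact Subtype.ext (C_injective (sub_right_injective h3))
  · rintro ⟨I, hI⟩
    have hIp : I.IsPrime := Ideal.isPrime_of_irreducible_absNorm (by rw [hI]; exact hr.out)
    have hmemI : (r : 𝓞 K) ∈ I := by rw [← hI]; exact Ideal.absNorm_mem I
    have hlie : I.LiesOver (Ideal.span {(r : ℤ)}) := by
      constructor
      have hmax : (Ideal.span {(r : ℤ)}).IsMaximal := Int.ideal_span_isMaximal_of_prime r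
      refine hmax.eq_of_le (Ideal.comap_ne_top _ hIp.ne_top) ?_
      rw [Ideal.span_singleton_le_iff_mem, Ideal.mem_comap]
      simpa using hmemI
    set Q := Ideal.primesOverSpanEquivMonicFactorsMod hp ⟨I, hIp, hlie⟩ with hQ
    have hQs : (Ideal.primesOverSpanEquivMonicFactorsMod hp).symm ⟨Q.1, Q.2⟩ = ⟨I, hIp, hlie⟩ := by
      rw [hQ]; exact Equiv.symm_apply_apply _ _
    have h1 := Ideal.inertiaDeg_primesOverSpanEquivMonicFactorsMod_symm_apply' hp Q.2
    rw [hQs] at h1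
    have h2 := Ideal.natAbs_pow_inertiaDeg (r : ℤ) I
    rw [hI] at h2
    have h3 : Ideal.inertiaDeg I ℤ = 1 := by
      have : r ^ Ideal.inertiaDeg I ℤ = r ^ 1 := by simpa using h2
      exact Nat.pow_right_injective hr.out.two_le this
    have hQ1 := Q.2
    rw [Multiset.mem_toFinset, hpol, Polynomial.mem_normalizedFactors_iff hne] at hQ1
    have hdeg : Q.1.natDegree = 1 := by rw [← h1]; exact h3
    obtain ⟨x, hx⟩ : ∃ x, Q.1 = X - C x := by
      refine ⟨-Q.1.coeff 0, ?_⟩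
      rw [C_neg, sub_neg_eq_add]
      exact hQ1.2.1.eq_X_add_C hdeg
    have hxr : x ^ n = -2 := by
      have := hQ1.2.2
      rw [hx, dvd_iff_isRoot, IsRoot.def] at this
      simp only [eval_add, eval_pow, eval_X, eval_C] at this
      linear_combination this
    refine ⟨⟨x, hxr⟩, Subtype.ext ?_⟩
    have : (⟨X - C x, hmem x hxr⟩ : monicFactorsMod h.θ r) = ⟨Q.1, Q.2⟩ := Subtype.ext hx.symm
    simp only [this, hQs]

end RadField.IsRad

namespace RadField

theorem irreducible_poly (j : ℕ) : Irreducible (X ^ 2 ^ j + C 2 : ℚ[X]) := by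
  have h0 : (2 ^ j) ≠ 0 := by positivity
  have hm : (X ^ 2 ^ j + C 2 : ℤ[X]).Monic := monic_X_pow_add_C _ h0
  have hirr : Irreducible (X ^ 2 ^ j + C 2 : ℤ[X]) := by
    apply irreducible_of_eisenstein_criterion (P := Ideal.span {2})
    · rw [Ideal.span_singleton_prime (by norm_num)]; exact Int.prime_two
    · rw [hm.leadingCoeff, Ideal.mem_span_singleton]; decide
    · intro i hi
      rw [degree_X_pow_add_C (by positivity)] at hi
      have hi' : i < 2 ^ j := by exact_mod_cast hi
      rw [coeff_add, coeff_X_pow, if_neg hi'.ne, zero_add, coeff_C, Ideal.mem_span_singleton]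
      split_ifs <;> simp
    · rw [degree_X_pow_add_C (by positivity)]; exact_mod_cast h0.bot_lt
    · rw [coeff_add, coeff_X_pow, if_neg h0.symm, coeff_C_zero, zero_add, sq, Ideal.span_singleton_mul_span_singleton,
        Ideal.mem_span_singleton]; decide
    · exact hm.isPrimitive
  have := (hm.irreducible_iff_irreducible_map_fraction_map (K := ℚ)).1 hirr
  rw [Polynomial.map_add, Polynomial.map_pow, map_X, map_C] at this
  simpa using this

instance (j : ℕ) : Fact (Irreducible (X ^ 2 ^ j + C 2 : ℚ[X])) := ⟨irreducible_poly j⟩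

/-- The field generated by a `2 ^ j`-th root of `-2`. -/
abbrev RK (j : ℕ) : Type := AdjoinRoot (X ^ 2 ^ j + C 2 : ℚ[X])

noncomputable instance (j : ℕ) : NumberField (RK j) where
  to_charZero := charZero_of_injective_algebraMap (algebraMap ℚ (RK j)).injective
  to_finiteDimensional := by
    have := (AdjoinRoot.powerBasis (irreducible_poly j).ne_zero).finite
    convert this

theorem isRad (j : ℕ) : IsRad (AdjoinRoot.powerBasis (irreducible_poly j).ne_zero) (2 ^ j) := by
  refine ⟨by positivity, ?_⟩
  have hm : (X ^ 2 ^ j + C 2 : ℚ[X]).Monic := monic_X_pow_add_C _ (by positivity)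
  have h1 := AdjoinRoot.minpoly_root (irreducible_poly j).ne_zero
  rw [hm.leadingCoeff, inv_one, C_1, mul_one] at h1
  rw [AdjoinRoot.powerBasis_gen]
  exact h1

end RadField

end

section

open Filter Topology

namespace Resid

theorem eq_sq_mul_cube {n : ℕ} (hn : IsPrimePow n) (hp : ¬ n.Prime) :
    ∃ a b : ℕ, n = a ^ 2 * b ^ 3 := by
  obtain ⟨p, k, hpp, hk, rfl⟩ := (isPrimePow_nat_iff n).1 hn
  have hk1 : k ≠ 1 := by
    rintro rfl
    exact hp (by simpa using hpp)
  obtain ⟨i, rfl | rfl⟩ := Nat.even_or_odd' k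
  · exact ⟨p ^ i, 1, by ring⟩
  · obtain ⟨i, rfl⟩ : ∃ l, i = l + 1 := ⟨i - 1, by omega⟩
    exact ⟨p ^ i, p, by ring⟩

theorem summable_indicator {σ : ℝ} (hσ : 1 / 2 < σ) :
    Summable ({n : ℕ | ∃ a b : ℕ, n = a ^ 2 * b ^ 3}.indicator fun n => (n : ℝ) ^ (-σ)) := by
  rw [← summable_subtype_iff_indicator]
  have h2 : Summable fun a : ℕ => (a : ℝ) ^ (-(2 * σ)) := by
    rw [Real.summable_nat_rpow]
    linarith
  have h3 : Summable fun a : ℕ => (a : ℝ) ^ (-(3 * σ)) := by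
    rw [Real.summable_nat_rpow]
    linarith
  have h := h2.mul_of_nonneg h3 (fun a => by positivity) (fun a => by positivity)
  have hex : ∀ n : {n : ℕ | ∃ a b : ℕ, n = a ^ 2 * b ^ 3}, ∃ x : ℕ × ℕ,
      (n : ℕ) = x.1 ^ 2 * x.2 ^ 3 := fun n => by
    obtain ⟨a, b, h⟩ := n.2
    exact ⟨(a, b), h⟩
  choose g hg using hex
  have hinj : Function.Injective g := fun m n hmn => Subtype.ext (by rw [hg m, hg n, hmn])
  refine (h.comp_injective hinj).congr fun n => ?_
  simp only [Function.comp]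
  rw [hg n]
  push_cast
  rw [Real.mul_rpow (by positivity) (by positivity), ← Real.rpow_natCast, ← Real.rpow_natCast,
    ← Real.rpow_mul (by positivity), ← Real.rpow_mul (by positivity)]
  norm_num

variable {e : ℕ → ℂ} {C : ℝ}

theorem norm_logCoeff_le (h : ∀ n, ‖e n‖ ≤ C * ArithmeticFunction.vonMangoldt n)
    (hp : ∀ p : ℕ, p.Prime → e p = 0) (hC : 0 ≤ C) (n : ℕ) :
    ‖IsVM.logCoeff e n‖ ≤ ({n : ℕ | ∃ a b : ℕ, n = a ^ 2 * b ^ 3}.indicator fun _ => C) n := by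
  rw [IsVM.logCoeff]
  by_cases hn : IsPrimePow n
  · by_cases hnp : n.Prime
    · rw [hp n hnp, zero_div, norm_zero]
      exact Set.indicator_nonneg (fun _ _ => hC) _
    · rw [Set.indicator_of_mem (show n ∈ {n : ℕ | ∃ a b : ℕ, n = a ^ 2 * b ^ 3} from
        eq_sq_mul_cube hn hnp)]
      have h1 : 1 < n := hn.one_lt
      have hl : 0 < Real.log n := Real.log_pos (by exact_mod_cast h1)
      rw [norm_div, ← Complex.natCast_log, Complex.norm_real, Real.norm_of_nonneg hl.le,
        div_le_iff₀ hl]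
      exact (h n).trans (mul_le_mul_of_nonneg_left ArithmeticFunction.vonMangoldt_le_log hC)
  · have : e n = 0 := by
      have := h n
      rw [ArithmeticFunction.vonMangoldt_eq_zero_iff.2 hn, mul_zero] at this
      exact norm_le_zero_iff.1 this
    rw [this, zero_div, norm_zero]
    exact Set.indicator_nonneg (fun _ _ => hC) _

theorem differentiableOn (h : ∀ n, ‖e n‖ ≤ C * ArithmeticFunction.vonMangoldt n)
    (hp : ∀ p : ℕ, p.Prime → e p = 0) :
    DifferentiableOn ℂ (LSeries (IsVM.logCoeff e)) {s | 1 / 2 < s.re} := by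
  have hC : 0 ≤ C := by
    have h2 := (norm_nonneg _).trans (h 2)
    rw [ArithmeticFunction.vonMangoldt_apply_prime Nat.prime_two] at h2
    have : 0 < Real.log ((2 : ℕ) : ℝ) := Real.log_pos (by norm_num)
    exact nonneg_of_mul_nonneg_left h2 this
  have key : LSeries.abscissaOfAbsConv (IsVM.logCoeff e) ≤ ((1 / 2 : ℝ) : EReal) := by
    refine LSeries.abscissaOfAbsConv_le_of_forall_lt_LSeriesSummable fun σ hσ => ?_
    refine Summable.of_norm_bounded ((summable_indicator hσ).mul_left C) fun n => ?_
    rw [LSeries.norm_term_eq]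
    split_ifs with hn
    · exact mul_nonneg hC (Set.indicator_nonneg (fun _ _ => by positivity) _)
    · rw [Complex.ofReal_re, div_eq_mul_inv, ← Real.rpow_neg (by positivity)]
      refine (mul_le_mul_of_nonneg_right (norm_logCoeff_le h hp hC n) (by positivity)).trans ?_
      by_cases hm : n ∈ {n : ℕ | ∃ a b : ℕ, n = a ^ 2 * b ^ 3}
      · rw [Set.indicator_of_mem hm, Set.indicator_of_mem hm]
      · rw [Set.indicator_of_notMem hm, Set.indicator_of_notMem hm, zero_mul, mul_zero]
  refine (LSeries_differentiableOn _).mono fun s hs => ?_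
  exact key.trans_lt (by exact_mod_cast hs)

end Resid

end

section

namespace RootNum

section Cyclic

variable {G : Type*} [CommGroup G] [IsCyclic G] [Finite G]

theorem range_pow_eq {d : ℕ} (hd : d ∣ Nat.card G) :
    (powMonoidHom d : G →* G).range = (powMonoidHom (Nat.card G / d) : G →* G).ker := by
  refine Subgroup.eq_of_le_of_card_ge ?_ ?_
  · rintro _ ⟨x, rfl⟩
    rw [MonoidHom.mem_ker, powMonoidHom_apply, powMonoidHom_apply, ← pow_mul,
      Nat.mul_div_cancel' hd, pow_card_eq_one']
  · rw [IsCyclic.card_powMonoidHom_ker, IsCyclic.card_powMonoidHom_range,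
      Nat.gcd_eq_right (Nat.div_dvd_of_dvd hd), Nat.gcd_eq_right hd]

theorem card_pow_eq (n : ℕ) (a : G) :
    Nat.card {x : G // x ^ n = a} = if ∃ y : G, y ^ n = a then (Nat.card G).gcd n else 0 := by
  split_ifs with h
  · obtain ⟨y, rfl⟩ := h
    rw [← IsCyclic.card_powMonoidHom_ker]
    refine Nat.card_congr ⟨fun x => ⟨x * y⁻¹, ?_⟩, fun x => ⟨x * y, ?_⟩, fun x => ?_, fun x => ?_⟩
    · rw [MonoidHom.mem_ker, powMonoidHom_apply, mul_pow, x.2, inv_pow, mul_inv_cancel]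
    · have := x.2
      rw [MonoidHom.mem_ker, powMonoidHom_apply] at this
      rw [mul_pow, this, one_mul]
    · ext
      simp
    · ext
      simp
  · rw [Nat.card_eq_zero]
    left
    exact ⟨fun x => h ⟨x, x.2⟩⟩

theorem gcd_two_pow {N : ℕ} (hN : N ≠ 0) (j : ℕ) :
    N.gcd (2 ^ j) = 2 ^ min j (padicValNat 2 N) := by
  have h1 : N.gcd (2 ^ j) ∣ 2 ^ j := Nat.gcd_dvd_right _ _
  obtain ⟨i, hi, he⟩ := (Nat.dvd_prime_pow Nat.prime_two).1 h1
  rw [he]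
  congr 1
  have h2 : 2 ^ i ∣ N := he ▸ Nat.gcd_dvd_left _ _
  rw [padicValNat_dvd_iff_le hN] at h2
  refine le_antisymm (le_min hi h2) ?_
  rw [← Nat.pow_dvd_pow_iff_le_right (le_refl 2), ← he]
  refine Nat.dvd_gcd ?_ (pow_dvd_pow _ (min_le_left _ _))
  exact (padicValNat_dvd_iff_le hN).2 (min_le_right _ _)

theorem exists_pow_iff (a : G) (j : ℕ) : (∃ y : G, y ^ 2 ^ j = a) ↔
    padicValNat 2 (orderOf a) + min j (padicValNat 2 (Nat.card G)) ≤
      padicValNat 2 (Nat.card G) := by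
  have hN : Nat.card G ≠ 0 := Nat.card_pos.ne'
  obtain ⟨v, hv⟩ : ∃ v, v = padicValNat 2 (Nat.card G) := ⟨_, rfl⟩
  have hd : 2 ^ min j v ∣ Nat.card G := by
    rw [padicValNat_dvd_iff_le hN, ← hv]
    exact min_le_right _ _
  have h1 : (∃ y : G, y ^ 2 ^ j = a) ↔ a ∈ (powMonoidHom (2 ^ min j v) : G →* G).range := by
    have : (powMonoidHom (2 ^ j) : G →* G).range = (powMonoidHom (2 ^ min j v)).range := by
      refine Subgroup.eq_of_le_of_card_ge ?_ ?_
      · rintro _ ⟨x, rfl⟩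
        refine ⟨x ^ 2 ^ (j - min j v), ?_⟩
        rw [powMonoidHom_apply, powMonoidHom_apply, ← pow_mul, ← pow_add,
          Nat.sub_add_cancel (min_le_left _ _)]
      · rw [IsCyclic.card_powMonoidHom_range, IsCyclic.card_powMonoidHom_range,
          gcd_two_pow hN, gcd_two_pow hN, ← hv, min_assoc, min_self]
    rw [← this]
    rfl
  rw [h1, range_pow_eq hd, MonoidHom.mem_ker, powMonoidHom_apply, ← orderOf_dvd_iff_pow_eq_one,
    ← hv]
  obtain ⟨c, hc⟩ := hd
  have hc0 : c ≠ 0 := by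
    rintro rfl
    exact hN (by simpa using hc)
  have hvc : v = min j v + padicValNat 2 c := by
    conv_lhs => rw [hv, hc, padicValNat.mul (by positivity) hc0, padicValNat.prime_pow]
  rw [hc, Nat.mul_div_cancel_left _ (by positivity)]
  have hw0 : orderOf a ≠ 0 := (orderOf_pos a).ne'
  constructor
  · intro h
    have := (padicValNat_dvd_iff_le (p := 2) hc0).1 ((pow_padicValNat_dvd).trans h)
    omega
  · intro h
    obtain ⟨u, hu⟩ := pow_padicValNat_dvd (p := 2) (n := orderOf a)
    have hu2 : ¬ 2 ∣ u := by
      intro h2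
      refine pow_succ_padicValNat_not_dvd (p := 2) hw0 ?_
      rw [pow_succ]
      conv_rhs => rw [hu]
      exact mul_dvd_mul_left _ h2
    rw [hu]
    refine Nat.Coprime.mul_dvd_of_dvd_of_dvd ?_ ?_ ?_
    · exact Nat.Coprime.pow_left _ ((Nat.Prime.coprime_iff_not_dvd Nat.prime_two).2 hu2)
    · rw [padicValNat_dvd_iff_le hc0]
      omega
    · have h3 : u ∣ 2 ^ min j v * c :=
        hc ▸ (Dvd.intro_left _ hu.symm).trans (orderOf_dvd_natCard a)
      exact (Nat.Coprime.pow_right _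
        ((Nat.Prime.coprime_iff_not_dvd Nat.prime_two).2 hu2).symm).dvd_of_dvd_mul_left h3

end Cyclic

/-- The number of roots of `x ^ 2 ^ j + 2` modulo `p`. -/
noncomputable def N (j p : ℕ) : ℕ := Nat.card {x : ZMod p // x ^ 2 ^ j = -2}

variable {p : ℕ} [hp : Fact p.Prime]

theorem N_eq (h2 : p ≠ 2) (j : ℕ) :
    N j p = if padicValNat 2 (orderOf (-2 : ZMod p)) + min j (padicValNat 2 (p - 1)) ≤
      padicValNat 2 (p - 1) then 2 ^ min j (padicValNat 2 (p - 1)) else 0 := by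
  have h20 : (-2 : ZMod p) ≠ 0 := by
    intro h
    rw [neg_eq_zero] at h
    have : ((2 : ℕ) : ZMod p) = 0 := by exact_mod_cast h
    rw [ZMod.natCast_eq_zero_iff] at this
    exact h2 ((Nat.prime_dvd_prime_iff_eq hp.out Nat.prime_two).1 this)
  obtain ⟨a, ha⟩ : ∃ a : (ZMod p)ˣ, (a : ZMod p) = -2 := ⟨Units.mk0 _ h20, rfl⟩
  have hcard : Nat.card (ZMod p)ˣ = p - 1 := by
    rw [Nat.card_eq_fintype_card, ZMod.card_units]
  have hN : p - 1 ≠ 0 := by have := hp.out.two_le; omega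
  have h1 : N j p = Nat.card {x : (ZMod p)ˣ // x ^ 2 ^ j = a} := by
    have hx0 : ∀ x : {x : ZMod p // x ^ 2 ^ j = -2}, (x : ZMod p) ≠ 0 := fun x h => by
      have := x.2
      rw [h, zero_pow (by positivity)] at this
      exact h20 this.symm
    exact Nat.card_congr
      { toFun := fun x => ⟨Units.mk0 (x : ZMod p) (hx0 x), by
          rw [Units.ext_iff, Units.val_pow_eq_pow_val, Units.val_mk0, x.2, ha]⟩
        invFun := fun x => ⟨((x : (ZMod p)ˣ) : ZMod p), by
          rw [← Units.val_pow_eq_pow_val, x.2, ha]⟩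
        left_inv := fun x => rfl
        right_inv := fun x => Subtype.ext (Units.ext rfl) }
  rw [h1, card_pow_eq, hcard, gcd_two_pow hN]
  simp only [exists_pow_iff]
  rw [hcard, ← ha, orderOf_units]

theorem padicVal_le_iff {a : ZMod p} {v u : ℕ} (hu : ¬ 2 ∣ u) (h : p - 1 = 2 ^ v * u)
    (ha : a ≠ 0) (t : ℕ) : padicValNat 2 (orderOf a) ≤ t ↔ a ^ (2 ^ t * u) = 1 := by
  have hd : orderOf a ∣ 2 ^ v * u := by
    rw [← h]
    exact orderOf_dvd_of_pow_eq_one (ZMod.pow_card_sub_one_eq_one ha)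
  have hu0 : u ≠ 0 := by
    rintro rfl
    exact hu (dvd_zero _)
  have ho : orderOf a ≠ 0 := fun h0 => by
    rw [h0, zero_dvd_iff] at hd
    have : 0 < 2 ^ v * u := by positivity
    omega
  rw [← orderOf_dvd_iff_pow_eq_one]
  obtain ⟨c, hc⟩ := pow_padicValNat_dvd (p := 2) (n := orderOf a)
  have hc2 : ¬ 2 ∣ c := by
    intro h2
    refine pow_succ_padicValNat_not_dvd (p := 2) ho ?_
    rw [pow_succ]
    conv_rhs => rw [hc]
    exact mul_dvd_mul_left _ h2
  have hcop : ∀ {c t : ℕ}, ¬ 2 ∣ c → Nat.Coprime (2 ^ t) c := fun h =>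
    Nat.Coprime.pow_left _ ((Nat.Prime.coprime_iff_not_dvd Nat.prime_two).2 h)
  constructor
  · intro ht
    rw [hc]
    exact mul_dvd_mul (pow_dvd_pow _ ht)
      ((hcop hc2).symm.dvd_of_dvd_mul_left ((Dvd.intro_left _ hc.symm).trans hd))
  · intro hd'
    rw [← Nat.pow_dvd_pow_iff_le_right (le_refl 2)]
    exact (hcop hu).dvd_of_dvd_mul_right (pow_padicValNat_dvd.trans hd')

theorem two_ne_zero' (h2 : p ≠ 2) : (2 : ZMod p) ≠ 0 := by
  intro h
  have : ((2 : ℕ) : ZMod p) = 0 := by exact_mod_cast h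
  rw [ZMod.natCast_eq_zero_iff] at this
  exact h2 ((Nat.prime_dvd_prime_iff_eq hp.out Nat.prime_two).1 this)

theorem exists_odd_part (p : ℕ) (hp : 2 ≤ p) :
    ∃ u, ¬ 2 ∣ u ∧ p - 1 = 2 ^ padicValNat 2 (p - 1) * u := by
  obtain ⟨u, hu⟩ := pow_padicValNat_dvd (p := 2) (n := p - 1)
  refine ⟨u, fun h => ?_, hu⟩
  refine pow_succ_padicValNat_not_dvd (p := 2) (n := p - 1) (by omega) ?_
  rw [pow_succ]
  conv_rhs => rw [hu]
  exact mul_dvd_mul_left _ h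

theorem val_two_iff (h2 : p ≠ 2) : ∀ t, 1 ≤ t →
    (padicValNat 2 (orderOf (2 : ZMod p)) ≤ t ↔ padicValNat 2 (orderOf (-2 : ZMod p)) ≤ t) := by
  intro t ht
  obtain ⟨u, hu, h⟩ := exists_odd_part p hp.out.two_le
  have h20 := two_ne_zero' h2
  rw [padicVal_le_iff hu h h20, padicVal_le_iff hu h (neg_ne_zero.2 h20), Even.neg_pow]
  exact (Even.pow_of_ne_zero even_two (by omega)).mul_right u

theorem val_eq_one_iff (h2 : p ≠ 2) : padicValNat 2 (orderOf (2 : ZMod p)) = 1 ↔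
    padicValNat 2 (orderOf (-2 : ZMod p)) = 0 := by
  obtain ⟨u, hu, h⟩ := exists_odd_part p hp.out.two_le
  have h20 := two_ne_zero' h2
  have hn : (-1 : ZMod p) ≠ 1 := by
    intro h
    apply h20
    linear_combination -h
  have e1 : padicValNat 2 (orderOf (2 : ZMod p)) = 1 ↔
      (padicValNat 2 (orderOf (2 : ZMod p)) ≤ 1 ∧ ¬ padicValNat 2 (orderOf (2 : ZMod p)) ≤ 0) := by
    omega
  rw [e1, ← Nat.le_zero, padicVal_le_iff hu h h20, padicVal_le_iff hu h h20,
    padicVal_le_iff hu h (neg_ne_zero.2 h20), pow_zero, one_mul, pow_one,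
    Odd.neg_pow (by rwa [← Nat.not_even_iff_odd, even_iff_two_dvd]), mul_comm, pow_mul]
  constructor
  · rintro ⟨ha, hb⟩
    rw [sq, mul_self_eq_one_iff] at ha
    rcases ha with h' | h'
    · exact absurd h' hb
    · rw [h', neg_neg]
  · intro ha
    have : (2 : ZMod p) ^ u = -1 := by rw [← ha, neg_neg]
    rw [this]
    exact ⟨by norm_num, hn⟩

theorem dvd_sub_one_iff (s : ℕ) : s ≤ padicValNat 2 (p - 1) ↔ 2 ^ s ∣ p - 1 := by
  rw [padicValNat_dvd_iff_le (by have := hp.out.two_le; omega)]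

theorem val_neg_two_le (h2 : p ≠ 2) :
    padicValNat 2 (orderOf (-2 : ZMod p)) ≤ padicValNat 2 (p - 1) := by
  rw [dvd_sub_one_iff]
  exact pow_padicValNat_dvd.trans (orderOf_dvd_of_pow_eq_one
    (ZMod.pow_card_sub_one_eq_one (neg_ne_zero.2 (two_ne_zero' h2))))

theorem one_le_val (h2 : p ≠ 2) : 1 ≤ padicValNat 2 (p - 1) := by
  rw [dvd_sub_one_iff, pow_one]
  have := hp.out.eq_two_or_odd
  have := hp.out.two_le
  omega

theorem isSquare_iff (h2 : p ≠ 2) : IsSquare (-2 : ZMod p) ↔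
    padicValNat 2 (orderOf (-2 : ZMod p)) + 1 ≤ padicValNat 2 (p - 1) := by
  have h1 : IsSquare (-2 : ZMod p) ↔ N 1 p ≠ 0 := by
    rw [N, Nat.card_ne_zero, pow_one]
    refine ⟨fun ⟨y, hy⟩ => ⟨⟨y, by rw [hy, sq]⟩, inferInstance⟩, fun ⟨⟨y, hy⟩, _⟩ => ⟨y, ?_⟩⟩
    rw [← hy, sq]
  rw [h1, N_eq h2, min_eq_left (one_le_val h2)]
  split_ifs with h <;> simp [h]

end RootNum

end

section

open NumberField Module ClassCount CharSum LTil Filter Topology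

namespace RealZero

theorem vmChar {M : ℕ} (χ : DirichletCharacter ℂ M) :
    IsVM (fun n => χ n) (fun n => χ n * (ArithmeticFunction.vonMangoldt n : ℂ)) := by
  have := IsVM.isVM_one.twist χ
  simpa using this

/-- The quadratic characters of conductors `8`, `8`, `4`. -/
noncomputable def c8 : DirichletCharacter ℂ 8 := ZMod.χ₈.ringHomComp (Int.castRingHom ℂ)

/-- The quadratic character of conductor `8` with `d8 (-1) = -1`. -/
noncomputable def d8 : DirichletCharacter ℂ 8 := ZMod.χ₈'.ringHomComp (Int.castRingHom ℂ)

/-- The quadratic character of conductor `4`. -/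
noncomputable def c4 : DirichletCharacter ℂ 4 := ZMod.χ₄.ringHomComp (Int.castRingHom ℂ)

theorem c8_apply (n : ℕ) :
    c8 n = if n % 2 = 0 then 0 else if n % 8 = 1 ∨ n % 8 = 7 then 1 else -1 := by
  rw [c8, MulChar.ringHomComp_apply, ZMod.χ₈_nat_eq_if_mod_eight]
  split_ifs <;> simp

theorem d8_apply (n : ℕ) :
    d8 n = if n % 2 = 0 then 0 else if n % 8 = 1 ∨ n % 8 = 3 then 1 else -1 := by
  rw [d8, MulChar.ringHomComp_apply, ZMod.χ₈'_nat_eq_if_mod_eight]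
  split_ifs <;> simp

theorem c4_apply (n : ℕ) :
    c4 n = if n % 2 = 0 then 0 else if n % 4 = 1 then 1 else -1 := by
  rw [c4, MulChar.ringHomComp_apply, ZMod.χ₄_nat_eq_if_mod_four]
  split_ifs <;> simp

theorem ne_one_of_three {M : ℕ} {χ : DirichletCharacter ℂ M} (h : χ ((3 : ℕ) : ZMod M) = -1) :
    χ ≠ 1 := by
  rintro rfl
  by_cases h3 : IsUnit ((3 : ℕ) : ZMod M)
  · rw [MulChar.one_apply h3] at h
    norm_num at h
  · rw [MulChar.map_nonunit _ h3] at h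
    norm_num at h

theorem c8_ne : c8 ≠ 1 := ne_one_of_three (by rw [c8_apply]; norm_num)

theorem c4_ne : c4 ≠ 1 := ne_one_of_three (by rw [c4_apply]; norm_num)

theorem d8_ne : d8 ≠ 1 := by
  intro h
  have h5 := d8_apply 5
  rw [h, MulChar.one_apply] at h5
  · norm_num at h5
  · exact (ZMod.isUnit_iff_coprime 5 8).2 (by norm_num)

section Chars

variable {m : ℕ}

theorem eq_of_three {ψ ψ' : DirichletCharacter ℂ (2 ^ (m + 2))} (h : ψ.Even) (h' : ψ'.Even)
    (h3 : ψ 3 = ψ' 3) : ψ = ψ' := by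
  refine MulChar.ext fun a => ?_
  obtain ⟨i, hi | hi⟩ := UnitsThree.exists_pow a.isUnit
  · rw [hi, map_pow, map_pow, h3]
  · have e1 : ψ (-1) = 1 := h
    have e2 : ψ' (-1) = 1 := h'
    rw [hi, ← neg_one_mul, map_mul, map_mul, map_pow, map_pow, h3, e1, e2]

theorem isUnit_three : IsUnit (3 : ZMod (2 ^ (m + 2))) := by
  have := (ZMod.isUnit_iff_coprime 3 (2 ^ (m + 2))).2 (Nat.Coprime.pow_right _ (by norm_num))
  exact_mod_cast this

theorem three_of_real {ψ : DirichletCharacter ℂ (2 ^ (m + 2))} (h : ψ⁻¹ = ψ) :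
    ψ 3 = 1 ∨ ψ 3 = -1 := by
  have h1 : ψ 3 * ψ 3 = 1 := by
    have : (ψ * ψ⁻¹) 3 = 1 := by rw [mul_inv_cancel, MulChar.one_apply isUnit_three]
    rwa [h, MulChar.mul_apply] at this
  exact mul_self_eq_one_iff.1 h1

theorem one_even : (1 : DirichletCharacter ℂ (2 ^ (m + 2))).Even :=
  MulChar.one_apply isUnit_one.neg

/-- The even quadratic character of conductor `8`. -/
noncomputable def ψ8 (m : ℕ) (hm : 1 ≤ m) : DirichletCharacter ℂ (2 ^ (m + 2)) :=
  DirichletCharacter.changeLevel (show 8 ∣ 2 ^ (m + 2) from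
    (by norm_num : 8 = 2 ^ 3) ▸ pow_dvd_pow 2 (by omega)) c8

theorem ψ8_apply (hm : 1 ≤ m) (n : ℕ) : ψ8 m hm n = c8 n := by
  rcases Nat.even_or_odd n with he | ho
  · have h0 : c8 n = 0 := by
      rw [c8_apply, if_pos (Nat.even_iff.1 he)]
    rw [h0]
    refine MulChar.map_nonunit _ fun h => ?_
    rw [ZMod.isUnit_iff_coprime] at h
    exact Nat.not_odd_iff_even.2 he ((Nat.coprime_two_right).1
      (h.coprime_dvd_right (dvd_pow_self 2 (by omega))))
  · have hc : IsCoprime (n : ℤ) ((2 ^ (m + 2) : ℕ) : ℤ) := by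
      rw [Nat.isCoprime_iff_coprime]
      exact Nat.Coprime.pow_right _ (Nat.coprime_two_right.2 ho)
    have := DirichletCharacter.changeLevel_eq_cast_of_dvd' c8 (show 8 ∣ 2 ^ (m + 2) from
      (by norm_num : 8 = 2 ^ 3) ▸ pow_dvd_pow 2 (by omega)) hc
    rw [Int.cast_natCast, Int.cast_natCast] at this
    exact this

theorem ψ8_even (hm : 1 ≤ m) : (ψ8 m hm).Even := by
  have h := ψ8_apply hm (2 ^ (m + 2) - 1)
  have hp : 1 ≤ 2 ^ (m + 2) := Nat.one_le_two_pow
  have h8 : (2 ^ (m + 2) - 1) % 8 = 7 := by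
    obtain ⟨i, rfl⟩ : ∃ i, m = i + 1 := ⟨m - 1, by omega⟩
    have : 1 ≤ 2 ^ i := Nat.one_le_two_pow
    have e : 2 ^ (i + 1 + 2) = 2 ^ i * 8 := by ring
    omega
  rw [c8_apply, if_neg (by omega), if_pos (by omega), Nat.cast_sub hp, ZMod.natCast_self,
    zero_sub, Nat.cast_one] at h
  exact h

theorem ψ8_three (hm : 1 ≤ m) : ψ8 m hm 3 = -1 := by
  have h := ψ8_apply hm 3
  rw [c8_apply] at h
  norm_num at h
  exact h

theorem ψ8_ne (hm : 1 ≤ m) : ψ8 m hm ≠ 1 :=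
  ne_one_of_three (by exact_mod_cast ψ8_three hm)

theorem real_even {ψ : DirichletCharacter ℂ (2 ^ (m + 2))} (h : ψ.Even) (hr : ψ⁻¹ = ψ) :
    ψ = 1 ∨ ∃ hm : 1 ≤ m, ψ = ψ8 m hm := by
  rcases three_of_real hr with h3 | h3
  · left
    refine eq_of_three h one_even ?_
    rw [h3, MulChar.one_apply isUnit_three]
  · rcases Nat.eq_zero_or_pos m with rfl | hm
    · exfalso
      have h1 : ψ (-1) = 1 := h
      have h2 : (-1 : ZMod (2 ^ (0 + 2))) = 3 := by decide
      rw [h2, h3] at h1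
      norm_num at h1
    · right
      exact ⟨hm, eq_of_three h (ψ8_even hm) (by rw [h3, ψ8_three])⟩

end Chars

theorem lam_RK (j : ℕ) {p : ℕ} (hp : p.Prime) (h2 : p ≠ 2) :
    IdealVM.lam (RadField.RK j) p = RootNum.N j p * Real.log p := by
  have : Fact p.Prime := ⟨hp⟩
  have hd : ¬ p ∣ 2 ^ j := fun h =>
    h2 ((Nat.prime_dvd_prime_iff_eq hp Nat.prime_two).1 (hp.dvd_of_dvd_pow h))
  rw [IdealVM.lam_prime hp, (RadField.isRad j).idealCount_eq h2 hd, RootNum.N,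
    Nat.card_eq_fintype_card, Fintype.card_subtype]

theorem finrank_RK (j : ℕ) : finrank ℚ (RadField.RK j) = 2 ^ j := (RadField.isRad j).finrank_eq

theorem N_of_three {p : ℕ} [hp : Fact p.Prime] (h : p % 8 = 3) {j : ℕ} (hj : 1 ≤ j) :
    RootNum.N j p = 2 := by
  have h2 : p ≠ 2 := by rintro rfl; norm_num at h
  have hv : padicValNat 2 (p - 1) = 1 := by
    have h1 := RootNum.one_le_val h2
    have h3 := (RootNum.dvd_sub_one_iff (p := p) 2).not.2 (by omega)
    omega
  have hs := (RootNum.isSquare_iff h2).1 ((ZMod.exists_sq_eq_neg_two_iff h2).2 (Or.inr h))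
  rw [RootNum.N_eq h2, hv, min_eq_right hj, if_pos (by omega), pow_one]

theorem N_of_not {p : ℕ} [hp : Fact p.Prime] (h2 : p ≠ 2) (h : p % 8 = 5 ∨ p % 8 = 7) {j : ℕ}
    (hj : 1 ≤ j) : RootNum.N j p = 0 := by
  have hs := (RootNum.isSquare_iff h2).not.1 ((ZMod.exists_sq_eq_neg_two_iff h2).not.2 (by omega))
  have h1 := RootNum.one_le_val h2
  have hm : 1 ≤ min j (padicValNat 2 (p - 1)) := le_min hj h1
  rw [RootNum.N_eq h2, if_neg (by omega)]

theorem N_zero {p : ℕ} : RootNum.N 0 p = 1 := by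
  rw [RootNum.N, Nat.card_eq_one_iff_unique]
  refine ⟨⟨fun x y => Subtype.ext ?_⟩, ⟨⟨-2, by simp⟩⟩⟩
  have hx := x.2
  have hy := y.2
  simp only [pow_zero, pow_one] at hx hy
  rw [hx, hy]

end RealZero

end

section

open NumberField Module ClassCount CharSum LTil Filter Topology RealZero

namespace RealExp

open IsVM

theorem norm_mul_vm_le {M : ℕ} (χ : DirichletCharacter ℂ M) (n : ℕ) :
    ‖χ n * (ArithmeticFunction.vonMangoldt n : ℂ)‖ ≤ ArithmeticFunction.vonMangoldt n := by
  rw [norm_mul, Complex.norm_real, Real.norm_of_nonneg ArithmeticFunction.vonMangoldt_nonneg]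
  exact mul_le_of_le_one_left ArithmeticFunction.vonMangoldt_nonneg (χ.norm_le_one _)

theorem norm_mul_lam_le {M : ℕ} (χ : DirichletCharacter ℂ M) (j n : ℕ) :
    ‖χ n * (IdealVM.lam (RadField.RK j) n : ℂ)‖ ≤
      2 ^ j * ArithmeticFunction.vonMangoldt n := by
  rw [norm_mul, Complex.norm_real, Real.norm_of_nonneg (IdealVM.lam_nonneg n)]
  refine (mul_le_of_le_one_left (IdealVM.lam_nonneg n) (χ.norm_le_one _)).trans ?_
  have := IdealVM.lam_le (K := RadField.RK j) n
  rw [finrank_RK] at this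
  exact_mod_cast this

theorem LSeries_logCoeff_add {f g : ℕ → ℂ} {s : ℂ} (hf : LSeriesSummable (logCoeff f) s)
    (hg : LSeriesSummable (logCoeff g) s) :
    LSeriesSummable (logCoeff (fun n => f n + g n)) s ∧
    LSeries (logCoeff (fun n => f n + g n)) s = LSeries (logCoeff f) s + LSeries (logCoeff g) s := by
  have : logCoeff (fun n => f n + g n) = logCoeff f + logCoeff g := by
    ext n
    simp only [logCoeff, Pi.add_apply]
    ring
  rw [this]
  exact ⟨hf.add hg, LSeries_add hf hg⟩

theorem LSeries_logCoeff_sub {f g : ℕ → ℂ} {s : ℂ} (hf : LSeriesSummable (logCoeff f) s)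
    (hg : LSeriesSummable (logCoeff g) s) :
    LSeriesSummable (logCoeff (fun n => f n - g n)) s ∧
    LSeries (logCoeff (fun n => f n - g n)) s = LSeries (logCoeff f) s - LSeries (logCoeff g) s := by
  have : logCoeff (fun n => f n - g n) = logCoeff f - logCoeff g := by
    ext n
    simp only [logCoeff, Pi.sub_apply]
    ring
  rw [this]
  exact ⟨hf.sub hg, LSeries_sub hf hg⟩

variable {m : ℕ}

theorem even_apply_two {M : ℕ} (hM : 2 ∣ M) (χ : DirichletCharacter ℂ M) : χ (2 : ℕ) = 0 := by
  refine MulChar.map_nonunit _ fun h => ?_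
  rw [ZMod.isUnit_iff_coprime] at h
  have := Nat.Coprime.eq_one_of_dvd h hM
  omega

theorem dvd_two_pow (m : ℕ) : 2 ∣ 2 ^ (m + 2) := dvd_pow_self 2 (by omega)

/-- The difference of the von Mangoldt coefficients of the two sides. -/
noncomputable def diffA (j m : ℕ) (hm : 1 ≤ m) (n : ℕ) : ℂ :=
  ((((1 : DirichletCharacter ℂ (2 ^ (m + 2))) n * (IdealVM.lam (RadField.RK j) n : ℂ) +
    c8 n * (ArithmeticFunction.vonMangoldt n : ℂ)) +
    c4 n * (ArithmeticFunction.vonMangoldt n : ℂ)) -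
    ψ8 m hm n * (IdealVM.lam (RadField.RK j) n : ℂ)) -
    (1 : DirichletCharacter ℂ 2) n * (ArithmeticFunction.vonMangoldt n : ℂ) -
    d8 n * (ArithmeticFunction.vonMangoldt n : ℂ)

theorem one_apply_odd {M p : ℕ} (h : Nat.Coprime p M) : (1 : DirichletCharacter ℂ M) p = 1 :=
  MulChar.one_apply ((ZMod.isUnit_iff_coprime _ _).2 h)

theorem diffA_prime {j : ℕ} (hj : 1 ≤ j) (hm : 1 ≤ m) (p : ℕ) (hp : p.Prime) :
    diffA j m hm p = 0 := by
  rw [diffA]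
  rcases eq_or_ne p 2 with rfl | h2
  · rw [even_apply_two (dvd_two_pow m), even_apply_two (dvd_two_pow m),
      even_apply_two (by norm_num), even_apply_two (by norm_num), even_apply_two (by norm_num),
      even_apply_two (by norm_num)]
    ring
  · have hf : Fact p.Prime := ⟨hp⟩
    have ho : p % 2 = 1 := hp.eq_two_or_odd.resolve_left h2
    have hc : Nat.Coprime p 2 := Nat.coprime_two_right.2 (Nat.odd_iff.2 ho)
    rw [one_apply_odd (hc.pow_right _), one_apply_odd hc, ψ8_apply, c8_apply, d8_apply, c4_apply,
      ArithmeticFunction.vonMangoldt_apply_prime hp, lam_RK j hp h2]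
    push_cast
    have h8 : p % 8 = 1 ∨ p % 8 = 3 ∨ p % 8 = 5 ∨ p % 8 = 7 := by omega
    rcases h8 with h | h | h | h
    · have h4 : p % 4 = 1 := by omega
      simp only [ho, h, h4]
      norm_num
      ring
    · have h4 : p % 4 = 3 := by omega
      simp only [ho, h, h4, N_of_three h hj]
      norm_num
      ring
    · have h4 : p % 4 = 1 := by omega
      simp only [ho, h, h4, N_of_not h2 (Or.inl h) hj]
      norm_num
    · have h4 : p % 4 = 3 := by omega
      simp only [ho, h, h4, N_of_not h2 (Or.inr h) hj]
      norm_num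

theorem norm_diffA_le (j : ℕ) (hm : 1 ≤ m) (n : ℕ) :
    ‖diffA j m hm n‖ ≤ (2 * 2 ^ j + 4) * ArithmeticFunction.vonMangoldt n := by
  rw [diffA]
  refine (norm_sub_le_of_le (norm_sub_le_of_le (norm_sub_le_of_le (norm_add_le_of_le
    (norm_add_le_of_le (norm_mul_lam_le 1 j n) (norm_mul_vm_le c8 n)) (norm_mul_vm_le c4 n))
    (norm_mul_lam_le (ψ8 m hm) j n)) (norm_mul_vm_le 1 n)) (norm_mul_vm_le d8 n)).trans
    (le_of_eq (by ring))

theorem exp_diffA (j : ℕ) (hm : 1 ≤ m) {s : ℂ} (hs : 1 < s.re) :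
    LSeries (coef (RadField.RK j) (1 : DirichletCharacter ℂ (2 ^ (m + 2)))) s *
      LSeries (fun n => c8 n) s * LSeries (fun n => c4 n) s =
    Complex.exp (LSeries (logCoeff (diffA j m hm)) s) *
      (LSeries (coef (RadField.RK j) (ψ8 m hm)) s *
        LSeries (fun n => (1 : DirichletCharacter ℂ 2) n) s * LSeries (fun n => d8 n) s) := by
  have h1 := LTil.isVM (K := RadField.RK j) (1 : DirichletCharacter ℂ (2 ^ (m + 2)))
  have h2 := vmChar c8
  have h3 := vmChar c4
  have h4 := LTil.isVM (K := RadField.RK j) (ψ8 m hm)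
  have h5 := vmChar (1 : DirichletCharacter ℂ 2)
  have h6 := vmChar d8
  have a1 := LSeries_logCoeff_add (h1.sum_logCoeff s hs) (h2.sum_logCoeff s hs)
  have a2 := LSeries_logCoeff_add a1.1 (h3.sum_logCoeff s hs)
  have a3 := LSeries_logCoeff_sub a2.1 (h4.sum_logCoeff s hs)
  have a4 := LSeries_logCoeff_sub a3.1 (h5.sum_logCoeff s hs)
  have a5 := LSeries_logCoeff_sub a4.1 (h6.sum_logCoeff s hs)
  have e : LSeries (logCoeff (diffA j m hm)) s = _ := a5.2
  rw [e, a4.2, a3.2, a2.2, a1.2, h1.eq_exp hs, h2.eq_exp hs, h3.eq_exp hs, h4.eq_exp hs,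
    h5.eq_exp hs, h6.eq_exp hs]
  simp only [← Complex.exp_add]
  congr 1
  ring

/-- The fixed factor: the product of the `L`-functions not depending on the field. -/
noncomputable def fixL (s : ℂ) : ℂ := c8.LFunction s * c4.LFunction s

/-- The counterpart of `fixL` built from the other two quadratic characters. -/
noncomputable def fixR (s : ℂ) : ℂ := DirichletCharacter.LFunctionTrivChar₁ 2 s * d8.LFunction s

theorem differentiable_fixL : Differentiable ℂ fixL :=
  (DirichletCharacter.differentiable_LFunction c8_ne).mul
    (DirichletCharacter.differentiable_LFunction c4_ne)

theorem differentiable_fixR : Differentiable ℂ fixR :=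
  (DirichletCharacter.differentiable_LFunctionTrivChar₁ 2).mul
    (DirichletCharacter.differentiable_LFunction d8_ne)

theorem fixL_one : fixL 1 ≠ 0 :=
  mul_ne_zero (DirichletCharacter.LFunction_ne_zero_of_one_le_re _ (Or.inl c8_ne) (by simp))
    (DirichletCharacter.LFunction_ne_zero_of_one_le_re _ (Or.inl c4_ne) (by simp))

theorem fixR_one : fixR 1 ≠ 0 :=
  mul_ne_zero (DirichletCharacter.LFunctionTrivChar₁_apply_one_ne_zero 2)
    (DirichletCharacter.LFunction_ne_zero_of_one_le_re _ (Or.inl d8_ne) (by simp))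

theorem trivChar₁_eq {s : ℂ} (hs : 1 < s.re) : DirichletCharacter.LFunctionTrivChar₁ 2 s =
    (s - 1) * LSeries (fun n => (1 : DirichletCharacter ℂ 2) n) s := by
  have h1 : s ≠ 1 := by
    rintro rfl
    simp at hs
  rw [DirichletCharacter.LFunctionTrivChar₁, Function.update_of_ne h1,
    DirichletCharacter.LFunctionTrivChar, DirichletCharacter.LFunction_eq_LSeries _ hs]

theorem eq_on {j : ℕ} (hj : 1 ≤ j) (hm : 1 ≤ m) {G H : ℂ → ℂ}
    (hG : IsCont (RadField.RK j) (1 : DirichletCharacter ℂ (2 ^ (m + 2))) G)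
    (hH : IsCont (RadField.RK j) (ψ8 m hm) H) {s : ℂ} (hs : 1 - 1 / (2 : ℝ) ^ j < s.re) :
    G s * fixL s = Complex.exp (LSeries (logCoeff (diffA j m hm)) s) * (H s * fixR s) := by
  have hj2 : (2 : ℝ) ≤ 2 ^ j := by
    calc (2 : ℝ) = 2 ^ 1 := by norm_num
      _ ≤ 2 ^ j := pow_le_pow_right₀ (by norm_num) hj
  have hc : (1 : ℝ) / 2 ≤ 1 - 1 / 2 ^ j := by
    have : 1 / (2 : ℝ) ^ j ≤ 1 / 2 := by gcongr
    linarith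
  have hd : 1 - 1 / (finrank ℚ (RadField.RK j) : ℝ) = 1 - 1 / (2 : ℝ) ^ j := by
    rw [finrank_RK]
    norm_num
  have hGd := hG.diff
  have hHd := hH.diff
  rw [hd] at hGd hHd
  refine eq_of_halfPlane (c := 1 - 1 / (2 : ℝ) ^ j)
    (f := fun s => G s * fixL s)
    (g := fun s => Complex.exp (LSeries (logCoeff (diffA j m hm)) s) * (H s * fixR s)) ?_ ?_ ?_ ?_
      s hs
  · have : (0 : ℝ) < 1 / 2 ^ j := by positivity
    linarith
  · exact hGd.mul differentiable_fixL.differentiableOn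
  · refine DifferentiableOn.mul (DifferentiableOn.cexp ?_)
      (hHd.mul differentiable_fixR.differentiableOn)
    exact (Resid.differentiableOn (norm_diffA_le j hm) (diffA_prime hj hm)).mono
      fun s hs => lt_of_le_of_lt hc hs
  · intro s hs
    have := exp_diffA j hm hs
    rw [hG.eq s hs, hH.eq s hs, fac, fac, if_pos rfl, if_neg (ψ8_ne hm), fixL, fixR,
      trivChar₁_eq hs, DirichletCharacter.LFunction_eq_LSeries _ hs,
      DirichletCharacter.LFunction_eq_LSeries _ hs, DirichletCharacter.LFunction_eq_LSeries _ hs]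
    linear_combination (s - 1) * this

/-- The coefficients of the difference for the rational field. -/
noncomputable def diffB (m : ℕ) (hm : 1 ≤ m) (n : ℕ) : ℂ :=
  ψ8 m hm n * (IdealVM.lam (RadField.RK 0) n : ℂ) -
    c8 n * (ArithmeticFunction.vonMangoldt n : ℂ)

theorem diffB_prime (hm : 1 ≤ m) (p : ℕ) (hp : p.Prime) : diffB m hm p = 0 := by
  rw [diffB]
  rcases eq_or_ne p 2 with rfl | h2
  · rw [even_apply_two (dvd_two_pow m), even_apply_two (by norm_num)]
    ring
  · rw [ψ8_apply, ArithmeticFunction.vonMangoldt_apply_prime hp, lam_RK 0 hp h2, N_zero]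
    push_cast
    ring

theorem norm_diffB_le (hm : 1 ≤ m) (n : ℕ) :
    ‖diffB m hm n‖ ≤ 2 * ArithmeticFunction.vonMangoldt n := by
  rw [diffB]
  refine (norm_sub_le_of_le (norm_mul_lam_le (ψ8 m hm) 0 n) (norm_mul_vm_le c8 n)).trans
    (le_of_eq (by ring))

theorem eq_on_zero (hm : 1 ≤ m) {H : ℂ → ℂ} (hH : IsCont (RadField.RK 0) (ψ8 m hm) H) {s : ℂ}
    (hs : 1 / 2 < s.re) :
    H s = Complex.exp (LSeries (logCoeff (diffB m hm)) s) * c8.LFunction s := by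
  have hHd := hH.diff
  refine eq_of_halfPlane (c := 1 / 2) (f := H)
    (g := fun s => Complex.exp (LSeries (logCoeff (diffB m hm)) s) * c8.LFunction s) (by norm_num)
      (hHd.mono fun s hs => ?_) ?_ ?_ s hs
  · change 1 - _ < s.re
    have : (1 : ℝ) / 2 < s.re := hs
    rw [finrank_RK]
    norm_num
    linarith
  · exact (DifferentiableOn.cexp (Resid.differentiableOn (norm_diffB_le hm) (diffB_prime hm))).mul
      (DirichletCharacter.differentiable_LFunction c8_ne).differentiableOn
  · intro s hs
    have h2 := vmChar c8
    have h4 := LTil.isVM (K := RadField.RK 0) (ψ8 m hm)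
    have e : LSeries (logCoeff (diffB m hm)) s = _ :=
      (LSeries_logCoeff_sub (h4.sum_logCoeff s hs) (h2.sum_logCoeff s hs)).2
    rw [hH.eq s hs, fac, if_neg (ψ8_ne hm), DirichletCharacter.LFunction_eq_LSeries _ hs, e,
      h4.eq_exp hs, h2.eq_exp hs, ← Complex.exp_add, one_mul, sub_add_cancel]

end RealExp

end

section

open NumberField Module ClassCount CharSum LTil Filter Topology RealZero RealExp

namespace RadGood

/-- A family of continuations of the twisted zeta functions, with growth bounds. -/
structure Fam (j m : ℕ) (κ : ℝ) (G : DirichletCharacter ℂ (2 ^ (m + 2)) → ℂ → ℂ) : Prop where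
  equi : Equi (RadField.RK j) (2 ^ (m + 2)) (8 * ((2 ^ j : ℕ) : ℝ) ^ 2 * 2 ^ (m + 2)) κ
  cont : ∀ ψ, ψ.Even → IsCont (RadField.RK j) ψ (G ψ)
  bound : ∀ ψ, ψ.Even → ∀ s : ℂ, 1 - 1 / (finrank ℚ (RadField.RK j) : ℝ) < s.re →
    ‖G ψ s‖ ≤ (‖s‖ + 1) ^ (Units.rank (RadField.RK j) + 2) * (dens (2 ^ (m + 2)) κ *
      (1 + 8 * ((2 ^ j : ℕ) : ℝ) ^ 2 * 2 ^ (m + 2)) ^ finrank ℚ (RadField.RK j)) *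
      (1 / (s.re - (1 - 1 / (finrank ℚ (RadField.RK j) : ℝ))) + 1)
  one : G 1 1 ≠ 0

theorem two_lt (m : ℕ) : 2 < 2 ^ (m + 2) := by
  have : 1 ≤ 2 ^ m := Nat.one_le_two_pow
  rw [pow_add]
  omega

theorem exists_fam (j m : ℕ) : ∃ κ G, Fam j m κ G := by
  obtain ⟨κ, h⟩ := (RadField.isRad j).exists_equi m
  have H : ∀ ψ : DirichletCharacter ℂ (2 ^ (m + 2)), ∃ G, ψ.Even → _ := fun ψ => by
    by_cases hψ : ψ.Even
    · obtain ⟨G, hG⟩ := exists_isCont h (two_lt m) hψ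
      exact ⟨G, fun _ => hG⟩
    · exact ⟨0, fun h' => absurd h' hψ⟩
  choose G hG using H
  exact ⟨κ, G, h, fun ψ hψ => (hG ψ hψ).1, fun ψ hψ => (hG ψ hψ).2.1,
    (hG 1 one_even).2.2 rfl⟩

theorem Fam.good {j m : ℕ} {κ : ℝ} {G : DirichletCharacter ℂ (2 ^ (m + 2)) → ℂ → ℂ}
    (h : Fam j m κ G) {P : ℝ} (hP : 1000 ≤ P) (hj : 2 ^ j ≤ P) (hm : 2 ^ (m + 2) ≤ P)
    (hd : ∀ β : ℝ, 1 - 1 / P ^ 7 < β → β ≤ 1 → ∀ ψ : DirichletCharacter ℂ (2 ^ (m + 2)),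
      ψ.Even → ψ⁻¹ = ψ → G ψ β = 0 → ∃ ψ', ψ' ≠ ψ ∧ ψ'.Even ∧ G ψ' β = 0) :
    GoodL P (fun s => ∏ ψ ∈ evens (2 ^ (m + 2)), G ψ s)
      (Lam (RadField.RK j) (2 ^ (m + 2))) := by
  refine GoodIns.goodL h.equi (two_lt m) hP ?_ (by exact_mod_cast hm) ?_ h.cont h.bound hd
  · rw [finrank_RK]
    exact_mod_cast hj
  · push_cast
    calc 8 * ((2 : ℝ) ^ j) ^ 2 * 2 ^ (m + 2) ≤ P * P ^ 2 * P := by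
          gcongr
          linarith
      _ = P ^ 4 := by ring

theorem exists_ball {F : ℂ → ℂ} (hF : ContinuousAt F 1) (h : F 1 ≠ 0) :
    ∃ δ > 0, ∀ β : ℝ, 1 - δ < β → β ≤ 1 → F β ≠ 0 := by
  obtain ⟨δ, hδ, H⟩ := Metric.eventually_nhds_iff.1 (hF.eventually_ne h)
  refine ⟨δ, hδ, fun β h1 h2 => H ?_⟩
  rw [dist_eq_norm, ← Complex.ofReal_one, ← Complex.ofReal_sub, Complex.norm_real,
    Real.norm_eq_abs, abs_of_nonpos (by linarith)]
  linarith

theorem inv_pow_le {δ P : ℝ} (hδ : 0 < δ) (hP1 : 1 ≤ P) (hP : 1 / δ ≤ P) : 1 / P ^ 7 ≤ δ := by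
  rw [div_le_iff₀ (by positivity)]
  rw [div_le_iff₀ hδ] at hP
  have : P ≤ P ^ 7 := le_self_pow₀ hP1 (by norm_num)
  nlinarith

theorem _root_.LTil.IsCont.continuousAt {K : Type*} [Field K] [NumberField K] {q : ℕ}
    {ψ : DirichletCharacter ℂ q} {G : ℂ → ℂ} (h : IsCont K ψ G) : ContinuousAt G 1 := by
  have ho : IsOpen {s : ℂ | 1 - 1 / (finrank ℚ K : ℝ) < s.re} :=
    isOpen_lt continuous_const Complex.continuous_re
  refine h.diff.continuousOn.continuousAt (ho.mem_nhds ?_)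
  have hn : (0 : ℝ) < finrank ℚ K := by exact_mod_cast Module.finrank_pos
  have : 0 < 1 / (finrank ℚ K : ℝ) := by positivity
  change _ < (1 : ℂ).re
  rw [Complex.one_re]
  linarith

/-- For fixed fields, none of the factors vanishes close to `1`. -/
theorem good_fixed (j m : ℕ) (hjm : m = 0 ∨ j = 0) : ∃ P0 : ℝ, ∀ P, P0 ≤ P → 2 ^ j ≤ P →
    2 ^ (m + 2) ≤ P → ∃ f, GoodL P f (Lam (RadField.RK j) (2 ^ (m + 2))) := by
  obtain ⟨κ, G, h⟩ := exists_fam j m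
  have key : ∃ δ > 0, ∀ β : ℝ, 1 - δ < β → β ≤ 1 → ∀ ψ : DirichletCharacter ℂ (2 ^ (m + 2)),
      ψ.Even → ψ⁻¹ = ψ → G ψ β ≠ 0 := by
    obtain ⟨δ, hδ, H⟩ := exists_ball (h.cont 1 one_even).continuousAt h.one
    by_cases hm : 1 ≤ m
    · obtain rfl : j = 0 := by omega
      have hc := h.cont _ (ψ8_even hm)
      have h8 : G (ψ8 m hm) 1 ≠ 0 := by
        rw [eq_on_zero hm hc (by norm_num)]
        exact mul_ne_zero (Complex.exp_ne_zero _)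
          (DirichletCharacter.LFunction_ne_zero_of_one_le_re _ (Or.inl c8_ne) (by simp))
      obtain ⟨δ', hδ', H'⟩ := exists_ball hc.continuousAt h8
      refine ⟨min δ δ', lt_min hδ hδ', fun β h1 h2 ψ hψ hr => ?_⟩
      have := min_le_left δ δ'
      have := min_le_right δ δ'
      rcases real_even hψ hr with rfl | ⟨_, rfl⟩
      · exact H β (by linarith) h2
      · exact H' β (by linarith) h2
    · refine ⟨δ, hδ, fun β h1 h2 ψ hψ hr => ?_⟩
      rcases real_even hψ hr with rfl | ⟨hm', rfl⟩
      · exact H β h1 h2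
      · exact absurd hm' hm
  obtain ⟨δ, hδ, H⟩ := key
  refine ⟨max 1000 (1 / δ), fun P hP hj hm => ⟨_, h.good ((le_max_left _ _).trans hP) hj hm ?_⟩⟩
  intro β h1 h2 ψ hψ hr h0
  have hP1 : 1000 ≤ P := (le_max_left _ _).trans hP
  have := inv_pow_le hδ (by linarith) ((le_max_right _ _).trans hP)
  exact absurd h0 (H β (by linarith) h2 ψ hψ hr)

theorem good_large : ∃ P0 : ℝ, ∀ P, P0 ≤ P → ∀ j m : ℕ, 1 ≤ j → 1 ≤ m → 2 ^ j ≤ P →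
    2 ^ (m + 2) ≤ P → ∃ f, GoodL P f (Lam (RadField.RK j) (2 ^ (m + 2))) := by
  obtain ⟨δ, hδ, H⟩ := exists_ball differentiable_fixL.continuous.continuousAt fixL_one
  obtain ⟨δ', hδ', H'⟩ := exists_ball differentiable_fixR.continuous.continuousAt fixR_one
  refine ⟨max 1000 (max (1 / δ) (1 / δ')), fun P hP j m hj1 hm1 hj hm => ?_⟩
  have hP1 : 1000 ≤ P := (le_max_left _ _).trans hP
  have e1 := inv_pow_le hδ (by linarith)
    (((le_max_left _ _).trans (le_max_right _ _)).trans hP)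
  have e2 := inv_pow_le hδ' (by linarith)
    (((le_max_right _ _).trans (le_max_right _ _)).trans hP)
  obtain ⟨κ, G, h⟩ := exists_fam j m
  refine ⟨_, h.good hP1 hj hm ?_⟩
  intro β h1 h2 ψ hψ hr h0
  have hβ : 1 - 1 / (2 : ℝ) ^ j < (β : ℂ).re := by
    rw [Complex.ofReal_re]
    have : 1 / P ^ 7 ≤ 1 / (2 : ℝ) ^ j := by
      gcongr
      exact hj.trans (le_self_pow₀ (by linarith) (by norm_num))
    linarith
  have E := eq_on hj1 hm1 (h.cont 1 one_even) (h.cont _ (ψ8_even hm1)) hβ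
  have n1 := H β (by linarith) h2
  have n2 := H' β (by linarith) h2
  have n3 := Complex.exp_ne_zero (LSeries (IsVM.logCoeff (diffA j m hm1)) β)
  rcases real_even hψ hr with rfl | ⟨_, rfl⟩
  · refine ⟨ψ8 m hm1, ψ8_ne hm1, ψ8_even hm1, ?_⟩
    rw [h0, zero_mul] at E
    have := E.symm
    simpa [n2, n3] using this
  · refine ⟨1, (ψ8_ne hm1).symm, one_even, ?_⟩
    rw [h0, zero_mul, mul_zero] at E
    simpa [n1] using E

end RadGood

end

section

open RealZero LTil

namespace PrimeSum

/-- The normalised number of roots of `x ^ 2 ^ j + 2` modulo a prime `p ≡ ± 1 [MOD 2 ^ (m + 2)]`. -/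
noncomputable def wt (j m p : ℕ) : ℝ :=
  if p.Prime ∧ ((p : ZMod (2 ^ (m + 2))) = 1 ∨ (p : ZMod (2 ^ (m + 2))) = -1) then
    2 ^ m * RootNum.N j p else 0

/-- The pairs for which equidistribution is available. -/
def Adm (j m : ℕ) : Prop := (1 ≤ j ∧ 1 ≤ m) ∨ (m = 0 ∧ j ≤ 1) ∨ (j = 0 ∧ m = 1)

theorem exists_good : ∃ P0 : ℝ, ∀ P, P0 ≤ P → ∀ j m : ℕ, Adm j m → 2 ^ j ≤ P →
    2 ^ (m + 2) ≤ P → ∃ f, GoodL P f (Lam (RadField.RK j) (2 ^ (m + 2))) := by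
  obtain ⟨P1, h1⟩ := RadGood.good_fixed 0 0 (Or.inl rfl)
  obtain ⟨P2, h2⟩ := RadGood.good_fixed 1 0 (Or.inl rfl)
  obtain ⟨P3, h3⟩ := RadGood.good_fixed 0 1 (Or.inr rfl)
  obtain ⟨P4, h4⟩ := RadGood.good_large
  refine ⟨max (max P1 P2) (max P3 P4), fun P hP j m ha hj hm => ?_⟩
  simp only [max_le_iff] at hP
  rcases ha with ⟨a, b⟩ | ⟨rfl, b⟩ | ⟨rfl, rfl⟩
  · exact h4 P hP.2.2 j m a b hj hm
  · interval_cases j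
    · exact h1 P hP.1.1 hj hm
    · exact h2 P hP.1.2 hj hm
  · exact h3 P hP.2.1 hj hm

theorem odd_of_class {m p : ℕ}
    (h : (p : ZMod (2 ^ (m + 2))) = 1 ∨ (p : ZMod (2 ^ (m + 2))) = -1) : p ≠ 2 := by
  rintro rfl
  have hu : IsUnit ((2 : ℕ) : ZMod (2 ^ (m + 2))) := by
    rcases h with h | h <;> rw [h]
    · exact isUnit_one
    · exact isUnit_one.neg
  rw [ZMod.isUnit_iff_coprime] at hu
  have := Nat.Coprime.eq_one_of_dvd hu (RealExp.dvd_two_pow m)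
  omega

theorem totient_eq (m : ℕ) : ((2 ^ (m + 2)).totient : ℝ) / 2 = 2 ^ m := by
  rw [Nat.totient_prime_pow Nat.prime_two (by omega)]
  norm_num
  rw [pow_succ]
  ring

theorem Lam_prime (j m : ℕ) {p : ℕ} (hp : p.Prime) :
    Lam (RadField.RK j) (2 ^ (m + 2)) p = wt j m p * Real.log p := by
  rw [Lam, wt]
  by_cases h : (p : ZMod (2 ^ (m + 2))) = 1 ∨ (p : ZMod (2 ^ (m + 2))) = -1
  · rw [if_pos h, if_pos ⟨hp, h⟩, totient_eq, lam_RK j hp (odd_of_class h), mul_assoc]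
  · rw [if_neg h, if_neg (fun h' => h h'.2), zero_mul]

theorem Lam_le (j m n : ℕ) : |Lam (RadField.RK j) (2 ^ (m + 2)) n| ≤
    2 ^ m * 2 ^ j * ArithmeticFunction.vonMangoldt n := by
  have h0 := ArithmeticFunction.vonMangoldt_nonneg (n := n)
  rw [Lam]
  split_ifs
  · rw [totient_eq, abs_of_nonneg (mul_nonneg (by positivity) (IdealVM.lam_nonneg n)), mul_assoc]
    refine mul_le_mul_of_nonneg_left ?_ (by positivity)
    have := IdealVM.lam_le (K := RadField.RK j) n
    rw [finrank_RK] at this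
    exact_mod_cast this
  · rw [abs_zero]
    positivity

theorem abs_sum_sub_le (j m n : ℕ) :
    |∑ k ∈ Finset.range (n + 1), Lam (RadField.RK j) (2 ^ (m + 2)) k -
      ∑ k ∈ Finset.range (n + 1), wt j m k * Real.log k| ≤
      2 ^ m * 2 ^ j * (Chebyshev.psi n - Chebyshev.theta n) := by
  rw [Chebyshev.psi_eq_sum_Icc, Chebyshev.theta_eq_sum_Icc, Nat.floor_natCast,
    ← Nat.range_succ_eq_Icc_zero, Finset.sum_filter, ← Finset.sum_sub_distrib,
    ← Finset.sum_sub_distrib, Finset.mul_sum]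
  refine (Finset.abs_sum_le_sum_abs _ _).trans (Finset.sum_le_sum fun k _ => ?_)
  split_ifs with hk
  · rw [Lam_prime j m hk, sub_self, abs_zero, ArithmeticFunction.vonMangoldt_apply_prime hk,
      sub_self, mul_zero]
  · rw [wt, if_neg (fun h => hk h.1), zero_mul, sub_zero, sub_zero]
    exact Lam_le j m k

theorem abs_sum_wt_sub_le : ∃ P0 : ℝ, ∀ P, P0 ≤ P → ∀ j m : ℕ, Adm j m → 2 ^ j ≤ P →
    2 ^ (m + 2) ≤ P → ∀ n : ℕ, (n : ℝ) = Real.exp (P ^ 12) →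
    |∑ k ∈ Finset.range (n + 1), wt j m k * Real.log k - n| ≤ 2 * (n / P ^ 2) := by
  obtain ⟨P0, h⟩ := exists_good
  refine ⟨max P0 (10 ^ 6), fun P hP j m ha hj hm n hn => ?_⟩
  have hP1 : 10 ^ 6 ≤ P := (le_max_right _ _).trans hP
  have hP0 : 1 ≤ P := by linarith
  obtain ⟨f, hf⟩ := h P ((le_max_left _ _).trans hP) j m ha hj hm
  have h1 := hf.abs_sum_sub_le hP1 hn
  rw [Nat.floor_natCast] at h1
  have h2 := abs_sum_sub_le j m n
  have hn1 : (1 : ℝ) ≤ n := by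
    rw [hn]
    exact Real.one_le_exp (by positivity)
  have h3 := (le_abs_self _).trans (Chebyshev.abs_psi_sub_theta_le_sqrt_mul_log hn1)
  have hm' : (2 : ℝ) ^ m ≤ P := by
    refine le_trans ?_ hm
    exact pow_le_pow_right₀ (by norm_num) (by omega)
  have h4 : 2 ^ m * 2 ^ j * (Chebyshev.psi n - Chebyshev.theta n) ≤ n / P ^ 2 := by
    calc 2 ^ m * 2 ^ j * (Chebyshev.psi n - Chebyshev.theta n)
        ≤ P * P * (2 * Real.sqrt n * Real.log n) := by
          gcongr
          exact sub_nonneg.2 (Chebyshev.theta_le_psi _)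
      _ = 2 * P ^ 14 * Real.exp (P ^ 12 / 2) := by
          have hs : Real.sqrt (Real.exp (P ^ 12)) = Real.exp (P ^ 12 / 2) := by
            rw [Real.sqrt_eq_iff_eq_sq (by positivity) (by positivity), sq, ← Real.exp_add]
            ring_nf
          rw [hn, Real.log_exp, hs]
          ring
      _ ≤ n / P ^ 2 := by
          rw [hn, le_div_iff₀ (by positivity), show P ^ 12 = P ^ 12 / 2 + P ^ 12 / 2 by ring,
            Real.exp_add, add_halves]
          have h5 := Real.quadratic_le_exp_of_nonneg (x := P ^ 12 / 2) (by positivity)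
          have h6 : 2 * P ^ 16 ≤ Real.exp (P ^ 12 / 2) := by
            refine le_trans ?_ h5
            have h7 : (P ^ 12 / 2) ^ 2 / 2 = P ^ 16 * (P ^ 8 / 8) := by ring
            have h8 : (2 : ℝ) ≤ P ^ 8 / 8 := by
              have : P ≤ P ^ 8 := le_self_pow₀ hP0 (by norm_num)
              linarith
            have h9 : 0 ≤ P ^ 16 * (P ^ 8 / 8 - 2) := by
              apply mul_nonneg (by positivity)
              linarith
            have : 0 ≤ P ^ 12 / 2 := by positivity
            nlinarith
          calc 2 * P ^ 14 * Real.exp (P ^ 12 / 2) * P ^ 2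
              = (2 * P ^ 16) * Real.exp (P ^ 12 / 2) := by ring
            _ ≤ _ := by gcongr
  rw [abs_le] at *
  constructor <;> linarith [h1.1, h1.2, h2.1, h2.2]

end PrimeSum

end

section

namespace Abel

theorem abs_sum_mul_le {d w : ℕ → ℝ} {a : ℕ} {M : ℝ} (hw : ∀ n, a < n → 0 ≤ w n)
    (hw' : ∀ n, a < n → w (n + 1) ≤ w n) {b : ℕ} (hab : a < b)
    (hM : ∀ k, a < k → k ≤ b → |∑ n ∈ Finset.Ioc a k, d n| ≤ M) :
    |∑ n ∈ Finset.Ioc a b, d n * w n| ≤ M * w (a + 1) := by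
  have key : |∑ n ∈ Finset.Ioc a b, d n * w n - (∑ n ∈ Finset.Ioc a b, d n) * w b| ≤
      M * (w (a + 1) - w b) := by
    induction b, hab using Nat.le_induction with
    | base => simp
    | succ b hb ih =>
      have h1 := ih (fun k h h' => hM k h (by omega))
      have h2 := hM b hb (by omega)
      rw [Finset.sum_Ioc_succ_top (by omega), Finset.sum_Ioc_succ_top (by omega)]
      set T := ∑ n ∈ Finset.Ioc a b, d n
      have h3 : |T * (w b - w (b + 1))| ≤ M * (w b - w (b + 1)) := by
        have := sub_nonneg.2 (hw' b hb)
        rw [abs_mul, abs_of_nonneg this]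
        exact mul_le_mul_of_nonneg_right h2 this
      rw [abs_le] at h1 h3 ⊢
      constructor <;> nlinarith [h1.1, h1.2, h3.1, h3.2]
  have h2 := hM b hab le_rfl
  have h3 : |(∑ n ∈ Finset.Ioc a b, d n) * w b| ≤ M * w b := by
    rw [abs_mul, abs_of_nonneg (hw b hab)]
    exact mul_le_mul_of_nonneg_right h2 (hw b hab)
  rw [abs_le] at key h3 ⊢
  constructor <;> linarith [key.1, key.2, h3.1, h3.2]

theorem Ico_succ (a b : ℕ) : Finset.Ico (a + 1) (b + 1) = Finset.Ioc a b := by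
  ext n
  simp only [Finset.mem_Ico, Finset.mem_Ioc]
  omega

open PrimeSum

theorem wt_nonneg (j m k : ℕ) : 0 ≤ wt j m k := by
  rw [wt]
  split_ifs <;> positivity

theorem wt_le (j m k : ℕ) : wt j m k ≤ 2 ^ m * 2 ^ j := by
  rw [wt]
  split_ifs with h
  · have := Fact.mk h.1
    refine mul_le_mul_of_nonneg_left ?_ (by positivity)
    rw [RootNum.N_eq (odd_of_class h.2)]
    split_ifs
    · push_cast
      exact pow_le_pow_right₀ (by norm_num) (min_le_left _ _)
    · simp
  · positivity

theorem pow_le_exp {P : ℝ} (hP : 16 ≤ P) : 2 * P ^ 16 ≤ Real.exp (P ^ 12 / 2) := by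
  have h5 := Real.quadratic_le_exp_of_nonneg (x := P ^ 12 / 2) (by positivity)
  refine le_trans ?_ h5
  have h8 : (2 : ℝ) ≤ P ^ 8 / 8 := by
    have : P ≤ P ^ 8 := le_self_pow₀ (by linarith) (by norm_num)
    linarith
  have h9 : 0 ≤ P ^ 16 * (P ^ 8 / 8 - 2) := by
    apply mul_nonneg (by positivity)
    linarith
  have : 0 ≤ P ^ 12 / 2 := by positivity
  nlinarith

theorem abs_sum_wt_sub_le : ∃ P0 : ℝ, ∀ P, P0 ≤ P → ∀ j m : ℕ, Adm j m → 2 ^ j ≤ P / 2 →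
    2 ^ (m + 2) ≤ P / 2 → ∀ x, x = Real.exp (P ^ 12) →
    |∑ k ∈ Finset.range (⌊x⌋₊ + 1), wt j m k - ∑ k ∈ Finset.range (⌊x⌋₊ + 1), wt 0 0 k| ≤
      129 * (x / P ^ 14) := by
  obtain ⟨P0, h⟩ := PrimeSum.abs_sum_wt_sub_le
  refine ⟨max (2 * P0) 16, fun P hP j m ha hj hm x hx => ?_⟩
  have hP0 : P0 ≤ P / 2 := by linarith [(le_max_left _ _).trans hP]
  have hP1 : 16 ≤ P := (le_max_right _ _).trans hP
  set y := Real.exp (P ^ 12 / 2) with hy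
  have hxy : x = y * y := by
    rw [hx, hy, ← Real.exp_add, add_halves]
  have hy1 : 2 * P ^ 16 ≤ y := pow_le_exp hP1
  have hy0 : 0 < y := Real.exp_pos _
  set a := ⌊y⌋₊ with hadef
  have hy4 : 4 ≤ y := by
    have : P ≤ P ^ 16 := le_self_pow₀ (by linarith) (by norm_num)
    linarith
  have hlog : ∀ n : ℕ, a ≤ n → P ^ 12 / 4 ≤ Real.log n := by
    intro n hn
    have h1 : y < a + 1 := Nat.lt_floor_add_one y
    have h2 : (a : ℝ) ≤ n := by exact_mod_cast hn
    have h3 : y / 2 ≤ n := by linarith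
    refine (Real.le_log_iff_exp_le (by linarith)).2 (le_trans ?_ h3)
    have h4 : y = Real.exp (P ^ 12 / 4) * Real.exp (P ^ 12 / 4) := by
      rw [hy, ← Real.exp_add]
      ring_nf
    have h5 : 0 < Real.exp (P ^ 12 / 4) := Real.exp_pos _
    have h6 : 2 ≤ Real.exp (P ^ 12 / 4) := by
      by_contra hc
      push Not at hc
      nlinarith
    rw [h4]
    nlinarith
  have hpos : 0 < P ^ 12 / 4 := by positivity
  have hx0 : 0 < x := by
    rw [hx]
    exact Real.exp_pos _
  have hab : a < ⌊x⌋₊ := by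
    have h1 : (a : ℝ) ≤ y := Nat.floor_le hy0.le
    have h2 : x < ⌊x⌋₊ + 1 := Nat.lt_floor_add_one x
    have : (a : ℝ) < ⌊x⌋₊ := by nlinarith
    exact_mod_cast this
  have hS : ∀ n : ℕ, a ≤ n → n ≤ ⌊x⌋₊ →
      |∑ k ∈ Finset.range (n + 1), (wt j m k - wt 0 0 k) * Real.log k| ≤ 16 * (x / P ^ 2) := by
    intro n hn hn'
    have hl := hlog n hn
    have hn0 : (n : ℝ) ≠ 0 := by
      intro h0
      rw [h0, Real.log_zero] at hl
      linarith
    have hnx : (n : ℝ) ≤ x := (Nat.cast_le.2 hn').trans (Nat.floor_le hx0.le)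
    obtain ⟨Q, hQ0, hQ⟩ : ∃ Q : ℝ, 0 ≤ Q ∧ Q ^ 12 = Real.log n := by
      refine ⟨(Real.log n) ^ ((1 : ℝ) / 12), by positivity, ?_⟩
      rw [← Real.rpow_natCast, ← Real.rpow_mul (by linarith)]
      norm_num
    have hQP : P / 2 ≤ Q := by
      refine le_of_pow_le_pow_left₀ (n := 12) (by norm_num) hQ0 ?_
      rw [hQ]
      refine le_trans ?_ hl
      rw [div_pow]
      gcongr
      norm_num
    have hne : (n : ℝ) = Real.exp (Q ^ 12) := by
      rw [hQ, Real.exp_log]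
      exact lt_of_le_of_ne (Nat.cast_nonneg n) hn0.symm
    have h1 := h Q (hP0.trans hQP) j m ha (hj.trans hQP) (hm.trans hQP) n hne
    have h2 := h Q (hP0.trans hQP) 0 0 (Or.inr (Or.inl ⟨rfl, by norm_num⟩))
      (by norm_num; linarith) (by norm_num; linarith) n hne
    have h3 : 2 * ((n : ℝ) / Q ^ 2) ≤ 8 * (x / P ^ 2) := by
      calc 2 * ((n : ℝ) / Q ^ 2) ≤ 2 * (x / (P / 2) ^ 2) := by gcongr
        _ = 8 * (x / P ^ 2) := by
          field_simp
          ring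
    simp only [sub_mul, Finset.sum_sub_distrib]
    rw [abs_le] at *
    constructor <;> linarith [h1.1, h1.2, h2.1, h2.2]
  have hT : ∀ k, a < k → k ≤ ⌊x⌋₊ →
      |∑ n ∈ Finset.Ioc a k, (wt j m n - wt 0 0 n) * Real.log n| ≤ 32 * (x / P ^ 2) := by
    intro k hk hk'
    have h1 := hS k hk.le hk'
    have h2 := hS a le_rfl hab.le
    have h3 := Finset.sum_range_add_sum_Ico (fun n : ℕ => (wt j m n - wt 0 0 n) * Real.log n)
      (show a + 1 ≤ k + 1 by omega)
    rw [Ico_succ] at h3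
    rw [abs_le] at *
    constructor <;> linarith [h1.1, h1.2, h2.1, h2.2]
  have hA := abs_sum_mul_le (w := fun n : ℕ => (Real.log n)⁻¹) (fun n hn =>
      inv_nonneg.2 (hpos.le.trans (hlog n hn.le))) (fun n hn => by
        have h1 := hlog n hn.le
        refine inv_anti₀ (by linarith) (Real.log_le_log ?_ (by push_cast; linarith))
        exact_mod_cast (by omega : 0 < n)) hab hT
  have hA1 : ∑ n ∈ Finset.Ioc a ⌊x⌋₊, (wt j m n - wt 0 0 n) * Real.log n * (Real.log n)⁻¹ =
      ∑ n ∈ Finset.Ioc a ⌊x⌋₊, (wt j m n - wt 0 0 n) := by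
    refine Finset.sum_congr rfl fun n hn => ?_
    rw [Finset.mem_Ioc] at hn
    have := hlog n hn.1.le
    rw [mul_assoc, mul_inv_cancel₀ (by linarith), mul_one]
  have hA2 : 32 * (x / P ^ 2) * (Real.log ((a + 1 : ℕ) : ℝ))⁻¹ ≤ 128 * (x / P ^ 14) := by
    calc 32 * (x / P ^ 2) * (Real.log ((a + 1 : ℕ) : ℝ))⁻¹
        ≤ 32 * (x / P ^ 2) * (P ^ 12 / 4)⁻¹ := by
          gcongr
          exact hlog _ (by omega)
      _ = 128 * (x / P ^ 14) := by
          field_simp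
          ring
  have hH : |∑ n ∈ Finset.range (a + 1), (wt j m n - wt 0 0 n)| ≤ x / P ^ 14 := by
    have hm' : (2 : ℝ) ^ m ≤ P / 2 := by
      refine le_trans ?_ hm
      exact pow_le_pow_right₀ (by norm_num) (by omega)
    have h0 : ∀ n, |wt j m n - wt 0 0 n| ≤ P ^ 2 / 4 := by
      intro n
      have h1 := wt_nonneg j m n
      have h2 := wt_nonneg 0 0 n
      have h3 := wt_le j m n
      have h4 := wt_le 0 0 n
      have h5 : (2 : ℝ) ^ m * 2 ^ j ≤ P / 2 * (P / 2) := by gcongr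
      rw [abs_le]
      constructor <;> nlinarith
    calc |∑ n ∈ Finset.range (a + 1), (wt j m n - wt 0 0 n)|
        ≤ ∑ n ∈ Finset.range (a + 1), P ^ 2 / 4 :=
          (Finset.abs_sum_le_sum_abs _ _).trans (Finset.sum_le_sum fun n _ => h0 n)
      _ = (a + 1) * (P ^ 2 / 4) := by
          rw [Finset.sum_const, Finset.card_range, nsmul_eq_mul]
          push_cast
          ring
      _ ≤ (2 * y) * (P ^ 2 / 4) := by
          gcongr
          linarith [Nat.floor_le hy0.le]
      _ ≤ x / P ^ 14 := by
          rw [le_div_iff₀ (by positivity), hxy]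
          nlinarith [mul_nonneg hy0.le (sub_nonneg.2 hy1),
            mul_nonneg hy0.le (pow_nonneg (by linarith : 0 ≤ P) 16)]
  have hsplit := Finset.sum_range_add_sum_Ico (fun n : ℕ => (wt j m n - wt 0 0 n))
      (show a + 1 ≤ ⌊x⌋₊ + 1 by omega)
  rw [Ico_succ] at hsplit
  rw [← Finset.sum_sub_distrib, ← hsplit]
  rw [hA1] at hA
  have := hA.trans hA2
  refine (abs_add_le _ _).trans ?_
  linarith

end Abel

end

section

open PrimeSum RealZero

namespace Counts

/-- The exponent of `2` in `p - 1`. -/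
noncomputable def v (p : ℕ) : ℕ := padicValNat 2 (p - 1)

/-- The exponent of `2` in the order of `-2` modulo `p`. -/
noncomputable def w (p : ℕ) : ℕ := padicValNat 2 (orderOf (-2 : ZMod p))

theorem cast_eq_one_iff (n : ℕ) {p : ℕ} (hp : 1 ≤ p) : (p : ZMod n) = 1 ↔ n ∣ p - 1 := by
  rw [← ZMod.natCast_eq_zero_iff, Nat.cast_sub hp, sub_eq_zero, Nat.cast_one]

theorem cast_eq_neg_one_iff (n p : ℕ) : (p : ZMod n) = -1 ↔ n ∣ p + 1 := by
  rw [← ZMod.natCast_eq_zero_iff, Nat.cast_add, Nat.cast_one, eq_neg_iff_add_eq_zero]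

section

variable {p : ℕ} (hp : p.Prime) (h2 : p ≠ 2)
include hp h2

omit h2 in
theorem wt_eq {j m : ℕ} : wt j m p =
    if 2 ^ (m + 2) ∣ p - 1 ∨ 2 ^ (m + 2) ∣ p + 1 then 2 ^ m * (RootNum.N j p : ℝ) else 0 := by
  rw [wt]
  refine if_congr ?_ rfl rfl
  rw [cast_eq_one_iff _ hp.one_le, cast_eq_neg_one_iff]
  exact and_iff_right hp

theorem mod_eight : p % 8 = 1 ∨ p % 8 = 3 ∨ p % 8 = 5 ∨ p % 8 = 7 := by
  have := hp.eq_two_or_odd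
  omega

theorem wt_of_le {j m : ℕ} (hj : 1 ≤ j) (hm : 1 ≤ m) :
    wt j m p = if m + 2 ≤ v p then 2 ^ m * (RootNum.N j p : ℝ) else 0 := by
  have := Fact.mk hp
  have hv : m + 2 ≤ v p ↔ 2 ^ (m + 2) ∣ p - 1 := RootNum.dvd_sub_one_iff _
  rw [wt_eq hp, if_congr hv rfl rfl]
  by_cases h : 2 ^ (m + 2) ∣ p + 1
  · have h8 : 8 ∣ p + 1 := (show 8 ∣ 2 ^ (m + 2) from
      pow_dvd_pow 2 (show 3 ≤ m + 2 by omega)).trans h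
    rw [N_of_not h2 (Or.inr (by omega)) hj]
    simp
  · simp [h]

theorem wt_zero_zero : wt 0 0 p = 1 := by
  have := Fact.mk hp
  rw [wt_eq hp, if_pos, N_zero]
  · simp
  · have := mod_eight hp h2
    norm_num
    omega

theorem N_one : RootNum.N 1 p = if p % 8 = 1 ∨ p % 8 = 3 then 2 else 0 := by
  have := Fact.mk hp
  rw [RootNum.N_eq h2, min_eq_left (RootNum.one_le_val h2)]
  refine if_congr ?_ rfl rfl
  rw [← ZMod.exists_sq_eq_neg_two_iff h2, RootNum.isSquare_iff h2]

theorem wt_one_zero : wt 1 0 p = if p % 8 = 1 ∨ p % 8 = 3 then 2 else 0 := by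
  have := Fact.mk hp
  have h8 := mod_eight hp h2
  rw [wt_eq hp, if_pos]
  · rw [N_one hp h2]
    split_ifs <;> simp
  · norm_num
    omega

theorem wt_one_one : wt 1 1 p = if p % 8 = 1 then 4 else 0 := by
  have := Fact.mk hp
  have h8 := mod_eight hp h2
  have h1 : 1 + 2 ≤ v p ↔ p % 8 = 1 := by
    rw [v, RootNum.dvd_sub_one_iff]
    norm_num
    omega
  rw [wt_of_le hp h2 le_rfl le_rfl, if_congr h1 rfl rfl]
  split_ifs with h
  · rw [N_one hp h2, if_pos (Or.inl h)]
    norm_num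
  · rfl

theorem wt_zero_one : wt 0 1 p = if p % 8 = 1 ∨ p % 8 = 7 then 2 else 0 := by
  have := Fact.mk hp
  have h8 := mod_eight hp h2
  have h1 : (2 ^ (1 + 2) ∣ p - 1 ∨ 2 ^ (1 + 2) ∣ p + 1) ↔ p % 8 = 1 ∨ p % 8 = 7 := by
    norm_num
    omega
  rw [wt_eq hp, if_congr h1 rfl rfl, N_zero]
  simp

theorem val_cases : (p % 8 = 1 ∧ 3 ≤ v p ∧ w p + 1 ≤ v p) ∨ (p % 8 = 3 ∧ v p = 1 ∧ w p = 0) ∨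
    (p % 8 = 5 ∧ v p = 2 ∧ w p = 2) ∨ (p % 8 = 7 ∧ v p = 1 ∧ w p = 1) := by
  have := Fact.mk hp
  have h8 := mod_eight hp h2
  have h1 : 1 ≤ v p := RootNum.one_le_val h2
  have hw : w p ≤ v p := RootNum.val_neg_two_le h2
  have hs : w p + 1 ≤ v p ↔ p % 8 = 1 ∨ p % 8 = 3 := by
    rw [← ZMod.exists_sq_eq_neg_two_iff h2, RootNum.isSquare_iff h2, w, v]
  have e2 : 2 ≤ v p ↔ 4 ∣ p - 1 := RootNum.dvd_sub_one_iff 2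
  have e3 : 3 ≤ v p ↔ 8 ∣ p - 1 := RootNum.dvd_sub_one_iff 3
  omega

end

/-- Indicator of the odd primes with `3 ≤ v p ≤ S` and `w p ≤ i`. -/
noncomputable def ind (i S p : ℕ) : ℝ :=
  if p.Prime ∧ p ≠ 2 ∧ 3 ≤ v p ∧ v p ≤ S ∧ w p ≤ i then 1 else 0

/-- Indicator of the odd primes with `3 ≤ v p` and `w p ≤ i`. -/
noncomputable def indInf (i p : ℕ) : ℝ :=
  if p.Prime ∧ p ≠ 2 ∧ 3 ≤ v p ∧ w p ≤ i then 1 else 0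

theorem wt_of_not {j m p : ℕ} (h : ¬ (p.Prime ∧ p ≠ 2)) : wt j m p = 0 := by
  rw [wt, if_neg]
  rintro ⟨h1, h3⟩
  exact h ⟨h1, odd_of_class h3⟩

theorem ind_two (i p : ℕ) : ind i 2 p = 0 := by
  rw [ind, if_neg]
  omega

theorem N_eq_of_le {p : ℕ} (hp : p.Prime) (h2 : p ≠ 2) {j : ℕ} (hj : j ≤ v p) :
    (RootNum.N j p : ℝ) = if w p + j ≤ v p then 2 ^ j else 0 := by
  have := Fact.mk hp
  rw [RootNum.N_eq h2, ← v, ← w, min_eq_left hj]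
  split_ifs <;> simp

theorem ind_succ {i s : ℕ} (hi : i ≤ 2) (hs : 3 ≤ s) (p : ℕ) :
    ind i s p = ind i (s - 1) p +
      (wt (s - i) (s - 2) p / 2 ^ (s - i + (s - 2)) -
        wt (s - i) (s - 1) p / 2 ^ (s - i + (s - 1))) := by
  by_cases h : p.Prime ∧ p ≠ 2
  · obtain ⟨hp, h2⟩ := h
    rw [wt_of_le hp h2 (by omega) (by omega), wt_of_le hp h2 (by omega) (by omega), ind, ind]
    simp only [hp, h2, ne_eq, not_false_eq_true, true_and]
    by_cases h1 : s ≤ v p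
    · rw [if_pos (show s - 2 + 2 ≤ v p by omega), N_eq_of_le hp h2 (by omega)]
      rcases h1.eq_or_lt with h3 | h3
      · rw [if_neg (show ¬ s - 1 + 2 ≤ v p by omega),
          if_neg (show ¬ (3 ≤ v p ∧ v p ≤ s - 1 ∧ w p ≤ i) by omega)]
        by_cases h4 : w p ≤ i
        · rw [if_pos (show 3 ≤ v p ∧ v p ≤ s ∧ w p ≤ i by omega),
            if_pos (show w p + (s - i) ≤ v p by omega), pow_add]
          field_simp
          simp
        · rw [if_neg (show ¬ (3 ≤ v p ∧ v p ≤ s ∧ w p ≤ i) by omega),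
            if_neg (show ¬ w p + (s - i) ≤ v p by omega)]
          simp
      · rw [if_pos (show s - 1 + 2 ≤ v p by omega),
          if_neg (show ¬ (3 ≤ v p ∧ v p ≤ s ∧ w p ≤ i) by omega),
          if_neg (show ¬ (3 ≤ v p ∧ v p ≤ s - 1 ∧ w p ≤ i) by omega), pow_add, pow_add]
        field_simp
        simp
    · rw [if_neg (show ¬ s - 2 + 2 ≤ v p by omega), if_neg (show ¬ s - 1 + 2 ≤ v p by omega)]
      have : (3 ≤ v p ∧ v p ≤ s ∧ w p ≤ i) ↔ (3 ≤ v p ∧ v p ≤ s - 1 ∧ w p ≤ i) := by omega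
      simp only [this]
      simp
  · rw [wt_of_not h, wt_of_not h, ind, ind, if_neg (fun h' => h ⟨h'.1, h'.2.1⟩),
      if_neg (fun h' => h ⟨h'.1, h'.2.1⟩)]
    simp

theorem ind_le_indInf (i S p : ℕ) : ind i S p ≤ indInf i p := by
  rw [ind, indInf]
  split_ifs with h1 h2 h2
  · norm_num
  · exact absurd ⟨h1.1, h1.2.1, h1.2.2.1, h1.2.2.2.2⟩ h2
  · norm_num
  · norm_num

theorem indInf_le {i S : ℕ} (hi : i ≤ 2) (hS : 2 ≤ S) (p : ℕ) :
    indInf i p ≤ ind i S p + wt (S + 1 - i) (S - 1) p / 2 ^ (S + 1 - i + (S - 1)) := by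
  have h0 := Abel.wt_nonneg (S + 1 - i) (S - 1) p
  have h0' : 0 ≤ wt (S + 1 - i) (S - 1) p / 2 ^ (S + 1 - i + (S - 1)) := by positivity
  rw [ind, indInf]
  by_cases h : p.Prime ∧ p ≠ 2 ∧ 3 ≤ v p ∧ w p ≤ i
  · rw [if_pos h]
    obtain ⟨hp, h2, h3, h4⟩ := h
    by_cases h5 : v p ≤ S
    · rw [if_pos ⟨hp, h2, h3, h5, h4⟩]
      linarith
    · rw [if_neg (fun h => h5 h.2.2.2.1), wt_of_le hp h2 (by omega) (by omega),
        if_pos (show S - 1 + 2 ≤ v p by omega), N_eq_of_le hp h2 (by omega),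
        if_pos (show w p + (S + 1 - i) ≤ v p by omega), pow_add]
      field_simp
      simp
  · rw [if_neg h]
    split_ifs <;> linarith

theorem abs_sum_ind_sub_le {B : ℕ → ℕ → ℝ} {s : Finset ℕ} {M δ : ℝ}
    (hB : ∀ j m, B j m = ∑ k ∈ s, wt j m k) {i : ℕ} (hi : i ≤ 2) {S : ℕ} (hS : 2 ≤ S)
    (h : ∀ j m, 1 ≤ j → 1 ≤ m → j ≤ S → m + 1 ≤ S → |B j m - M| ≤ δ) :
    |∑ k ∈ s, ind i S k - 2 ^ (i + 1) * (1 / 48 - 1 / 4 ^ S / 3) * M| ≤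
      24 * (1 / 48 - 1 / 4 ^ S / 3) * δ := by
  induction S, hS using Nat.le_induction with
  | base =>
    simp only [ind_two]
    norm_num
  | succ n hn ih =>
    have ih := ih (fun j m a b c d => h j m a b (by omega) (by omega))
    have h1 := h (n + 1 - i) (n + 1 - 2) (by omega) (by omega) (by omega) (by omega)
    have h2 := h (n + 1 - i) (n + 1 - 1) (by omega) (by omega) (by omega) (by omega)
    have hs : ∑ k ∈ s, ind i (n + 1) k = ∑ k ∈ s, ind i n k +
        (B (n + 1 - i) (n + 1 - 2) / 2 ^ (n + 1 - i + (n + 1 - 2)) -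
          B (n + 1 - i) (n + 1 - 1) / 2 ^ (n + 1 - i + (n + 1 - 1))) := by
      rw [hB, hB, Finset.sum_div, Finset.sum_div, ← Finset.sum_sub_distrib,
        ← Finset.sum_add_distrib]
      exact Finset.sum_congr rfl fun k _ => ind_succ hi (by omega) k
    rw [hs]
    set B1 := B (n + 1 - i) (n + 1 - 2)
    set B2 := B (n + 1 - i) (n + 1 - 1)
    set T := ∑ k ∈ s, ind i n k
    have hδ : 0 ≤ δ := (abs_nonneg _).trans h1
    have e1 : (1 : ℝ) / 2 ^ (n + 1 - i + (n + 1 - 2)) = 2 ^ i / 4 ^ n := by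
      rw [div_eq_div_iff (by positivity) (by positivity), one_mul, ← pow_add,
        show (4 : ℝ) = 2 ^ 2 by norm_num, ← pow_mul]
      congr 1
      omega
    have e2 : (1 : ℝ) / 2 ^ (n + 1 - i + (n + 1 - 1)) = 2 ^ i / 4 ^ n / 2 := by
      rw [← e1, show n + 1 - i + (n + 1 - 1) = n + 1 - i + (n + 1 - 2) + 1 by omega, pow_succ]
      field_simp
    have e3 : (1 : ℝ) / 4 ^ (n + 1) = 1 / 4 ^ n / 4 := by
      rw [pow_succ]
      field_simp
    rw [div_eq_mul_one_div B1, div_eq_mul_one_div B2, e1, e2, e3]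
    rw [div_eq_mul_one_div ((2 : ℝ) ^ i)]
    set q : ℝ := 1 / 4 ^ n
    have hq : 0 ≤ q := by positivity
    have hi0 : (0 : ℝ) ≤ 2 ^ i := by positivity
    have hi4 : (2 : ℝ) ^ i ≤ 4 := by
      calc (2 : ℝ) ^ i ≤ 2 ^ 2 := pow_le_pow_right₀ (by norm_num) hi
        _ = 4 := by norm_num
    rw [pow_succ 2 i] at ih ⊢
    set c : ℝ := 2 ^ i
    have hcq : 0 ≤ c * q := by positivity
    have hcq' : c * q * δ ≤ 4 * q * δ := by gcongr
    have h3 : |(B1 - M) * (c * q)| ≤ δ * (c * q) := by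
      rw [abs_mul, abs_of_nonneg hcq]
      exact mul_le_mul_of_nonneg_right h1 hcq
    have h4 : |(B2 - M) * (c * q)| ≤ δ * (c * q) := by
      rw [abs_mul, abs_of_nonneg hcq]
      exact mul_le_mul_of_nonneg_right h2 hcq
    rw [abs_le] at *
    constructor <;> nlinarith [h3.1, h3.2, h4.1, h4.2, ih.1, ih.2]

theorem abs_sum_indInf_sub_le {B : ℕ → ℕ → ℝ} {s : Finset ℕ} {M δ : ℝ} (hM : 0 ≤ M)
    (hB : ∀ j m, B j m = ∑ k ∈ s, wt j m k) {i : ℕ} (hi : i ≤ 2) {S : ℕ} (hS : 2 ≤ S)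
    (h : ∀ j m, 1 ≤ j → 1 ≤ m → j ≤ S + 1 → m + 1 ≤ S → |B j m - M| ≤ δ) :
    |∑ k ∈ s, indInf i k - 2 ^ i / 24 * M| ≤ 8 * (1 / 4 ^ S) * M + 5 * δ := by
  have h1 := abs_sum_ind_sub_le hB hi hS (fun j m a b c d => h j m a b (by omega) d)
  have h2 := h (S + 1 - i) (S - 1) (by omega) (by omega) (by omega) (by omega)
  have h3 : ∑ k ∈ s, ind i S k ≤ ∑ k ∈ s, indInf i k :=
    Finset.sum_le_sum fun k _ => ind_le_indInf i S k
  have h4 : ∑ k ∈ s, indInf i k ≤ ∑ k ∈ s, ind i S k +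
      B (S + 1 - i) (S - 1) / 2 ^ (S + 1 - i + (S - 1)) := by
    rw [hB, Finset.sum_div, ← Finset.sum_add_distrib]
    exact Finset.sum_le_sum fun k _ => indInf_le hi hS k
  set B1 := B (S + 1 - i) (S - 1)
  have hδ : 0 ≤ δ := (abs_nonneg _).trans h2
  have e1 : (1 : ℝ) / 2 ^ (S + 1 - i + (S - 1)) = 2 ^ i * (1 / 4 ^ S) := by
    rw [mul_one_div, div_eq_div_iff (by positivity) (by positivity), one_mul, ← pow_add,
      show (4 : ℝ) = 2 ^ 2 by norm_num, ← pow_mul]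
    congr 1
    omega
  rw [div_eq_mul_one_div B1, e1] at h4
  rw [pow_succ] at h1
  have hi0 : (0 : ℝ) ≤ 2 ^ i := by positivity
  have hi4 : (2 : ℝ) ^ i ≤ 4 := by
    calc (2 : ℝ) ^ i ≤ 2 ^ 2 := pow_le_pow_right₀ (by norm_num) hi
      _ = 4 := by norm_num
  have hq : (0 : ℝ) ≤ 1 / 4 ^ S := by positivity
  have hq1 : (1 : ℝ) / 4 ^ S ≤ 1 := by
    rw [div_le_one (by positivity)]
    exact one_le_pow₀ (by norm_num)
  set q : ℝ := 1 / 4 ^ S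
  set c : ℝ := 2 ^ i
  have hcq : c * q * M ≤ 4 * q * M := by gcongr
  have hcq0 : 0 ≤ c * q * M := by positivity
  have h5 : B1 * (c * q) ≤ (M + δ) * (4 * q) := by
    rw [abs_le] at h2
    calc B1 * (c * q) ≤ (M + δ) * (c * q) := by
          gcongr
          linarith [h2.2]
      _ ≤ (M + δ) * (4 * q) := by gcongr
  have h6 : q * δ ≤ 1 * δ := by gcongr
  have h7 : 0 ≤ q * δ := by positivity
  rw [abs_le] at *
  constructor <;> nlinarith [h1.1, h1.2]

end Counts

end

section

open PrimeSum Counts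

namespace OrderCounts

theorem memR_iff (k r : ℕ) : memR 2 k r ↔ (r.Prime ∧ r ≠ 2) ∧
    padicValNat 2 (orderOf (2 : ZMod r)) = k := by
  rw [memR, Nat.cast_two]
  constructor
  · rintro ⟨h1, -, h2, h3⟩
    exact ⟨⟨h1, h2⟩, h3⟩
  · rintro ⟨⟨h1, h2⟩, h3⟩
    exact ⟨h1, h1.odd_of_ne_two h2, h2, h3⟩

theorem countR_eq (k : ℕ) (x : ℝ) : (countR 2 k x : ℝ) =
    ∑ r ∈ Finset.range (⌊x⌋₊ + 1), if (r.Prime ∧ r ≠ 2) ∧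
      padicValNat 2 (orderOf (2 : ZMod r)) = k then (1 : ℝ) else 0 := by
  rw [countR, ← Finset.sum_boole]
  exact Finset.sum_congr rfl fun r _ => if_congr (memR_iff k r) rfl rfl

theorem countRge3_eq (x : ℝ) : (countRge3 2 x : ℝ) =
    ∑ r ∈ Finset.range (⌊x⌋₊ + 1), if (r.Prime ∧ r ≠ 2) ∧
      3 ≤ padicValNat 2 (orderOf (2 : ZMod r)) then (1 : ℝ) else 0 := by
  rw [countRge3, ← Finset.sum_boole]
  refine Finset.sum_congr rfl fun r _ => if_congr ?_ rfl rfl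
  rw [Nat.cast_two]
  constructor
  · rintro ⟨h1, -, h2, h3⟩
    exact ⟨⟨h1, h2⟩, h3⟩
  · rintro ⟨⟨h1, h2⟩, h3⟩
    exact ⟨h1, h1.odd_of_ne_two h2, h2, h3⟩

theorem val_iff {r : ℕ} (hr : r.Prime) (h2 : r ≠ 2) :
    (padicValNat 2 (orderOf (2 : ZMod r)) = 1 ↔ w r = 0) ∧
    (padicValNat 2 (orderOf (2 : ZMod r)) = 2 ↔ w r = 2) ∧
    (3 ≤ padicValNat 2 (orderOf (2 : ZMod r)) ↔ 3 ≤ w r) := by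
  have := Fact.mk hr
  have h := RootNum.val_eq_one_iff h2
  have e1 := RootNum.val_two_iff h2 1 le_rfl
  have e2 := RootNum.val_two_iff h2 2 (by norm_num)
  rw [← w] at h e1 e2
  omega

theorem indInf_of {i r : ℕ} (hr : r.Prime) (h2 : r ≠ 2) :
    indInf i r = if 3 ≤ v r ∧ w r ≤ i then 1 else 0 := by
  rw [indInf]
  exact if_congr (by tauto) rfl rfl

theorem indInf_of_not {i r : ℕ} (h : ¬ (r.Prime ∧ r ≠ 2)) : indInf i r = 0 := by
  rw [indInf, if_neg]
  tauto

theorem boole_eq_one (r : ℕ) : (if (r.Prime ∧ r ≠ 2) ∧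
    padicValNat 2 (orderOf (2 : ZMod r)) = 1 then (1 : ℝ) else 0) =
    (wt 1 0 r - wt 1 1 r / 2) / 2 + indInf 0 r := by
  by_cases h : r.Prime ∧ r ≠ 2
  · obtain ⟨hp, h2⟩ := h
    have hv := (val_iff hp h2).1
    rw [wt_one_zero hp h2, wt_one_one hp h2, indInf_of hp h2]
    rcases val_cases hp h2 with ⟨a, b, c⟩ | ⟨a, b, c⟩ | ⟨a, b, c⟩ | ⟨a, b, c⟩
    · simp [hp, h2, hv, a, b]
      norm_num
    · simp [hp, h2, hv, a, b, c]
    · simp [hp, h2, hv, a, b, c]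
    · simp [hp, h2, hv, a, b, c]
  · rw [wt_of_not h, wt_of_not h, indInf_of_not h, if_neg (fun h' => h h'.1)]
    simp

theorem boole_eq_two (r : ℕ) : (if (r.Prime ∧ r ≠ 2) ∧
    padicValNat 2 (orderOf (2 : ZMod r)) = 2 then (1 : ℝ) else 0) =
    wt 0 0 r - wt 0 1 r / 2 - (wt 1 0 r - wt 1 1 r / 2) / 2 +
      (indInf 2 r - indInf 1 r) := by
  by_cases h : r.Prime ∧ r ≠ 2
  · obtain ⟨hp, h2⟩ := h
    have hv := (val_iff hp h2).2.1
    rw [wt_one_zero hp h2, wt_one_one hp h2, wt_zero_zero hp h2, wt_zero_one hp h2,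
      indInf_of hp h2, indInf_of hp h2]
    rcases val_cases hp h2 with ⟨a, b, c⟩ | ⟨a, b, c⟩ | ⟨a, b, c⟩ | ⟨a, b, c⟩
    · simp only [hp, hv, a, b]
      rcases lt_trichotomy (w r) 2 with d | d | d
      · have d1 : w r ≤ 1 := by omega
        have d2 : w r ≤ 2 := by omega
        have d3 : w r ≠ 2 := by omega
        simp [d1, d2, d3]
        norm_num
      · simp [d, h2]
        norm_num
      · have d1 : ¬ w r ≤ 1 := by omega
        have d2 : ¬ w r ≤ 2 := by omega
        have d3 : w r ≠ 2 := by omega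
        simp [d1, d2, d3]
        norm_num
    · simp [hp, h2, hv, a, b, c]
    · simp [hp, h2, hv, a, b, c]
    · simp [hp, h2, hv, a, b, c]
  · rw [wt_of_not h, wt_of_not h, wt_of_not h, wt_of_not h, indInf_of_not h, indInf_of_not h,
      if_neg (fun h' => h h'.1)]
    simp

theorem boole_three_le (r : ℕ) : (if (r.Prime ∧ r ≠ 2) ∧
    3 ≤ padicValNat 2 (orderOf (2 : ZMod r)) then (1 : ℝ) else 0) =
    wt 1 1 r / 4 - indInf 2 r := by
  by_cases h : r.Prime ∧ r ≠ 2
  · obtain ⟨hp, h2⟩ := h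
    have hv := (val_iff hp h2).2.2
    rw [wt_one_one hp h2, indInf_of hp h2]
    rcases val_cases hp h2 with ⟨a, b, c⟩ | ⟨a, b, c⟩ | ⟨a, b, c⟩ | ⟨a, b, c⟩
    · by_cases d : w r ≤ 2
      · have d1 : ¬ 3 ≤ w r := by omega
        simp [hp, h2, hv, a, b, d, d1]
      · have d1 : 3 ≤ w r := by omega
        simp [hp, h2, hv, a, b, d, d1]
    · simp [hp, h2, hv, a, b, c]
    · simp [hp, h2, hv, a, b, c]
    · simp [hp, h2, hv, a, b, c]
  · rw [wt_of_not h, indInf_of_not h, if_neg (fun h' => h h'.1)]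
    simp

theorem primePi_eq (x : ℝ) : primePi x = Nat.primeCounting ⌊x⌋₊ := by
  rw [primePi, Nat.primeCounting, Nat.primeCounting', Nat.count_eq_card_filter_range]

theorem sum_wt_zero (x : ℝ) :
    ∑ r ∈ Finset.range (⌊x⌋₊ + 1), wt 0 0 r ≤ primePi x ∧
    primePi x ≤ ∑ r ∈ Finset.range (⌊x⌋₊ + 1), wt 0 0 r + 1 := by
  have h1 : (primePi x : ℝ) = ∑ r ∈ Finset.range (⌊x⌋₊ + 1), if r.Prime then (1 : ℝ) else 0 := by
    rw [primePi, ← Finset.sum_boole]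
  have h2 : ∀ r, wt 0 0 r ≤ (if r.Prime then (1 : ℝ) else 0) ∧
      (if r.Prime then (1 : ℝ) else 0) ≤ wt 0 0 r + if r = 2 then 1 else 0 := by
    intro r
    by_cases h : r.Prime ∧ r ≠ 2
    · rw [wt_zero_zero h.1 h.2, if_pos h.1, if_neg h.2]
      norm_num
    · rw [wt_of_not h]
      by_cases h3 : r = 2
      · rw [h3]
        norm_num
      · rw [if_neg (fun h' => h ⟨h', h3⟩), if_neg h3]
        norm_num
  have h3 : ∑ r ∈ Finset.range (⌊x⌋₊ + 1), (if r = 2 then (1 : ℝ) else 0) ≤ 1 := by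
    rw [Finset.sum_ite_eq']
    split_ifs <;> norm_num
  rw [h1]
  constructor
  · exact Finset.sum_le_sum fun r _ => (h2 r).1
  · calc _ ≤ ∑ r ∈ Finset.range (⌊x⌋₊ + 1), (wt 0 0 r + if r = 2 then 1 else 0) :=
          Finset.sum_le_sum fun r _ => (h2 r).2
      _ ≤ _ := by
          rw [Finset.sum_add_distrib]
          linarith

theorem exists_primePi_le : ∃ X0 : ℝ, ∀ x, X0 ≤ x → (primePi x : ℝ) ≤ 3 * (x / Real.log x) := by
  have h := Chebyshev.eventually_primeCounting_le (ε := 1) one_pos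
  obtain ⟨X0, hX⟩ := Filter.eventually_atTop.1 h
  refine ⟨max X0 2, fun x hx => ?_⟩
  have h1 := hX x ((le_max_left _ _).trans hx)
  have hx2 : 2 ≤ x := (le_max_right _ _).trans hx
  have hl : 0 < Real.log x := Real.log_pos (by linarith)
  rw [primePi_eq]
  refine h1.trans ?_
  have h4 : Real.log 4 ≤ 2 := by
    rw [show (4 : ℝ) = 2 ^ 2 by norm_num, Real.log_pow]
    have := Real.log_two_lt_d9
    push_cast
    linarith
  rw [mul_div_assoc]
  gcongr
  linarith

theorem exists_bounds : ∃ P0 : ℝ, ∀ P, P0 ≤ P → ∀ x, x = Real.exp (P ^ 12) →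
    |(countR 2 1 x : ℝ) - (7 / 24) * primePi x| ≤ 10000 * (x / P ^ 14) ∧
    |(countR 2 2 x : ℝ) - primePi x / 3| ≤ 10000 * (x / P ^ 14) ∧
    |(countRge3 2 x : ℝ) - primePi x / 12| ≤ 10000 * (x / P ^ 14) := by
  obtain ⟨P1, h1⟩ := Abel.abs_sum_wt_sub_le
  obtain ⟨X0, hX⟩ := exists_primePi_le
  refine ⟨max P1 (max X0 16), fun P hP x hx => ?_⟩
  simp only [max_le_iff] at hP
  obtain ⟨hP1, hP2, hP3⟩ := hP
  have hx0 : 0 < x := by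
    rw [hx]
    exact Real.exp_pos _
  have hPx : P ^ 14 ≤ x := by
    have h2 := Abel.pow_le_exp hP3
    have h3 : P ^ 14 ≤ P ^ 16 := pow_le_pow_right₀ (by linarith) (by norm_num)
    have h4 : Real.exp (P ^ 12 / 2) ≤ x := by
      rw [hx]
      apply Real.exp_le_exp.2
      have : 0 ≤ P ^ 12 := by positivity
      linarith
    have : 0 ≤ P ^ 16 := by positivity
    linarith
  have hπ : (primePi x : ℝ) ≤ 3 * (x / P ^ 12) := by
    have h2 : P ≤ P ^ 14 := le_self_pow₀ (by linarith) (by norm_num)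
    have h3 := hX x (by linarith)
    rwa [hx, Real.log_exp, ← hx] at h3
  obtain ⟨n, hn, hn'⟩ := exists_nat_pow_near (x := P / 2) (y := 2) (by linarith) (by norm_num)
  have hn3 : 3 ≤ n := by
    by_contra hc
    have : (2 : ℝ) ^ (n + 1) ≤ 2 ^ 3 := pow_le_pow_right₀ (by norm_num) (by omega)
    linarith
  obtain ⟨S, rfl⟩ : ∃ S, n = S + 1 := ⟨n - 1, by omega⟩
  have hpow : ∀ k, k ≤ S + 1 → (2 : ℝ) ^ k ≤ P / 2 := fun k hk =>
    (pow_le_pow_right₀ (by norm_num) hk).trans hn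
  obtain ⟨B, hB⟩ : ∃ B : ℕ → ℕ → ℝ, ∀ j m, B j m =
      ∑ k ∈ Finset.range (⌊x⌋₊ + 1), wt j m k := ⟨_, fun _ _ => rfl⟩
  have hBδ : ∀ j m, Adm j m → j ≤ S + 1 → m + 1 ≤ S → |B j m - B 0 0| ≤ 129 * (x / P ^ 14) := by
    intro j m ha hj hm
    rw [hB, hB]
    exact h1 P hP1 j m ha (hpow j hj) (hpow _ (by omega)) x hx
  have hM := sum_wt_zero x
  rw [← hB] at hM
  have hM0 : 0 ≤ B 0 0 := by
    rw [hB]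
    exact Finset.sum_nonneg fun k _ => Abel.wt_nonneg 0 0 k
  have hq : 8 * (1 / 4 ^ S) * B 0 0 ≤ 1536 * (x / P ^ 14) := by
    have h2 : (1 : ℝ) / 4 ^ S ≤ 64 / P ^ 2 := by
      rw [div_le_div_iff₀ (by positivity) (by positivity), one_mul]
      have h3 : P ≤ 8 * 2 ^ S := by
        rw [pow_succ, pow_succ] at hn'
        linarith
      calc P ^ 2 ≤ (8 * 2 ^ S) ^ 2 := by gcongr
        _ = 64 * 4 ^ S := by
          rw [mul_pow, ← pow_mul, mul_comm S 2, pow_mul]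
          norm_num
    calc 8 * (1 / 4 ^ S) * B 0 0 ≤ 8 * (64 / P ^ 2) * (3 * (x / P ^ 12)) := by
          gcongr
          exact hM.1.trans hπ
      _ = 1536 * (x / P ^ 14) := by
          field_simp
          ring
  have hW : ∀ i ≤ 2, |∑ k ∈ Finset.range (⌊x⌋₊ + 1), indInf i k - 2 ^ i / 24 * B 0 0| ≤
      2181 * (x / P ^ 14) := by
    intro i hi
    refine (abs_sum_indInf_sub_le hM0 hB hi (by omega) (fun j m a b c d =>
      hBδ j m (Or.inl ⟨a, b⟩) c d)).trans ?_
    linarith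
  have e1 := hBδ 1 0 (Or.inr (Or.inl ⟨rfl, le_rfl⟩)) (by omega) (by omega)
  have e2 := hBδ 1 1 (Or.inl ⟨le_rfl, le_rfl⟩) (by omega) (by omega)
  have e3 := hBδ 0 1 (Or.inr (Or.inr ⟨rfl, rfl⟩)) (by omega) (by omega)
  have w0 := hW 0 (by omega)
  have w1 := hW 1 (by omega)
  have w2 := hW 2 (by omega)
  have hone : 1 ≤ x / P ^ 14 := by
    rw [one_le_div (by positivity)]
    exact hPx
  have c1 : (countR 2 1 x : ℝ) = (B 1 0 - B 1 1 / 2) / 2 +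
      ∑ k ∈ Finset.range (⌊x⌋₊ + 1), indInf 0 k := by
    rw [countR_eq, Finset.sum_congr rfl fun r _ => boole_eq_one r]
    simp only [Finset.sum_add_distrib, Finset.sum_sub_distrib, ← Finset.sum_div, hB]
  have c2 : (countR 2 2 x : ℝ) = B 0 0 - B 0 1 / 2 - (B 1 0 - B 1 1 / 2) / 2 +
      (∑ k ∈ Finset.range (⌊x⌋₊ + 1), indInf 2 k -
        ∑ k ∈ Finset.range (⌊x⌋₊ + 1), indInf 1 k) := by
    rw [countR_eq, Finset.sum_congr rfl fun r _ => boole_eq_two r]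
    simp only [Finset.sum_add_distrib, Finset.sum_sub_distrib, ← Finset.sum_div, hB]
  have c3 : (countRge3 2 x : ℝ) = B 1 1 / 4 -
      ∑ k ∈ Finset.range (⌊x⌋₊ + 1), indInf 2 k := by
    rw [countRge3_eq, Finset.sum_congr rfl fun r _ => boole_three_le r]
    simp only [Finset.sum_sub_distrib, ← Finset.sum_div, hB]
  rw [c1, c2, c3]
  norm_num at w0 w1 w2
  simp only [abs_le] at *
  refine ⟨⟨?_, ?_⟩, ⟨?_, ?_⟩, ⟨?_, ?_⟩⟩ <;>
    linarith [e1.1, e1.2, e2.1, e2.2, e3.1, e3.2, w0.1, w0.2, w1.1, w1.2, w2.1, w2.2, hM.1, hM.2]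

end OrderCounts

end

/-- There are absolute constants `C > 0` and `x₀` such that
for all `x ≥ x₀`, with `E(x) = x log₂ x / (log x)^{7/6}` one has
`|#R_{2,1}(x) − (7/24) π(x)| ≤ C E(x)`, `|#R_{2,2}(x) − π(x)/3| ≤ C E(x)` and
`|Σ_{k≥3} #R_{2,k}(x) − π(x)/12| ≤ C E(x)`. -/
theorem rank_stats_stmt4 :
    ∃ C : ℝ, 0 < C ∧ ∃ x0 : ℝ, ∀ x : ℝ, x0 ≤ x →
      |(countR 2 1 x : ℝ) - (7 / 24) * primePi x|
        ≤ C * (x * logI 2 x / Real.log x ^ ((7 : ℝ) / 6)) ∧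
      |(countR 2 2 x : ℝ) - primePi x / 3|
        ≤ C * (x * logI 2 x / Real.log x ^ ((7 : ℝ) / 6)) ∧
      |(countRge3 2 x : ℝ) - primePi x / 12|
        ≤ C * (x * logI 2 x / Real.log x ^ ((7 : ℝ) / 6)) := by
  obtain ⟨P0, h⟩ := OrderCounts.exists_bounds
  refine ⟨10000, by norm_num, Real.exp (max P0 1 ^ 12), fun x hx => ?_⟩
  have hx0 : 0 < x := (Real.exp_pos _).trans_le hx
  have hl : max P0 1 ^ 12 ≤ Real.log x := (Real.le_log_iff_exp_le hx0).2 hx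
  have hl0 : 0 ≤ Real.log x := le_trans (by positivity) hl
  obtain ⟨P, hP0, hP, hP'⟩ : ∃ P : ℝ, 0 ≤ P ∧ P ^ 12 = Real.log x ∧
      P ^ 14 = Real.log x ^ ((7 : ℝ) / 6) := by
    refine ⟨(Real.log x) ^ ((1 : ℝ) / 12), by positivity, ?_, ?_⟩
    · rw [← Real.rpow_natCast, ← Real.rpow_mul hl0]
      norm_num
    · rw [← Real.rpow_natCast, ← Real.rpow_mul hl0]
      norm_num
  have hPP : max P0 1 ≤ P := by
    refine le_of_pow_le_pow_left₀ (n := 12) (by norm_num) hP0 ?_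
    rw [hP]
    exact hl
  have hxe : x = Real.exp (P ^ 12) := by
    rw [hP, Real.exp_log hx0]
  have hE : 10000 * (x / P ^ 14) ≤ 10000 * (x * logI 2 x / Real.log x ^ ((7 : ℝ) / 6)) := by
    rw [← hP']
    have h1 : 1 ≤ logI 2 x := le_max_right _ _
    gcongr
    exact le_mul_of_one_le_right hx0.le h1
  obtain ⟨h1, h2, h3⟩ := h P ((le_max_left _ _).trans hPP) x hxe
  exact ⟨h1.trans hE, h2.trans hE, h3.trans hE⟩
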